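/- Let $C$ be a smooth, integral, proper (equivalently projective) complex curve of genus $3$ that is not hyperelliptic, let $\mathcal B$ be the moduli space of semistable rank-two vector bundles on $C$ with determinant isomorphic to $\omega_C^{\otimes 2}$, and write $[E]$ for the S-equivalence class of $E$ and $E_o=\omega_C\oplus\omega_C$. For $E$ with $[E]\in\mathcal B$ and $h^0(E)=4$, choose a basis $s_0,\dots,s_3$ of $H^0(E)$ and an isomorphism $\det E\cong\omega_C^{\otimes 2}$, put $p_{ij}=s_i\wedge s_j\in H^0(\omega_C^{\otimes 2})$, and let $\gamma([E])$ be the quadric $p_{01}p_{23}-p_{02}p_{13}+p_{03}p_{12}=0$ in $\mathbb P^5=\mathbb P H^0(\omega_C^{\otimes 2})^*$ (when this form is nonzero), which is independent of the choices. The rational map $\gamma$, of degree two onto the space $\mathbb P^6$ of quadrics through the bicanonical curve, is the linear projection from $[E_o]$ of $\mathcal B$, embedded in $\mathbb P^7=|2\Theta|$ as the Coble quartic by the theta map; $\iota$ denotes the birational involution of $\mathcal B$ associated with $\gamma$. For a globally generated bundle $E$ let $\overline E$ be its dual span, the dual of the kernel of the evaluation map $H^0(E)\otimes\mathcal O_C\to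 E$; if $E$ is moreover stable with $[E]\in\mathcal B$, then $\iota([E])=[\overline E]$. Let $E$ be a stable, globally generated rank-two bundle with $\det E\cong\omega_C^{\otimes 2}$. Then $\overline E$ is a semistable rank-two bundle with determinant isomorphic to $\omega_C^{\otimes 2}$, and $\gamma([\overline E])=\gamma([E])$ if $[\overline E]\ne[E_o]$. Moreover, let $F$ be a semistable rank-two bundle with $\det F\cong\omega_C^{\otimes 2}$ such that $\gamma([F])=\gamma([E])$ or $[F]=[\overline E]$; this holds in particular for $[F]=\iota([E])$. If $[F]\neq[E_o]$, then $F$ is stable. -/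

import Mathlib

/-!
# Vector bundles on a smooth complete complex curve

A vector bundle on a smooth curve with function field `K` is given by its generic fibre `V`, a
finite-dimensional `K`-vector space, and its stalks at the closed points `x`, which are
`𝒪_{C,x}`-lattices in `V`; the lattices are arbitrary except that almost all of them are spanned by
one common `K`-basis of `V`.  The sections over an open `U` are the vectors lying in the stalks at
all closed points of `U`.  Homomorphisms, subbundles, quotients, tensor products, exterior powers
and duals are computed on the generic fibre and stalkwise.
-/

noncomputable section

open AlgebraicGeometry CategoryTheory
open scoped TensorProduct KaehlerDifferential

namespace CobleCurve

section Bundles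

variable {K : Type} [Field K] [Algebra ℂ K] {P : Type}

/-- A family of `O x`-submodules (the stalks) of one `K`-vector space (the generic fibre). -/
structure StalkFamily (O : P → Subalgebra ℂ K) where
  V : Type
  [addCommGroup : AddCommGroup V]
  [module : Module K V]
  stalk : ∀ x : P, Submodule (O x) V

attribute [instance] StalkFamily.addCommGroup StalkFamily.module

namespace StalkFamily

variable {O : P → Subalgebra ℂ K}

instance (E : StalkFamily O) : Module ℂ E.V := Module.compHom E.V (algebraMap ℂ K)

instance (E : StalkFamily O) : IsScalarTower ℂ K E.V :=
  ⟨fun a k v => by rw [Algebra.smul_def, mul_smul]; rfl⟩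

/-- The family is a vector bundle: lattices in a finite-dimensional space, almost all of them
spanned by a common basis. -/
structure IsVectorBundle (E : StalkFamily O) : Prop where
  finite : FiniteDimensional K E.V
  fg : ∀ x, (E.stalk x).FG
  span_eq_top : ∀ x, Submodule.span K (E.stalk x : Set E.V) = ⊤
  generic : ∃ b : Module.Basis (Fin (Module.finrank K E.V)) K E.V,
    {x : P | E.stalk x ≠ Submodule.span (O x) (Set.range b)}.Finite

/-- The rank. -/
def rank (E : StalkFamily O) : ℕ := Module.finrank K E.V

/-- Isomorphisms of vector bundles. -/
structure Iso (E F : StalkFamily O) where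
  toEquiv : E.V ≃ₗ[K] F.V
  mem_iff : ∀ (x : P) (v : E.V), toEquiv v ∈ F.stalk x ↔ v ∈ E.stalk x

/-- Two bundles are isomorphic. -/
def Isomorphic (E F : StalkFamily O) : Prop := Nonempty (Iso E F)

/-- The space `H⁰(E)` of global sections. -/
def H0 (E : StalkFamily O) : Submodule ℂ E.V where
  carrier := {v | ∀ x, v ∈ E.stalk x}
  add_mem' hv hw x := add_mem (hv x) (hw x)
  zero_mem' x := zero_mem _
  smul_mem' c v hv x := by
    have h := (E.stalk x).smul_mem (algebraMap ℂ (O x) c) (hv x)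
    exact h

/-- `E` is globally generated: at each point the global sections generate the stalk. -/
def GloballyGenerated (E : StalkFamily O) : Prop :=
  ∀ x, Submodule.span (O x) (E.H0 : Set E.V) = E.stalk x

/-- The degree: the sum over all points of the local index of the stalk relative to the lattice
spanned by a fixed `K`-basis of the generic fibre.  For `𝒪(p)` it is `1`.  By the product formula
the degree of a vector bundle does not depend on the basis. -/
def degree (E : StalkFamily O) : ℤ :=
  ∑ᶠ x : P,
    let Λ : Submodule (O x) E.V := Submodule.span (O x) (Set.range (Module.Free.chooseBasis K E.V))
    ((Module.length (O x) (E.stalk x ⧸ Λ.submoduleOf (E.stalk x))).toNat : ℤ) -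
      ((Module.length (O x) (Λ ⧸ (E.stalk x).submoduleOf Λ)).toNat : ℤ)

/-- The subbundle of `E` with generic fibre `W`.  All subbundles (saturated subsheaves) of `E` are
of this form. -/
def sub (E : StalkFamily O) (W : Submodule K E.V) : StalkFamily O where
  V := W
  stalk x := (E.stalk x).comap (W.subtype.restrictScalars (O x))

/-- The quotient of `E` by the subbundle with generic fibre `W`. -/
def quot (E : StalkFamily O) (W : Submodule K E.V) : StalkFamily O where
  V := E.V ⧸ W
  stalk x := (E.stalk x).map (W.mkQ.restrictScalars (O x))

/-- The direct sum `E ⊕ F`. -/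
def directSum (E F : StalkFamily O) : StalkFamily O where
  V := E.V × F.V
  stalk x := (E.stalk x).prod (F.stalk x)

/-- The tensor product `E ⊗ F`. -/
def tensor (E F : StalkFamily O) : StalkFamily O where
  V := E.V ⊗[K] F.V
  stalk x := Submodule.span (O x) {t | ∃ v ∈ E.stalk x, ∃ w ∈ F.stalk x, t = v ⊗ₜ[K] w}

/-- The dual bundle. -/
def dual (E : StalkFamily O) : StalkFamily O where
  V := Module.Dual K E.V
  stalk x :=
    { carrier := {φ | ∀ v ∈ E.stalk x, φ v ∈ O x}
      add_mem' := fun hφ hψ v hv => add_mem (hφ v hv) (hψ v hv)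
      zero_mem' := fun _ _ => zero_mem _
      smul_mem' := fun a _ hφ v hv => mul_mem a.2 (hφ v hv) }

/-- The second exterior power, which is the determinant of a bundle of rank two. -/
def det₂ (E : StalkFamily O) : StalkFamily O where
  V := ⋀[K]^2 E.V
  stalk x := Submodule.span (O x)
    {t | ∃ v : Fin 2 → E.V, (∀ i, v i ∈ E.stalk x) ∧ t = exteriorPower.ιMulti K 2 v}

/-- The trivial bundle `U ⊗ 𝒪` with fibre a complex vector space `U`. -/
def trivialBundle (O : P → Subalgebra ℂ K) (U : Type) [AddCommGroup U] [Module ℂ U] :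
    StalkFamily O where
  V := K ⊗[ℂ] U
  stalk x := Submodule.span (O x) (Set.range fun u : U => (1 : K) ⊗ₜ[ℂ] u)

/-- The evaluation map `H⁰(E) ⊗ 𝒪 → E` on generic fibres. -/
def evaluation (E : StalkFamily O) : K ⊗[ℂ] E.H0 →ₗ[K] E.V :=
  E.H0.subtype.liftBaseChange K

/-- The dual span of `E`: the dual of the kernel of the evaluation map `H⁰(E) ⊗ 𝒪 → E`. -/
def dualSpan (E : StalkFamily O) : StalkFamily O :=
  ((trivialBundle O E.H0).sub (LinearMap.ker E.evaluation)).dual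

/-- The canonical bundle: its generic fibre is `Ω_{K/ℂ}` and its stalk at `x` is generated by the
differentials of the elements of the local ring at `x`. -/
def canonical (O : P → Subalgebra ℂ K) : StalkFamily O where
  V := Ω[K⁄ℂ]
  stalk x := Submodule.span (O x) {η | ∃ a ∈ O x, η = KaehlerDifferential.D ℂ K a}

/-- The bicanonical line bundle `ω^{⊗2}`. -/
def bicanonical (O : P → Subalgebra ℂ K) : StalkFamily O := (canonical O).tensor (canonical O)

/-- `E_o = ω ⊕ ω`. -/
def Eo (O : P → Subalgebra ℂ K) : StalkFamily O := (canonical O).directSum (canonical O)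

/-- Slope stability. -/
def Stable (E : StalkFamily O) : Prop :=
  ∀ W : Submodule K E.V, W ≠ ⊥ → W ≠ ⊤ →
    (E.sub W).degree * E.rank < E.degree * (E.sub W).rank

/-- Slope semistability. -/
def Semistable (E : StalkFamily O) : Prop :=
  ∀ W : Submodule K E.V, W ≠ ⊥ → W ≠ ⊤ →
    (E.sub W).degree * E.rank ≤ E.degree * (E.sub W).rank

/-- `G` is the graded bundle of a Jordan–Hölder filtration of the semistable bundle `E` of rank
two: either `E` itself, if `E` is stable, or `L ⊕ E/L` for a line subbundle `L` of the slope
of `E`. -/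
def IsGraded (E G : StalkFamily O) : Prop :=
  (E.Stable ∧ E.Isomorphic G) ∨
    ∃ W : Submodule K E.V, W ≠ ⊥ ∧ W ≠ ⊤ ∧
      (E.sub W).degree * E.rank = E.degree * (E.sub W).rank ∧
      ((E.sub W).directSum (E.quot W)).Isomorphic G

/-- S-equivalence of semistable bundles of rank two: `[E] = [F]` in the moduli space. -/
def SEquiv (E F : StalkFamily O) : Prop := ∃ G : StalkFamily O, E.IsGraded G ∧ F.IsGraded G

/-- `E` is a semistable bundle of rank two with bicanonical determinant, so that it has a moduli
point `[E] ∈ 𝓑`. -/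
structure InModuli (E : StalkFamily O) : Prop where
  isVectorBundle : E.IsVectorBundle
  rank_eq : E.rank = 2
  semistable : E.Semistable
  det : E.det₂.Isomorphic (bicanonical O)

theorem wedge_mem {E : StalkFamily O} (s t : E.H0) (x : P) :
    (exteriorPower.ιMulti K 2 ![(s : E.V), (t : E.V)] : ⋀[K]^2 E.V) ∈ E.det₂.stalk x := by
  refine Submodule.subset_span (R := O x) (M := ⋀[K]^2 E.V) ⟨_, fun i => ?_, rfl⟩
  fin_cases i
  · exact s.2 x
  · exact t.2 x

/-- The section `s ∧ t` of the bicanonical bundle given by two sections `s`, `t` of `E` and an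
isomorphism `δ : det E ≅ ω^{⊗2}`. -/
def wedge {E : StalkFamily O} (δ : Iso E.det₂ (bicanonical O)) (s t : E.H0) :
    (bicanonical O).H0 :=
  ⟨δ.toEquiv (exteriorPower.ιMulti K 2 ![(s : E.V), (t : E.V)] : ⋀[K]^2 E.V), fun x =>
    (δ.mem_iff x _).2 (wedge_mem s t x)⟩

/-- The Plücker quadratic form on `H⁰(ω^{⊗2})^*` (whose projectivization is the space `ℙ⁵` of the
bicanonical curve), pulled back from `∧² H⁰(E)^*`:
`p₀₁ p₂₃ - p₀₂ p₁₃ + p₀₃ p₁₂` with `pᵢⱼ = sᵢ ∧ sⱼ` for a basis `s` of `H⁰(E)`.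
As a section of `ω^{⊗2} ⊠ ω^{⊗2}` on `C × C`, its polarization is
the determinant of the evaluation `H⁰(E) → E_x ⊕ E_y`. -/
def pluckerForm {E : StalkFamily O} (s : Module.Basis (Fin 4) ℂ E.H0)
    (δ : Iso E.det₂ (bicanonical O)) : QuadraticForm ℂ (Module.Dual ℂ (bicanonical O).H0) :=
  let p (i j : Fin 4) : Module.Dual ℂ (bicanonical O).H0 →ₗ[ℂ] ℂ :=
    Module.Dual.eval ℂ (bicanonical O).H0 (wedge δ (s i) (s j))
  QuadraticMap.linMulLin (p 0 1) (p 2 3) - QuadraticMap.linMulLin (p 0 2) (p 1 3) +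
    QuadraticMap.linMulLin (p 0 3) (p 1 2)

/-- The quadric `q = 0` is the Plücker quadric `γ([E])` of `E`.  The choices of the basis and of
the isomorphism change `q` exactly by all nonzero scalar factors. -/
def IsPluckerForm (E : StalkFamily O)
    (q : QuadraticForm ℂ (Module.Dual ℂ (bicanonical O).H0)) : Prop :=
  ∃ (s : Module.Basis (Fin 4) ℂ E.H0) (δ : Iso E.det₂ (bicanonical O)), q = pluckerForm s δ

/-- `γ([E]) = γ([F])`, where `γ : 𝓑 ⇢ ℙ⁶` sends `[E]` to its Plücker quadric in the linear system
of quadrics through the bicanonical curve.  The map `γ` is the projection of the Coble quartic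
from `[E_o]`, so for `[E], [F] ≠ [E_o]` this says that `[F]` lies on the line joining `[E_o]`
and `[E]`. -/
def SameGamma (E F : StalkFamily O) : Prop :=
  ∃ q, q ≠ 0 ∧ E.IsPluckerForm q ∧ F.IsPluckerForm q

end StalkFamily

end Bundles

section Curve

variable {C : Scheme.{0}} [IsIntegral C] (f : C ⟶ Spec (CommRingCat.of ℂ))

/-- The function field of `C`, considered as a `ℂ`-algebra through the structure morphism `f`. -/
def FunctionField (_f : C ⟶ Spec (CommRingCat.of ℂ)) : Type := C.functionField

instance : Field (FunctionField f) := inferInstanceAs (Field C.functionField)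

/-- The constants `ℂ → 𝒪_{C,x}`. -/
def constStalk (x : C) : ℂ →+* C.presheaf.stalk x :=
  ((Scheme.ΓSpecIso (CommRingCat.of ℂ)).inv ≫ f.appTop ≫ C.presheaf.germ ⊤ x trivial).hom

instance : Algebra ℂ (FunctionField f) :=
  RingHom.toAlgebra (R := ℂ) (S := FunctionField f) (constStalk f (genericPoint C))

/-- The closed points of `C`. -/
def ClosedPoint (C : Scheme.{0}) : Type := {x : C // IsClosed ({x} : Set C)}

/-- The local ring `𝒪_{C,x}` at a closed point, as a subring of the function field. -/
def localRing (x : ClosedPoint C) : Subalgebra ℂ (FunctionField f) where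
  toSubsemiring := (algebraMap (C.presheaf.stalk x.1) C.functionField).rangeS
  algebraMap_mem' c := by
    refine ⟨constStalk f x.1 c, ?_⟩
    have h : C.presheaf.germ ⊤ x.1 trivial ≫ C.presheaf.stalkSpecializes
        ((genericPoint_spec C).specializes trivial) =
        C.presheaf.germ ⊤ (genericPoint C) trivial :=
      C.presheaf.germ_stalkSpecializes _ _
    change (C.presheaf.stalkSpecializes _).hom _ = constStalk f (genericPoint C) c
    simp only [constStalk, ← h, CommRingCat.hom_comp, RingHom.comp_apply]

/-- The genus, `dim H⁰(C, ω_C)`. -/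
def genus : ℕ := Module.finrank ℂ (StalkFamily.canonical (localRing f)).H0

/-- `C` admits a morphism of degree two to `ℙ¹`, that is, its function field has degree two over
the subfield generated by some rational function. -/
def HasDoubleCover : Prop :=
  ∃ t : FunctionField f, Module.finrank (IntermediateField.adjoin ℂ {t}) (FunctionField f) = 2

end Curve

end CobleCurve

end

noncomputable section
open AlgebraicGeometry CategoryTheory
open scoped TensorProduct KaehlerDifferential
open IsLocalRing

/-- The maximal ideal of the local ring of a rational point of a smooth curve is principal. -/
theorem finrank_cotangentSpace_le_one {k A : Type} [Field k] [CommRing A] [IsLocalRing A]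
    [Algebra k A]
    [Algebra.FormallySmooth k A] (hk : Function.Bijective (algebraMap k (ResidueField A)))
    (hΩ : ∃ ω : Ω[A⁄k], Submodule.span A {ω} = ⊤) :
    Module.finrank (ResidueField A) (CotangentSpace A) ≤ 1 := by
  have hs : Function.Surjective (algebraMap A (ResidueField A)) := residue_surjective
  have : Algebra.FormallySmooth k (ResidueField A) :=
    Algebra.FormallySmooth.of_equiv (AlgEquiv.ofBijective (Algebra.ofId k (ResidueField A)) hk)
  have hinj := (Algebra.FormallySmooth.kerCotangentToTensor_injective_iff (R := k) (P := A) hs).2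
    inferInstance
  have hker : RingHom.ker (algebraMap A (ResidueField A)) = maximalIdeal A := ker_residue
  have key : ∀ a ∈ maximalIdeal A,
      (1 : ResidueField A) ⊗ₜ[A] KaehlerDifferential.D k A a = 0 → a ∈ maximalIdeal A ^ 2 := by
    intro a ha h0
    have ha' : a ∈ RingHom.ker (algebraMap A (ResidueField A)) := hker ▸ ha
    have h1 : Ideal.toCotangent _ ⟨a, ha'⟩ = 0 := by
      apply hinj
      rw [map_zero, KaehlerDifferential.kerCotangentToTensor_toCotangent]
      exact h0
    have h2 := (Ideal.toCotangent_eq_zero _ _).1 h1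
    exact hker ▸ h2
  obtain ⟨ω, hω⟩ := hΩ
  have hc : ∀ a : A, ∃ c : A, (1 : ResidueField A) ⊗ₜ[A] KaehlerDifferential.D k A a =
      c • ((1 : ResidueField A) ⊗ₜ[A] ω) := by
    intro a
    have : KaehlerDifferential.D k A a ∈ Submodule.span A {ω} := hω ▸ trivial
    obtain ⟨c, hc⟩ := Submodule.mem_span_singleton.1 this
    exact ⟨c, by rw [← hc, TensorProduct.tmul_smul]⟩
  by_cases h : ∀ v : CotangentSpace A, v = 0
  · have : Subsingleton (CotangentSpace A) := ⟨fun a b => by rw [h a, h b]⟩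
    rw [Module.finrank_zero_of_subsingleton]; exact zero_le_one
  push Not at h
  obtain ⟨v, hv⟩ := h
  obtain ⟨⟨a, ha⟩, rfl⟩ := Ideal.toCotangent_surjective _ v
  refine finrank_le_one ((maximalIdeal A).toCotangent ⟨a, ha⟩) fun w => ?_
  obtain ⟨⟨b, hb⟩, rfl⟩ := Ideal.toCotangent_surjective _ w
  obtain ⟨c, hc'⟩ := hc a
  obtain ⟨d, hd'⟩ := hc b
  have hcu : IsUnit c := by
    by_contra hcu
    apply hv
    rw [Ideal.toCotangent_eq_zero]
    apply key a ha
    rw [hc', ← algebraMap_smul (ResidueField A) c]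
    have : algebraMap A (ResidueField A) c = 0 := by
      rw [ResidueField.algebraMap_eq, residue_eq_zero_iff]; exact hcu
    rw [this, zero_smul]
  obtain ⟨u, rfl⟩ := hcu
  refine ⟨algebraMap A _ (d * ↑u⁻¹), ?_⟩
  rw [algebraMap_smul, ← map_smul, Ideal.toCotangent_eq]
  apply key _ (sub_mem (Ideal.mul_mem_left _ _ ha) hb)
  have e1 : (1 : ResidueField A) ⊗ₜ[A] KaehlerDifferential.D k A ((d * ↑u⁻¹) * a) =
      (d * ↑u⁻¹) • ((1 : ResidueField A) ⊗ₜ[A] KaehlerDifferential.D k A a) := by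
    rw [Derivation.leibniz, TensorProduct.tmul_add, TensorProduct.tmul_smul,
      TensorProduct.tmul_smul, ← algebraMap_smul (ResidueField A) a]
    have : algebraMap A (ResidueField A) a = 0 := by
      rw [ResidueField.algebraMap_eq, residue_eq_zero_iff]; exact ha
    rw [this, zero_smul, add_zero]
  have e2 : ((⟨(d * ↑u⁻¹) * a, Ideal.mul_mem_left _ _ ha⟩ : maximalIdeal A) : A) =
    (d * ↑u⁻¹) * a := rfl
  change (1 : ResidueField A) ⊗ₜ[A] KaehlerDifferential.D k A ((d * ↑u⁻¹) * a - b) = 0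
  rw [map_sub, TensorProduct.tmul_sub, e1, hc', hd', smul_smul, mul_assoc, Units.inv_mul, mul_one,
    sub_self]

theorem D_ne_zero_of_transcendental {k K : Type} [Field k] [CharZero k] [Field K] [Algebra k K]
    [Algebra.EssFiniteType k K] (t : K) (ht : Transcendental k t) :
    KaehlerDifferential.D k K t ≠ 0 := by
  let := (Polynomial.aeval (R := k) t).toAlgebra
  have : IsScalarTower k (Polynomial k) K := IsScalarTower.of_algebraMap_eq
    fun c => by rw [RingHom.algebraMap_toAlgebra]; simp
  have htt : algebraMap (Polynomial k) K Polynomial.X = t := by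
    rw [RingHom.algebraMap_toAlgebra]; simp
  have hinjt : Function.Injective (algebraMap (Polynomial k) K) :=
    transcendental_iff_injective.1 ht
  have : FaithfulSMul (Polynomial k) K := (faithfulSMul_iff_algebraMap_injective _ _).2 hinjt
  let F := FractionRing (Polynomial k)
  let : Algebra F K := FractionRing.liftAlgebra (Polynomial k) K
  have : IsScalarTower (Polynomial k) F K := FractionRing.isScalarTower_liftAlgebra _ _
  have : IsScalarTower k F K := IsScalarTower.to₁₃₄ k (Polynomial k) F K
  have : Algebra.EssFiniteType F K := Algebra.EssFiniteType.of_comp k F K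
  have : Algebra.FormallySmooth F K := inferInstance
  have : Algebra.FormallyEtale (Polynomial k) F :=
    Algebra.FormallyEtale.of_isLocalization (nonZeroDivisors (Polynomial k))
  have : Algebra.FormallySmooth (Polynomial k) K := Algebra.FormallySmooth.comp _ F K
  have hi : Function.Injective (KaehlerDifferential.mapBaseChange k (Polynomial k) K) := by
    rw [injective_iff_map_eq_zero]
    intro a ha
    obtain ⟨b, rfl⟩ := (Algebra.H1Cotangent.exact_δ_mapBaseChange k (Polynomial k) K a).1 ha
    rw [Subsingleton.elim b 0, map_zero]
  intro h0
  have h1 : (1 : K) ⊗ₜ[Polynomial k] KaehlerDifferential.D k (Polynomial k) Polynomial.X = 0 := by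
    apply hi
    rw [map_zero, KaehlerDifferential.mapBaseChange_tmul, KaehlerDifferential.map_D, htt, h0,
      smul_zero]
  have h2 := congrArg ((TensorProduct.rid (Polynomial k) K).toLinearMap ∘ₗ
    (KaehlerDifferential.polynomialEquiv k).toLinearMap.lTensor K) h1
  simp at h2

theorem finiteDimensional_of_kaehler {k K : Type} [Field k] [CharZero k] [Field K] [Algebra k K]
    [Algebra.EssFiniteType k K] (t : K) (ht : Transcendental k t)
    (h1 : Module.finrank K Ω[K⁄k] = 1) : FiniteDimensional (IntermediateField.adjoin k {t}) K := by
  set F := IntermediateField.adjoin k {t}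
  have : Algebra.EssFiniteType F K := Algebra.EssFiniteType.of_comp k F K
  have hspan : ∀ η : Ω[K⁄k], ∃ c : K, c • KaehlerDifferential.D k K t = η :=
    (finrank_eq_one_iff_of_nonzero' _ (D_ne_zero_of_transcendental t ht)).1 h1
  have : Subsingleton Ω[K⁄F] := by
    refine subsingleton_of_forall_eq 0 fun y => ?_
    obtain ⟨η, rfl⟩ := KaehlerDifferential.map_surjective k F K y
    obtain ⟨c, rfl⟩ := hspan η
    have h0 : KaehlerDifferential.D F K t = 0 :=
      (KaehlerDifferential.D F K).map_algebraMap
        ⟨t, IntermediateField.mem_adjoin_simple_self k t⟩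
    rw [map_smul, KaehlerDifferential.map_D, Algebra.algebraMap_self_apply, h0, smul_zero]
  have : Algebra.FormallyUnramified F K := ⟨this⟩
  exact Algebra.FormallyUnramified.finite_of_free F K

theorem finrank_kaehler_of_standardSmooth {k A K : Type} [Field k] [CommRing A] [IsDomain A]
    [Algebra k A] [Algebra.IsStandardSmoothOfRelativeDimension 1 k A] [Field K] [Algebra A K]
    [Algebra k K] [IsScalarTower k A K] [IsFractionRing A K] : Module.finrank K Ω[K⁄k] = 1 := by
  have : Algebra.IsStandardSmooth k A :=
    Algebra.IsStandardSmoothOfRelativeDimension.isStandardSmooth 1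
  have : Algebra.FormallyEtale A K := Algebra.FormallyEtale.of_isLocalization (nonZeroDivisors A)
  have e := KaehlerDifferential.tensorKaehlerEquivOfFormallyEtale k A K
  rw [← e.finrank_eq, Module.finrank_baseChange]
  have := Algebra.IsStandardSmoothOfRelativeDimension.rank_kaehlerDifferential (R := k) (S := A) 1
  rw [Module.finrank, this]; simp

theorem isDiscreteValuationRing_of_standardSmooth {k A R : Type} [Field k] [CommRing A] [IsDomain A]
    [Algebra k A] [Algebra.IsStandardSmoothOfRelativeDimension 1 k A] (p : Ideal A) [p.IsPrime]
    [CommRing R] [Algebra A R] [Algebra k R] [IsScalarTower k A R] [IsLocalization.AtPrime R p]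
    [IsDomain R] [IsLocalRing R] (hk : Function.Bijective (algebraMap k (ResidueField R))) :
    IsDiscreteValuationRing R := by
  have : Algebra.IsStandardSmooth k A :=
    Algebra.IsStandardSmoothOfRelativeDimension.isStandardSmooth 1
  have : Algebra.FormallyEtale A R := Algebra.FormallyEtale.of_isLocalization p.primeCompl
  have : Algebra.FormallySmooth k R := Algebra.FormallySmooth.comp k A R
  have : IsNoetherianRing A := Algebra.FiniteType.isNoetherianRing k A
  have : IsNoetherianRing R := IsLocalization.isNoetherianRing p.primeCompl R inferInstance
  have hr : Module.finrank A Ω[A⁄k] = 1 := by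
    have := Algebra.IsStandardSmoothOfRelativeDimension.rank_kaehlerDifferential (R := k) (S := A) 1
    rw [Module.finrank, this]; simp
  have e := KaehlerDifferential.tensorKaehlerEquivOfFormallyEtale k A R
  have hr' : Module.finrank R Ω[R⁄k] = 1 := by
    rw [← e.finrank_eq, Module.finrank_baseChange, hr]
  have hfree : Module.Free R Ω[R⁄k] := Module.Free.of_equiv e
  have hΩ : ∃ ω : Ω[R⁄k], Submodule.span R {ω} = ⊤ := by
    obtain ⟨v⟩ := finrank_eq_one_iff Unit |>.1 hr'
    exact ⟨v (), by have h := v.span_eq; rwa [Set.range_unique] at h⟩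
  have hle := finrank_cotangentSpace_le_one hk hΩ
  have hpid : IsPrincipalIdealRing R :=
    ((tfae_of_isNoetherianRing_of_isLocalRing_of_isDomain R).out 5 0).1 hle
  refine { hpid with not_a_field' := fun hbot => ?_ }
  have hR : Function.Bijective (algebraMap R (ResidueField R)) := by
    refine ⟨?_, residue_surjective⟩
    rw [RingHom.injective_iff_ker_eq_bot]
    exact (ker_residue (R := R)).trans hbot
  have hsurj : Function.Surjective (algebraMap k R) := by
    intro r
    obtain ⟨c, hc⟩ := hk.2 (algebraMap R _ r)
    refine ⟨c, hR.1 ?_⟩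
    rw [← hc, ← IsScalarTower.algebraMap_apply]
  have : Subsingleton Ω[R⁄k] := KaehlerDifferential.subsingleton_of_surjective k R hsurj
  rw [Module.finrank_zero_of_subsingleton] at hr'
  exact zero_ne_one hr'
end

noncomputable section
open AlgebraicGeometry CategoryTheory
open scoped TensorProduct KaehlerDifferential
open IsLocalRing
namespace CobleCurve
set_option linter.unusedSectionVars false
variable {C : Scheme.{0}} [IsIntegral C] (f : C ⟶ Spec (CommRingCat.of ℂ))

theorem specMap_constStalk (x : C) :
    Spec.map (CommRingCat.ofHom (constStalk f x)) = C.fromSpecStalk x ≫ f := by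
  have h1 : f = C.toSpecΓ ≫ Spec.map (f.appTop) ≫
      Spec.map ((Scheme.ΓSpecIso (CommRingCat.of ℂ)).inv) := by
    rw [← Scheme.toSpecΓ_naturality_assoc, toSpecΓ_SpecMap_ΓSpecIso_inv, Category.comp_id]
  conv_rhs => rw [h1]
  rw [Scheme.fromSpecStalk_toSpecΓ_assoc, ← Spec.map_comp, ← Spec.map_comp]
  rfl

theorem residue_constStalk_bijective [LocallyOfFiniteType f] (x : C) (hx : IsClosed ({x} : Set C)) :
    Function.Bijective ((residue (C.presheaf.stalk x)).comp (constStalk f x)) := by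
  have h : (CommRingCat.ofHom (constStalk f x) ≫ C.residue x :
      CommRingCat.of ℂ ⟶ C.residueField x) = (residueFieldIsoBase f x hx).inv := by
    apply Spec.map_injective
    rw [SpecMap_residueFieldIsoBase_inv, Spec.map_comp, specMap_constStalk]
    rfl
  have h2 := (ConcreteCategory.isIso_iff_bijective (residueFieldIsoBase f x hx).inv).1 inferInstance
  rw [← h] at h2
  exact h2

theorem exists_standardSmooth [SmoothOfRelativeDimension 1 f] (x : C) :
    ∃ V : C.Opens, IsAffineOpen V ∧ x ∈ V ∧
      ((Scheme.ΓSpecIso (CommRingCat.of ℂ)).inv ≫ f.appTop ≫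
        C.presheaf.map (homOfLE le_top).op : CommRingCat.of ℂ ⟶ Γ(C, V)).hom.IsStandardSmoothOfRelativeDimension
          1 := by
  obtain ⟨U, hU, V, hV, hxV, e, h⟩ :=
    SmoothOfRelativeDimension.exists_isStandardSmoothOfRelativeDimension (n := 1) (f := f) x
  refine ⟨V, hV, hxV, ?_⟩
  have hUtop : U = ⊤ := by
    have hs : Subsingleton (Spec (CommRingCat.of ℂ)) :=
      inferInstanceAs (Subsingleton (PrimeSpectrum ℂ))
    refine top_unique fun y _ => ?_
    rw [Subsingleton.elim y (f x)]
    exact e hxV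
  subst hUtop
  have h2 : f.appLE ⊤ V e = f.appTop ≫ C.presheaf.map (homOfLE le_top).op := by
    simp [Scheme.Hom.appLE, Scheme.Hom.appTop]
  rw [h2] at h
  exact RingHom.IsStandardSmoothOfRelativeDimension.comp (m := 0) h
    (RingHom.IsStandardSmoothOfRelativeDimension.equiv
      (Scheme.ΓSpecIso (CommRingCat.of ℂ)).symm.commRingCatIsoToRingEquiv)

/-- A curve, in terms of its function field `K` and its local rings: the local rings are the
discrete valuation rings of `K` over `ℂ`. -/
structure IsCurve {K : Type} [Field K] [Algebra ℂ K] {P : Type} (O : P → Subalgebra ℂ K) :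
    Prop where
  dvr : ∀ x, IsDiscreteValuationRing (O x)
  isFractionRing : ∀ x, IsFractionRing (O x) K
  exists_eq : ∀ R : ValuationSubring K, R ≠ ⊤ → (∀ c : ℂ, algebraMap ℂ K c ∈ R) →
    ∃ x, ∀ g, g ∈ O x ↔ g ∈ R
  injective : Function.Injective O
  finiteDimensional : ∀ t : K, t ∉ (algebraMap ℂ K).range →
    FiniteDimensional (IntermediateField.adjoin ℂ {t}) K
  finrank_kaehler : Module.finrank K Ω[K⁄ℂ] = 1
  D_ne_zero : ∀ t : K, t ∉ (algebraMap ℂ K).range → KaehlerDifferential.D ℂ K t ≠ 0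

theorem transcendental_of_notMem_range {K : Type} [Field K] [Algebra ℂ K] {t : K}
    (ht : t ∉ (algebraMap ℂ K).range) : Transcendental ℂ t := by
  intro h
  have : Algebra.IsAlgebraic ℂ (IntermediateField.adjoin ℂ {t}) :=
    IntermediateField.isAlgebraic_adjoin_simple h.isIntegral
  have h2 := IntermediateField.eq_bot_of_isAlgClosed_of_isAlgebraic (IntermediateField.adjoin ℂ {t})
  have h3 := IntermediateField.mem_adjoin_simple_self ℂ t
  rw [h2, IntermediateField.mem_bot] at h3
  exact ht h3

/-- The local ring as a subring is isomorphic to the stalk. -/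
def stalkEquiv (x : ClosedPoint C) : C.presheaf.stalk x.1 ≃+* localRing f x :=
  RingEquiv.ofBijective ((algebraMap (C.presheaf.stalk x.1) C.functionField).codRestrict
    (localRing f x) (fun a => ⟨a, rfl⟩)) (by
    constructor
    · intro a b h
      exact IsFractionRing.injective (C.presheaf.stalk x.1) C.functionField (congrArg Subtype.val h)
    · rintro ⟨_, a, rfl⟩
      exact ⟨a, rfl⟩)

theorem isDiscreteValuationRing_stalk [LocallyOfFiniteType f] [SmoothOfRelativeDimension 1 f]
    (x : ClosedPoint C) : IsDiscreteValuationRing (C.presheaf.stalk x.1) := by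
  obtain ⟨V, hV, hxV, h⟩ := exists_standardSmooth f x.1
  set φ := ((Scheme.ΓSpecIso (CommRingCat.of ℂ)).inv ≫ f.appTop ≫
        C.presheaf.map (homOfLE le_top).op : CommRingCat.of ℂ ⟶ Γ(C, V)) with hφ
  let : Algebra ℂ Γ(C, V) := φ.hom.toAlgebra
  have : Algebra.IsStandardSmoothOfRelativeDimension 1 ℂ Γ(C, V) := h
  let : Algebra ℂ (C.presheaf.stalk x.1) := (constStalk f x.1).toAlgebra
  let := C.presheaf.algebra_section_stalk ⟨x.1, hxV⟩
  have : IsLocalization.AtPrime (C.presheaf.stalk x.1) (hV.primeIdealOf ⟨x.1, hxV⟩).asIdeal :=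
    hV.isLocalization_stalk ⟨x.1, hxV⟩
  have : IsScalarTower ℂ Γ(C, V) (C.presheaf.stalk x.1) := by
    refine IsScalarTower.of_algebraMap_eq' ?_
    change constStalk f x.1 = (φ ≫ C.presheaf.germ V x.1 hxV).hom
    rw [hφ]
    simp [constStalk]
  have : Nonempty V := ⟨⟨x.1, hxV⟩⟩
  exact isDiscreteValuationRing_of_standardSmooth (k := ℂ) (A := Γ(C, V))
    (hV.primeIdealOf ⟨x.1, hxV⟩).asIdeal (residue_constStalk_bijective f x.1 x.2)

theorem isFractionRing_localRing (x : ClosedPoint C) :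
    IsFractionRing (localRing f x) (FunctionField f) := by
  refine IsFractionRing.of_field _ _ fun z => ?_
  obtain ⟨a, b, -, h⟩ := IsFractionRing.div_surjective (A := C.presheaf.stalk x.1)
    (K := C.functionField) z
  exact ⟨stalkEquiv f x a, stalkEquiv f x b, h.symm⟩

theorem eq_of_le_of_isDiscreteValuationRing {K : Type} [Field K] (A R : Subring K)
    [IsDiscreteValuationRing A] [IsFractionRing A K] (hAR : A ≤ R) (hR : R ≠ ⊤) : R = A := by
  refine le_antisymm (fun g hg => ?_) hAR
  by_contra hgA
  apply hR
  refine top_unique fun k _ => ?_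
  have hg0 : g ≠ 0 := fun h => hgA (h ▸ zero_mem A)
  have hinv : g⁻¹ ∈ A := by
    rcases ValuationRing.isInteger_or_isInteger A g with ⟨a, ha⟩ | ⟨a, ha⟩
    · exact absurd (ha ▸ a.2) hgA
    · exact ha ▸ a.2
  obtain ⟨a, b, hb, rfl⟩ := IsFractionRing.div_surjective (A := A) k
  have hb0 : b ≠ 0 := nonZeroDivisors.ne_zero hb
  obtain ⟨π, hπ⟩ := IsDiscreteValuationRing.exists_irreducible A
  obtain ⟨n, hn⟩ := IsDiscreteValuationRing.associated_pow_irreducible hb0 hπ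
  have hnu : ¬ IsUnit (⟨g⁻¹, hinv⟩ : A) := by
    intro hu
    obtain ⟨c, hc⟩ := isUnit_iff_exists_inv.1 hu
    apply hgA
    have : (g⁻¹ : K) * c = 1 := congrArg Subtype.val hc
    have : (c : K) = g := by field_simp at this; exact this
    exact this ▸ c.2
  have hdvd : π ∣ (⟨g⁻¹, hinv⟩ : A) := by
    rw [← Ideal.mem_span_singleton, ← hπ.maximalIdeal_eq]
    exact hnu
  obtain ⟨c, hc⟩ := (hn.dvd).trans (pow_dvd_pow_of_dvd hdvd n)
  have hc' : (g⁻¹ : K) ^ n = b * c := congrArg Subtype.val hc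
  have hbK : (b : K) ≠ 0 := fun h => hb0 (Subtype.ext h)
  have : (a : K) / b = a * c * g ^ n := by
    rw [div_eq_iff hbK, mul_assoc, mul_assoc, mul_comm (g ^ n), ← mul_assoc (c : K), mul_comm (c : K),
      ← hc', inv_pow, inv_mul_cancel₀ (pow_ne_zero _ hg0), mul_one]
  change (a : K) / b ∈ R
  rw [this]
  exact mul_mem (mul_mem (hAR a.2) (hAR c.2)) (pow_mem hg n)

theorem exists_localRing_eq [IsProper f] [SmoothOfRelativeDimension 1 f]
    (R : ValuationSubring (FunctionField f)) (hR : R ≠ ⊤)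
    (hc : ∀ c : ℂ, algebraMap ℂ (FunctionField f) c ∈ R) :
    ∃ x, ∀ g, g ∈ localRing f x ↔ g ∈ R := by
  have hex : ValuativeCriterion.Existence f := by
    have : UniversallyClosed f := inferInstance
    rw [UniversallyClosed.eq_valuativeCriterion] at this
    exact this.1
  let j : ℂ →+* R := (algebraMap ℂ (FunctionField f)).codRestrict R hc
  let i₁ : Spec (CommRingCat.of (FunctionField f)) ⟶ C := C.fromSpecStalk (genericPoint C)
  let i₂ : Spec (CommRingCat.of R) ⟶ Spec (CommRingCat.of ℂ) := Spec.map (CommRingCat.ofHom j)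
  have sq : CommSq i₁ (Spec.map (CommRingCat.ofHom (algebraMap R (FunctionField f)))) f i₂ := by
    constructor
    rw [← Spec.map_comp]
    exact (specMap_constStalk f (genericPoint C)).symm
  obtain ⟨⟨l, hl1, hl2⟩⟩ := (hex ⟨R, FunctionField f, i₁, i₂, sq⟩).exists_lift
  let x : C := l (closedPoint R)
  let φ : C.presheaf.stalk x ⟶ CommRingCat.of R := Scheme.stalkClosedPointTo l
  have hφ : Spec.map φ ≫ C.fromSpecStalk x = l := Scheme.Spec_stalkClosedPointTo_fromSpecStalk l
  have hgx : genericPoint C ⤳ x := (genericPoint_spec C).specializes trivial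
  have hcomp : φ ≫ CommRingCat.ofHom (algebraMap R (FunctionField f)) =
      C.presheaf.stalkSpecializes hgx := by
    apply Spec.map_injective
    rw [← cancel_mono (C.fromSpecStalk x)]
    refine Eq.trans ?_ (Scheme.SpecMap_stalkSpecializes_fromSpecStalk hgx).symm
    rw [Spec.map_comp, Category.assoc, hφ]
    exact hl1
  have : CompactSpace C := by
    have : QuasiCompact f := inferInstance
    exact QuasiCompact.compactSpace_of_compactSpace f
  obtain ⟨y, hy1, hy2⟩ := (isClosed_closure (s := ({x} : Set C))).exists_closed_singleton
    ⟨x, subset_closure rfl⟩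
  have hxy : x ⤳ y := specializes_iff_mem_closure.2 hy1
  refine ⟨⟨y, hy2⟩, ?_⟩
  have := isDiscreteValuationRing_stalk f ⟨y, hy2⟩
  have : IsDiscreteValuationRing (localRing f ⟨y, hy2⟩).toSubring :=
    IsDiscreteValuationRing.RingEquivClass.isDiscreteValuationRing (stalkEquiv f ⟨y, hy2⟩)
  have : IsFractionRing (localRing f ⟨y, hy2⟩).toSubring (FunctionField f) :=
    isFractionRing_localRing f ⟨y, hy2⟩
  have hle : (localRing f ⟨y, hy2⟩).toSubring ≤ R.toSubring := by
    rintro _ ⟨a, rfl⟩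
    have h1 : C.presheaf.stalkSpecializes hxy ≫ C.presheaf.stalkSpecializes hgx =
      C.presheaf.stalkSpecializes (hgx.trans hxy) := C.presheaf.stalkSpecializes_comp _ _
    have h2 : algebraMap (C.presheaf.stalk y) C.functionField a =
        ((φ ((C.presheaf.stalkSpecializes hxy) a) : R) : FunctionField f) := by
      change C.presheaf.stalkSpecializes (hgx.trans hxy) a = _
      rw [← h1, ← hcomp]
      rfl
    rw [h2]
    exact Subtype.property _
  have := eq_of_le_of_isDiscreteValuationRing _ R.toSubring hle
    (fun h => hR (ValuationSubring.toSubring_injective h))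
  intro g
  change g ∈ (localRing f ⟨y, hy2⟩).toSubring ↔ g ∈ R.toSubring
  rw [this]

theorem localRing_injective [IsProper f] [SmoothOfRelativeDimension 1 f] :
    Function.Injective (localRing f) := by
  intro x y hxy
  have huniq : ValuativeCriterion.Uniqueness f := IsSeparated.valuativeCriterion f
  let R := localRing f x
  have := isDiscreteValuationRing_stalk f x
  have : IsDiscreteValuationRing R :=
    IsDiscreteValuationRing.RingEquivClass.isDiscreteValuationRing (stalkEquiv f x)
  have : IsFractionRing R (FunctionField f) := isFractionRing_localRing f x
  let ey : C.presheaf.stalk y.1 ≃+* R :=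
    (stalkEquiv f y).trans (Subalgebra.equivOfEq _ _ hxy.symm).toRingEquiv
  let lx : Spec (CommRingCat.of R) ⟶ C :=
    Spec.map (CommRingCat.ofHom (stalkEquiv f x).toRingHom) ≫ C.fromSpecStalk x.1
  let ly : Spec (CommRingCat.of R) ⟶ C :=
    Spec.map (CommRingCat.ofHom ey.toRingHom) ≫ C.fromSpecStalk y.1
  let i₁ : Spec (CommRingCat.of (FunctionField f)) ⟶ C := C.fromSpecStalk (genericPoint C)
  let i₂ : Spec (CommRingCat.of R) ⟶ Spec (CommRingCat.of ℂ) :=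
    Spec.map (CommRingCat.ofHom (algebraMap ℂ R))
  have sq : CommSq i₁ (Spec.map (CommRingCat.ofHom (algebraMap R (FunctionField f)))) f i₂ := by
    constructor
    rw [← Spec.map_comp]
    exact (specMap_constStalk f (genericPoint C)).symm
  have key : ∀ (z : C) (e : C.presheaf.stalk z ≃+* R)
      (_ : ∀ a, ((e a : R) : FunctionField f) =
        algebraMap (C.presheaf.stalk z) C.functionField a),
      Spec.map (CommRingCat.ofHom (algebraMap R (FunctionField f))) ≫
        Spec.map (CommRingCat.ofHom e.toRingHom) ≫ C.fromSpecStalk z = i₁ ∧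
      (Spec.map (CommRingCat.ofHom e.toRingHom) ≫ C.fromSpecStalk z) ≫ f = i₂ := by
    intro z e he
    have hg : genericPoint C ⤳ z := (genericPoint_spec C).specializes trivial
    constructor
    · rw [← Spec.map_comp_assoc]
      have : CommRingCat.ofHom e.toRingHom ≫ CommRingCat.ofHom (algebraMap R (FunctionField f)) =
          C.presheaf.stalkSpecializes hg := by
        ext a
        exact he a
      rw [this]
      exact Scheme.SpecMap_stalkSpecializes_fromSpecStalk hg
    · rw [Category.assoc, ← specMap_constStalk, ← Spec.map_comp]
      refine congrArg (fun j : ℂ →+* R => Spec.map (CommRingCat.ofHom j))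
        (RingHom.ext fun c => Subtype.ext ?_ :
          e.toRingHom.comp (constStalk f z) = algebraMap ℂ R)
      change ((e (constStalk f z c) : R) : FunctionField f) = algebraMap ℂ (FunctionField f) c
      rw [he]
      have h : C.presheaf.germ ⊤ z trivial ≫ C.presheaf.stalkSpecializes hg =
        C.presheaf.germ ⊤ (genericPoint C) trivial := C.presheaf.germ_stalkSpecializes _ _
      change (C.presheaf.stalkSpecializes hg).hom _ = constStalk f (genericPoint C) c
      simp only [constStalk, ← h, CommRingCat.hom_comp, RingHom.comp_apply]
  have hsub := huniq ⟨R, FunctionField f, i₁, i₂, sq⟩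
  obtain ⟨a1, a2⟩ := key x.1 (stalkEquiv f x) (fun a => rfl)
  obtain ⟨b1, b2⟩ := key y.1 ey (fun a => rfl)
  have hl : lx = ly := congrArg CommSq.LiftStruct.l (hsub.elim ⟨lx, a1, a2⟩ ⟨ly, b1, b2⟩)
  have hpt : ∀ (z : C) (e : C.presheaf.stalk z ≃+* R),
      (Spec.map (CommRingCat.ofHom e.toRingHom) ≫ C.fromSpecStalk z) (closedPoint R) = z := by
    intro z e
    have : IsLocalHom (CommRingCat.ofHom e.toRingHom).hom :=
      inferInstanceAs (IsLocalHom (e : C.presheaf.stalk z →+* R))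
    have h := Spec_closedPoint (f := CommRingCat.ofHom e.toRingHom)
    refine (Scheme.Hom.comp_apply _ _ _).trans ?_
    exact (congrArg _ h).trans Scheme.fromSpecStalk_closedPoint
  apply Subtype.ext
  refine (hpt x.1 (stalkEquiv f x)).symm.trans (Eq.trans ?_ (hpt y.1 ey))
  exact congrArg (fun l : Spec (CommRingCat.of R) ⟶ C => l (closedPoint R)) hl

theorem isCurve [IsProper f] [SmoothOfRelativeDimension 1 f] : IsCurve (localRing f) := by
  obtain ⟨V, hV, hxV, h⟩ := exists_standardSmooth f (genericPoint C)
  set φ := ((Scheme.ΓSpecIso (CommRingCat.of ℂ)).inv ≫ f.appTop ≫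
        C.presheaf.map (homOfLE le_top).op : CommRingCat.of ℂ ⟶ Γ(C, V)) with hφ
  let : Algebra ℂ Γ(C, V) := φ.hom.toAlgebra
  have : Algebra.IsStandardSmoothOfRelativeDimension 1 ℂ Γ(C, V) := h
  have : Algebra.IsStandardSmooth ℂ Γ(C, V) :=
    Algebra.IsStandardSmoothOfRelativeDimension.isStandardSmooth 1
  have : Nonempty V := ⟨⟨_, hxV⟩⟩
  let : Algebra Γ(C, V) (FunctionField f) := inferInstanceAs (Algebra Γ(C, V) C.functionField)
  have : IsScalarTower ℂ Γ(C, V) (FunctionField f) := by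
    refine IsScalarTower.of_algebraMap_eq' ?_
    change constStalk f (genericPoint C) = (φ ≫ C.presheaf.germ V (genericPoint C) hxV).hom
    rw [hφ]
    simp [constStalk]
  have : IsFractionRing Γ(C, V) (FunctionField f) :=
    functionField_isFractionRing_of_isAffineOpen C V hV
  have hrk := finrank_kaehler_of_standardSmooth (k := ℂ) (A := Γ(C, V)) (K := FunctionField f)
  have : Algebra.EssFiniteType Γ(C, V) (FunctionField f) :=
    Algebra.EssFiniteType.of_isLocalization _ (nonZeroDivisors Γ(C, V))
  have : Algebra.EssFiniteType ℂ (FunctionField f) :=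
    Algebra.EssFiniteType.comp ℂ Γ(C, V) (FunctionField f)
  exact
  { dvr := fun x => by
      have := isDiscreteValuationRing_stalk f x
      exact IsDiscreteValuationRing.RingEquivClass.isDiscreteValuationRing (stalkEquiv f x)
    isFractionRing := isFractionRing_localRing f
    exists_eq := exists_localRing_eq f
    injective := localRing_injective f
    finiteDimensional := fun t ht =>
      finiteDimensional_of_kaehler t (transcendental_of_notMem_range ht) hrk
    finrank_kaehler := hrk
    D_ne_zero := fun t ht =>
      D_ne_zero_of_transcendental t (transcendental_of_notMem_range ht) }

end CobleCurve
end

noncomputable section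
open scoped TensorProduct KaehlerDifferential
namespace CobleCurve
namespace IsCurve
variable {K : Type} [Field K] [Algebra ℂ K] {P : Type} {O : P → Subalgebra ℂ K} (hC : IsCurve O)

include hC in
theorem exists_uniformizer (x : P) : ∃ π : K, π ≠ 0 ∧ π ∈ O x ∧ π⁻¹ ∉ O x ∧
    ∀ g : K, g ≠ 0 → ∃ (n : ℤ) (u : K), u ∈ O x ∧ u⁻¹ ∈ O x ∧ g = π ^ n * u := by
  have := hC.dvr x
  have := hC.isFractionRing x
  obtain ⟨π, hπ⟩ := IsDiscreteValuationRing.exists_irreducible (O x)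
  have hπ0 : (π : K) ≠ 0 := fun h => hπ.ne_zero (Subtype.ext h)
  have hunit : ∀ u : (O x)ˣ, ((u : O x) : K)⁻¹ ∈ O x := fun u => by
    have : ((u : O x) : K) * ((u⁻¹ : (O x)ˣ) : O x) = 1 := congrArg Subtype.val u.mul_inv
    rw [← eq_inv_of_mul_eq_one_right this]
    exact Subtype.property _
  refine ⟨π, hπ0, π.2, fun h => hπ.not_isUnit ?_, fun g hg => ?_⟩
  · exact IsUnit.of_mul_eq_one ⟨_, h⟩ (Subtype.ext (mul_inv_cancel₀ hπ0))
  · obtain ⟨a, b, hb, rfl⟩ := IsFractionRing.div_surjective (A := O x) g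
    have hb0 : b ≠ 0 := nonZeroDivisors.ne_zero hb
    have ha0 : a ≠ 0 := by rintro rfl; simp at hg
    obtain ⟨n, u, hu⟩ := IsDiscreteValuationRing.associated_pow_irreducible ha0 hπ
    obtain ⟨m, v, hv⟩ := IsDiscreteValuationRing.associated_pow_irreducible hb0 hπ
    have hu' : (a : K) * ((u : O x) : K) = (π : K) ^ n := congrArg Subtype.val hu
    have hv' : (b : K) * ((v : O x) : K) = (π : K) ^ m := congrArg Subtype.val hv
    have hu0 : ((u : O x) : K) ≠ 0 := fun h => by
      rw [h, mul_zero] at hu'; exact pow_ne_zero _ hπ0 hu'.symm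
    have hv0 : ((v : O x) : K) ≠ 0 := fun h => by
      rw [h, mul_zero] at hv'; exact pow_ne_zero _ hπ0 hv'.symm
    have hbK : (b : K) ≠ 0 := fun h => hb0 (Subtype.ext h)
    refine ⟨n - m, ((v : O x) : K) * ((u : O x) : K)⁻¹, mul_mem v.1.2 (hunit u), ?_, ?_⟩
    · rw [mul_inv, inv_inv]
      exact mul_mem (hunit v) u.1.2
    · change (a : K) / b = _
      rw [zpow_sub₀ hπ0, zpow_natCast, zpow_natCast, ← hu', ← hv']
      field_simp

/-- A uniformizer at `x`. -/
def unif (x : P) : K := (hC.exists_uniformizer x).choose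

theorem unif_ne_zero (x : P) : hC.unif x ≠ 0 := (hC.exists_uniformizer x).choose_spec.1
theorem unif_mem (x : P) : hC.unif x ∈ O x := (hC.exists_uniformizer x).choose_spec.2.1
theorem unif_inv_notMem (x : P) : (hC.unif x)⁻¹ ∉ O x :=
  (hC.exists_uniformizer x).choose_spec.2.2.1
theorem exists_eq_zpow (x : P) {g : K} (hg : g ≠ 0) :
    ∃ (n : ℤ) (u : K), u ∈ O x ∧ u⁻¹ ∈ O x ∧ g = hC.unif x ^ n * u :=
  (hC.exists_uniformizer x).choose_spec.2.2.2 g hg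

open Classical in
/-- The order of vanishing at `x` (with the junk value `0` at `0`). -/
def ord (x : P) (g : K) : ℤ := if hg : g ≠ 0 then (hC.exists_eq_zpow x hg).choose else 0

theorem zpow_mem_iff (x : P) (n : ℤ) : hC.unif x ^ n ∈ O x ↔ 0 ≤ n := by
  constructor
  · intro h
    by_contra hn
    apply hC.unif_inv_notMem x
    have h2 : (hC.unif x)⁻¹ = hC.unif x ^ n * hC.unif x ^ (-n - 1).toNat := by
      rw [← zpow_natCast, ← zpow_add₀ (hC.unif_ne_zero x), ← zpow_neg_one]
      congr 1; omega
    rw [h2]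
    exact mul_mem h (pow_mem (hC.unif_mem x) _)
  · intro h
    lift n to ℕ using h
    rw [zpow_natCast]
    exact pow_mem (hC.unif_mem x) _

theorem exists_unit (x : P) {g : K} (hg : g ≠ 0) :
    ∃ u : K, u ∈ O x ∧ u⁻¹ ∈ O x ∧ u ≠ 0 ∧ g = hC.unif x ^ hC.ord x g * u := by
  obtain ⟨u, h1, h2, h3⟩ := (hC.exists_eq_zpow x hg).choose_spec
  refine ⟨u, h1, h2, fun h => hg (by rw [h3, h, mul_zero]), ?_⟩
  rw [ord, dif_pos hg]
  exact h3

theorem ord_eq (x : P) (n : ℤ) {u : K} (hu : u ∈ O x) (hu' : u⁻¹ ∈ O x) (hu0 : u ≠ 0) :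
    hC.ord x (hC.unif x ^ n * u) = n := by
  have hg : hC.unif x ^ n * u ≠ 0 := mul_ne_zero (zpow_ne_zero _ (hC.unif_ne_zero x)) hu0
  obtain ⟨v, h1, h2, h3, h4⟩ := hC.exists_unit x hg
  set m := hC.ord x (hC.unif x ^ n * u)
  have e : hC.unif x ^ (n - m) = v * u⁻¹ := by
    rw [zpow_sub₀ (hC.unif_ne_zero x), div_eq_iff (zpow_ne_zero _ (hC.unif_ne_zero x))]
    field_simp
    rw [h4]; ring
  have e' : hC.unif x ^ (m - n) = u * v⁻¹ := by
    rw [← neg_sub, zpow_neg, e, mul_inv, inv_inv, mul_comm]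
  have i1 := (hC.zpow_mem_iff x (n - m)).1 (e ▸ mul_mem h1 hu')
  have i2 := (hC.zpow_mem_iff x (m - n)).1 (e' ▸ mul_mem hu h2)
  omega

theorem ord_mul (x : P) {g h : K} (hg : g ≠ 0) (hh : h ≠ 0) :
    hC.ord x (g * h) = hC.ord x g + hC.ord x h := by
  obtain ⟨u, h1, h2, h3, h4⟩ := hC.exists_unit x hg
  obtain ⟨v, k1, k2, k3, k4⟩ := hC.exists_unit x hh
  have : g * h = hC.unif x ^ (hC.ord x g + hC.ord x h) * (u * v) := by
    conv_lhs => rw [h4, k4]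
    rw [zpow_add₀ (hC.unif_ne_zero x)]; ring
  rw [this]
  exact hC.ord_eq x _ (mul_mem h1 k1) (by rw [mul_inv]; exact mul_mem h2 k2) (mul_ne_zero h3 k3)

theorem ord_one (x : P) : hC.ord x 1 = 0 := by
  have := hC.ord_eq x 0 (one_mem (O x)) (by rw [inv_one]; exact one_mem _) one_ne_zero
  simpa using this

theorem ord_inv (x : P) {g : K} (hg : g ≠ 0) : hC.ord x g⁻¹ = - hC.ord x g := by
  have := hC.ord_mul x hg (inv_ne_zero hg)
  rw [mul_inv_cancel₀ hg, ord_one] at this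
  omega

theorem ord_pow (x : P) {g : K} (hg : g ≠ 0) (n : ℕ) : hC.ord x (g ^ n) = n * hC.ord x g := by
  induction n with
  | zero => simp [ord_one]
  | succ n ih => rw [pow_succ, hC.ord_mul x (pow_ne_zero _ hg) hg, ih]; push_cast; ring

theorem ord_unif_zpow (x : P) (n : ℤ) : hC.ord x (hC.unif x ^ n) = n := by
  have := hC.ord_eq x n (one_mem (O x)) (by rw [inv_one]; exact one_mem _) one_ne_zero
  simpa using this

theorem ord_unif (x : P) : hC.ord x (hC.unif x) = 1 := by
  simpa using hC.ord_unif_zpow x 1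

theorem mem_iff (x : P) {g : K} (hg : g ≠ 0) : g ∈ O x ↔ 0 ≤ hC.ord x g := by
  obtain ⟨u, h1, h2, h3, h4⟩ := hC.exists_unit x hg
  rw [← hC.zpow_mem_iff]
  constructor
  · intro h
    have : hC.unif x ^ hC.ord x g = g * u⁻¹ := by
      conv_rhs => rw [h4]
      field_simp
    rw [this]
    exact mul_mem h h2
  · intro h
    rw [h4]; exact mul_mem h h1

/-- The fractional ideal `𝔪ₓⁿ`. -/
def mpow (x : P) (n : ℤ) : Submodule (O x) K where
  carrier := {g | hC.unif x ^ (-n) * g ∈ O x}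
  add_mem' ha hb := by
    simp only [Set.mem_ofPred_eq, mul_add] at *
    exact add_mem ha hb
  zero_mem' := by simp
  smul_mem' c g hg := by
    have : hC.unif x ^ (-n) * (c • g) = c * (hC.unif x ^ (-n) * g) := by
      rw [Subalgebra.smul_def, smul_eq_mul]; ring
    simp only [Set.mem_ofPred_eq] at *
    rw [this]
    exact mul_mem c.2 hg

theorem mem_mpow (x : P) (n : ℤ) (g : K) : g ∈ hC.mpow x n ↔ g = 0 ∨ n ≤ hC.ord x g := by
  change hC.unif x ^ (-n) * g ∈ O x ↔ _
  by_cases hg : g = 0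
  · simp [hg]
  · have h0 := zpow_ne_zero (-n) (hC.unif_ne_zero x)
    rw [hC.mem_iff x (mul_ne_zero h0 hg), hC.ord_mul x h0 hg, ord_unif_zpow]
    simp only [hg, false_or]
    omega

theorem mem_mpow_of_ne_zero (x : P) (n : ℤ) {g : K} (hg : g ≠ 0) :
    g ∈ hC.mpow x n ↔ n ≤ hC.ord x g := by simp [mem_mpow, hg]

theorem mem_mpow_zero (x : P) (g : K) : g ∈ hC.mpow x 0 ↔ g ∈ O x := by
  change hC.unif x ^ (-0 : ℤ) * g ∈ O x ↔ _
  simp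

theorem mpow_mono (x : P) {m n : ℤ} (h : m ≤ n) {g : K} (hg : g ∈ hC.mpow x n) :
    g ∈ hC.mpow x m := by
  rw [mem_mpow] at *
  exact hg.imp_right h.trans

theorem mul_mem_mpow (x : P) {m n : ℤ} {g h : K} (hg : g ∈ hC.mpow x m) (hh : h ∈ hC.mpow x n) :
    g * h ∈ hC.mpow x (m + n) := by
  by_cases hg0 : g = 0
  · simp [hg0]
  by_cases hh0 : h = 0
  · simp [hh0]
  rw [mem_mpow_of_ne_zero _ _ _ hg0] at hg
  rw [mem_mpow_of_ne_zero _ _ _ hh0] at hh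
  rw [mem_mpow_of_ne_zero _ _ _ (mul_ne_zero hg0 hh0), hC.ord_mul x hg0 hh0]
  omega

theorem mul_mem_mpow_iff (x : P) {n : ℤ} {g h : K} (hg : g ≠ 0) :
    g * h ∈ hC.mpow x n ↔ h ∈ hC.mpow x (n - hC.ord x g) := by
  by_cases hh0 : h = 0
  · simp [hh0]
  rw [mem_mpow_of_ne_zero _ _ _ hh0, mem_mpow_of_ne_zero _ _ _ (mul_ne_zero hg hh0),
    hC.ord_mul x hg hh0]
  omega

theorem ord_eq_zero_of_mem (x : P) {g : K} (h1 : g ∈ O x) (h2 : g ∉ hC.mpow x 1) :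
    hC.ord x g = 0 := by
  have hg : g ≠ 0 := fun h => h2 (h ▸ zero_mem _)
  rw [mem_mpow_of_ne_zero _ _ _ hg] at h2
  rw [hC.mem_iff x hg] at h1
  omega

theorem inv_mem_mpow_one_iff (x : P) {g : K} (hg : g ≠ 0) : g⁻¹ ∈ hC.mpow x 1 ↔ g ∉ O x := by
  rw [mem_mpow_of_ne_zero _ _ _ (inv_ne_zero hg), hC.ord_inv x hg, hC.mem_iff x hg]
  omega

theorem ord_algebraMap (x : P) (c : ℂ) : hC.ord x (algebraMap ℂ K c) = 0 := by
  by_cases hc : c = 0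
  · rw [hc, map_zero, ord, dif_neg (by simp)]
  have h0 : algebraMap ℂ K c ≠ 0 := by simpa using hc
  have h1 := (hC.mem_iff x h0).1 ((O x).algebraMap_mem c)
  have h2 := (hC.mem_iff x (inv_ne_zero h0)).1
    (by rw [← map_inv₀]; exact (O x).algebraMap_mem c⁻¹)
  rw [hC.ord_inv x h0] at h2
  omega

theorem one_notMem_mpow_one (x : P) : (1 : K) ∉ hC.mpow x 1 := by
  rw [mem_mpow_of_ne_zero _ _ _ one_ne_zero, ord_one]; omega

/-- The local ring as a valuation subring. -/
def valuationSubring (x : P) : ValuationSubring K :=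
  { (O x).toSubring with
    mem_or_inv_mem' := fun g => by
      by_cases hg : g = 0
      · left; rw [hg]; exact zero_mem (O x)
      · rcases le_total 0 (hC.ord x g) with h | h
        · left; exact (hC.mem_iff x hg).2 h
        · right; exact (hC.mem_iff x (inv_ne_zero hg)).2 (by rw [hC.ord_inv x hg]; omega) }

include hC in
theorem mem_of_isIntegral (x : P) {A : Type} [CommRing A] [Algebra A K]
    (hA : ∀ a : A, algebraMap A K a ∈ O x) {g : K} (hg : IsIntegral A g) : g ∈ O x := by
  have h1 : IsIntegral (hC.valuationSubring x) g := by
    obtain ⟨p, hp, hp'⟩ := hg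
    let j : A →+* hC.valuationSubring x :=
      (algebraMap A K).codRestrict (hC.valuationSubring x) hA
    refine ⟨p.map j, hp.map j, ?_⟩
    rw [Polynomial.eval₂_map]
    exact hp'
  obtain ⟨y, hy⟩ := IsIntegrallyClosed.isIntegral_iff.1 h1
  rw [← hy]
  exact y.2

/-- The residue field at each point is `ℂ`. -/
theorem exists_sub_mem (x : P) {g : K} (hg : g ∈ O x) :
    ∃ c : ℂ, g - algebraMap ℂ K c ∈ hC.mpow x 1 := by
  by_contra hcon
  push Not at hcon
  have hgc : g ∉ (algebraMap ℂ K).range := by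
    rintro ⟨c, rfl⟩
    exact hcon c (by simp)
  have hunit : ∀ p : Polynomial ℂ, p ≠ 0 → Polynomial.aeval g p ∈ O x ∧
      (Polynomial.aeval g p)⁻¹ ∈ O x := by
    intro p hp
    have hs := IsAlgClosed.splits p
    have hlin : ∀ c : ℂ, (g - algebraMap ℂ K c)⁻¹ ∈ O x := by
      intro c
      have h0 : g - algebraMap ℂ K c ≠ 0 := fun h => hcon c (h ▸ zero_mem _)
      rw [hC.mem_iff x (inv_ne_zero h0), hC.ord_inv x h0,
        hC.ord_eq_zero_of_mem x (sub_mem hg ((O x).algebraMap_mem c)) (hcon c)]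
      simp
    refine ⟨Subalgebra.aeval_coe (O x) (⟨g, hg⟩ : O x) p ▸ Subtype.property _, ?_⟩
    rw [hs.eq_prod_roots]
    rw [map_mul, map_multiset_prod, Polynomial.aeval_C, mul_inv, ← map_inv₀, Multiset.map_map,
      ← Multiset.prod_map_inv]
    refine mul_mem ((O x).algebraMap_mem _) (Submonoid.multiset_prod_mem (O x).toSubmonoid _ ?_)
    intro a ha
    simp only [Multiset.mem_map, Function.comp_apply] at ha
    obtain ⟨c, -, rfl⟩ := ha
    simpa using hlin c
  have hF : ∀ a : IntermediateField.adjoin ℂ {g}, algebraMap _ K a ∈ O x := by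
    rintro ⟨a, ha⟩
    obtain ⟨p, q, h⟩ := (IntermediateField.mem_adjoin_simple_iff ℂ a).1 ha
    change a ∈ O x
    rw [h]
    by_cases hq : q = 0
    · simp [hq]
    by_cases hp : p = 0
    · simp [hp]
    rw [div_eq_mul_inv]
    exact mul_mem (hunit p hp).1 (hunit q hq).2
  have := hC.finiteDimensional g hgc
  apply hC.unif_inv_notMem x
  exact hC.mem_of_isIntegral x hF
    (Algebra.IsIntegral.isIntegral (R := IntermediateField.adjoin ℂ {g}) _)

end IsCurve
end CobleCurve
end

noncomputable section
open scoped TensorProduct KaehlerDifferential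
namespace CobleCurve
namespace IsCurve
variable {K : Type} [Field K] [Algebra ℂ K] {P : Type} {O : P → Subalgebra ℂ K} (hC : IsCurve O)
include hC

theorem exists_of_valuationSubring (R : ValuationSubring K) (hc : ∀ c : ℂ, algebraMap ℂ K c ∈ R)
    {g : K} (hg : g ∉ R) : ∃ x, g ∉ O x ∧ ∀ h ∈ R, h ∈ O x := by
  obtain ⟨x, hx⟩ := hC.exists_eq R (fun h => hg (h ▸ ValuationSubring.mem_top g)) hc
  exact ⟨x, fun h => hg ((hx g).1 h), fun h hh => (hx h).2 hh⟩

/-- The integral closure of `ℂ[t]` consists of the functions regular wherever `t` is. -/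
theorem isIntegral_adjoin_iff (t g : K) :
    IsIntegral (Algebra.adjoin ℂ {t}) g ↔ ∀ x, t ∈ O x → g ∈ O x := by
  constructor
  · intro h x hx
    refine hC.mem_of_isIntegral x (fun a => ?_) h
    exact Algebra.adjoin_le (Set.singleton_subset_iff.2 hx) a.2
  · intro h
    by_contra hg
    let B := (integralClosure (Algebra.adjoin ℂ {t}) K).toSubring
    have : IsIntegrallyClosedIn B K :=
      inferInstanceAs (IsIntegrallyClosedIn (integralClosure (Algebra.adjoin ℂ {t}) K) K)
    obtain ⟨V, hV, hgV⟩ := Subring.exists_le_valuationSubring_of_isIntegrallyClosedIn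
      (R := B) (x := g) hg
    have hV' : ∀ a ∈ Algebra.adjoin ℂ {t}, a ∈ V := fun a ha =>
      hV (show a ∈ integralClosure (Algebra.adjoin ℂ {t}) K from
        isIntegral_algebraMap (x := (⟨a, ha⟩ : Algebra.adjoin ℂ {t})))
    obtain ⟨x, hx1, hx2⟩ := hC.exists_of_valuationSubring V
      (fun c => hV' _ (Subalgebra.algebraMap_mem _ c)) hgV
    exact hx1 (h x (hx2 t (hV' t (Algebra.self_mem_adjoin_singleton ℂ t))))

/-- A nonconstant function has a zero. -/
theorem exists_zero {s : K} (hs : s ∉ (algebraMap ℂ K).range) : ∃ x, s ∈ hC.mpow x 1 := by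
  have ht := transcendental_of_notMem_range hs
  have hs0 : s ≠ 0 := fun h => hs ⟨0, by simp [h]⟩
  let A := (Algebra.adjoin ℂ {s}).toSubring
  have hsA : s ∈ A := Algebra.self_mem_adjoin_singleton ℂ s
  have hI : Ideal.span {(⟨s, hsA⟩ : A)} ≠ ⊤ := by
    intro h
    rw [Ideal.span_singleton_eq_top, isUnit_iff_exists_inv] at h
    obtain ⟨⟨b, hb⟩, hb'⟩ := h
    have hb2 : s * b = 1 := congrArg Subtype.val hb'
    have hb : b ∈ Algebra.adjoin ℂ {s} := hb
    rw [Algebra.adjoin_singleton_eq_range_aeval] at hb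
    obtain ⟨p, rfl⟩ := hb
    have h3 : Polynomial.aeval s (Polynomial.X * p - 1) = 0 := by
      simpa [sub_eq_zero] using hb2
    have h4 := (transcendental_iff.1 ht) _ h3
    have := congrArg (Polynomial.eval 0) h4
    simp at this
  obtain ⟨V, hV1, hV2⟩ := Ideal.image_subset_nonunits_valuationSubring _ hI
  have hsV : s ∈ V.nonunits := hV2 ⟨_, Ideal.mem_span_singleton_self _, rfl⟩
  have hinv : s⁻¹ ∉ V := by
    intro h
    have h1 : s⁻¹⁻¹ ∈ V.nonunits := by rwa [inv_inv]
    rcases V.inv_mem_nonunits_iff.1 h1 with h2 | h2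
    · exact hs0 (inv_eq_zero.1 h2)
    · exact h2 h
  obtain ⟨x, hx, -⟩ := hC.exists_of_valuationSubring V
    (fun c => hV1 ((Algebra.adjoin ℂ {s}).algebraMap_mem c)) hinv
  refine ⟨x, ?_⟩
  rw [← inv_inv s, hC.inv_mem_mpow_one_iff x (inv_ne_zero hs0)]
  exact hx

/-- A function without poles is constant. -/
theorem mem_range_of_forall_mem {g : K} (hg : ∀ x, g ∈ O x) : g ∈ (algebraMap ℂ K).range := by
  by_contra h
  have h0 : g ≠ 0 := fun h' => h ⟨0, by simp [h']⟩
  have hinv : g⁻¹ ∉ (algebraMap ℂ K).range := by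
    rintro ⟨c, hc⟩
    exact h ⟨c⁻¹, by rw [map_inv₀, hc, inv_inv]⟩
  obtain ⟨x, hx⟩ := hC.exists_zero hinv
  exact (hC.inv_mem_mpow_one_iff x h0).1 hx (hg x)

omit hC in
theorem isPrincipalIdealRing_adjoin {t : K} (ht : t ∉ (algebraMap ℂ K).range) :
    IsPrincipalIdealRing (Algebra.adjoin ℂ {t}) := by
  have hinj := transcendental_iff_injective.1 (transcendental_of_notMem_range ht)
  let e : Polynomial ℂ ≃+* Algebra.adjoin ℂ {t} :=
    ((AlgEquiv.ofInjective (Polynomial.aeval t) hinj).trans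
      (Subalgebra.equivOfEq _ _ (Algebra.adjoin_singleton_eq_range_aeval ℂ t).symm)).toRingEquiv
  exact IsPrincipalIdealRing.of_surjective e.toRingHom e.surjective

open scoped IntermediateField.algebraAdjoinAdjoin

theorem isDedekindDomain_integralClosure {t : K} (ht : t ∉ (algebraMap ℂ K).range) :
    IsDedekindDomain (integralClosure (Algebra.adjoin ℂ {t}) K) := by
  have := isPrincipalIdealRing_adjoin ht
  have := hC.finiteDimensional t ht
  exact integralClosure.isDedekindDomain _ (IntermediateField.adjoin ℂ {t}) K

theorem isFractionRing_integralClosure {t : K} (ht : t ∉ (algebraMap ℂ K).range) :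
    IsFractionRing (integralClosure (Algebra.adjoin ℂ {t}) K) K := by
  have := hC.finiteDimensional t ht
  exact integralClosure.isFractionRing_of_finite_extension (IntermediateField.adjoin ℂ {t}) K

omit hC in
/-- The prime ideal of a point in the ring of functions regular wherever `t` is. -/
def primeAt (hC : IsCurve O) {t : K} (x : P) (hx : t ∈ O x) :
    Ideal (integralClosure (Algebra.adjoin ℂ {t}) K) where
  carrier := {b | (b : K) ∈ hC.mpow x 1}
  add_mem' ha hb := (hC.mpow x 1).add_mem ha hb
  zero_mem' := zero_mem (hC.mpow x 1)
  smul_mem' c _ hb := (hC.mpow x 1).smul_mem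
    (⟨c, (hC.isIntegral_adjoin_iff t c).1 c.2 x hx⟩ : O x) hb

theorem mul_notMem_mpow_one (x : P) {a b : K} (ha : a ∈ O x) (hb : b ∈ O x)
    (ha' : a ∉ hC.mpow x 1) (hb' : b ∉ hC.mpow x 1) : a * b ∉ hC.mpow x 1 := by
  have ha0 : a ≠ 0 := fun h => ha' (h ▸ zero_mem _)
  have hb0 : b ≠ 0 := fun h => hb' (h ▸ zero_mem _)
  rw [mem_mpow_of_ne_zero _ _ _ (mul_ne_zero ha0 hb0), hC.ord_mul x ha0 hb0,
    hC.ord_eq_zero_of_mem x ha ha', hC.ord_eq_zero_of_mem x hb hb']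
  omega

theorem isPrime_primeAt {t : K} (x : P) (hx : t ∈ O x) : (hC.primeAt x hx).IsPrime := by
  constructor
  · intro h
    have : (1 : integralClosure (Algebra.adjoin ℂ {t}) K) ∈ hC.primeAt x hx := h ▸ trivial
    exact hC.one_notMem_mpow_one x this
  · intro a b hab
    by_contra hcon
    push Not at hcon
    exact hC.mul_notMem_mpow_one x ((hC.isIntegral_adjoin_iff t a).1 a.2 x hx)
      ((hC.isIntegral_adjoin_iff t b).1 b.2 x hx) hcon.1 hcon.2 hab

theorem exists_mem_primeAt {t : K} (ht : t ∉ (algebraMap ℂ K).range) (x : P) (hx : t ∈ O x) :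
    ∃ b ∈ hC.primeAt x hx, b ≠ 0 := by
  obtain ⟨c, hc⟩ := hC.exists_sub_mem x hx
  refine ⟨⟨t - algebraMap ℂ K c, ?_⟩, hc, fun h => ht ⟨c, ?_⟩⟩
  · exact (hC.isIntegral_adjoin_iff t _).2 fun y hy => sub_mem hy ((O y).algebraMap_mem c)
  · exact (sub_eq_zero.1 (congrArg Subtype.val h)).symm

theorem eq_of_primeAt_le {t : K} (ht : t ∉ (algebraMap ℂ K).range) (x y : P) (hx : t ∈ O x)
    (hy : t ∈ O y) (h : hC.primeAt x hx ≤ hC.primeAt y hy) : x = y := by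
  have := hC.isDedekindDomain_integralClosure ht
  have := hC.isFractionRing_integralClosure ht
  have hpx := hC.isPrime_primeAt x hx
  have hpy := hC.isPrime_primeAt y hy
  obtain ⟨b, hb, hb0⟩ := hC.exists_mem_primeAt ht x hx
  have hne : hC.primeAt x hx ≠ ⊥ := fun h => hb0 (by rw [h] at hb; exact hb)
  have heq : hC.primeAt x hx = hC.primeAt y hy :=
    (hpx.isMaximal hne).eq_of_le hpy.ne_top h
  let B := (integralClosure (Algebra.adjoin ℂ {t}) K).toSubring
  have : IsDedekindDomain B := hC.isDedekindDomain_integralClosure ht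
  have : IsFractionRing B K := hC.isFractionRing_integralClosure ht
  let p : Ideal B := hC.primeAt x hx
  have : p.IsPrime := hpx
  let R := (LocalSubring.ofPrime B p).toSubring
  have hRdvr : IsDiscreteValuationRing R :=
    IsLocalization.AtPrime.isDiscreteValuationRing_of_dedekind_domain B (P := p) hne R
  have : IsFractionRing R K :=
    IsFractionRing.isFractionRing_of_isDomain_of_isLocalization p.primeCompl R K
  have key : ∀ z (hz : t ∈ O z), p = hC.primeAt z hz → (O z).toSubring = R := by
    intro z hz hzp
    refine eq_of_le_of_isDiscreteValuationRing R _ (fun g hg => ?_) (fun htop => ?_)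
    · obtain ⟨a, s, hs⟩ := IsLocalization.exists_mk'_eq p.primeCompl (⟨g, hg⟩ : R)
      have h1 : (algebraMap B R s : K) * g = (algebraMap B R a : K) := by
        have := IsLocalization.mk'_spec' R a s
        rw [hs] at this
        exact congrArg Subtype.val this
      have h2 : ((s : B) : K) * g = (a : B) := h1
      have hs1 : ((s : B) : K) ∉ hC.mpow z 1 := fun h => s.2 (by
        have h' : (s : B) ∈ hC.primeAt z hz := h
        exact hzp.ge h')
      have hs2 : ((s : B) : K) ∈ O z := (hC.isIntegral_adjoin_iff t _).1 s.1.2 z hz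
      have ha2 : ((a : B) : K) ∈ O z := (hC.isIntegral_adjoin_iff t _).1 a.2 z hz
      have hs0 : ((s : B) : K) ≠ 0 := fun h => hs1 (h ▸ zero_mem _)
      have : g = (a : K) * ((s : B) : K)⁻¹ := by rw [← h2]; field_simp
      rw [this]
      refine mul_mem ha2 ((hC.mem_iff z (inv_ne_zero hs0)).2 ?_)
      rw [hC.ord_inv z hs0, hC.ord_eq_zero_of_mem z hs2 hs1]; simp
    · have : (hC.unif z)⁻¹ ∈ (O z).toSubring := htop ▸ trivial
      exact hC.unif_inv_notMem z this
  have hxy : (O x).toSubring = (O y).toSubring := (key x hx rfl).trans (key y hy heq).symm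
  exact hC.injective (Subalgebra.toSubring_injective hxy)

theorem finite_setOf_mem_mpow_one {s : K} (hs : s ≠ 0) : {x | s ∈ hC.mpow x 1}.Finite := by
  by_cases hsc : s ∈ (algebraMap ℂ K).range
  · obtain ⟨c, rfl⟩ := hsc
    convert Set.finite_empty
    refine Set.eq_empty_of_forall_notMem fun x hx => ?_
    rw [Set.mem_ofPred_eq, mem_mpow_of_ne_zero _ _ _ hs, ord_algebraMap] at hx
    omega
  have hs_int : s ∈ integralClosure (Algebra.adjoin ℂ {s}) K :=
    (hC.isIntegral_adjoin_iff s s).2 fun _ h => h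
  have := hC.isDedekindDomain_integralClosure hsc
  have hreg : ∀ x : {x | s ∈ hC.mpow x 1}, s ∈ O x.1 := fun x =>
    (hC.mem_mpow_zero _ _).1 (hC.mpow_mono x.1 zero_le_one x.2)
  have hI : Ideal.span {(⟨s, hs_int⟩ : integralClosure (Algebra.adjoin ℂ {s}) K)} ≠ 0 := by
    intro h
    rw [Submodule.zero_eq_bot, Ideal.span_singleton_eq_bot] at h
    exact hs (congrArg Subtype.val h)
  have hfin := Ideal.finite_factors hI
  let φ : {x | s ∈ hC.mpow x 1} → IsDedekindDomain.HeightOneSpectrum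
      (integralClosure (Algebra.adjoin ℂ {s}) K) := fun x =>
    ⟨hC.primeAt x.1 (hreg x), hC.isPrime_primeAt x.1 (hreg x), fun h => by
      obtain ⟨b, hb, hb0⟩ := hC.exists_mem_primeAt hsc x.1 (hreg x)
      rw [h] at hb
      exact hb0 hb⟩
  have hφ : Function.Injective φ := fun x y h => Subtype.ext
    (hC.eq_of_primeAt_le hsc x.1 y.1 (hreg x) (hreg y)
      (congrArg IsDedekindDomain.HeightOneSpectrum.asIdeal h).le)
  have hfin2 : (Set.univ : Set {x | s ∈ hC.mpow x 1}).Finite := by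
    refine Set.Finite.of_finite_image (hfin.subset ?_) hφ.injOn
    rintro _ ⟨x, -, rfl⟩
    exact Ideal.dvd_span_singleton.2 x.2
  exact Set.finite_coe_iff.1 (Set.finite_univ_iff.1 hfin2)

theorem finite_setOf_notMem (g : K) : {x | g ∉ O x}.Finite := by
  by_cases hg : g = 0
  · convert Set.finite_empty
    refine Set.eq_empty_of_forall_notMem fun x hx => hx ?_
    rw [hg]; exact zero_mem (O x)
  refine (hC.finite_setOf_mem_mpow_one (inv_ne_zero hg)).subset fun x hx => ?_
  exact (hC.inv_mem_mpow_one_iff x hg).2 hx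

theorem finite_setOf_ord_ne_zero {g : K} (hg : g ≠ 0) : {x | hC.ord x g ≠ 0}.Finite := by
  refine ((hC.finite_setOf_notMem g).union (hC.finite_setOf_notMem g⁻¹)).subset fun x hx => ?_
  simp only [Set.mem_union, Set.mem_ofPred_eq, hC.mem_iff x hg, hC.mem_iff x (inv_ne_zero hg),
    hC.ord_inv x hg] at *
  omega

theorem exists_regular_separating {t : K} (ht : t ∉ (algebraMap ℂ K).range) {p q : P}
    (hp : t ∈ O p) (hq : t ∈ O q) (hpq : p ≠ q) :
    ∃ f : K, (∀ x, t ∈ O x → f ∈ O x) ∧ f ∉ hC.mpow p 1 ∧ f ∈ hC.mpow q 1 := by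
  by_contra hcon
  push Not at hcon
  refine hpq (hC.eq_of_primeAt_le ht q p hq hp fun b hb => ?_).symm
  by_contra hb'
  exact hcon b ((hC.isIntegral_adjoin_iff t _).1 b.2) hb' hb

theorem pow_mem_mpow (x : P) {f : K} {m : ℤ} (h : f ∈ hC.mpow x m) (N : ℕ) :
    f ^ N ∈ hC.mpow x (N * m) := by
  induction N with
  | zero => simp [mem_mpow_zero]
  | succ n ih =>
    rw [pow_succ]
    have := hC.mul_mem_mpow x ih h
    convert this using 2
    push_cast; ring

/-- Approximation on the affine open set where `t` is regular. -/
theorem exists_approx {t : K} (ht : t ∉ (algebraMap ℂ K).range) {p : P} (hp : t ∈ O p)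
    {S : Set P} (hS : S.Finite) (hpS : p ∉ S) (hSt : ∀ x ∈ S, t ∈ O x) (N : ℕ) :
    ∃ f : K, (∀ x, t ∈ O x → f ∈ O x) ∧ f - 1 ∈ hC.mpow p N ∧ ∀ x ∈ S, f ∈ hC.mpow x N := by
  have hunit : ∃ f : K, (∀ x, t ∈ O x → f ∈ O x) ∧ f ∉ hC.mpow p 1 ∧
      ∀ x ∈ S, f ∈ hC.mpow x 1 := by
    induction S, hS using Set.Finite.induction_on with
    | empty => exact ⟨1, fun x _ => one_mem _, hC.one_notMem_mpow_one p, by simp⟩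
    | @insert a S ha hS ih =>
      obtain ⟨f, hf1, hf2, hf3⟩ := ih (fun h => hpS (Set.mem_insert_of_mem _ h))
        (fun x hx => hSt x (Set.mem_insert_of_mem _ hx))
      have haS := hSt a (Set.mem_insert _ _)
      obtain ⟨g, hg1, hg2, hg3⟩ := hC.exists_regular_separating ht hp haS
        (fun h => hpS (h ▸ Set.mem_insert _ _))
      refine ⟨f * g, fun x hx => mul_mem (hf1 x hx) (hg1 x hx),
        hC.mul_notMem_mpow_one p (hf1 p hp) (hg1 p hp) hf2 hg2, ?_⟩
      rintro x (rfl | hx)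
      · have := hC.mul_mem_mpow x ((hC.mem_mpow_zero x f).2 (hf1 x haS)) hg3
        simpa using this
      · have hxt := hSt x (Set.mem_insert_of_mem _ hx)
        have := hC.mul_mem_mpow x (hf3 x hx) ((hC.mem_mpow_zero x g).2 (hg1 x hxt))
        simpa using this
  obtain ⟨f, hf1, hf2, hf3⟩ := hunit
  obtain ⟨c, hc⟩ := hC.exists_sub_mem p (hf1 p hp)
  have hc0 : c ≠ 0 := by
    rintro rfl
    apply hf2
    simpa using hc
  set h : K := algebraMap ℂ K c⁻¹ * f with hh
  have h1 : ∀ x, t ∈ O x → h ∈ O x := fun x hx => mul_mem ((O x).algebraMap_mem _) (hf1 x hx)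
  have h2 : 1 - h ∈ hC.mpow p 1 := by
    have : 1 - h = (-algebraMap ℂ K c⁻¹) * (f - algebraMap ℂ K c) := by
      rw [hh, mul_sub, neg_mul, neg_mul, ← map_mul, inv_mul_cancel₀ hc0, map_one]; ring
    rw [this]
    have := hC.mul_mem_mpow p ((hC.mem_mpow_zero p _).2
      (neg_mem ((O p).algebraMap_mem c⁻¹))) hc
    simpa using this
  have h3 : ∀ x ∈ S, h ∈ hC.mpow x 1 := fun x hx => by
    have := hC.mul_mem_mpow x ((hC.mem_mpow_zero x _).2 ((O x).algebraMap_mem c⁻¹)) (hf3 x hx)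
    rwa [zero_add] at this
  refine ⟨1 - (1 - h ^ N) ^ N, fun x hx => ?_, ?_, fun x hx => ?_⟩
  · exact sub_mem (one_mem _) (pow_mem (sub_mem (one_mem _) (pow_mem (h1 x hx) _)) _)
  · have e1 : 1 - h ^ N ∈ hC.mpow p 1 := by
      have e : 1 - h ^ N = (∑ i ∈ Finset.range N, h ^ i) * (1 - h) := by
        have := geom_sum_mul h N
        linear_combination this
      rw [e]
      have hs : (∑ i ∈ Finset.range N, h ^ i) ∈ O p :=
        sum_mem fun i _ => pow_mem (h1 p hp) i
      simpa using hC.mul_mem_mpow p ((hC.mem_mpow_zero p _).2 hs) h2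
    have := hC.pow_mem_mpow p e1 N
    have e2 : 1 - (1 - h ^ N) ^ N - 1 = -((1 - h ^ N) ^ N) := by ring
    rw [e2]
    simpa using neg_mem this
  · have hxt := hSt x hx
    have e1 : 1 - (1 - h ^ N) ^ N = (∑ i ∈ Finset.range N, (1 - h ^ N) ^ i) * h ^ N := by
      have := geom_sum_mul (1 - h ^ N) N
      linear_combination this
    rw [e1]
    have hs : (∑ i ∈ Finset.range N, (1 - h ^ N) ^ i) ∈ O x :=
      sum_mem fun i _ => pow_mem (sub_mem (one_mem _) (pow_mem (h1 x hxt) _)) i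
    simpa using hC.mul_mem_mpow x ((hC.mem_mpow_zero x _).2 hs) (hC.pow_mem_mpow x (h3 x hx) N)

end IsCurve
end CobleCurve
end

noncomputable section
open scoped TensorProduct KaehlerDifferential
namespace CobleCurve
namespace IsCurve
variable {K : Type} [Field K] [Algebra ℂ K] {P : Type} {O : P → Subalgebra ℂ K} (hC : IsCurve O)
include hC

theorem exists_mul_regular {t : K} (ht : t ∉ (algebraMap ℂ K).range) {p : P} (hp : t ∈ O p)
    {g : K} (hg : g ∈ O p) : ∃ c : K, (∀ x, t ∈ O x → c ∈ O x) ∧ c - 1 ∈ hC.mpow p 1 ∧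
      ∀ x, t ∈ O x → c * g ∈ O x := by
  by_cases hg0 : g = 0
  · exact ⟨1, fun x _ => one_mem _, by simp, fun x _ => by simp [hg0]⟩
  have hfin := hC.finite_setOf_notMem g
  let S := {x | g ∉ O x} ∩ {x | t ∈ O x}
  have hS : S.Finite := hfin.inter_of_left _
  obtain ⟨N, hN⟩ : ∃ N : ℕ, ∀ x ∈ S, - hC.ord x g ≤ N := by
    obtain ⟨M, hM⟩ := (hS.image fun x => - hC.ord x g).bddAbove
    exact ⟨M.toNat, fun x hx => (hM ⟨x, hx, rfl⟩).trans (Int.self_le_toNat M)⟩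
  obtain ⟨f, h1, h2, h3⟩ := hC.exists_approx ht hp hS (fun h => h.1 hg) (fun x hx => hx.2) (N + 1)
  refine ⟨f, h1, hC.mpow_mono p (by push_cast; omega) h2, fun x hx => ?_⟩
  by_cases hxg : g ∈ O x
  · exact mul_mem (h1 x hx) hxg
  · have h4 := hC.mul_mem_mpow x (h3 x ⟨hxg, hx⟩)
      ((hC.mem_mpow_of_ne_zero x (hC.ord x g) hg0).2 le_rfl)
    rw [← hC.mem_mpow_zero]
    refine hC.mpow_mono x ?_ h4
    have := hN x ⟨hxg, hx⟩
    push_cast; omega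

theorem notMem_range_of_mem {x : P} {σ : K} (h0 : σ ≠ 0) (h1 : σ ∈ hC.mpow x 1) :
    σ ∉ (algebraMap ℂ K).range := by
  rintro ⟨c, rfl⟩
  rw [mem_mpow_of_ne_zero _ _ _ h0, ord_algebraMap] at h1
  omega

theorem unif_mem_mpow (x : P) : hC.unif x ∈ hC.mpow x 1 := by
  rw [mem_mpow_of_ne_zero _ _ _ (hC.unif_ne_zero x), ord_unif]

theorem D_unif_ne_zero (x : P) : KaehlerDifferential.D ℂ K (hC.unif x) ≠ 0 :=
  hC.D_ne_zero _ (hC.notMem_range_of_mem (hC.unif_ne_zero x) (hC.unif_mem_mpow x))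

theorem exists_smul_D {t : K} (ht : t ∉ (algebraMap ℂ K).range) (η : Ω[K⁄ℂ]) :
    ∃ c : K, c • KaehlerDifferential.D ℂ K t = η :=
  (finrank_eq_one_iff_of_nonzero' _ (hC.D_ne_zero t ht)).1 hC.finrank_kaehler η

open scoped IntermediateField.algebraAdjoinAdjoin in
/-- The derivative with respect to a uniformizer preserves the local ring. -/
theorem exists_smul_D_unif (x : P) {a : K} (ha : a ∈ O x) :
    ∃ g ∈ O x, KaehlerDifferential.D ℂ K a = g • KaehlerDifferential.D ℂ K (hC.unif x) := by
  set π := hC.unif x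
  have hπ := hC.notMem_range_of_mem (hC.unif_ne_zero x) (hC.unif_mem_mpow x)
  have hD0 := hC.D_unif_ne_zero x
  have hπx := hC.unif_mem x
  choose δ hδ using fun a => hC.exists_smul_D hπ (KaehlerDifferential.D ℂ K a)
  have huniq : ∀ {a g : K}, KaehlerDifferential.D ℂ K a = g • KaehlerDifferential.D ℂ K π →
      g = δ a := fun {a g} h => by
    rw [← hδ a] at h
    exact (smul_left_injective K hD0 h).symm
  have hadd : ∀ a b, δ (a + b) = δ a + δ b := fun a b =>
    (huniq (by rw [map_add, add_smul, hδ, hδ])).symm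
  have hmul : ∀ a b, δ (a * b) = a * δ b + b * δ a := fun a b =>
    (huniq (by rw [Derivation.leibniz, add_smul, mul_smul, mul_smul, hδ, hδ])).symm
  have hconst : ∀ c, δ (algebraMap ℂ K c) = 0 := fun c =>
    (huniq (by rw [Derivation.map_algebraMap, zero_smul])).symm
  have hπ1 : δ π = 1 := (huniq (by rw [one_smul])).symm
  have hpol : ∀ p ∈ Algebra.adjoin ℂ {π}, δ p ∈ O x ∧ p ∈ O x := by
    intro p hp
    refine ⟨?_, Algebra.adjoin_le (Set.singleton_subset_iff.2 hπx) hp⟩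
    induction hp using Algebra.adjoin_induction with
    | mem y hy => rw [Set.mem_singleton_iff.1 hy, hπ1]; exact one_mem _
    | algebraMap c => rw [hconst]; exact zero_mem _
    | add a b _ _ iha ihb => rw [hadd]; exact add_mem iha ihb
    | mul a b ha hb iha ihb =>
      rw [hmul]
      have h1 : a ∈ O x := Algebra.adjoin_le (Set.singleton_subset_iff.2 hπx) ha
      have h2 : b ∈ O x := Algebra.adjoin_le (Set.singleton_subset_iff.2 hπx) hb
      exact add_mem (mul_mem h1 ihb) (mul_mem h2 iha)
  have hB : ∃ N : ℕ, ∀ b ∈ integralClosure (Algebra.adjoin ℂ {π}) K, δ b ∈ hC.mpow x (-N) := by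
    have := isPrincipalIdealRing_adjoin hπ
    have := hC.finiteDimensional π hπ
    have hfin : Module.Finite (Algebra.adjoin ℂ {π}) (integralClosure (Algebra.adjoin ℂ {π}) K) :=
      IsIntegralClosure.finite _ (IntermediateField.adjoin ℂ {π}) K _
    obtain ⟨s, hs⟩ := hfin.fg_top
    obtain ⟨N, hN⟩ : ∃ N : ℕ, ∀ b ∈ s, δ (b : K) ∈ hC.mpow x (-N) := by
      obtain ⟨M, hM⟩ := (s.finite_toSet.image
        fun b : integralClosure (Algebra.adjoin ℂ {π}) K => - hC.ord x (δ (b : K))).bddAbove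
      refine ⟨M.toNat, fun b hb => ?_⟩
      rw [mem_mpow]
      right
      have : - hC.ord x (δ (b : K)) ≤ M := hM ⟨b, hb, rfl⟩
      have := Int.self_le_toNat M
      omega
    refine ⟨N, fun b hb => ?_⟩
    have hmem : (⟨b, hb⟩ : integralClosure (Algebra.adjoin ℂ {π}) K) ∈
        Submodule.span (Algebra.adjoin ℂ {π}) (s : Set _) := hs ▸ trivial
    have : ∀ c : integralClosure (Algebra.adjoin ℂ {π}) K,
        c ∈ Submodule.span (Algebra.adjoin ℂ {π}) (s : Set _) → δ (c : K) ∈ hC.mpow x (-N) := by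
      intro c hc
      induction hc using Submodule.span_induction with
      | mem y hy => exact hN y hy
      | zero =>
        have : δ 0 = 0 := by simpa using hconst 0
        rw [ZeroMemClass.coe_zero, this]; exact zero_mem _
      | add a b _ _ iha ihb => rw [AddMemClass.coe_add, hadd]; exact add_mem iha ihb
      | smul p c _ ih =>
        have e : ((p • c : integralClosure (Algebra.adjoin ℂ {π}) K) : K) = (p : K) * (c : K) := rfl
        rw [e, hmul]
        have hc : (c : K) ∈ O x := (hC.isIntegral_adjoin_iff π _).1 c.2 x hπx
        refine add_mem ((hC.mpow x _).smul_mem ⟨_, (hpol p p.2).2⟩ ih) ?_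
        exact hC.mpow_mono x (by omega)
          ((hC.mem_mpow_zero x _).2 (mul_mem hc (hpol p p.2).1))
    exact this _ hmem
  have hO : ∃ N : ℕ, ∀ b ∈ O x, δ b ∈ hC.mpow x (-N) := by
    obtain ⟨N, hN⟩ := hB
    refine ⟨N, fun b hb => ?_⟩
    obtain ⟨c, hc1, hc2, hc3⟩ := hC.exists_mul_regular hπ hπx hb
    have h1 := hN _ ((hC.isIntegral_adjoin_iff π _).2 hc3)
    have h2 := hN _ ((hC.isIntegral_adjoin_iff π _).2 hc1)
    rw [hmul] at h1
    have h3 : b * δ c ∈ hC.mpow x (-N) := (hC.mpow x _).smul_mem ⟨b, hb⟩ h2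
    have h4 : c * δ b ∈ hC.mpow x (-N) := by simpa using sub_mem h1 h3
    have hc4 : c ∉ hC.mpow x 1 := fun h => hC.one_notMem_mpow_one x (by
      simpa using sub_mem h hc2)
    have hc0 : c ≠ 0 := fun h => hc4 (h ▸ zero_mem _)
    rw [hC.mul_mem_mpow_iff x hc0, hC.ord_eq_zero_of_mem x (hc1 x hπx) hc4] at h4
    simpa using h4
  have hstep : ∀ N : ℕ, (∀ b ∈ O x, δ b ∈ hC.mpow x (-N)) → ∀ b ∈ O x, δ b ∈ hC.mpow x 0 := by
    intro N
    induction N with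
    | zero => intro h; simpa using h
    | succ N ih =>
      intro h
      refine ih fun b hb => ?_
      obtain ⟨c, hc⟩ := hC.exists_sub_mem x hb
      have e : hC.unif x ^ (-1 : ℤ) * (b - algebraMap ℂ K c) ∈ O x := hc
      set b' := hC.unif x ^ (-1 : ℤ) * (b - algebraMap ℂ K c) with hb'
      have hbb : b = algebraMap ℂ K c + π * b' := by
        rw [hb', zpow_neg_one, mul_inv_cancel_left₀ (hC.unif_ne_zero x)]; ring
      rw [hbb, hadd, hconst, zero_add, hmul, hπ1, mul_one]
      refine add_mem ?_ (hC.mpow_mono x (by omega) ((hC.mem_mpow_zero x _).2 e))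
      have := hC.mul_mem_mpow x (hC.unif_mem_mpow x) (h _ e)
      convert this using 2
      push_cast; ring
  obtain ⟨N, hN⟩ := hO
  exact ⟨δ a, (hC.mem_mpow_zero x _).1 (hstep N hN a ha), (hδ a).symm⟩

theorem smul_D_unif_mem_iff (x : P) (g : K) :
    g • KaehlerDifferential.D ℂ K (hC.unif x) ∈ (StalkFamily.canonical O).stalk x ↔ g ∈ O x := by
  constructor
  · intro h
    have : ∀ η ∈ (StalkFamily.canonical O).stalk x, ∃ g ∈ O x,
        η = g • KaehlerDifferential.D ℂ K (hC.unif x) := by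
      intro η hη
      induction hη using Submodule.span_induction with
      | mem y hy =>
        obtain ⟨a, ha, rfl⟩ := hy
        exact hC.exists_smul_D_unif x ha
      | zero => exact ⟨0, zero_mem _, show (0 : Ω[K⁄ℂ]) = _ from (zero_smul K _).symm⟩
      | add a b _ _ iha ihb =>
        obtain ⟨g, hg, rfl⟩ := iha
        obtain ⟨h, hh, rfl⟩ := ihb
        exact ⟨g + h, add_mem hg hh, (add_smul g h _).symm⟩
      | smul r a _ ih =>
        obtain ⟨g, hg, rfl⟩ := ih
        exact ⟨r * g, mul_mem r.2 hg, by rw [mul_smul]; rfl⟩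
    obtain ⟨g', hg', h'⟩ := this _ h
    rw [smul_left_injective K (hC.D_unif_ne_zero x) h']
    exact hg'
  · intro h
    exact Submodule.smul_mem (M := Ω[K⁄ℂ]) (Submodule.span (O x) _) (⟨g, h⟩ : O x)
      (Submodule.subset_span ⟨_, hC.unif_mem x, rfl⟩)

/-- If `σ` vanishes at `x`, then `dσ/σ` has a simple pole at `x`. -/
theorem smul_D_mem_iff (x : P) {σ : K} (h0 : σ ≠ 0) (h1 : σ ∈ hC.mpow x 1) (g : K) :
    g • KaehlerDifferential.D ℂ K σ ∈ (StalkFamily.canonical O).stalk x ↔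
      σ * g ∈ hC.mpow x 1 := by
  set π := hC.unif x
  have hord : 1 ≤ hC.ord x σ := (hC.mem_mpow_of_ne_zero x 1 h0).1 h1
  obtain ⟨e, he⟩ : ∃ e : ℕ, hC.ord x σ = e + 1 := ⟨(hC.ord x σ - 1).toNat, by omega⟩
  obtain ⟨u, hu1, hu2, hu0, hu⟩ := hC.exists_unit x h0
  obtain ⟨v, hv, hv'⟩ := hC.exists_smul_D_unif x hu1
  change KaehlerDifferential.D ℂ K u = v • KaehlerDifferential.D ℂ K π at hv'
  rw [he] at hu
  have hu : σ = π ^ (e + 1) * u := by exact_mod_cast hu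
  have hD : KaehlerDifferential.D ℂ K σ =
      (π ^ e * ((e + 1 : ℂ) • u + π * v)) • KaehlerDifferential.D ℂ K π := by
    rw [hu, Derivation.leibniz, Derivation.leibniz_pow, hv', Algebra.smul_def, map_add, map_one,
      map_natCast]
    simp only [add_tsub_cancel_right, ← Nat.cast_smul_eq_nsmul K, smul_smul, ← add_smul]
    congr 1
    push_cast; ring
  have hw : (e + 1 : ℂ) • u + π * v ∉ hC.mpow x 1 := by
    intro h
    have h2 : π * v ∈ hC.mpow x 1 := by
      simpa using hC.mul_mem_mpow x (hC.unif_mem_mpow x) ((hC.mem_mpow_zero x v).2 hv)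
    have h3 : (e + 1 : ℂ) • u ∈ hC.mpow x 1 := by simpa using sub_mem h h2
    have hne : (e + 1 : ℂ) ≠ 0 := by exact_mod_cast Nat.succ_ne_zero e
    have h4 : algebraMap ℂ K (e + 1) ≠ 0 :=
      (map_ne_zero_iff _ (algebraMap ℂ K).injective).2 hne
    rw [Algebra.smul_def, hC.mul_mem_mpow_iff x h4, ord_algebraMap,
      hC.mem_mpow_of_ne_zero x _ hu0] at h3
    have := (hC.mem_iff x (inv_ne_zero hu0)).1 hu2
    rw [hC.ord_inv x hu0] at this
    omega
  have hw1 : (e + 1 : ℂ) • u + π * v ∈ O x :=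
    add_mem ((O x).smul_mem hu1 _) (mul_mem (hC.unif_mem x) hv)
  have hw0 : (e + 1 : ℂ) • u + π * v ≠ 0 := fun h => hw (h ▸ zero_mem _)
  have hc0 : π ^ e * ((e + 1 : ℂ) • u + π * v) ≠ 0 :=
    mul_ne_zero (pow_ne_zero _ (hC.unif_ne_zero x)) hw0
  rw [hD, smul_smul, hC.smul_D_unif_mem_iff, ← hC.mem_mpow_zero, mul_comm g,
    hC.mul_mem_mpow_iff x hc0, hC.mul_mem_mpow_iff x h0, he,
    hC.ord_mul x (pow_ne_zero _ (hC.unif_ne_zero x)) hw0, hC.ord_eq_zero_of_mem x hw1 hw,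
    hC.ord_pow x (hC.unif_ne_zero x), ord_unif]
  have : (0 : ℤ) - (e * 1 + 0) = 1 - (e + 1) := by ring
  rw [this]

end IsCurve
end CobleCurve
end

noncomputable section
open scoped TensorProduct KaehlerDifferential
namespace CobleCurve
namespace IsCurve
variable {K : Type} [Field K] [Algebra ℂ K] {P : Type} {O : P → Subalgebra ℂ K} (hC : IsCurve O)

/-- A family of lattices in `V` given by the bounds that its vectors and the linear forms on `V`
satisfy, locally and at almost all points. -/
structure Bdl {V : Type} [AddCommGroup V] [Module K V] (Λ : ∀ x, Submodule (O x) V) : Prop where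
  finite : FiniteDimensional K V
  absorb : ∀ x v, ∃ n : ℕ, ∀ g ∈ hC.mpow x n, g • v ∈ Λ x
  bound : ∀ x (φ : Module.Dual K V), ∃ n : ℕ, ∀ v ∈ Λ x, φ v ∈ hC.mpow x (-n)
  finite_notMem : ∀ v, {x | v ∉ Λ x}.Finite
  finite_notBound : ∀ φ : Module.Dual K V, {x | ¬ ∀ v ∈ Λ x, φ v ∈ O x}.Finite

variable {hC}
variable {V : Type} [AddCommGroup V] [Module K V] {Λ Λ' : ∀ x, Submodule (O x) V}

theorem smul_mem_of_mem {x : P} {N : Submodule (O x) V} {g : K} (hg : g ∈ O x) {v : V}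
    (hv : v ∈ N) : g • v ∈ N := N.smul_mem ⟨g, hg⟩ hv

theorem exists_nat_bound {ι : Type*} [Finite ι] {p : ι → ℕ → Prop} (h : ∀ i, ∃ n, p i n)
    (hp : ∀ i m n, m ≤ n → p i m → p i n) : ∃ n, ∀ i, p i n := by
  choose f hf using h
  obtain ⟨M, hM⟩ := (Set.finite_range f).bddAbove
  exact ⟨M, fun i => hp i _ _ (hM ⟨i, rfl⟩) (hf i)⟩

namespace Bdl

theorem exists_smul_mem (h : hC.Bdl Λ) (h' : hC.Bdl Λ') (x : P) :
    ∃ n : ℕ, ∀ g ∈ hC.mpow x n, ∀ v ∈ Λ x, g • v ∈ Λ' x := by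
  have := h.finite
  let b := Module.finBasis K V
  obtain ⟨n, hn⟩ := exists_nat_bound (fun i => h.bound x (b.coord i)) fun i m n hmn hp v hv =>
    hC.mpow_mono x (by omega) (hp v hv)
  obtain ⟨m, hm⟩ := exists_nat_bound (fun i => h'.absorb x (b i)) fun i m n hmn hp g hg =>
    hp g (hC.mpow_mono x (by omega) hg)
  refine ⟨m + n, fun g hg v hv => ?_⟩
  rw [← b.sum_repr v, Finset.smul_sum]
  refine sum_mem fun i _ => ?_
  rw [smul_smul]
  refine hm i _ ?_
  have := hC.mul_mem_mpow x hg (hn i v hv)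
  rw [Nat.cast_add, add_neg_cancel_right] at this
  exact this

theorem finite_not_le (h : hC.Bdl Λ) (h' : hC.Bdl Λ') : {x | ¬ Λ x ≤ Λ' x}.Finite := by
  have := h.finite
  let b := Module.finBasis K V
  refine ((Set.finite_iUnion fun i => h.finite_notBound (b.coord i)).union
    (Set.finite_iUnion fun i => h'.finite_notMem (b i))).subset ?_
  intro x hx
  by_contra hx'
  simp only [Set.mem_union, Set.mem_iUnion, Set.mem_ofPred_eq, not_or, not_exists, not_not] at hx'
  refine hx fun v hv => ?_
  rw [← b.sum_repr v]
  exact sum_mem fun i _ => smul_mem_of_mem (hx'.1 i v hv) (hx'.2 i)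

theorem finite_ne (h : hC.Bdl Λ) (h' : hC.Bdl Λ') : {x | Λ x ≠ Λ' x}.Finite := by
  refine ((h.finite_not_le h').union (h'.finite_not_le h)).subset fun x hx => ?_
  by_contra hx'
  simp only [Set.mem_union, Set.mem_ofPred_eq, not_or, not_not] at hx'
  exact hx (le_antisymm hx'.1 hx'.2)

theorem inf (h : hC.Bdl Λ) (h' : hC.Bdl Λ') : hC.Bdl fun x => Λ x ⊓ Λ' x where
  finite := h.finite
  absorb x v := by
    obtain ⟨m, hm⟩ := h.absorb x v
    obtain ⟨n, hn⟩ := h'.absorb x v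
    exact ⟨m + n, fun g hg => ⟨hm g (hC.mpow_mono x (by omega) hg),
      hn g (hC.mpow_mono x (by omega) hg)⟩⟩
  bound x φ := by
    obtain ⟨n, hn⟩ := h.bound x φ
    exact ⟨n, fun v hv => hn v hv.1⟩
  finite_notMem v := ((h.finite_notMem v).union (h'.finite_notMem v)).subset fun x hx => by
    by_contra hx'
    simp only [Set.mem_union, Set.mem_ofPred_eq, not_or, not_not] at hx'
    exact hx hx'
  finite_notBound φ := (h.finite_notBound φ).subset fun _ hx h => hx fun v hv => h v hv.1

/-- The sublattices `Λ ∩ W`. -/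
theorem comap_subtype (h : hC.Bdl Λ) (W : Submodule K V) :
    hC.Bdl fun x => (Λ x).comap (W.subtype.restrictScalars (O x)) where
  finite := by have := h.finite; infer_instance
  absorb x v := h.absorb x v
  bound x φ := by
    obtain ⟨ψ, rfl⟩ := (LinearMap.exists_extend φ).imp fun ψ h => h.symm
    obtain ⟨n, hn⟩ := h.bound x ψ
    exact ⟨n, fun v hv => hn v hv⟩
  finite_notMem v := h.finite_notMem v
  finite_notBound φ := by
    obtain ⟨ψ, rfl⟩ := (LinearMap.exists_extend φ).imp fun ψ h => h.symm
    exact (h.finite_notBound ψ).subset fun x hx h => hx fun v hv => h v hv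

theorem map_mkQ (h : hC.Bdl Λ) (W : Submodule K V) :
    hC.Bdl fun x => (Λ x).map (W.mkQ.restrictScalars (O x)) where
  finite := by have := h.finite; infer_instance
  absorb x v := by
    obtain ⟨v, rfl⟩ := W.mkQ_surjective v
    obtain ⟨n, hn⟩ := h.absorb x v
    exact ⟨n, fun g hg => ⟨_, hn g hg, rfl⟩⟩
  bound x φ := by
    obtain ⟨n, hn⟩ := h.bound x (φ ∘ₗ W.mkQ)
    refine ⟨n, ?_⟩
    rintro _ ⟨v, hv, rfl⟩
    exact hn v hv
  finite_notMem v := by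
    obtain ⟨v, rfl⟩ := W.mkQ_surjective v
    exact (h.finite_notMem v).subset fun x hx h => hx ⟨v, h, rfl⟩
  finite_notBound φ := (h.finite_notBound (φ ∘ₗ W.mkQ)).subset fun x hx h => hx (by
    rintro _ ⟨v, hv, rfl⟩
    exact h v hv)

theorem fg (h : hC.Bdl Λ) (x : P) : (Λ x).FG := by
  have := h.finite
  have := hC.dvr x
  let b := Module.finBasis K V
  obtain ⟨n, hn⟩ := exists_nat_bound (fun i => h.bound x (b.coord i)) fun i m n hmn hp v hv =>
    hC.mpow_mono x (by omega) (hp v hv)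
  let N : Submodule (O x) V :=
    Submodule.span (O x) (Set.range fun i => (hC.unif x ^ (-n : ℤ)) • b i)
  have hN : N.FG := Submodule.fg_span (Set.finite_range _)
  have : IsNoetherian (O x) N := isNoetherian_of_fg_of_noetherian N hN
  have hle : Λ x ≤ N := by
    intro v hv
    rw [← b.sum_repr v]
    refine sum_mem fun i _ => ?_
    have h1 : hC.unif x ^ (n : ℤ) * b.repr v i ∈ O x := by
      rw [← neg_neg (n : ℤ)]; exact hn i v hv
    have h2 : b.repr v i • b i =
        (⟨_, h1⟩ : O x) • ((hC.unif x ^ (-n : ℤ)) • b i) := by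
      change _ = (hC.unif x ^ (n : ℤ) * b.repr v i) • ((hC.unif x ^ (-n : ℤ)) • b i)
      rw [smul_smul, mul_right_comm, ← zpow_add₀ (hC.unif_ne_zero x)]
      simp
    rw [h2]
    exact N.smul_mem _ (Submodule.subset_span ⟨i, rfl⟩)
  have h3 := (isNoetherian_submodule.1 this) (Λ x) hle
  exact h3

end Bdl

theorem isVectorBundle_iff {E : StalkFamily O} : E.IsVectorBundle ↔ hC.Bdl E.stalk := by
  constructor
  · intro h
    have := h.finite
    obtain ⟨b, hb⟩ := h.generic
    refine ⟨h.finite, fun x v => ?_, fun x φ => ?_, fun v => ?_, fun φ => ?_⟩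
    · have hv : v ∈ Submodule.span K (E.stalk x : Set E.V) := h.span_eq_top x ▸ trivial
      induction hv using Submodule.span_induction with
      | mem v hv =>
        exact ⟨0, fun g hg => smul_mem_of_mem ((hC.mem_mpow_zero x g).1 (by simpa using hg)) hv⟩
      | zero => exact ⟨0, fun g _ => by rw [smul_zero]; exact zero_mem _⟩
      | add v w _ _ hv hw =>
        obtain ⟨m, hm⟩ := hv
        obtain ⟨n, hn⟩ := hw
        refine ⟨m + n, fun g hg => ?_⟩
        rw [smul_add]
        exact add_mem (hm g (hC.mpow_mono x (by omega) hg)) (hn g (hC.mpow_mono x (by omega) hg))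
      | smul a v _ hv =>
        obtain ⟨m, hm⟩ := hv
        refine ⟨m + (hC.ord x a).natAbs, fun g hg => ?_⟩
        rw [smul_smul]
        refine hm _ ?_
        by_cases ha : a = 0
        · simp [ha]
        rw [mul_comm, hC.mul_mem_mpow_iff x ha]
        refine hC.mpow_mono x ?_ hg
        omega
    · obtain ⟨s, hs⟩ := h.fg x
      have : ∀ v : s, ∃ n : ℕ, φ v ∈ hC.mpow x (-n) := fun v =>
        ⟨(hC.ord x (φ v)).natAbs, (hC.mem_mpow x _ _).2 (Or.inr (by omega))⟩
      obtain ⟨n, hn⟩ := exists_nat_bound this fun i m n hmn hp => hC.mpow_mono x (by omega) hp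
      refine ⟨n, fun v hv => ?_⟩
      rw [← hs] at hv
      induction hv using Submodule.span_induction with
      | mem v hv => exact hn ⟨v, hv⟩
      | zero => rw [map_zero]; exact zero_mem _
      | add v w _ _ hv hw => rw [map_add]; exact add_mem hv hw
      | smul a v _ hv =>
        have : φ (a • v) = (a : K) • φ v := φ.map_smul (a : K) v
        rw [this]
        exact (hC.mpow x _).smul_mem a hv
    · refine (hb.union (Set.finite_iUnion fun i => hC.finite_setOf_notMem (b.repr v i))).subset ?_
      intro x hx
      by_contra hx'
      simp only [ne_eq, Set.mem_union, Set.mem_ofPred_eq, Set.mem_iUnion, not_or, not_not,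
        not_exists] at hx'
      refine hx ?_
      rw [hx'.1, ← b.sum_repr v]
      exact sum_mem fun i _ => smul_mem_of_mem (hx'.2 i) (Submodule.subset_span ⟨i, rfl⟩)
    · refine (hb.union (Set.finite_iUnion fun i => hC.finite_setOf_notMem (φ (b i)))).subset ?_
      intro x hx
      by_contra hx'
      simp only [ne_eq, Set.mem_union, Set.mem_ofPred_eq, Set.mem_iUnion, not_or, not_not,
        not_exists] at hx'
      refine hx fun v hv => ?_
      rw [hx'.1] at hv
      induction hv using Submodule.span_induction with
      | mem v hv => obtain ⟨i, rfl⟩ := hv; exact hx'.2 i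
      | zero => rw [map_zero]; exact zero_mem _
      | add v w _ _ hv hw => rw [map_add]; exact add_mem hv hw
      | smul a v _ hv =>
        have : φ (a • v) = (a : K) • φ v := φ.map_smul (a : K) v
        rw [this]
        exact mul_mem a.2 hv
  · intro h
    have := h.finite
    refine ⟨h.finite, h.fg, fun x => ?_, Module.finBasis K E.V, ?_⟩
    · refine eq_top_iff.2 fun v _ => ?_
      obtain ⟨n, hn⟩ := h.absorb x v
      have h0 := pow_ne_zero n (hC.unif_ne_zero x)
      have h1 : hC.unif x ^ n ∈ hC.mpow x n := by
        rw [hC.mem_mpow_of_ne_zero x _ h0, hC.ord_pow x (hC.unif_ne_zero x), ord_unif, mul_one]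
      rw [← inv_smul_smul₀ h0 v]
      exact Submodule.smul_mem _ _ (Submodule.subset_span (hn _ h1))
    · set b := Module.finBasis K E.V
      refine ((Set.finite_iUnion fun i => h.finite_notBound (b.coord i)).union
        (Set.finite_iUnion fun i => h.finite_notMem (b i))).subset ?_
      intro x hx
      by_contra hx'
      simp only [Set.mem_union, Set.mem_iUnion, Set.mem_ofPred_eq, not_or, not_exists,
        not_not] at hx'
      refine hx (le_antisymm (fun v hv => ?_) (Submodule.span_le.2 ?_))
      · rw [← b.sum_repr v]
        exact sum_mem fun i _ => smul_mem_of_mem (hx'.1 i v hv) (Submodule.subset_span ⟨i, rfl⟩)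
      · rintro _ ⟨i, rfl⟩
        exact hx'.2 i

/-- The lattices spanned by a basis. -/
theorem bdl_span {ι : Type*} [Finite ι] (b : Module.Basis ι K V) :
    hC.Bdl fun x => Submodule.span (O x) (Set.range b) := by
  have : Fintype ι := Fintype.ofFinite ι
  have key : ∀ (x : P) (n : ℤ) (φ : Module.Dual K V), (∀ i, φ (b i) ∈ hC.mpow x n) →
      ∀ v ∈ Submodule.span (O x) (Set.range b), φ v ∈ hC.mpow x n := by
    intro x n φ h v hv
    induction hv using Submodule.span_induction with
    | mem v hv => obtain ⟨i, rfl⟩ := hv; exact h i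
    | zero => rw [map_zero]; exact zero_mem _
    | add v w _ _ hv hw => rw [map_add]; exact add_mem hv hw
    | smul a v _ hv =>
      have : φ (a • v) = (a : K) • φ v := φ.map_smul (a : K) v
      rw [this]
      exact (hC.mpow x _).smul_mem a hv
  refine ⟨Module.Finite.of_basis b, fun x v => ?_, fun x φ => ?_, fun v => ?_, fun φ => ?_⟩
  · have : ∀ i, ∃ n : ℕ, ∀ g ∈ hC.mpow x n, g * b.repr v i ∈ O x := fun i =>
      ⟨(hC.ord x (b.repr v i)).natAbs, fun g hg => by
        rw [← hC.mem_mpow_zero]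
        have := hC.mul_mem_mpow x hg
          ((hC.mem_mpow x (hC.ord x (b.repr v i)) (b.repr v i)).2 (Or.inr le_rfl))
        exact hC.mpow_mono x (by omega) this⟩
    obtain ⟨n, hn⟩ := exists_nat_bound this fun i m n hmn hp g hg =>
      hp g (hC.mpow_mono x (by omega) hg)
    refine ⟨n, fun g hg => ?_⟩
    rw [← b.sum_repr v, Finset.smul_sum]
    refine sum_mem fun i _ => ?_
    rw [smul_smul]
    exact smul_mem_of_mem (hn i g hg) (Submodule.subset_span ⟨i, rfl⟩)
  · have : ∀ i, ∃ n : ℕ, φ (b i) ∈ hC.mpow x (-n) := fun i =>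
      ⟨(hC.ord x (φ (b i))).natAbs, (hC.mem_mpow x _ _).2 (Or.inr (by omega))⟩
    obtain ⟨n, hn⟩ := exists_nat_bound this fun i m n hmn hp => hC.mpow_mono x (by omega) hp
    exact ⟨n, key x _ φ hn⟩
  · refine (Set.finite_iUnion fun i => hC.finite_setOf_notMem (b.repr v i)).subset fun x hx => ?_
    by_contra hx'
    simp only [Set.mem_iUnion, Set.mem_ofPred_eq, not_exists, not_not] at hx'
    refine hx ?_
    rw [← b.sum_repr v]
    exact sum_mem fun i _ => smul_mem_of_mem (hx' i) (Submodule.subset_span ⟨i, rfl⟩)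
  · refine (Set.finite_iUnion fun i => hC.finite_setOf_notMem (φ (b i))).subset fun x hx => ?_
    by_contra hx'
    simp only [Set.mem_iUnion, Set.mem_ofPred_eq, not_exists, not_not] at hx'
    refine hx fun v hv => (hC.mem_mpow_zero x _).1 (key x 0 φ (fun i => ?_) v hv)
    exact (hC.mem_mpow_zero x _).2 (hx' i)

end IsCurve
end CobleCurve
end

noncomputable section
open scoped TensorProduct KaehlerDifferential
namespace CobleCurve

section Length
variable {k : Type*} [Field k] {V : Type*} [AddCommGroup V] [Module k V]

theorem length_eq_add_submoduleOf {A A' : Submodule k V} (h : A' ≤ A) :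
    Module.length k A = Module.length k A' + Module.length k (A ⧸ A'.submoduleOf A) := by
  refine Module.length_eq_add_of_exact (Submodule.inclusion h) (A'.submoduleOf A).mkQ
    (Submodule.inclusion_injective h) (Submodule.mkQ_surjective _) ?_
  rw [LinearMap.exact_iff, Submodule.ker_mkQ, Submodule.range_inclusion]
  rfl

theorem length_quotient_eq_add {A A' : Submodule k V} (h : A' ≤ A) :
    Module.length k (V ⧸ A') =
      Module.length k (A ⧸ A'.submoduleOf A) + Module.length k (V ⧸ A) := by
  refine Module.length_eq_add_of_exact ((A'.submoduleOf A).mapQ A' A.subtype fun v hv => hv)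
    (A'.mapQ A LinearMap.id h) ?_ ?_ ?_
  · rw [← LinearMap.ker_eq_bot, LinearMap.ker_eq_bot']
    intro q hq
    obtain ⟨v, rfl⟩ := Submodule.mkQ_surjective _ q
    exact (Submodule.Quotient.mk_eq_zero (A'.submoduleOf A)).2
      ((Submodule.Quotient.mk_eq_zero A').1 hq)
  · intro q
    obtain ⟨v, rfl⟩ := Submodule.mkQ_surjective _ q
    exact ⟨Submodule.Quotient.mk v, rfl⟩
  · intro q
    obtain ⟨v, rfl⟩ := Submodule.mkQ_surjective _ q
    constructor
    · intro hq
      exact ⟨Submodule.Quotient.mk ⟨v, (Submodule.Quotient.mk_eq_zero A).1 hq⟩, rfl⟩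
    · rintro ⟨q, hq⟩
      obtain ⟨w, rfl⟩ := Submodule.mkQ_surjective _ q
      rw [← hq]
      exact (Submodule.Quotient.mk_eq_zero A).2 w.2

/-- The change of the dimensions of the intersection and the cokernel of a sum of two subspaces. -/
theorem exists_length_eq {A A' : Submodule k V} (h : A' ≤ A) (B : Submodule k V) :
    ∃ c d, Module.length k ↥(A ⊓ B) = Module.length k ↥(A' ⊓ B) + c ∧
      Module.length k (V ⧸ A' ⊔ B) = d + Module.length k (V ⧸ A ⊔ B) ∧
      c + d = Module.length k (A ⧸ A'.submoduleOf A) := by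
  have h1 : A' ⊓ B ≤ A ⊓ B := inf_le_inf_right B h
  have h2 : A' ⊔ B ≤ A ⊔ B := sup_le_sup_right h B
  refine ⟨_, _, length_eq_add_submoduleOf h1, length_quotient_eq_add h2, ?_⟩
  let f : (↥(A ⊓ B) ⧸ (A' ⊓ B).submoduleOf (A ⊓ B)) →ₗ[k] A ⧸ A'.submoduleOf A :=
    ((A' ⊓ B).submoduleOf (A ⊓ B)).mapQ (A'.submoduleOf A) (Submodule.inclusion inf_le_left)
      fun v hv => hv.1
  let g : (A ⧸ A'.submoduleOf A) →ₗ[k] ↥(A ⊔ B) ⧸ (A' ⊔ B).submoduleOf (A ⊔ B) :=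
    (A'.submoduleOf A).mapQ ((A' ⊔ B).submoduleOf (A ⊔ B)) (Submodule.inclusion le_sup_left)
      fun v hv => Submodule.mem_sup_left hv
  refine (Module.length_eq_add_of_exact f g ?_ ?_ ?_).symm
  · rw [← LinearMap.ker_eq_bot, LinearMap.ker_eq_bot']
    intro q hq
    obtain ⟨v, rfl⟩ := Submodule.mkQ_surjective _ q
    have hv : (v : V) ∈ A' := (Submodule.Quotient.mk_eq_zero (A'.submoduleOf A)).1 hq
    exact (Submodule.Quotient.mk_eq_zero _).2 ⟨hv, v.2.2⟩
  · intro q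
    obtain ⟨⟨v, hv⟩, rfl⟩ := Submodule.mkQ_surjective _ q
    obtain ⟨a, ha, b, hb, rfl⟩ := Submodule.mem_sup.1 hv
    refine ⟨Submodule.Quotient.mk ⟨a, ha⟩, (Submodule.Quotient.eq _).2 ?_⟩
    change a - (a + b) ∈ A' ⊔ B
    exact Submodule.mem_sup_right (by simpa using hb)
  · intro q
    obtain ⟨⟨v, hv⟩, rfl⟩ := Submodule.mkQ_surjective _ q
    constructor
    · intro hq
      have : v ∈ A' ⊔ B :=
        (Submodule.Quotient.mk_eq_zero ((A' ⊔ B).submoduleOf (A ⊔ B))).1 hq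
      obtain ⟨a, ha, b, hb, hab⟩ := Submodule.mem_sup.1 this
      have hbA : b ∈ A := by
        have : b = v - a := by rw [← hab]; abel
        rw [this]; exact sub_mem hv (h ha)
      refine ⟨Submodule.Quotient.mk ⟨b, hbA, hb⟩, (Submodule.Quotient.eq _).2 ?_⟩
      change b - v ∈ A'
      rw [← hab]
      simpa using neg_mem ha
    · rintro ⟨q, hq⟩
      obtain ⟨v', rfl⟩ := Submodule.mkQ_surjective _ q
      rw [← hq]
      exact (Submodule.Quotient.mk_eq_zero _).2 (Submodule.mem_sup_right v'.2.2)

theorem length_quotient_eq_sum {ι : Type*} [Fintype ι] {Q : ι → Type*} [∀ i, AddCommGroup (Q i)]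
    [∀ i, Module k (Q i)] (g : ∀ i, V →ₗ[k] Q i) (A : Submodule k V)
    (hA : ∀ v, v ∈ A ↔ ∀ i, g i v = 0) (hg : ∀ q : ∀ i, Q i, ∃ v, ∀ i, g i v = q i) :
    Module.length k (V ⧸ A) = ∑ i, Module.length k (Q i) := by
  have hker : LinearMap.ker (LinearMap.pi g) = A := by
    ext v
    rw [LinearMap.mem_ker, hA, funext_iff]
    rfl
  rw [← hker, ← Module.length_pi_of_fintype]
  exact (LinearMap.quotKerEquivOfSurjective _ fun q => (hg q).imp fun v hv => funext hv).length_eq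

end Length

section Local
variable {R Q : Type*} [CommRing R] [IsDomain R] [IsDiscreteValuationRing R] [AddCommGroup Q]
  [Module R Q]

theorem length_ne_top_of_smul_eq_zero [Module.Finite R Q] {r : R} (hr : r ≠ 0)
    (h : ∀ q : Q, r • q = 0) : Module.length R Q ≠ ⊤ := by
  rw [Module.length_ne_top_iff]
  have hfin := isFiniteLength_quotient_span_singleton R (mem_nonZeroDivisors_of_ne_zero hr)
  obtain ⟨h1, h2⟩ := isFiniteLength_iff_isNoetherian_isArtinian.1 hfin
  obtain ⟨n, q, hq⟩ := Module.Finite.exists_fin (R := R) (M := Q)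
  let f : (Fin n → R ⧸ Ideal.span {r}) →ₗ[R] Q := LinearMap.lsum R _ R fun i =>
    (Ideal.span {r}).liftQ (LinearMap.toSpanSingleton R Q (q i)) (by
      rw [Ideal.span_le, Set.singleton_subset_iff]
      exact h (q i))
  have hf : Function.Surjective f := by
    rw [← LinearMap.range_eq_top, eq_top_iff, ← hq, Submodule.span_le]
    rintro _ ⟨i, rfl⟩
    refine ⟨Pi.single i (Submodule.Quotient.mk 1), ?_⟩
    simp only [f, LinearMap.lsum_apply, LinearMap.sum_apply, LinearMap.comp_apply,
      LinearMap.proj_apply]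
    rw [Finset.sum_eq_single i]
    · rw [Pi.single_eq_same]
      exact one_smul R (q i)
    · intro j _ hj
      rw [Pi.single_eq_of_ne hj, map_zero]
    · simp
  have h3 : IsFiniteLength R (Fin n → R ⧸ Ideal.span {r}) :=
    isFiniteLength_iff_isNoetherian_isArtinian.2 ⟨inferInstance, inferInstance⟩
  exact h3.of_surjective hf

end Local

namespace IsCurve
variable {K : Type} [Field K] [Algebra ℂ K] {P : Type} {O : P → Subalgebra ℂ K} (hC : IsCurve O)
variable {V : Type} [AddCommGroup V] [Module K V] [Module ℂ V] [IsScalarTower ℂ K V]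
  {Λ Λ' : ∀ x, Submodule (O x) V}

include hC in
theorem length_complex_eq (x : P) (Q : Type) [AddCommGroup Q] [Module (O x) Q] [Module ℂ Q]
    [IsScalarTower ℂ (O x) Q] : Module.length ℂ Q = Module.length (O x) Q := by
  have := hC.dvr x
  have hloc : IsLocalHom (algebraMap ℂ (O x)) := ⟨fun c hc => by
    rw [isUnit_iff_ne_zero]
    rintro rfl
    rw [map_zero] at hc
    exact not_isUnit_zero hc⟩
  rw [IsLocalRing.length_restrictScalars ℂ (O x) Q]
  suffices h : Function.Surjective (algebraMap (IsLocalRing.ResidueField ℂ)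
      (IsLocalRing.ResidueField (O x))) by
    have h1 : Module.length (IsLocalRing.ResidueField ℂ) (IsLocalRing.ResidueField (O x)) = 1 := by
      rw [Module.length_eq_of_surjective h, Module.length_eq_one_iff]
      infer_instance
    rw [h1, mul_one]
  intro r
  obtain ⟨⟨g, hg⟩, rfl⟩ := IsLocalRing.residue_surjective r
  obtain ⟨c, hc⟩ := hC.exists_sub_mem x hg
  refine ⟨IsLocalRing.residue ℂ c, ?_⟩
  rw [IsLocalRing.ResidueField.algebraMap_residue, eq_comm, ← sub_eq_zero, ← map_sub,
    IsLocalRing.residue_eq_zero_iff, IsLocalRing.mem_maximalIdeal, mem_nonunits_iff]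
  intro hu
  obtain ⟨u, hu⟩ := hu
  have h1 : ((u⁻¹ : (O x)ˣ) : O x) * (⟨g, hg⟩ - algebraMap ℂ (O x) c) = 1 := by
    rw [← hu]; simp
  have h2 := (hC.mpow x 1).smul_mem ((u⁻¹ : (O x)ˣ) : O x) hc
  refine hC.one_notMem_mpow_one x ?_
  convert h2
  exact (congrArg Subtype.val h1).symm

instance (x : P) : IsScalarTower ℂ (O x) V :=
  ⟨fun c a v => by
    change (c • (a : K)) • v = c • ((a : K) • v)
    rw [smul_assoc]⟩

/-- The local index of a sublattice. -/
def index (Λ Λ' : ∀ x, Submodule (O x) V) (x : P) : ℕ∞ :=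
  Module.length (O x) (Λ x ⧸ (Λ' x).submoduleOf (Λ x))

variable {hC}

omit [Module ℂ V] [IsScalarTower ℂ K V] in
theorem Bdl.index_ne_top (h : hC.Bdl Λ) (h' : hC.Bdl Λ') (x : P) : index Λ Λ' x ≠ ⊤ := by
  have := hC.dvr x
  obtain ⟨n, hn⟩ := h.exists_smul_mem h' x
  have h0 := pow_ne_zero n (hC.unif_ne_zero x)
  have h1 : hC.unif x ^ n ∈ hC.mpow x n := by
    rw [hC.mem_mpow_of_ne_zero x _ h0, hC.ord_pow x (hC.unif_ne_zero x), ord_unif, mul_one]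
  have : Module.Finite (O x) (Λ x) := Module.Finite.of_fg (h.fg x)
  refine length_ne_top_of_smul_eq_zero (R := O x)
    (r := ⟨hC.unif x ^ n, pow_mem (hC.unif_mem x) n⟩) (fun h => h0 (congrArg Subtype.val h)) ?_
  intro q
  obtain ⟨v, rfl⟩ := Submodule.mkQ_surjective _ q
  exact (Submodule.Quotient.mk_eq_zero _).2 (hn _ h1 v v.2)

/-- The sections over a set of points. -/
def secs (Λ : ∀ x, Submodule (O x) V) (S : Set P) : Submodule ℂ V where
  carrier := {v | ∀ x ∈ S, v ∈ Λ x}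
  add_mem' hv hw x hx := add_mem (hv x hx) (hw x hx)
  zero_mem' x _ := zero_mem _
  smul_mem' c v hv x hx := by
    rw [← algebraMap_smul K]
    exact smul_mem_of_mem ((O x).algebraMap_mem c) (hv x hx)

variable (hC) in
/-- The properties of an affine open set, or of the complement of one, that are used to construct
sections. -/
structure Affine (S : Set P) : Prop where
  nonempty : S.Nonempty
  mem_of_forall : ∀ y, (∀ g, (∀ x ∈ S, g ∈ O x) → g ∈ O y) → y ∈ S
  approx : ∀ p ∈ S, ∀ T : Set P, T.Finite → T ⊆ S → p ∉ T → ∀ N : ℕ, ∃ f : K,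
    (∀ x ∈ S, f ∈ O x) ∧ f - 1 ∈ hC.mpow p N ∧ ∀ x ∈ T, f ∈ hC.mpow x N

theorem inv_notMem_range {t : K} (ht : t ∉ (algebraMap ℂ K).range) :
    t⁻¹ ∉ (algebraMap ℂ K).range := by
  rintro ⟨c, hc⟩
  exact ht ⟨c⁻¹, by rw [map_inv₀, hc, inv_inv]⟩

theorem ne_zero_of_notMem_range {t : K} (ht : t ∉ (algebraMap ℂ K).range) : t ≠ 0 :=
  fun h => ht ⟨0, by simp [h]⟩

variable (hC) in
theorem affine_setOf_mem {t : K} (ht : t ∉ (algebraMap ℂ K).range) :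
    hC.Affine {x | t ∈ O x} where
  nonempty := by
    obtain ⟨x, hx⟩ := hC.exists_zero ht
    exact ⟨x, (hC.mem_mpow_zero x t).1 (hC.mpow_mono x zero_le_one hx)⟩
  mem_of_forall y h := h t fun _ hx => hx
  approx p hp T hT hTS hpT N := hC.exists_approx ht hp hT hpT hTS N

variable (hC) in
theorem mem_inv_of_notMem {t : K} {x : P} (h : t ∉ O x) : t⁻¹ ∈ hC.mpow x 1 := by
  have h0 : t ≠ 0 := fun h' => h (h' ▸ zero_mem _)
  exact (hC.inv_mem_mpow_one_iff x h0).2 h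

variable (hC) in
theorem mem_of_mem_mpow_one {x : P} {g : K} (h : g ∈ hC.mpow x 1) : g ∈ O x :=
  (hC.mem_mpow_zero x g).1 (hC.mpow_mono x zero_le_one h)

variable (hC) in
theorem affine_compl {t : K} (ht : t ∉ (algebraMap ℂ K).range) :
    hC.Affine {x | t ∈ O x}ᶜ where
  nonempty := by
    obtain ⟨x, hx⟩ := hC.exists_zero (inv_notMem_range ht)
    rw [hC.inv_mem_mpow_one_iff x (ne_zero_of_notMem_range ht)] at hx
    exact ⟨x, hx⟩
  mem_of_forall y h := by
    intro hy
    have ht0 := ne_zero_of_notMem_range ht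
    obtain ⟨c, hc⟩ := hC.exists_sub_mem y hy
    have hs : t⁻¹ ∈ O y := h _ fun x hx => hC.mem_of_mem_mpow_one (hC.mem_inv_of_notMem hx)
    have h0 : t - algebraMap ℂ K c ≠ 0 := fun h => ht ⟨c, (sub_eq_zero.1 h).symm⟩
    have h1 : (1 - algebraMap ℂ K c * t⁻¹) ∈ hC.mpow y 1 := by
      have : 1 - algebraMap ℂ K c * t⁻¹ = (⟨t⁻¹, hs⟩ : O y) • (t - algebraMap ℂ K c) := by
        change _ = t⁻¹ * (t - algebraMap ℂ K c)
        field_simp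
      rw [this]
      exact (hC.mpow y 1).smul_mem _ hc
    have h2 : 1 - algebraMap ℂ K c * t⁻¹ ≠ 0 := by
      have : 1 - algebraMap ℂ K c * t⁻¹ = t⁻¹ * (t - algebraMap ℂ K c) := by field_simp
      rw [this]
      exact mul_ne_zero (inv_ne_zero ht0) h0
    have h3 := h (1 - algebraMap ℂ K c * t⁻¹)⁻¹ fun x hx => by
      have h4 : algebraMap ℂ K c * t⁻¹ ∈ hC.mpow x 1 :=
        (hC.mpow x 1).smul_mem ⟨_, (O x).algebraMap_mem c⟩ (hC.mem_inv_of_notMem hx)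
      have h5 : (1 - algebraMap ℂ K c * t⁻¹) ∉ hC.mpow x 1 := fun h => by
        refine hC.one_notMem_mpow_one x ?_
        simpa using add_mem h h4
      by_contra h6
      rw [← hC.inv_mem_mpow_one_iff x (inv_ne_zero h2), inv_inv] at h6
      exact h5 h6
    refine hC.one_notMem_mpow_one y ?_
    have := (hC.mpow y 1).smul_mem ⟨_, h3⟩ h1
    convert this
    change _ = (1 - algebraMap ℂ K c * t⁻¹)⁻¹ * _
    rw [inv_mul_cancel₀ h2]
  approx p hp T hT hTS hpT N := by
    have hm : ∀ x ∈ {x | t ∈ O x}ᶜ, t⁻¹ ∈ O x := fun x hx =>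
      hC.mem_of_mem_mpow_one (hC.mem_inv_of_notMem hx)
    obtain ⟨f, h1, h2, h3⟩ := hC.exists_approx (inv_notMem_range ht) (hm p hp) hT hpT
      (fun x hx => hm x (hTS hx)) N
    exact ⟨f, fun x hx => h1 x (hm x hx), h2, h3⟩

theorem Affine.exists_smul_mem_secs {S : Set P} (hS : hC.Affine S) (h : hC.Bdl Λ) {p : P}
    (hp : p ∈ S) {v : V} (hv : v ∈ Λ p) {T : Set P} (hT : T.Finite) (hTS : T ⊆ S) (hpT : p ∉ T)
    (N : ℕ) : ∃ f : K, (∀ x ∈ S, f ∈ O x) ∧ f - 1 ∈ hC.mpow p N ∧ (∀ x ∈ T, f ∈ hC.mpow x N) ∧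
      f • v ∈ secs Λ S := by
  have hB : ({x | v ∉ Λ x} ∩ S).Finite := (h.finite_notMem v).inter_of_left _
  have := hB.to_subtype
  obtain ⟨n, hn⟩ := exists_nat_bound
    (fun x : ↥({x | v ∉ Λ x} ∩ S) => h.absorb x v) fun i m n hmn hp g hg =>
      hp g (hC.mpow_mono i (by omega) hg)
  obtain ⟨f, h1, h2, h3⟩ := hS.approx p hp (T ∪ ({x | v ∉ Λ x} ∩ S)) (hT.union hB)
    (Set.union_subset hTS Set.inter_subset_right) (fun h => h.elim hpT fun h => h.1 hv) (N + n)
  refine ⟨f, h1, hC.mpow_mono p (by omega) h2,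
    fun x hx => hC.mpow_mono x (by omega) (h3 x (Or.inl hx)), fun x hx => ?_⟩
  by_cases hxv : v ∈ Λ x
  · exact smul_mem_of_mem (h1 x hx) hxv
  · exact hn ⟨x, hxv, hx⟩ f (hC.mpow_mono x (by omega) (h3 x (Or.inr ⟨hxv, hx⟩)))

omit [IsScalarTower ℂ K V] in
/-- A local-global principle. -/
theorem Affine.exists_of_local {S : Set P} (hS : hC.Affine S) {M : Submodule ℂ V}
    (hM : ∀ g, (∀ x ∈ S, g ∈ O x) → ∀ v ∈ M, g • v ∈ M) {v : V}
    (h : ∀ p ∈ S, ∃ f : K, (∀ x ∈ S, f ∈ O x) ∧ f ∉ hC.mpow p 1 ∧ f • v ∈ M) : v ∈ M := by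
  let A : Subring K := (⨅ x ∈ S, O x : Subalgebra ℂ K).toSubring
  have hA : ∀ g, g ∈ A ↔ ∀ x ∈ S, g ∈ O x := fun g => by
    change g ∈ (⨅ x ∈ S, O x : Subalgebra ℂ K) ↔ _
    simp only [Algebra.mem_iInf]
  let I : Ideal A :=
    { carrier := {f | (f : K) • v ∈ M}
      add_mem' := fun {a b} ha hb => by
        change ((a : K) + b) • v ∈ M
        rw [add_smul]; exact add_mem ha hb
      zero_mem' := by
        change (0 : K) • v ∈ M
        rw [zero_smul]; exact zero_mem _
      smul_mem' := fun a b hb => by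
        change ((a : K) * b) • v ∈ M
        rw [mul_smul]; exact hM _ ((hA a).1 a.2) _ hb }
  by_cases hI : I = ⊤
  · have : (1 : A) ∈ I := hI ▸ trivial
    have h1 : (1 : K) • v ∈ M := this
    rwa [one_smul] at h1
  obtain ⟨R, hR1, hR2⟩ := I.image_subset_nonunits_valuationSubring hI
  obtain ⟨p, hp⟩ := hS.nonempty
  obtain ⟨f, hf1, hf2, hf3⟩ := h p hp
  have hf0 : f ≠ 0 := fun h => hf2 (h ▸ zero_mem _)
  have hnu : ∀ f : K, (∀ x ∈ S, f ∈ O x) → f • v ∈ M → f ∈ R.nonunits := fun f h1 h2 =>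
    hR2 ⟨⟨f, (hA f).2 h1⟩, h2, rfl⟩
  have hinv : f⁻¹ ∉ R := by
    have := (R.inv_mem_nonunits_iff (x := f⁻¹)).1 (by rw [inv_inv]; exact hnu f hf1 hf3)
    exact this.resolve_left (inv_ne_zero hf0)
  obtain ⟨y, hy1⟩ := hC.exists_eq R (fun h => hinv (h ▸ trivial))
    fun c => hR1 ((hA _).2 fun x _ => (O x).algebraMap_mem c)
  have hyS : y ∈ S := hS.mem_of_forall y fun g hg => (hy1 g).2 (hR1 ((hA g).2 hg))
  obtain ⟨f', hf1', hf2', hf3'⟩ := h y hyS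
  have hf0' : f' ≠ 0 := fun h => hf2' (h ▸ zero_mem _)
  have h5 := (R.inv_mem_nonunits_iff (x := f'⁻¹)).1 (by rw [inv_inv]; exact hnu f' hf1' hf3')
  have h6 := h5.resolve_left (inv_ne_zero hf0')
  rw [← hy1, ← hC.inv_mem_mpow_one_iff y (inv_ne_zero hf0'), inv_inv] at h6
  exact absurd h6 hf2'

theorem Affine.length_secs {S : Set P} (hS : hC.Affine S) (h : hC.Bdl Λ) (h' : hC.Bdl Λ')
    (T : Finset P) (hT : ∀ x ∉ T, Λ x = Λ' x) [DecidablePred (· ∈ S)] :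
    Module.length ℂ (secs Λ S ⧸ (secs Λ' S).submoduleOf (secs Λ S)) =
      ∑ x ∈ T with x ∈ S, index Λ Λ' x := by
  classical
  let T' := {x ∈ T | x ∈ S}
  have hT' : ∀ x : T', (x : P) ∈ S := fun x => (Finset.mem_filter.1 x.2).2
  let g (x : T') : secs Λ S →ₗ[ℂ] Λ x ⧸ (Λ' x).submoduleOf (Λ x) :=
    { toFun := fun v => Submodule.Quotient.mk ⟨v, v.2 x (hT' x)⟩
      map_add' := fun _ _ => rfl
      map_smul' := fun _ _ => rfl }
  have hg : ∀ v (x : T'), g x v = Submodule.Quotient.mk ⟨v, v.2 x (hT' x)⟩ := fun _ _ => rfl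
  have hker : ∀ v, v ∈ (secs Λ' S).submoduleOf (secs Λ S) ↔ ∀ x, g x v = 0 := by
    intro v
    change (v : V) ∈ secs Λ' S ↔ _
    constructor
    · intro hv x
      rw [hg]
      exact (Submodule.Quotient.mk_eq_zero _).2 (hv x (hT' x))
    · intro hv x hx
      by_cases hxT : x ∈ T
      · have := hv ⟨x, Finset.mem_filter.2 ⟨hxT, hx⟩⟩
        rw [hg] at this
        exact (Submodule.Quotient.mk_eq_zero ((Λ' x).submoduleOf (Λ x))).1 this
      · rw [← hT x hxT]; exact v.2 x hx
  have hsurj : ∀ q : ∀ x : T', Λ x ⧸ (Λ' x).submoduleOf (Λ x), ∃ v, ∀ x, g x v = q x := by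
    intro q
    choose v hv using fun x : T' => Submodule.mkQ_surjective _ (q x)
    obtain ⟨N, hN⟩ := exists_nat_bound (fun i : T' × T' => h'.absorb i.1 (v i.2 : V))
      fun i m n hmn hp g hg => hp g (hC.mpow_mono i.1 (by omega) hg)
    choose f hf1 hf2 hf3 hf4 using fun x : T' => hS.exists_smul_mem_secs h (hT' x) (v x).2
      (T := (T' : Set P) \ {(x : P)}) (T'.finite_toSet.subset Set.sdiff_subset)
      (fun y hy => hT' ⟨y, hy.1⟩) (fun h => h.2 rfl) N
    refine ⟨∑ x, ⟨_, hf4 x⟩, fun y => ?_⟩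
    rw [map_sum, Finset.sum_eq_single y]
    · rw [hg, ← hv y]
      refine (Submodule.Quotient.eq _).2 ?_
      change f y • (v y : V) - (v y : V) ∈ Λ' y
      have : f y • (v y : V) - (v y : V) = (f y - 1) • (v y : V) := by rw [sub_smul, one_smul]
      rw [this]
      exact hN (y, y) _ (hf2 y)
    · intro x _ hxy
      rw [hg]
      refine (Submodule.Quotient.mk_eq_zero _).2 ?_
      exact hN (y, x) _ (hf3 x y ⟨y.2, fun h => hxy (Subtype.ext h.symm)⟩)
    · simp
  rw [length_quotient_eq_sum (Q := fun x : T' => Λ x ⧸ (Λ' x).submoduleOf (Λ x)) g _ hker hsurj]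
  refine Eq.trans ?_ (Finset.sum_coe_sort T' (index Λ Λ'))
  exact Finset.sum_congr rfl fun x _ =>
    hC.length_complex_eq (x : P) (Λ x ⧸ (Λ' x).submoduleOf (Λ x))

end IsCurve
end CobleCurve
end

noncomputable section
open scoped TensorProduct KaehlerDifferential
namespace CobleCurve

section Length
variable {k : Type*} [Field k] {V : Type*} [AddCommGroup V] [Module k V]

theorem length_quotient_congr {X Y Z : Type*} [AddCommGroup X] [Module k X] [AddCommGroup Y]
    [Module k Y] [AddCommGroup Z] [Module k Z] (f : Z →ₗ[k] X) (g : Z →ₗ[k] Y)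
    (hf : Function.Surjective f) (hg : Function.Surjective g) (h : ∀ z, f z = 0 ↔ g z = 0) :
    Module.length k X = Module.length k Y := by
  have e : LinearMap.ker f = LinearMap.ker g := by ext z; exact h z
  rw [← (f.quotKerEquivOfSurjective hf).length_eq, ← (g.quotKerEquivOfSurjective hg).length_eq, e]

/-- The six-term exact sequence of the intersections and the cokernels of the sums of two subspaces
in a subspace, the space and the quotient. -/
theorem exists_length_eq_of_quotient (A B W : Submodule k V) : ∃ i j m,
    Module.length k ↥(A ⊓ B) = Module.length k ↥(A.comap W.subtype ⊓ B.comap W.subtype) + i ∧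
    Module.length k ↥(A.map W.mkQ ⊓ B.map W.mkQ) = i + j ∧
    Module.length k (W ⧸ A.comap W.subtype ⊔ B.comap W.subtype) = j + m ∧
    Module.length k (V ⧸ A ⊔ B) = m + Module.length k ((V ⧸ W) ⧸ A.map W.mkQ ⊔ B.map W.mkQ) := by
  let I : Submodule k (V ⧸ W) := (A ⊓ B).map W.mkQ
  have hI : I ≤ A.map W.mkQ ⊓ B.map W.mkQ := Submodule.map_inf_le _
  let Y : Submodule k W := (A ⊔ B).comap W.subtype
  have hY : A.comap W.subtype ⊔ B.comap W.subtype ≤ Y :=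
    sup_le (Submodule.comap_mono le_sup_left) (Submodule.comap_mono le_sup_right)
  refine ⟨Module.length k I, _, Module.length k (W ⧸ Y), ?_, length_eq_add_submoduleOf hI, ?_, ?_⟩
  · refine Module.length_eq_add_of_exact
      (W.subtype.restrict (p := A.comap W.subtype ⊓ B.comap W.subtype) (q := A ⊓ B) fun v hv => hv)
      (W.mkQ.restrict (p := A ⊓ B) (q := I) fun v hv => ⟨v, hv, rfl⟩) ?_ ?_ ?_
    · intro v w h
      have h' : ((v : W) : V) = (w : W) := congrArg (A ⊓ B).subtype h
      exact Subtype.ext (Subtype.ext h')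
    · rintro ⟨_, v, hv, rfl⟩
      exact ⟨⟨v, hv⟩, rfl⟩
    · rintro ⟨v, hv⟩
      constructor
      · intro h
        have : v ∈ W := (Submodule.Quotient.mk_eq_zero W).1 (congrArg Subtype.val h)
        exact ⟨⟨⟨v, this⟩, hv⟩, rfl⟩
      · rintro ⟨w, hw⟩
        refine Subtype.ext ((Submodule.Quotient.mk_eq_zero W).2 ?_)
        have hw' : ((w : W) : V) = v := congrArg Subtype.val hw
        change v ∈ W
        rw [← hw']
        exact w.1.2
  · rw [length_quotient_eq_add hY]
    congr 1
    let Z : Submodule k (V × V) :=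
      (A.prod B) ⊓ W.comap (LinearMap.fst k V V - LinearMap.snd k V V)
    let f : Z →ₗ[k] Y :=
      { toFun := fun z => ⟨⟨z.1.1 - z.1.2, z.2.2⟩, sub_mem (Submodule.mem_sup_left z.2.1.1)
          (Submodule.mem_sup_right z.2.1.2)⟩
        map_add' := fun z w => Subtype.ext (Subtype.ext (by
          change (z.1.1 + w.1.1) - (z.1.2 + w.1.2) = (z.1.1 - z.1.2) + (w.1.1 - w.1.2)
          abel))
        map_smul' := fun c z => Subtype.ext (Subtype.ext (by
          change c • z.1.1 - c • z.1.2 = c • (z.1.1 - z.1.2)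
          rw [smul_sub])) }
    let g : Z →ₗ[k] ↥(A.map W.mkQ ⊓ B.map W.mkQ) :=
      { toFun := fun z => ⟨W.mkQ z.1.1, ⟨_, z.2.1.1, rfl⟩, ⟨z.1.2, z.2.1.2, by
          have : z.1.1 - z.1.2 ∈ W := z.2.2
          refine ((Submodule.Quotient.eq W).2 ?_)
          rw [← neg_sub]; exact neg_mem this⟩⟩
        map_add' := fun z w => rfl
        map_smul' := fun c z => rfl }
    refine length_quotient_congr (Submodule.mkQ _ ∘ₗ f) (Submodule.mkQ _ ∘ₗ g) ?_ ?_ ?_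
    · refine (Submodule.mkQ_surjective _).comp ?_
      rintro ⟨⟨v, hvW⟩, hv⟩
      obtain ⟨a, ha, b, hb, hab⟩ := Submodule.mem_sup.1 hv
      change a + b = v at hab
      refine ⟨⟨(a, -b), ⟨ha, neg_mem hb⟩, ?_⟩, Subtype.ext (Subtype.ext ?_)⟩
      · change a - -b ∈ W
        rw [sub_neg_eq_add, hab]; exact hvW
      · change a - -b = v
        rw [sub_neg_eq_add, hab]
    · refine (Submodule.mkQ_surjective _).comp ?_
      rintro ⟨q, ⟨a, ha, rfl⟩, b, hb, hab⟩
      refine ⟨⟨(a, b), ⟨ha, hb⟩, ?_⟩, rfl⟩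
      change a - b ∈ W
      exact (Submodule.Quotient.eq W).1 hab.symm
    · rintro ⟨⟨a, b⟩, ⟨ha, hb⟩, hab⟩
      change a - b ∈ W at hab
      simp only [LinearMap.comp_apply, Submodule.mkQ_apply, Submodule.Quotient.mk_eq_zero]
      change (⟨a - b, hab⟩ : W) ∈ A.comap W.subtype ⊔ B.comap W.subtype ↔ W.mkQ a ∈ I
      constructor
      · intro h
        obtain ⟨a', ha', b', hb', h'⟩ := Submodule.mem_sup.1 h
        have h'' : (a' : V) + b' = a - b := congrArg Subtype.val h'
        refine ⟨a - a', ⟨sub_mem ha ha', ?_⟩, (Submodule.Quotient.eq W).2 ?_⟩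
        · have : a - a' = b + b' := by rw [sub_eq_iff_eq_add, add_assoc, add_comm (b' : V), h'']; abel
          rw [this]; exact add_mem hb hb'
        · rw [sub_sub_cancel_left]; exact neg_mem a'.2
      · rintro ⟨c, ⟨hcA, hcB⟩, hc⟩
        have h1 : a - c ∈ W := (Submodule.Quotient.eq W).1 hc.symm
        have h2 : c - b ∈ W := by
          have : c - b = (a - b) - (a - c) := by abel
          rw [this]; exact sub_mem hab h1
        refine Submodule.mem_sup.2 ⟨⟨a - c, h1⟩, sub_mem ha hcA, ⟨c - b, h2⟩, sub_mem hcB hb, ?_⟩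
        exact Subtype.ext (by change (a - c) + (c - b) = a - b; abel)
  · refine Module.length_eq_add_of_exact (Y.mapQ (A ⊔ B) W.subtype fun v hv => hv)
      ((A ⊔ B).mapQ (A.map W.mkQ ⊔ B.map W.mkQ) W.mkQ ?_) ?_ ?_ ?_
    · exact sup_le (fun v hv => Submodule.mem_sup_left ⟨v, hv, rfl⟩)
        fun v hv => Submodule.mem_sup_right ⟨v, hv, rfl⟩
    · rw [← LinearMap.ker_eq_bot, LinearMap.ker_eq_bot']
      intro q hq
      obtain ⟨v, rfl⟩ := Submodule.mkQ_surjective _ q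
      exact (Submodule.Quotient.mk_eq_zero Y).2 ((Submodule.Quotient.mk_eq_zero (A ⊔ B)).1 hq)
    · intro q
      obtain ⟨v, rfl⟩ := Submodule.mkQ_surjective _ q
      obtain ⟨v, rfl⟩ := Submodule.mkQ_surjective _ v
      exact ⟨Submodule.Quotient.mk v, rfl⟩
    · intro q
      obtain ⟨v, rfl⟩ := Submodule.mkQ_surjective _ q
      constructor
      · intro hq
        have h1 := (Submodule.Quotient.mk_eq_zero (A.map W.mkQ ⊔ B.map W.mkQ)).1 hq
        rw [← Submodule.map_sup] at h1
        obtain ⟨u, hu, huv⟩ := h1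
        have huW : u - v ∈ W := (Submodule.Quotient.eq W).1 huv
        refine ⟨Submodule.Quotient.mk ⟨v - u, ?_⟩, (Submodule.Quotient.eq (A ⊔ B)).2 ?_⟩
        · rw [← neg_sub]; exact neg_mem huW
        · change v - u - v ∈ A ⊔ B
          rw [sub_sub_cancel_left]; exact neg_mem hu
      · rintro ⟨q, hq⟩
        obtain ⟨w, rfl⟩ := Submodule.mkQ_surjective _ q
        rw [← hq]
        refine (Submodule.Quotient.mk_eq_zero _).2 ?_
        change W.mkQ (w : V) ∈ _
        have : W.mkQ (w : V) = 0 := (Submodule.Quotient.mk_eq_zero W).2 w.2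
        rw [this]; exact zero_mem _

end Length

namespace IsCurve
variable {K : Type} [Field K] [Algebra ℂ K] {P : Type} {O : P → Subalgebra ℂ K} {hC : IsCurve O}
variable {V : Type} [AddCommGroup V] [Module K V] [Module ℂ V] [IsScalarTower ℂ K V]
  {Λ Λ' : ∀ x, Submodule (O x) V}

/-- The points where `t` is regular. -/
abbrev regularSet (O : P → Subalgebra ℂ K) (t : K) : Set P := {x | t ∈ O x}

/-- The dimension of `H⁰`. -/
def h0 (Λ : ∀ x, Submodule (O x) V) : ℕ∞ := Module.length ℂ (secs Λ Set.univ)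

/-- The dimension of `H¹`, computed by the sections over the points where `t` is regular and over
the poles of `t`. -/
def h1 (t : K) (Λ : ∀ x, Submodule (O x) V) : ℕ∞ :=
  Module.length ℂ (V ⧸ secs Λ (regularSet O t) ⊔ secs Λ (regularSet O t)ᶜ)

theorem secs_inf_compl (S : Set P) : secs Λ S ⊓ secs Λ Sᶜ = secs Λ Set.univ := by
  ext v
  constructor
  · rintro ⟨h1, h2⟩ x -
    by_cases hx : x ∈ S
    exacts [h1 x hx, h2 x hx]
  · exact fun h => ⟨fun x _ => h x trivial, fun x _ => h x trivial⟩

theorem secs_mono (hle : ∀ x, Λ' x ≤ Λ x) (S : Set P) : secs Λ' S ≤ secs Λ S :=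
  fun _ hv x hx => hle x (hv x hx)

theorem exists_h0_h1_eq {t : K} (ht : t ∉ (algebraMap ℂ K).range) (h : hC.Bdl Λ) (h' : hC.Bdl Λ')
    (hle : ∀ x, Λ' x ≤ Λ x) (T : Finset P) (hT : ∀ x ∉ T, Λ x = Λ' x) : ∃ c d,
    h0 Λ = h0 Λ' + c ∧ h1 t Λ' = d + h1 t Λ ∧ c + d = ∑ x ∈ T, index Λ Λ' x := by
  classical
  set S := regularSet O t
  obtain ⟨c, d, h2, h3, h4⟩ := exists_length_eq (secs_mono hle S) (secs Λ Sᶜ)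
  obtain ⟨c', d', h5, h6, h7⟩ := exists_length_eq (secs_mono hle Sᶜ) (secs Λ' S)
  rw [(hC.affine_setOf_mem ht).length_secs h h' T hT] at h4
  rw [(hC.affine_compl ht).length_secs h h' T hT] at h7
  rw [secs_inf_compl] at h2
  rw [inf_comm (secs Λ' Sᶜ), secs_inf_compl, inf_comm] at h5
  rw [sup_comm (secs Λ' Sᶜ), sup_comm (secs Λ Sᶜ)] at h6
  refine ⟨c' + c, d' + d, ?_, ?_, ?_⟩
  · rw [h0, h2, h5, h0, add_assoc]
  · rw [h1, h6, h3, h1, add_assoc]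
  · rw [← Finset.sum_filter_add_sum_filter_not T (· ∈ S), add_add_add_comm, h7, h4, add_comm]
    rfl

theorem secs_map_mkQ (h : hC.Bdl Λ) (W : Submodule K V) {S : Set P} (hS : hC.Affine S) :
    secs (fun x => (Λ x).map (W.mkQ.restrictScalars (O x))) S =
      (secs Λ S).map (W.mkQ.restrictScalars ℂ) := by
  refine le_antisymm (fun q hq => ?_) ?_
  · refine hS.exists_of_local (V := V ⧸ W) (M := (secs Λ S).map (W.mkQ.restrictScalars ℂ)) ?_ ?_
    · rintro g hg _ ⟨v, hv, rfl⟩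
      exact ⟨g • v, fun x hx => smul_mem_of_mem (hg x hx) (hv x hx), rfl⟩
    · intro p hp
      obtain ⟨v, hv, rfl⟩ := hq p hp
      obtain ⟨f, hf1, hf2, -, hf3⟩ := hS.exists_smul_mem_secs h hp hv Set.finite_empty
        (Set.empty_subset _) (Set.notMem_empty _) 1
      refine ⟨f, hf1, fun hf => hC.one_notMem_mpow_one p ?_, ⟨_, hf3, rfl⟩⟩
      simpa using sub_mem hf hf2
  · rintro _ ⟨v, hv, rfl⟩ x hx
    exact ⟨v, hv x hx, rfl⟩

theorem exists_h0_h1_eq_of_quotient {t : K} (ht : t ∉ (algebraMap ℂ K).range) (h : hC.Bdl Λ)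
    (W : Submodule K V) : ∃ i j m,
    h0 Λ = h0 (fun x => (Λ x).comap (W.subtype.restrictScalars (O x))) + i ∧
    h0 (fun x => (Λ x).map (W.mkQ.restrictScalars (O x))) = i + j ∧
    h1 t (fun x => (Λ x).comap (W.subtype.restrictScalars (O x))) = j + m ∧
    h1 t Λ = m + h1 t (fun x => (Λ x).map (W.mkQ.restrictScalars (O x))) := by
  obtain ⟨i, j, m, e1, e2, e3, e4⟩ := exists_length_eq_of_quotient (secs Λ (regularSet O t))
    (secs Λ (regularSet O t)ᶜ) (W.restrictScalars ℂ)
  rw [secs_inf_compl] at e1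
  refine ⟨i, j, m, ?_, ?_, e3, ?_⟩
  · rw [h0, h0, ← secs_inf_compl (Λ := fun x => (Λ x).comap _) (regularSet O t)]
    exact e1
  · rw [h0, ← secs_inf_compl (regularSet O t), secs_map_mkQ h W (hC.affine_setOf_mem ht),
      secs_map_mkQ h W (hC.affine_compl ht)]
    exact e2
  · rw [h1, h1, secs_map_mkQ h W (hC.affine_setOf_mem ht), secs_map_mkQ h W (hC.affine_compl ht)]
    exact e4

end IsCurve
end CobleCurve
end

noncomputable section
open scoped TensorProduct KaehlerDifferential
namespace CobleCurve

section Trace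
variable {A B : Type*} [CommRing A] [CommRing B] [Algebra A B] [IsDedekindDomain A] [IsDomain B]
  [Module.IsTorsionFree A B] [Module.Finite A B] [IsIntegrallyClosed B] (p : Ideal A)
  [p.IsMaximal]

theorem intTrace_mem_of_pow_mem {b : B} {N : ℕ} (h : b ^ N ∈ p.map (algebraMap A B)) :
    Algebra.intTrace A B b ∈ p := by
  rw [← Ideal.Quotient.eq_zero_iff_mem, ← Algebra.trace_quotient_eq_of_isDedekindDomain,
    ← isNilpotent_iff_eq_zero]
  refine Algebra.isNilpotent_trace_of_isNilpotent ⟨N, ?_⟩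
  rwa [← map_pow, Ideal.Quotient.eq_zero_iff_mem]

theorem intTrace_notMem_of_idempotent [CharZero (A ⧸ p)] {e : B}
    (h : e * e - e ∈ p.map (algebraMap A B)) (he : e ∉ p.map (algebraMap A B)) :
    Algebra.intTrace A B e ∉ p := by
  let _ := Ideal.Quotient.field p
  rw [← Ideal.Quotient.eq_zero_iff_mem, ← Algebra.trace_quotient_eq_of_isDedekindDomain,
    Algebra.trace_apply]
  set q := Ideal.Quotient.mk (p.map (algebraMap A B)) e
  have hq : q * q = q := by
    rw [← sub_eq_zero, ← map_mul, ← map_sub, Ideal.Quotient.eq_zero_iff_mem]; exact h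
  have hq0 : q ≠ 0 := by rwa [ne_eq, Ideal.Quotient.eq_zero_iff_mem]
  set f := Algebra.lmul (A ⧸ p) (B ⧸ p.map (algebraMap A B)) q
  have hf : IsIdempotentElem f := by
    rw [IsIdempotentElem, ← map_mul, hq]
  have hfin : Module.Finite (A ⧸ p) (B ⧸ p.map (algebraMap A B)) := inferInstance
  rw [LinearMap.IsIdempotentElem.trace_eq_zero_iff hf]
  exact fun h => hq0 (by simpa [f] using congrArg (fun g => g 1) h)

end Trace

namespace IsCurve
variable {K : Type} [Field K] [Algebra ℂ K] {P : Type} {O : P → Subalgebra ℂ K} (hC : IsCurve O)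

open scoped IntermediateField.algebraAdjoinAdjoin

/-- The trace of `K` over the field of rational functions in `t`, with values in `K`. -/
def tr (t h : K) : K := (Algebra.trace (IntermediateField.adjoin ℂ {t}) K h : K)

theorem exists_eq_add_mul {σ a : K} (ha : a ∈ Algebra.adjoin ℂ {σ}) :
    ∃ (c : ℂ), ∃ a' ∈ Algebra.adjoin ℂ {σ}, a = algebraMap ℂ K c + σ * a' := by
  rw [Algebra.adjoin_singleton_eq_range_aeval] at ha ⊢
  obtain ⟨p, rfl⟩ := ha
  refine ⟨p.coeff 0, _, ⟨p.divX, rfl⟩, ?_⟩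
  have := congrArg (Polynomial.aeval σ) p.divX_mul_X_add
  rw [map_add, map_mul, Polynomial.aeval_X, Polynomial.aeval_C] at this
  exact this.symm.trans (by rw [add_comm, mul_comm]; rfl)

theorem adjoin_le {x : P} {σ : K} (h : σ ∈ O x) : Algebra.adjoin ℂ {σ} ≤ O x :=
  Algebra.adjoin_le (Set.singleton_subset_iff.2 h)

include hC

theorem isMaximal_span {σ : K} (hσ : σ ∉ (algebraMap ℂ K).range) :
    (Ideal.span {(⟨σ, Algebra.self_mem_adjoin_singleton ℂ σ⟩ : Algebra.adjoin ℂ {σ})}).IsMaximal := by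
  obtain ⟨x, hx⟩ := hC.exists_zero hσ
  have hxO := hC.mem_of_mem_mpow_one hx
  rw [Ideal.isMaximal_iff]
  constructor
  · intro h
    obtain ⟨a, ha⟩ := Ideal.mem_span_singleton'.1 h
    refine hC.one_notMem_mpow_one x ?_
    have := (hC.mpow x 1).smul_mem ⟨a, adjoin_le hxO a.2⟩ hx
    convert this
    exact (congrArg Subtype.val ha).symm
  · rintro J ⟨y, hy⟩ hJ hyI hyJ
    obtain ⟨c, a, ha, e⟩ := exists_eq_add_mul hy
    have hσa : (⟨σ, Algebra.self_mem_adjoin_singleton ℂ σ⟩ * ⟨a, ha⟩ : Algebra.adjoin ℂ {σ}) ∈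
        Ideal.span {(⟨σ, Algebra.self_mem_adjoin_singleton ℂ σ⟩ : Algebra.adjoin ℂ {σ})} :=
      Ideal.mul_mem_right _ _ (Ideal.mem_span_singleton_self _)
    have e' : (⟨y, hy⟩ : Algebra.adjoin ℂ {σ}) = algebraMap ℂ (Algebra.adjoin ℂ {σ}) c +
        ⟨σ, Algebra.self_mem_adjoin_singleton ℂ σ⟩ * ⟨a, ha⟩ := Subtype.ext e
    have hc : c ≠ 0 := by
      rintro rfl
      rw [map_zero, zero_add] at e'
      exact hyI (e' ▸ hσa)
    have h1 : algebraMap ℂ (Algebra.adjoin ℂ {σ}) c ∈ J := by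
      have := sub_mem hyJ (hJ hσa)
      rwa [e', add_sub_cancel_right] at this
    have h2 := J.mul_mem_left (algebraMap ℂ (Algebra.adjoin ℂ {σ}) c⁻¹) h1
    rwa [← map_mul, inv_mul_cancel₀ hc, map_one] at h2

theorem tr_mem_adjoin {σ b : K} (hσ : σ ∉ (algebraMap ℂ K).range) (hb : ∀ x, σ ∈ O x → b ∈ O x) :
    tr σ b ∈ Algebra.adjoin ℂ {σ} := by
  have := isPrincipalIdealRing_adjoin hσ
  have := hC.finiteDimensional σ hσ
  have h1 : IsIntegral (Algebra.adjoin ℂ {σ}) b := (hC.isIntegral_adjoin_iff σ b).2 hb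
  have h2 : IsIntegral (Algebra.adjoin ℂ {σ})
      (Algebra.trace (IntermediateField.adjoin ℂ {σ}) K b) := Algebra.isIntegral_trace h1
  obtain ⟨a, ha⟩ := IsIntegrallyClosed.isIntegral_iff.1 h2
  rw [tr, ← ha]
  exact a.2

/-- The trace of a function that is regular where `σ` is and vanishes at the zeros of `σ` is
divisible by `σ`; the trace of a nonzero idempotent modulo `σ` is not. -/
theorem tr_aux {σ b : K} (hσ : σ ∉ (algebraMap ℂ K).range) (hb : ∀ x, σ ∈ O x → b ∈ O x) :
    ((∀ x, σ ∈ hC.mpow x 1 → b ∈ hC.mpow x 1) →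
      ∃ a ∈ Algebra.adjoin ℂ {σ}, tr σ b = σ * a) ∧
    ((∀ x, σ ∈ O x → σ⁻¹ * (b * b - b) ∈ O x) → (∃ x, σ ∈ O x ∧ σ⁻¹ * b ∉ O x) →
      ¬ ∃ a ∈ Algebra.adjoin ℂ {σ}, tr σ b = σ * a) := by
  have hσ0 := ne_zero_of_notMem_range hσ
  let A := Algebra.adjoin ℂ {σ}
  let B := integralClosure A K
  have := isPrincipalIdealRing_adjoin hσ
  have := hC.finiteDimensional σ hσ
  have := hC.isDedekindDomain_integralClosure hσ
  have := hC.isFractionRing_integralClosure hσ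
  have hfin : Module.Finite A B :=
    IsIntegralClosure.finite _ (IntermediateField.adjoin ℂ {σ}) K _
  have := hC.isMaximal_span hσ
  set p := Ideal.span {(⟨σ, Algebra.self_mem_adjoin_singleton ℂ σ⟩ : A)} with hp
  have hmem : ∀ c : B, c ∈ p.map (algebraMap A B) ↔ ∀ x, σ ∈ O x → σ⁻¹ * (c : K) ∈ O x := by
    intro c
    rw [hp, Ideal.map_span, Set.image_singleton, Ideal.mem_span_singleton']
    constructor
    · rintro ⟨a, rfl⟩ x hx
      have e : ((a * algebraMap A B ⟨σ, Algebra.self_mem_adjoin_singleton ℂ σ⟩ : B) : K) =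
        (a : K) * σ := rfl
      rw [e, mul_comm (a : K), inv_mul_cancel_left₀ hσ0]
      exact (hC.isIntegral_adjoin_iff σ _).1 a.2 x hx
    · intro h
      refine ⟨⟨_, (hC.isIntegral_adjoin_iff σ _).2 h⟩, Subtype.ext ?_⟩
      change σ⁻¹ * (c : K) * σ = c
      field_simp
  let b' : B := ⟨b, (hC.isIntegral_adjoin_iff σ b).2 hb⟩
  have htr : ((Algebra.intTrace A B b' : A) : K) = tr σ b := by
    have := Algebra.algebraMap_intTrace (A := A) (K := IntermediateField.adjoin ℂ {σ}) (L := K)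
      (B := B) b'
    exact congrArg Subtype.val this
  have hiff : Algebra.intTrace A B b' ∈ p ↔ ∃ a ∈ Algebra.adjoin ℂ {σ}, tr σ b = σ * a := by
    rw [hp, Ideal.mem_span_singleton']
    constructor
    · rintro ⟨a, ha⟩
      refine ⟨a, a.2, ?_⟩
      rw [← htr, ← ha, mul_comm]
      rfl
    · rintro ⟨a, ha, h⟩
      refine ⟨⟨a, ha⟩, Subtype.ext ?_⟩
      rw [htr, h, mul_comm]
      rfl
  rw [← hiff]
  constructor
  · intro h
    obtain ⟨N, hN⟩ : ∃ N : ℕ, ∀ x ∈ {x | σ ∈ hC.mpow x 1}, hC.ord x σ ≤ N := by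
      obtain ⟨M, hM⟩ := ((hC.finite_setOf_mem_mpow_one hσ0).image fun x => hC.ord x σ).bddAbove
      exact ⟨M.toNat, fun x hx => (hM ⟨x, hx, rfl⟩).trans (Int.self_le_toNat M)⟩
    refine intTrace_mem_of_pow_mem p (N := N) ((hmem _).2 fun x hx => ?_)
    change σ⁻¹ * b ^ N ∈ O x
    by_cases hx1 : σ ∈ hC.mpow x 1
    · rw [← hC.mem_mpow_zero, hC.mul_mem_mpow_iff x (inv_ne_zero hσ0), hC.ord_inv x hσ0]
      have := hC.pow_mem_mpow x (h x hx1) N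
      refine hC.mpow_mono x ?_ this
      have := hN x hx1
      omega
    · refine mul_mem ?_ (pow_mem (hb x hx) N)
      by_contra h2
      rw [← hC.inv_mem_mpow_one_iff x (inv_ne_zero hσ0), inv_inv] at h2
      exact hx1 h2
  · rintro h ⟨x, hx, hx'⟩
    have : CharZero (A ⧸ p) := by
      have : Nontrivial (A ⧸ p) := Ideal.Quotient.nontrivial_iff.2 (Ideal.IsPrime.ne_top inferInstance)
      exact charZero_of_injective_algebraMap (algebraMap ℂ (A ⧸ p)).injective
    exact intTrace_notMem_of_idempotent p ((hmem _).2 h) fun h2 => hx' ((hmem _).1 h2 x hx)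

end IsCurve
end CobleCurve
end

noncomputable section
open scoped TensorProduct KaehlerDifferential
namespace CobleCurve
namespace IsCurve
variable {K : Type} [Field K] [Algebra ℂ K] {P : Type} {O : P → Subalgebra ℂ K} (hC : IsCurve O)

theorem adjoin_sub_algebraMap (t : K) (c : ℂ) :
    IntermediateField.adjoin ℂ {t - algebraMap ℂ K c} = IntermediateField.adjoin ℂ {t} := by
  apply le_antisymm
  · rw [IntermediateField.adjoin_simple_le_iff]
    exact sub_mem (IntermediateField.mem_adjoin_simple_self ℂ t)
      (IntermediateField.algebraMap_mem _ c)
  · rw [IntermediateField.adjoin_simple_le_iff]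
    have := add_mem (IntermediateField.mem_adjoin_simple_self ℂ (t - algebraMap ℂ K c))
      (IntermediateField.algebraMap_mem _ c)
    simpa using this

theorem adjoin_inv (t : K) :
    IntermediateField.adjoin ℂ {t⁻¹} = IntermediateField.adjoin ℂ {t} := by
  apply le_antisymm
  · rw [IntermediateField.adjoin_simple_le_iff]
    exact inv_mem (IntermediateField.mem_adjoin_simple_self ℂ t)
  · rw [IntermediateField.adjoin_simple_le_iff]
    simpa using inv_mem (IntermediateField.mem_adjoin_simple_self ℂ t⁻¹)

theorem tr_congr {t u : K} (h : IntermediateField.adjoin ℂ {t} = IntermediateField.adjoin ℂ {u})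
    (g : K) : tr t g = tr u g := by
  have key : ∀ F F' : IntermediateField ℂ K, F = F' →
      ((Algebra.trace F K g : F) : K) = (Algebra.trace F' K g : F') := by
    rintro F _ rfl; rfl
  exact key _ _ h

theorem tr_mem (t g : K) : tr t g ∈ IntermediateField.adjoin ℂ {t} :=
  (Algebra.trace (IntermediateField.adjoin ℂ {t}) K g).2

theorem tr_add (t g h : K) : tr t (g + h) = tr t g + tr t h := by simp [tr]

theorem tr_mul (t : K) {a : K} (ha : a ∈ IntermediateField.adjoin ℂ {t}) (g : K) :
    tr t (a * g) = a * tr t g := by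
  have : a * g = (⟨a, ha⟩ : IntermediateField.adjoin ℂ {t}) • g := rfl
  rw [this, tr, map_smul]
  rfl

theorem adjoin_le_field (t : K) {a : K} (ha : a ∈ Algebra.adjoin ℂ {t}) :
    a ∈ IntermediateField.adjoin ℂ {t} :=
  IntermediateField.algebra_adjoin_le_adjoin ℂ _ ha

theorem mem_range_of_sub {t : K} {c : ℂ} (ht : t ∉ (algebraMap ℂ K).range) :
    t - algebraMap ℂ K c ∉ (algebraMap ℂ K).range := by
  rintro ⟨d, hd⟩
  exact ht ⟨d + c, by rw [map_add, hd]; ring⟩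

include hC

theorem inv_mem_of_notMem {x : P} {a : K} (h : a ∉ hC.mpow x 1) : a⁻¹ ∈ O x := by
  have h0 : a ≠ 0 := fun h' => h (h' ▸ zero_mem _)
  by_contra h2
  rw [← hC.inv_mem_mpow_one_iff x (inv_ne_zero h0), inv_inv] at h2
  exact h h2

theorem algebraMap_notMem {x : P} {c : ℂ} (hc : c ≠ 0) : algebraMap ℂ K c ∉ hC.mpow x 1 := by
  have h0 : algebraMap ℂ K c ≠ 0 := (map_ne_zero_iff _ (algebraMap ℂ K).injective).2 hc
  rw [hC.mem_mpow_of_ne_zero x _ h0, ord_algebraMap]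
  omega

theorem eq_of_algebraMap_sub_mem {x : P} {c d : ℂ}
    (h : algebraMap ℂ K c - algebraMap ℂ K d ∈ hC.mpow x 1) : c = d := by
  by_contra hne
  rw [← map_sub] at h
  exact hC.algebraMap_notMem (sub_ne_zero.2 hne) h

theorem pow_notMem {x : P} {a : K} (h1 : a ∈ O x) (h2 : a ∉ hC.mpow x 1) (n : ℕ) :
    a ^ n ∉ hC.mpow x 1 := by
  induction n with
  | zero => simpa using hC.one_notMem_mpow_one x
  | succ n ih =>
    rw [pow_succ]
    exact hC.mul_notMem_mpow_one x (pow_mem h1 n) h1 ih h2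

theorem exists_polynomial_mul_regular {σ h : K}
    (hh : ∀ x, σ ∈ hC.mpow x 1 → h ∈ O x) : ∃ p ∈ Algebra.adjoin ℂ {σ},
      (∀ x, σ ∈ hC.mpow x 1 → p ∉ hC.mpow x 1) ∧ ∀ x, σ ∈ O x → p * h ∈ O x := by
  classical
  have hZ : ({x | h ∉ O x} ∩ {x | σ ∈ O x}).Finite := (hC.finite_setOf_notMem h).inter_of_left _
  obtain ⟨N, hN⟩ : ∃ N : ℕ, ∀ x ∈ {x | h ∉ O x} ∩ {x | σ ∈ O x}, - hC.ord x h ≤ N := by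
    obtain ⟨M, hM⟩ := (hZ.image fun x => - hC.ord x h).bddAbove
    exact ⟨M.toNat, fun x hx => (hM ⟨x, hx, rfl⟩).trans (Int.self_le_toNat M)⟩
  choose! c hc using fun x (hx : σ ∈ O x) => hC.exists_sub_mem x hx
  refine ⟨∏ x ∈ hZ.toFinset, (σ - algebraMap ℂ K (c x)) ^ N, ?_, fun x hx => ?_, fun x hx => ?_⟩
  · exact prod_mem fun x _ => pow_mem (sub_mem (Algebra.self_mem_adjoin_singleton ℂ σ)
      (Subalgebra.algebraMap_mem _ _)) N
  · have hx' := hC.mem_of_mem_mpow_one hx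
    have key : ∀ y ∈ hZ.toFinset, σ - algebraMap ℂ K (c y) ∉ hC.mpow x 1 := by
      intro y hy h1
      have hy := (hZ.mem_toFinset).1 hy
      have h2 : c y = 0 := by
        by_contra h3
        exact hC.algebraMap_notMem h3 (by simpa using sub_mem hx h1)
      refine hy.1 (hh y ?_)
      have := hc y hy.2
      rwa [h2, map_zero, sub_zero] at this
    have key2 : ∀ s ⊆ hZ.toFinset, ∏ x ∈ s, (σ - algebraMap ℂ K (c x)) ^ N ∈ O x ∧
        ∏ x ∈ s, (σ - algebraMap ℂ K (c x)) ^ N ∉ hC.mpow x 1 := by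
      intro s hs
      refine Finset.prod_induction _ (fun g => g ∈ O x ∧ g ∉ hC.mpow x 1) ?_ ?_ ?_
      · exact fun a b ha hb => ⟨mul_mem ha.1 hb.1, hC.mul_notMem_mpow_one x ha.1 hb.1 ha.2 hb.2⟩
      · exact ⟨one_mem _, hC.one_notMem_mpow_one x⟩
      · intro y hy
        have h1 : σ - algebraMap ℂ K (c y) ∈ O x := sub_mem hx' ((O x).algebraMap_mem _)
        refine ⟨pow_mem h1 N, ?_⟩
        exact hC.pow_notMem h1 (key y (hs hy)) N
    exact (key2 _ subset_rfl).2
  · have hO : ∀ s : Finset P, ∏ y ∈ s, (σ - algebraMap ℂ K (c y)) ^ N ∈ O x := fun s =>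
      prod_mem fun y _ => pow_mem (sub_mem hx ((O x).algebraMap_mem _)) N
    by_cases hxh : h ∈ O x
    · exact mul_mem (hO _) hxh
    · have hxZ : x ∈ hZ.toFinset := hZ.mem_toFinset.2 ⟨hxh, hx⟩
      rw [← Finset.mul_prod_erase _ _ hxZ, mul_right_comm]
      refine mul_mem ?_ (hO _)
      have h0 : h ≠ 0 := fun h' => hxh (h' ▸ zero_mem _)
      rw [mul_comm, ← hC.mem_mpow_zero, hC.mul_mem_mpow_iff x h0]
      refine hC.mpow_mono x ?_ (hC.pow_mem_mpow x (hc x hx) N)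
      have := hN x ⟨hxh, hx⟩
      omega

/-- The trace of a function that vanishes at all zeros of `σ` is divisible by `σ` there. -/
theorem inv_mul_tr_mem {σ h : K} (hσ : σ ∉ (algebraMap ℂ K).range)
    (hh : ∀ x, σ ∈ hC.mpow x 1 → h ∈ hC.mpow x 1) {x : P} (hx : σ ∈ hC.mpow x 1) :
    σ⁻¹ * tr σ h ∈ O x := by
  have hσ0 := ne_zero_of_notMem_range hσ
  obtain ⟨p, hp1, hp2, hp3⟩ := hC.exists_polynomial_mul_regular
    fun x hx => hC.mem_of_mem_mpow_one (hh x hx)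
  obtain ⟨a, ha, e⟩ := (hC.tr_aux hσ hp3).1 fun y hy =>
    (hC.mpow y 1).smul_mem ⟨p, adjoin_le (hC.mem_of_mem_mpow_one hy) hp1⟩ (hh y hy)
  have hp0 : p ≠ 0 := fun h => hp2 x hx (h ▸ zero_mem _)
  rw [tr_mul σ (adjoin_le_field σ hp1)] at e
  have : σ⁻¹ * tr σ h = p⁻¹ * a := by
    field_simp
    rw [mul_comm, e]
  rw [this]
  exact mul_mem (hC.inv_mem_of_notMem (hp2 x hx)) (adjoin_le (hC.mem_of_mem_mpow_one hx) ha)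

/-- A function that is close to `1` at one zero of `σ` and to `0` at the others has a trace that
is not divisible by `σ`. -/
theorem exists_tr_notMem {σ : K} (hσ : σ ∉ (algebraMap ℂ K).range) {p : P}
    (hp : σ ∈ hC.mpow p 1) : ∃ N : ℕ, ∀ e : K, (∀ x, σ ∈ O x → e ∈ O x) → e - 1 ∈ hC.mpow p N →
      (∀ x, x ≠ p → σ ∈ hC.mpow x 1 → e ∈ hC.mpow x N) → σ⁻¹ * tr σ e ∉ O p := by
  have hσ0 := ne_zero_of_notMem_range hσ
  obtain ⟨N, hN⟩ : ∃ N : ℕ, ∀ x ∈ {x | σ ∈ hC.mpow x 1}, hC.ord x σ ≤ N := by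
    obtain ⟨M, hM⟩ := ((hC.finite_setOf_mem_mpow_one hσ0).image fun x => hC.ord x σ).bddAbove
    exact ⟨M.toNat, fun x hx => (hM ⟨x, hx, rfl⟩).trans (Int.self_le_toNat M)⟩
  have hN1 : (1 : ℤ) ≤ N := ((hC.mem_mpow_of_ne_zero p 1 hσ0).1 hp).trans (hN p hp)
  refine ⟨N, fun e he1 he2 he3 htr => ?_⟩
  have hep : e ∉ hC.mpow p 1 := fun h => hC.one_notMem_mpow_one p (by
    simpa using sub_mem h (hC.mpow_mono p hN1 he2))
  have hpO := hC.mem_of_mem_mpow_one hp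
  refine (hC.tr_aux hσ he1).2 (fun x hx => ?_) ⟨p, hpO, fun h => hep ?_⟩ ?_
  · by_cases hx1 : σ ∈ hC.mpow x 1
    · rw [← hC.mem_mpow_zero, hC.mul_mem_mpow_iff x (inv_ne_zero hσ0), hC.ord_inv x hσ0,
        zero_sub, neg_neg]
      refine hC.mpow_mono x (hN x hx1) ?_
      have e1 : e * e - e = e * (e - 1) := by ring
      rw [e1]
      by_cases hxp : x = p
      · rw [hxp]
        exact (hC.mpow p N).smul_mem ⟨e, he1 p hpO⟩ he2
      · rw [mul_comm]
        exact (hC.mpow x N).smul_mem ⟨e - 1, sub_mem (he1 x hx) (one_mem _)⟩ (he3 x hxp hx1)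
    · exact mul_mem (hC.inv_mem_of_notMem hx1)
        (sub_mem (mul_mem (he1 x hx) (he1 x hx)) (he1 x hx))
  · have := (hC.mpow p 1).smul_mem ⟨_, h⟩ hp
    convert this using 1
    change e = σ⁻¹ * e * σ
    field_simp
  · obtain ⟨c, a, ha, h⟩ := exists_eq_add_mul (hC.tr_mem_adjoin hσ he1)
    have h1 : tr σ e ∈ hC.mpow p 1 := by
      have := (hC.mpow p 1).smul_mem ⟨_, htr⟩ hp
      convert this using 1
      change _ = σ⁻¹ * tr σ e * σ
      field_simp
    have h2 : σ * a ∈ hC.mpow p 1 := by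
      rw [mul_comm]
      exact (hC.mpow p 1).smul_mem ⟨a, adjoin_le hpO ha⟩ hp
    have h3 : c = 0 := by
      by_contra h3
      exact hC.algebraMap_notMem h3 (by simpa [h] using sub_mem h1 h2)
    exact ⟨a, ha, by rw [h, h3, map_zero, zero_add]⟩

omit hC in
theorem exists_pow_mul_unit (hC : IsCurve O) {s : K}
    {p : Polynomial ℂ} (hp : p ≠ 0) : ∃ (k : ℕ), ∃ u ∈ Algebra.adjoin ℂ {s},
      Polynomial.aeval s p = s ^ k * u ∧ ∀ x, s ∈ hC.mpow x 1 → u ∉ hC.mpow x 1 := by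
  obtain ⟨q, hq, hq'⟩ := Polynomial.exists_eq_pow_rootMultiplicity_mul_and_not_dvd p hp 0
  refine ⟨p.rootMultiplicity 0, Polynomial.aeval s q, ?_, ?_, fun x hx h => ?_⟩
  · rw [Algebra.adjoin_singleton_eq_range_aeval]
    exact ⟨q, rfl⟩
  · conv_lhs => rw [hq]
    simp
  · rw [Polynomial.C_0, sub_zero, Polynomial.X_dvd_iff] at hq'
    have := congrArg (Polynomial.aeval s) q.divX_mul_X_add
    rw [map_add, map_mul, Polynomial.aeval_X, Polynomial.aeval_C] at this
    have hO : Polynomial.aeval s q.divX ∈ O x := by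
      refine adjoin_le (hC.mem_of_mem_mpow_one hx) ?_
      rw [Algebra.adjoin_singleton_eq_range_aeval]
      exact ⟨_, rfl⟩
    have h2 := (hC.mpow x 1).smul_mem ⟨_, hO⟩ hx
    refine hC.algebraMap_notMem hq' (x := x) ?_
    have h3 := sub_mem h h2
    rw [← this] at h3
    convert h3 using 1
    change _ = Polynomial.aeval s q.divX * s + _ - Polynomial.aeval s q.divX * s
    ring

/-- A nonzero rational function in `s` is a power of `s` times a unit at the zeros of `s`. -/
theorem exists_zpow_mul_unit {s : K} (hs : s ∉ (algebraMap ℂ K).range) {f : K}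
    (hf : f ∈ IntermediateField.adjoin ℂ {s}) (hf0 : f ≠ 0) :
    ∃ (n : ℤ) (u : K), f = s ^ n * u ∧ u ≠ 0 ∧ ∀ x, s ∈ hC.mpow x 1 → u ∈ O x ∧ u⁻¹ ∈ O x := by
  obtain ⟨p, q, rfl⟩ := (IntermediateField.mem_adjoin_simple_iff ℂ f).1 hf
  have hp : p ≠ 0 := by rintro rfl; simp at hf0
  have hq : q ≠ 0 := by rintro rfl; simp at hf0
  have hs0 := ne_zero_of_notMem_range hs
  obtain ⟨k, u, hu, e1, hu'⟩ := exists_pow_mul_unit hC hp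
  obtain ⟨l, v, hv, e2, hv'⟩ := exists_pow_mul_unit hC hq
  have hv0 : v ≠ 0 := by
    rintro rfl
    rw [e2, mul_zero, div_zero] at hf0
    exact hf0 rfl
  have hu0 : u ≠ 0 := by
    rintro rfl
    rw [e1, mul_zero, zero_div] at hf0
    exact hf0 rfl
  refine ⟨k - l, u * v⁻¹, ?_, mul_ne_zero hu0 (inv_ne_zero hv0), fun x hx => ⟨?_, ?_⟩⟩
  · rw [e1, e2, zpow_sub₀ hs0, zpow_natCast, zpow_natCast]
    field_simp
  · exact mul_mem (adjoin_le (hC.mem_of_mem_mpow_one hx) hu) (hC.inv_mem_of_notMem (hv' x hx))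
  · rw [mul_inv, inv_inv]
    exact mul_mem (hC.inv_mem_of_notMem (hu' x hx)) (adjoin_le (hC.mem_of_mem_mpow_one hx) hv)

end IsCurve
end CobleCurve
end

noncomputable section
open scoped TensorProduct KaehlerDifferential
namespace CobleCurve
namespace IsCurve
variable {K : Type} [Field K] [Algebra ℂ K] {P : Type} {O : P → Subalgebra ℂ K} (hC : IsCurve O)

/-- The residue (up to sign) at the pole `x₀` of `t` of the differential `f dt`, where `f` is a
rational function in `t`, divided by the ramification index: `r` is the value at infinity of
`t (f - p)` for a polynomial `p` in `t`. -/
def IsRes (t : K) (x₀ : P) (f : K) (r : ℂ) : Prop :=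
  ∃ p ∈ Algebra.adjoin ℂ {t}, t * (f - p) - algebraMap ℂ K r ∈ hC.mpow x₀ 1

open Classical in
/-- The residue as a function. -/
def res (t : K) (x₀ : P) (f : K) : ℂ := if h : ∃ r, hC.IsRes t x₀ f r then h.choose else 0

variable {t : K} (ht : t ∉ (algebraMap ℂ K).range) {x₀ : P} (hx₀ : t ∉ O x₀)

variable {hC}
include hC ht

theorem exists_eq_inv_zpow {f : K} (hf : f ∈ IntermediateField.adjoin ℂ {t}) (hf0 : f ≠ 0) :
    ∃ (n : ℤ) (u : K), f = t⁻¹ ^ n * u ∧ u ≠ 0 ∧ ∀ x, t ∉ O x → u ∈ O x ∧ u⁻¹ ∈ O x := by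
  rw [← adjoin_inv] at hf
  obtain ⟨n, u, h1, h2, h3⟩ := hC.exists_zpow_mul_unit (inv_notMem_range ht) hf hf0
  exact ⟨n, u, h1, h2, fun x hx => h3 x (hC.mem_inv_of_notMem hx)⟩

omit ht in
theorem inv_mem_stalk {x : P} (hx : t ∉ O x) : t⁻¹ ∈ O x :=
  hC.mem_of_mem_mpow_one (hC.mem_inv_of_notMem hx)

include hx₀

theorem mul_mem_of_mem_mpow_one {f : K} (hf : f ∈ IntermediateField.adjoin ℂ {t})
    (h : f ∈ hC.mpow x₀ 1) {x : P} (hx : t ∉ O x) : t * f ∈ O x := by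
  by_cases hf0 : f = 0
  · rw [hf0, mul_zero]; exact zero_mem _
  have ht0 := ne_zero_of_notMem_range ht
  obtain ⟨n, u, rfl, hu, hu'⟩ := exists_eq_inv_zpow (hC := hC) ht hf hf0
  by_cases hn : 1 ≤ n
  · obtain ⟨k, rfl⟩ : ∃ k : ℕ, n = k + 1 := ⟨(n - 1).toNat, by omega⟩
    have : t * (t⁻¹ ^ ((k : ℤ) + 1) * u) = t⁻¹ ^ k * u := by
      rw [zpow_add₀ (inv_ne_zero ht0), zpow_natCast]
      simp only [inv_pow]; field_simp
    rw [this]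
    exact mul_mem (pow_mem (inv_mem_stalk (hC := hC) hx) k) (hu' x hx).1
  · obtain ⟨k, rfl⟩ : ∃ k : ℕ, n = -k := ⟨(-n).toNat, by omega⟩
    refine absurd ?_ (hC.one_notMem_mpow_one x₀)
    have h1 : t⁻¹ ^ k * u⁻¹ ∈ O x₀ :=
      mul_mem (pow_mem (inv_mem_stalk (hC := hC) hx₀) k) (hu' x₀ hx₀).2
    have := (hC.mpow x₀ 1).smul_mem ⟨_, h1⟩ h
    convert this using 1
    change 1 = t⁻¹ ^ k * u⁻¹ * (t⁻¹ ^ (-k : ℤ) * u)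
    rw [zpow_neg, zpow_natCast]
    simp only [inv_pow]; field_simp

theorem mem_of_mem_field {f : K} (hf : f ∈ IntermediateField.adjoin ℂ {t})
    (h : f ∈ O x₀) {x : P} (hx : t ∉ O x) : f ∈ O x := by
  have ht0 := ne_zero_of_notMem_range ht
  have h1 : t⁻¹ * f ∈ hC.mpow x₀ 1 := by
    rw [mul_comm]
    exact (hC.mpow x₀ 1).smul_mem ⟨f, h⟩ (hC.mem_inv_of_notMem hx₀)
  have := mul_mem_of_mem_mpow_one ht hx₀ (mul_mem
    (inv_mem (IntermediateField.mem_adjoin_simple_self ℂ t)) hf) h1 hx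
  rwa [mul_inv_cancel_left₀ ht0] at this

theorem eq_zero_of_mem_adjoin {q : K} (hq : q ∈ Algebra.adjoin ℂ {t}) (h : t * q ∈ O x₀) :
    q = 0 := by
  have ht0 := ne_zero_of_notMem_range ht
  have h1 : ∀ x, t ∉ O x → q ∈ hC.mpow x 1 := fun x hx => by
    have := mem_of_mem_field (hC := hC) ht hx₀ (mul_mem (IntermediateField.mem_adjoin_simple_self ℂ t)
      (adjoin_le_field t hq)) h hx
    have := (hC.mpow x 1).smul_mem ⟨_, this⟩ (hC.mem_inv_of_notMem hx)
    convert this using 1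
    change q = t * q * t⁻¹
    field_simp
  have h2 : ∀ x, q ∈ O x := fun x => by
    by_cases hx : t ∈ O x
    · exact adjoin_le hx hq
    · exact hC.mem_of_mem_mpow_one (h1 x hx)
  obtain ⟨c, rfl⟩ := hC.mem_range_of_forall_mem h2
  by_cases hc : c = 0
  · rw [hc, map_zero]
  · exact absurd (h1 x₀ hx₀) (hC.algebraMap_notMem hc)

theorem IsRes.unique {f : K} {r r' : ℂ} (h : hC.IsRes t x₀ f r) (h' : hC.IsRes t x₀ f r') :
    r = r' := by
  obtain ⟨p, hp, h⟩ := h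
  obtain ⟨p', hp', h'⟩ := h'
  have h1 : t * (p' - p) - (algebraMap ℂ K r - algebraMap ℂ K r') ∈ hC.mpow x₀ 1 := by
    convert sub_mem h h' using 1; ring
  have h2 : t * (p' - p) ∈ O x₀ := by
    have := add_mem (hC.mem_of_mem_mpow_one h1)
      (sub_mem ((O x₀).algebraMap_mem r) ((O x₀).algebraMap_mem r'))
    simpa using this
  rw [eq_zero_of_mem_adjoin (hC := hC) ht hx₀ (sub_mem hp' hp) h2, mul_zero, zero_sub] at h1
  exact hC.eq_of_algebraMap_sub_mem (x := x₀) (by simpa using neg_mem h1)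

theorem res_eq {f : K} {r : ℂ} (h : hC.IsRes t x₀ f r) : hC.res t x₀ f = r := by
  have hex : ∃ r, hC.IsRes t x₀ f r := ⟨r, h⟩
  rw [res, dif_pos hex]
  exact IsRes.unique ht hx₀ hex.choose_spec h

theorem exists_isRes {f : K} (hf : f ∈ IntermediateField.adjoin ℂ {t}) :
    ∃ r, hC.IsRes t x₀ f r := by
  have ht0 := ne_zero_of_notMem_range ht
  have htF := IntermediateField.mem_adjoin_simple_self ℂ t
  have key : ∀ k : ℕ, ∀ f ∈ IntermediateField.adjoin ℂ {t}, t⁻¹ ^ k * (t * f) ∈ O x₀ →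
      ∃ r, hC.IsRes t x₀ f r := by
    intro k
    induction k with
    | zero =>
      intro f hf h
      rw [pow_zero, one_mul] at h
      obtain ⟨r, hr⟩ := hC.exists_sub_mem x₀ h
      exact ⟨r, 0, zero_mem _, by rwa [sub_zero]⟩
    | succ k ih =>
      intro f hf h
      have e : t⁻¹ ^ (k + 1) * (t * f) = t⁻¹ ^ k * f := by
        simp only [inv_pow]; field_simp; ring
      rw [e] at h
      obtain ⟨b, hb⟩ := hC.exists_sub_mem x₀ h
      have hbt : algebraMap ℂ K b * t ^ k ∈ Algebra.adjoin ℂ {t} :=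
        mul_mem (Subalgebra.algebraMap_mem _ _) (pow_mem (Algebra.self_mem_adjoin_singleton ℂ t) k)
      obtain ⟨r, p, hp, hr⟩ := ih (f - algebraMap ℂ K b * t ^ k)
        (sub_mem hf (adjoin_le_field t hbt)) (by
          have := mul_mem_of_mem_mpow_one ht hx₀ (sub_mem (mul_mem (pow_mem (inv_mem htF) k) hf)
            (IntermediateField.algebraMap_mem _ b)) hb hx₀
          convert this using 1
          simp only [inv_pow]; field_simp)
      exact ⟨r, algebraMap ℂ K b * t ^ k + p, add_mem hbt hp, by rwa [← sub_sub]⟩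
  by_cases hf0 : f = 0
  · exact ⟨0, 0, zero_mem _, by simp [hf0]⟩
  obtain ⟨n, u, rfl, hu, hu'⟩ := exists_eq_inv_zpow (hC := hC) ht hf hf0
  refine key (n.natAbs + 1) _ hf ?_
  obtain ⟨m, hm⟩ : ∃ m : ℕ, (n.natAbs : ℤ) + n = m := ⟨(n.natAbs + n).toNat, by omega⟩
  have e : t⁻¹ ^ (n.natAbs + 1) * (t * (t⁻¹ ^ n * u)) = t⁻¹ ^ m * u := by
    rw [← zpow_natCast t⁻¹ m, ← hm, zpow_add₀ (inv_ne_zero ht0), zpow_natCast, pow_succ]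
    simp only [inv_pow]; field_simp
  rw [e]
  exact mul_mem (pow_mem (inv_mem_stalk (hC := hC) hx₀) m) (hu' x₀ hx₀).1

theorem isRes_res {f : K} (hf : f ∈ IntermediateField.adjoin ℂ {t}) :
    hC.IsRes t x₀ f (hC.res t x₀ f) := by
  obtain ⟨r, hr⟩ := exists_isRes ht hx₀ hf
  rwa [res_eq ht hx₀ hr]

theorem res_add {f g : K} (hf : f ∈ IntermediateField.adjoin ℂ {t})
    (hg : g ∈ IntermediateField.adjoin ℂ {t}) :
    hC.res t x₀ (f + g) = hC.res t x₀ f + hC.res t x₀ g := by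
  obtain ⟨p, hp, h⟩ := isRes_res (hC := hC) ht hx₀ hf
  obtain ⟨q, hq, h'⟩ := isRes_res (hC := hC) ht hx₀ hg
  refine res_eq ht hx₀ ⟨p + q, add_mem hp hq, ?_⟩
  rw [map_add]
  convert add_mem h h' using 1; ring

theorem res_mul {f : K} (hf : f ∈ IntermediateField.adjoin ℂ {t}) (c : ℂ) :
    hC.res t x₀ (algebraMap ℂ K c * f) = c * hC.res t x₀ f := by
  obtain ⟨p, hp, h⟩ := isRes_res (hC := hC) ht hx₀ hf
  refine res_eq ht hx₀ ⟨algebraMap ℂ K c * p, mul_mem (Subalgebra.algebraMap_mem _ _) hp, ?_⟩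
  have := (hC.mpow x₀ 1).smul_mem ⟨_, (O x₀).algebraMap_mem c⟩ h
  convert this using 1
  change _ = algebraMap ℂ K c * (t * (f - p) - algebraMap ℂ K (hC.res t x₀ f))
  rw [map_mul]; ring

theorem res_of_mem_adjoin {f : K} (hf : f ∈ Algebra.adjoin ℂ {t}) : hC.res t x₀ f = 0 :=
  res_eq ht hx₀ ⟨f, hf, by simp⟩

theorem res_of_mul_mem {f : K} (h : t ^ 2 * f ∈ O x₀) : hC.res t x₀ f = 0 := by
  have ht0 := ne_zero_of_notMem_range ht
  refine res_eq ht hx₀ ⟨0, zero_mem _, ?_⟩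
  have := (hC.mpow x₀ 1).smul_mem ⟨_, h⟩ (hC.mem_inv_of_notMem hx₀)
  convert this using 1
  change t * (f - 0) - algebraMap ℂ K 0 = t ^ 2 * f * t⁻¹
  rw [map_zero]
  field_simp
  ring

theorem res_inv_mul_ne_zero {u : K} (h1 : u ∈ O x₀) (h2 : u⁻¹ ∈ O x₀) (h0 : u ≠ 0) :
    hC.res t x₀ (t⁻¹ * u) ≠ 0 := by
  have ht0 := ne_zero_of_notMem_range ht
  obtain ⟨r, hr⟩ := hC.exists_sub_mem x₀ h1
  have : hC.IsRes t x₀ (t⁻¹ * u) r :=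
    ⟨0, zero_mem _, by rwa [sub_zero, mul_inv_cancel_left₀ ht0]⟩
  rw [res_eq ht hx₀ this]
  rintro rfl
  rw [map_zero, sub_zero] at hr
  refine hC.one_notMem_mpow_one x₀ ?_
  have := (hC.mpow x₀ 1).smul_mem ⟨_, h2⟩ hr
  convert this using 1
  exact (inv_mul_cancel₀ h0).symm

theorem mem_adjoin_of_res_eq_zero {f : K} (hf : f ∈ IntermediateField.adjoin ℂ {t})
    (h : ∀ k : ℕ, hC.res t x₀ (t ^ k * f) = 0) : f ∈ Algebra.adjoin ℂ {t} := by
  have ht0 := ne_zero_of_notMem_range ht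
  have htF := IntermediateField.mem_adjoin_simple_self ℂ t
  have htA := Algebra.self_mem_adjoin_singleton ℂ t
  obtain ⟨p, hp, hr⟩ := isRes_res (hC := hC) ht hx₀ hf
  have hp' := adjoin_le_field t hp
  by_cases hne : f - p = 0
  · rwa [sub_eq_zero.1 hne]
  have h1 : ∀ k : ℕ, hC.res t x₀ (t ^ k * (f - p)) = 0 := fun k => by
    have := res_add (hC := hC) ht hx₀ (mul_mem (pow_mem htF k) (sub_mem hf hp'))
      (mul_mem (pow_mem htF k) hp')
    rwa [← mul_add, sub_add_cancel, h k, res_of_mem_adjoin ht hx₀ (mul_mem (pow_mem htA k) hp),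
      add_zero, eq_comm] at this
  have h2 : t * (f - p) ∈ O x₀ := by
    have := add_mem (hC.mem_of_mem_mpow_one hr) ((O x₀).algebraMap_mem (hC.res t x₀ f))
    simpa using this
  obtain ⟨n, u, e, hu, hu'⟩ := exists_eq_inv_zpow (hC := hC) ht (sub_mem hf hp') hne
  obtain ⟨hu1, hu2⟩ := hu' x₀ hx₀
  rw [e] at h1 h2
  exfalso
  by_cases hn : 1 ≤ n
  · obtain ⟨k, rfl⟩ : ∃ k : ℕ, n = k + 1 := ⟨(n - 1).toNat, by omega⟩
    refine res_inv_mul_ne_zero (hC := hC) ht hx₀ hu1 hu2 hu ?_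
    rw [← h1 k, zpow_add₀ (inv_ne_zero ht0), zpow_natCast]
    congr 1
    simp only [inv_pow]; field_simp
  · obtain ⟨k, rfl⟩ : ∃ k : ℕ, n = -k := ⟨(-n).toNat, by omega⟩
    refine hx₀ ?_
    have := mul_mem h2 (mul_mem (pow_mem (inv_mem_stalk (hC := hC) hx₀) k) hu2)
    convert this using 1
    rw [zpow_neg, zpow_natCast]
    simp only [inv_pow]; field_simp

theorem mul_mem_of_res_eq_zero {f : K} (hf : f ∈ IntermediateField.adjoin ℂ {t})
    (h : ∀ k : ℕ, hC.res t x₀ (t⁻¹ ^ k * f) = 0) {x : P} (hx : t ∉ O x) : t ^ 2 * f ∈ O x := by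
  have ht0 := ne_zero_of_notMem_range ht
  by_cases hf0 : f = 0
  · rw [hf0, mul_zero]; exact zero_mem _
  obtain ⟨n, u, rfl, hu, hu'⟩ := exists_eq_inv_zpow (hC := hC) ht hf hf0
  obtain ⟨hu1, hu2⟩ := hu' x₀ hx₀
  by_cases hn : 2 ≤ n
  · obtain ⟨k, rfl⟩ : ∃ k : ℕ, n = k + 2 := ⟨(n - 2).toNat, by omega⟩
    have : t ^ 2 * (t⁻¹ ^ ((k : ℤ) + 2) * u) = t⁻¹ ^ k * u := by
      rw [zpow_add₀ (inv_ne_zero ht0), zpow_natCast]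
      simp only [inv_pow]; field_simp
    rw [this]
    exact mul_mem (pow_mem (inv_mem_stalk (hC := hC) hx) k) (hu' x hx).1
  · exfalso
    obtain ⟨k, hk⟩ : ∃ k : ℕ, n = 1 - k := ⟨(1 - n).toNat, by omega⟩
    refine res_inv_mul_ne_zero (hC := hC) ht hx₀ hu1 hu2 hu ?_
    rw [← h k, ← mul_assoc, ← zpow_natCast, ← zpow_add₀ (inv_ne_zero ht0), hk,
      add_sub_cancel, zpow_one]

/-- A functional on the rational functions in `t` that vanishes on polynomials and on functions of
high order at infinity is a residue. -/
theorem exists_eq_res (m : ℕ) (μ : K → ℂ)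
    (hadd : ∀ f ∈ IntermediateField.adjoin ℂ {t}, ∀ g ∈ IntermediateField.adjoin ℂ {t},
      μ (f + g) = μ f + μ g)
    (hmul : ∀ f ∈ IntermediateField.adjoin ℂ {t}, ∀ c : ℂ, μ (algebraMap ℂ K c * f) = c * μ f)
    (h1 : ∀ f ∈ Algebra.adjoin ℂ {t}, μ f = 0)
    (h2 : ∀ f ∈ IntermediateField.adjoin ℂ {t}, t ^ (m + 1) * f ∈ O x₀ → μ f = 0) :
    ∃ q ∈ Algebra.adjoin ℂ {t}, ∀ f ∈ IntermediateField.adjoin ℂ {t},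
      μ f = hC.res t x₀ (q * f) := by
  have ht0 := ne_zero_of_notMem_range ht
  have htF := IntermediateField.mem_adjoin_simple_self ℂ t
  have htA := Algebra.self_mem_adjoin_singleton ℂ t
  induction m generalizing μ with
  | zero =>
    refine ⟨0, zero_mem _, fun f hf => ?_⟩
    rw [zero_mul, res_of_mem_adjoin ht hx₀ (zero_mem _)]
    obtain ⟨p, hp, hr⟩ := isRes_res (hC := hC) ht hx₀ hf
    have h3 : t * (f - p) ∈ O x₀ := by
      have := add_mem (hC.mem_of_mem_mpow_one hr) ((O x₀).algebraMap_mem (hC.res t x₀ f))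
      simpa using this
    have h4 := hadd (f - p) (sub_mem hf (adjoin_le_field t hp)) p (adjoin_le_field t hp)
    rw [sub_add_cancel, h1 p hp, add_zero] at h4
    rw [h4, h2 _ (sub_mem hf (adjoin_le_field t hp)) (by simpa using h3)]
  | succ m ih =>
    set a := μ (t⁻¹ ^ (m + 1)) with ha
    have hs : t⁻¹ ^ (m + 1) ∈ IntermediateField.adjoin ℂ {t} := pow_mem (inv_mem htF) _
    have hq : algebraMap ℂ K a * t ^ m ∈ Algebra.adjoin ℂ {t} :=
      mul_mem (Subalgebra.algebraMap_mem _ _) (pow_mem htA m)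
    have hqF := adjoin_le_field t hq
    have hadd' : ∀ f ∈ IntermediateField.adjoin ℂ {t}, ∀ g ∈ IntermediateField.adjoin ℂ {t},
        μ (f + g) - hC.res t x₀ (algebraMap ℂ K a * t ^ m * (f + g)) =
        (μ f - hC.res t x₀ (algebraMap ℂ K a * t ^ m * f)) +
          (μ g - hC.res t x₀ (algebraMap ℂ K a * t ^ m * g)) := fun f hf g hg => by
      rw [hadd f hf g hg, mul_add, res_add ht hx₀ (mul_mem hqF hf) (mul_mem hqF hg)]; ring
    have hmul' : ∀ f ∈ IntermediateField.adjoin ℂ {t}, ∀ c : ℂ,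
        μ (algebraMap ℂ K c * f) - hC.res t x₀ (algebraMap ℂ K a * t ^ m * (algebraMap ℂ K c * f)) =
        c * (μ f - hC.res t x₀ (algebraMap ℂ K a * t ^ m * f)) := fun f hf c => by
      rw [hmul f hf c, mul_left_comm, res_mul ht hx₀ (mul_mem hqF hf)]; ring
    obtain ⟨q, hqA, hq'⟩ := ih (fun f => μ f - hC.res t x₀ (algebraMap ℂ K a * t ^ m * f))
      hadd' hmul' (fun f hf => by
        rw [h1 f hf, res_of_mem_adjoin ht hx₀ (mul_mem hq hf), sub_zero]) (fun f hf h => by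
      obtain ⟨b, hb⟩ := hC.exists_sub_mem x₀ h
      have hbs : algebraMap ℂ K b * t⁻¹ ^ (m + 1) ∈ IntermediateField.adjoin ℂ {t} :=
        mul_mem (IntermediateField.algebraMap_mem _ _) hs
      have hg : f - algebraMap ℂ K b * t⁻¹ ^ (m + 1) ∈ IntermediateField.adjoin ℂ {t} :=
        sub_mem hf hbs
      have h3 : t ^ (m + 1 + 1) * (f - algebraMap ℂ K b * t⁻¹ ^ (m + 1)) ∈ O x₀ := by
        have := mul_mem_of_mem_mpow_one ht hx₀ (sub_mem (mul_mem (pow_mem htF (m + 1)) hf)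
          (IntermediateField.algebraMap_mem _ b)) hb hx₀
        convert this using 1
        simp only [inv_pow]; field_simp; ring
      have h4 := hadd' _ hg _ hbs
      rw [sub_add_cancel] at h4
      rw [h4, h2 _ hg h3, hmul' _ hs, ← ha]
      have h5 : hC.res t x₀ (algebraMap ℂ K a * t ^ m *
          (f - algebraMap ℂ K b * t⁻¹ ^ (m + 1))) = 0 := by
        rw [mul_assoc, res_mul ht hx₀ (mul_mem (pow_mem htF m) hg), res_of_mul_mem ht hx₀, mul_zero]
        convert h3 using 1
        ring
      have h6 : hC.res t x₀ (algebraMap ℂ K a * t ^ m * t⁻¹ ^ (m + 1)) = a := by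
        refine res_eq ht hx₀ ⟨0, zero_mem _, ?_⟩
        have : t * (algebraMap ℂ K a * t ^ m * t⁻¹ ^ (m + 1) - 0) - algebraMap ℂ K a = 0 := by
          simp only [inv_pow]; field_simp; ring
        rw [this]; exact zero_mem _
      rw [h5, h6]; ring)
    refine ⟨q + algebraMap ℂ K a * t ^ m, add_mem hqA hq, fun f hf => ?_⟩
    rw [add_mul, res_add ht hx₀ (mul_mem (adjoin_le_field t hqA) hf) (mul_mem hqF hf), ← hq' f hf]
    ring

end IsCurve
end CobleCurve
end

noncomputable section
open scoped TensorProduct KaehlerDifferential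
namespace CobleCurve
namespace IsCurve
variable {K : Type} [Field K] [Algebra ℂ K] {P : Type} {O : P → Subalgebra ℂ K} (hC : IsCurve O)

/-- The lattices of the line bundle of a divisor. -/
theorem bdl_mpow {D : P → ℤ} (hD : D.support.Finite) : hC.Bdl fun x => hC.mpow x (- D x) := by
  have hD' : {x | D x ≠ 0}.Finite := hD
  refine ⟨inferInstance, fun x v => ?_, fun x φ => ?_, fun v => ?_, fun φ => ?_⟩
  · refine ⟨(D x).natAbs + (hC.ord x v).natAbs, fun g hg => ?_⟩
    have := hC.mul_mem_mpow x hg ((hC.mem_mpow x (hC.ord x v) v).2 (Or.inr le_rfl))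
    exact hC.mpow_mono x (by omega) this
  · refine ⟨(D x).natAbs + (hC.ord x (φ 1)).natAbs, fun v hv => ?_⟩
    have := hC.mul_mem_mpow x hv ((hC.mem_mpow x (hC.ord x (φ 1)) (φ 1)).2 (Or.inr le_rfl))
    have e : φ v = v * φ 1 := by rw [← smul_eq_mul, ← map_smul, smul_eq_mul, mul_one]
    rw [e]
    exact hC.mpow_mono x (by omega) this
  · refine (hD'.union (hC.finite_setOf_notMem v)).subset fun x hx => ?_
    by_contra h
    simp only [Set.mem_union, Set.mem_ofPred_eq, not_or, not_not] at h
    refine hx ?_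
    rw [h.1, neg_zero, hC.mem_mpow_zero]
    exact h.2
  · refine (hD'.union (hC.finite_setOf_notMem (φ 1))).subset fun x hx => ?_
    by_contra h
    simp only [Set.mem_union, Set.mem_ofPred_eq, not_or, not_not] at h
    refine hx fun v hv => ?_
    rw [h.1, neg_zero, hC.mem_mpow_zero] at hv
    have e : φ v = v * φ 1 := by rw [← smul_eq_mul, ← map_smul, smul_eq_mul, mul_one]
    rw [e]
    exact mul_mem hv h.2

theorem smul_D_mem_iff_of_sub_mem {t : K} (ht : t ∉ (algebraMap ℂ K).range) {x : P} {c : ℂ}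
    (hc : t - algebraMap ℂ K c ∈ hC.mpow x 1) (h : K) :
    h • KaehlerDifferential.D ℂ K t ∈ (StalkFamily.canonical O).stalk x ↔
      (t - algebraMap ℂ K c) * h ∈ hC.mpow x 1 := by
  rw [← hC.smul_D_mem_iff x (ne_zero_of_notMem_range (mem_range_of_sub ht)) hc h, map_sub,
    Derivation.map_algebraMap, sub_zero]

theorem smul_D_mem_iff_of_notMem {t : K} {x : P} (hx : t ∉ O x) (h : K) :
    h • KaehlerDifferential.D ℂ K t ∈ (StalkFamily.canonical O).stalk x ↔
      t * h ∈ hC.mpow x 1 := by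
  have ht0 : t ≠ 0 := fun h => hx (h ▸ zero_mem _)
  have e : h • KaehlerDifferential.D ℂ K t = (- t ^ 2 * h) • KaehlerDifferential.D ℂ K t⁻¹ := by
    rw [Derivation.leibniz_inv, smul_smul]
    congr 1
    field_simp
  rw [e, hC.smul_D_mem_iff x (inv_ne_zero ht0) (hC.mem_inv_of_notMem hx)]
  have e2 : t⁻¹ * (-t ^ 2 * h) = - (t * h) := by field_simp
  rw [e2, neg_mem_iff]

section Duality
variable {hC}
variable {V : Type} [AddCommGroup V] [Module K V] [Module ℂ V] [IsScalarTower ℂ K V]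
  {Λ : ∀ x, Submodule (O x) V}

/-- The dual lattices with values in the canonical bundle, a form `ψ` on `V` standing for
`ψ dt`. -/
def sharp (t : K) (Λ : ∀ x, Submodule (O x) V) (x : P) : Submodule (O x) (Module.Dual K V) where
  carrier := {ψ | ∀ v ∈ Λ x, ψ v • KaehlerDifferential.D ℂ K t ∈
    (StalkFamily.canonical O).stalk x}
  add_mem' h h' v hv := by
    rw [LinearMap.add_apply, add_smul]; exact add_mem (h v hv) (h' v hv)
  zero_mem' v _ := by
    rw [LinearMap.zero_apply, zero_smul]; exact zero_mem _
  smul_mem' a ψ h v hv := by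
    have e : (a • ψ) v • KaehlerDifferential.D ℂ K t =
      (a : K) • (ψ v • KaehlerDifferential.D ℂ K t) := by
      rw [smul_smul]; rfl
    rw [e]
    exact smul_mem_of_mem (V := Ω[K⁄ℂ]) a.2 (h v hv)

variable {t : K} (ht : t ∉ (algebraMap ℂ K).range) {x₀ : P} (hx₀ : t ∉ O x₀)
include ht hx₀

theorem res_tr_eq_zero_of_regular {h : K} (hh : ∀ x, t ∈ O x →
    h • KaehlerDifferential.D ℂ K t ∈ (StalkFamily.canonical O).stalk x) :
    hC.res t x₀ (tr t h) = 0 := by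
  refine res_of_mem_adjoin ht hx₀ ?_
  have h1 : ∀ x, t ∈ O x → tr t h ∈ O x := by
    intro x hx
    obtain ⟨c, hc⟩ := hC.exists_sub_mem x hx
    have hσ := mem_range_of_sub (c := c) ht
    have hσ0 := ne_zero_of_notMem_range hσ
    have h2 := hC.inv_mul_tr_mem hσ (h := (t - algebraMap ℂ K c) * h) (fun y hy => by
      rw [← hC.smul_D_mem_iff_of_sub_mem ht hy]
      refine hh y ?_
      have := add_mem (hC.mem_of_mem_mpow_one hy) ((O y).algebraMap_mem c)
      simpa using this) hc
    rw [tr_congr (adjoin_sub_algebraMap t c), tr_mul _ (sub_mem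
      (IntermediateField.mem_adjoin_simple_self ℂ t) (IntermediateField.algebraMap_mem _ c)),
      inv_mul_cancel_left₀ hσ0] at h2
    exact h2
  have h2 : IsIntegral (Algebra.adjoin ℂ {t}) (tr t h) := (hC.isIntegral_adjoin_iff t _).2 h1
  have := isPrincipalIdealRing_adjoin ht
  open scoped IntermediateField.algebraAdjoinAdjoin in
  obtain ⟨a, ha⟩ := IsIntegrallyClosed.isIntegral_iff.1
    ((isIntegral_algebraMap_iff (A := IntermediateField.adjoin ℂ {t}) (B := K)
      (algebraMap (IntermediateField.adjoin ℂ {t}) K).injective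
      (x := ⟨tr t h, tr_mem t h⟩)).1 h2)
  have : (a : K) = tr t h := congrArg Subtype.val ha
  rw [← this]; exact a.2

theorem res_tr_eq_zero_of_pole {h : K} (hh : ∀ x, t ∉ O x →
    h • KaehlerDifferential.D ℂ K t ∈ (StalkFamily.canonical O).stalk x) :
    hC.res t x₀ (tr t h) = 0 := by
  have ht0 := ne_zero_of_notMem_range ht
  refine res_of_mul_mem ht hx₀ ?_
  have h2 := hC.inv_mul_tr_mem (inv_notMem_range ht) (h := t * h) (fun y hy => by
      rw [hC.inv_mem_mpow_one_iff y ht0] at hy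
      rw [← hC.smul_D_mem_iff_of_notMem hy]
      exact hh y hy) (hC.mem_inv_of_notMem hx₀)
  rw [tr_congr (adjoin_inv t), tr_mul _ (IntermediateField.mem_adjoin_simple_self ℂ t), inv_inv,
    ← mul_assoc, ← sq] at h2
  exact h2

theorem eq_zero_of_res_tr_eq_zero {κ : K} (h : ∀ g, hC.res t x₀ (tr t (κ * g)) = 0) : κ = 0 := by
  by_contra hκ
  have := hC.finiteDimensional t ht
  have h1 := h (κ⁻¹ * t⁻¹)
  rw [mul_inv_cancel_left₀ hκ] at h1
  have h2 : tr t t⁻¹ = t⁻¹ * algebraMap ℂ K (Module.finrank (IntermediateField.adjoin ℂ {t}) K) := by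
    rw [← mul_one t⁻¹, tr_mul _ (inv_mem (IntermediateField.mem_adjoin_simple_self ℂ t)), mul_one]
    congr 1
    have := Algebra.trace_algebraMap (R := IntermediateField.adjoin ℂ {t}) (S := K) 1
    rw [map_one] at this
    rw [tr, this]
    simp
  have hn : (Module.finrank (IntermediateField.adjoin ℂ {t}) K : ℂ) ≠ 0 := by
    exact_mod_cast (Module.finrank_pos (R := IntermediateField.adjoin ℂ {t}) (M := K)).ne'
  rw [h2] at h1
  refine res_inv_mul_ne_zero (hC := hC) ht hx₀ ((O x₀).algebraMap_mem _) ?_ ?_ h1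
  · rw [← map_inv₀]; exact (O x₀).algebraMap_mem _
  · exact (map_ne_zero_iff _ (algebraMap ℂ K).injective).2 hn

theorem mem_sharp_of_regular (hΛ : hC.Bdl Λ) {ψ : Module.Dual K V}
    (h : ∀ v ∈ secs Λ (regularSet O t), hC.res t x₀ (tr t (ψ v)) = 0) {p : P} (hp : t ∈ O p) :
    ψ ∈ sharp t Λ p := by
  intro v hv
  obtain ⟨c, hc⟩ := hC.exists_sub_mem p hp
  rw [hC.smul_D_mem_iff_of_sub_mem ht hc]
  set σ := t - algebraMap ℂ K c with hσdef
  by_contra hcon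
  have hσ : σ ∉ _ := mem_range_of_sub (c := c) ht
  have hσ0 := ne_zero_of_notMem_range hσ
  have hS := hC.affine_setOf_mem ht
  obtain ⟨f, hf1, hf2, -, hf3⟩ := hS.exists_smul_mem_secs hΛ hp hv Set.finite_empty
    (Set.empty_subset _) (Set.notMem_empty _) 1
  have hf4 : f ∉ hC.mpow p 1 := fun h => hC.one_notMem_mpow_one p (by simpa using sub_mem h hf2)
  have hf0 : f ≠ 0 := fun h => hf4 (h ▸ zero_mem _)
  have hh' : σ * (f * ψ v) ∉ hC.mpow p 1 := by
    intro hm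
    refine hcon ?_
    have := (hC.mpow p 1).smul_mem ⟨_, hC.inv_mem_of_notMem hf4⟩ hm
    convert this using 1
    change _ = f⁻¹ * _
    field_simp
  have hh0 : σ * (f * ψ v) ≠ 0 := fun h => hh' (h ▸ zero_mem _)
  obtain ⟨N, hN⟩ := hC.exists_tr_notMem hσ hc
  have hZ : ({x | σ ∈ hC.mpow x 1} \ {p}).Finite :=
    (hC.finite_setOf_mem_mpow_one hσ0).subset Set.sdiff_subset
  have hσO : ∀ x, σ ∈ O x ↔ t ∈ O x := fun x =>
    ⟨fun h => by simpa [σ] using add_mem h ((O x).algebraMap_mem c),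
      fun h => sub_mem h ((O x).algebraMap_mem c)⟩
  have hO := hC.bdl_mpow (D := fun _ : P => 0) (by simp)
  obtain ⟨f₁, h1, h2, h3, h4⟩ := hS.exists_smul_mem_secs hO hp
    (v := (σ * (f * ψ v))⁻¹) (by
      simp only [neg_zero]
      rw [hC.mem_mpow_zero]
      exact hC.inv_mem_of_notMem hh') hZ
    (fun x hx => (hσO x).1 (hC.mem_of_mem_mpow_one hx.1)) (fun h => h.2 rfl) N
  set g := f₁ * (σ * (f * ψ v))⁻¹ with hg
  have h4 : ∀ x, t ∈ O x → g ∈ O x := fun x hx => by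
    have := h4 x hx
    simp only [neg_zero] at this
    exact (hC.mem_mpow_zero x _).1 this
  have hgf : g * (σ * (f * ψ v)) = f₁ := by rw [hg, inv_mul_cancel_right₀ hh0]
  refine hN f₁ (fun x hx => h1 x ((hσO x).1 hx)) h2 (fun x hxp hx => h3 x ⟨hx, hxp⟩) ?_
  have key : tr t (g * (f * ψ v)) ∈ Algebra.adjoin ℂ {t} := by
    refine mem_adjoin_of_res_eq_zero (hC := hC) ht hx₀ (tr_mem _ _) fun k => ?_
    rw [← tr_mul t (pow_mem (IntermediateField.mem_adjoin_simple_self ℂ t) k)]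
    have := h ((t ^ k * g) • (f • v)) fun x hx =>
      smul_mem_of_mem (mul_mem (pow_mem hx k) (h4 x hx)) (hf3 x hx)
    rwa [map_smul, map_smul, smul_eq_mul, smul_eq_mul, mul_assoc] at this
  rw [tr_congr (adjoin_sub_algebraMap t c), ← hgf, mul_left_comm, tr_mul _ (sub_mem
      (IntermediateField.mem_adjoin_simple_self ℂ t) (IntermediateField.algebraMap_mem _ c)),
      inv_mul_cancel_left₀ hσ0]
  exact adjoin_le hp key

theorem mem_sharp_of_pole (hΛ : hC.Bdl Λ) {ψ : Module.Dual K V}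
    (h : ∀ v ∈ secs Λ (regularSet O t)ᶜ, hC.res t x₀ (tr t (ψ v)) = 0) {p : P} (hp : t ∉ O p) :
    ψ ∈ sharp t Λ p := by
  intro v hv
  rw [hC.smul_D_mem_iff_of_notMem hp]
  by_contra hcon
  have ht0 := ne_zero_of_notMem_range ht
  have hs := inv_notMem_range ht
  obtain ⟨f, hf1, hf2, -, hf3⟩ := (hC.affine_compl ht).exists_smul_mem_secs hΛ hp hv
    Set.finite_empty (Set.empty_subset _) (Set.notMem_empty _) 1
  have hf4 : f ∉ hC.mpow p 1 := fun h => hC.one_notMem_mpow_one p (by simpa using sub_mem h hf2)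
  have hf0 : f ≠ 0 := fun h => hf4 (h ▸ zero_mem _)
  have hh' : t * (f * ψ v) ∉ hC.mpow p 1 := by
    intro hm
    refine hcon ?_
    have := (hC.mpow p 1).smul_mem ⟨_, hC.inv_mem_of_notMem hf4⟩ hm
    convert this using 1
    change _ = f⁻¹ * _
    field_simp
  have hh0 : t * (f * ψ v) ≠ 0 := fun h => hh' (h ▸ zero_mem _)
  have hpz := hC.mem_inv_of_notMem hp
  obtain ⟨N, hN⟩ := hC.exists_tr_notMem hs hpz
  have hZ : ({x | t⁻¹ ∈ hC.mpow x 1} \ {p}).Finite :=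
    (hC.finite_setOf_mem_mpow_one (inv_ne_zero ht0)).subset Set.sdiff_subset
  have hO := hC.bdl_mpow (D := fun _ : P => 0) (by simp)
  obtain ⟨f₁, h1, h2, h3, h4⟩ := (hC.affine_setOf_mem hs).exists_smul_mem_secs hO
    (hC.mem_of_mem_mpow_one hpz) (v := (t * (f * ψ v))⁻¹) (by
      simp only [neg_zero]
      rw [hC.mem_mpow_zero]
      exact hC.inv_mem_of_notMem hh') hZ
    (fun x hx => hC.mem_of_mem_mpow_one hx.1) (fun h => h.2 rfl) N
  set g := f₁ * (t * (f * ψ v))⁻¹ with hg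
  have h4 : ∀ x, t⁻¹ ∈ O x → g ∈ O x := fun x hx => by
    have := h4 x hx
    simp only [neg_zero] at this
    exact (hC.mem_mpow_zero x _).1 this
  have hgf : g * (t * (f * ψ v)) = f₁ := by rw [hg, inv_mul_cancel_right₀ hh0]
  refine hN f₁ h1 h2 (fun x hxp hx => h3 x ⟨hx, hxp⟩) ?_
  have key := mul_mem_of_res_eq_zero (hC := hC) ht hx₀ (tr_mem t (g * (f * ψ v)))
    (fun k => by
      rw [← tr_mul t (pow_mem (inv_mem (IntermediateField.mem_adjoin_simple_self ℂ t)) k)]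
      have := h ((t⁻¹ ^ k * g) • (f • v)) fun x hx =>
        smul_mem_of_mem (mul_mem (pow_mem (inv_mem_stalk (hC := hC) hx) k)
          (h4 x (inv_mem_stalk (hC := hC) hx))) (hf3 x hx)
      rwa [map_smul, map_smul, smul_eq_mul, smul_eq_mul, mul_assoc] at this) hp
  rw [tr_congr (adjoin_inv t), ← hgf, mul_left_comm, tr_mul _
      (IntermediateField.mem_adjoin_simple_self ℂ t), inv_inv, ← mul_assoc, ← sq]
  exact key

end Duality
end IsCurve
end CobleCurve
end

noncomputable section
open scoped TensorProduct KaehlerDifferential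
namespace CobleCurve
namespace IsCurve
variable {K : Type} [Field K] [Algebra ℂ K] {P : Type} {O : P → Subalgebra ℂ K} {hC : IsCurve O}
variable {V : Type} [AddCommGroup V] [Module K V] [Module ℂ V] [IsScalarTower ℂ K V]
  {Λ : ∀ x, Submodule (O x) V}
variable {t : K} (ht : t ∉ (algebraMap ℂ K).range) {x₀ : P} (hx₀ : t ∉ O x₀)
include ht

omit ht in
theorem finite_compl_regularSet (hC : IsCurve O) (t : K) : ((regularSet O t)ᶜ).Finite :=
  hC.finite_setOf_notMem t

theorem exists_polynomial_mem_mpow {Z : Set P} (hZ : Z.Finite) (hZt : ∀ x ∈ Z, t ∈ O x) (N : ℕ) :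
    ∃ p ∈ Algebra.adjoin ℂ {t}, p ≠ 0 ∧ ∀ x ∈ Z, p ∈ hC.mpow x N := by
  induction Z, hZ using Set.Finite.induction_on with
  | empty => exact ⟨1, one_mem _, one_ne_zero, by simp⟩
  | @insert a Z _ _ ih =>
    obtain ⟨p, hp1, hp2, hp3⟩ := ih fun x hx => hZt x (Or.inr hx)
    obtain ⟨c, hc⟩ := hC.exists_sub_mem a (hZt a (Or.inl rfl))
    have hA : (t - algebraMap ℂ K c) ^ N ∈ Algebra.adjoin ℂ {t} :=
      pow_mem (sub_mem (Algebra.self_mem_adjoin_singleton ℂ t) (Subalgebra.algebraMap_mem _ _)) N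
    refine ⟨(t - algebraMap ℂ K c) ^ N * p, mul_mem hA hp1, mul_ne_zero
      (pow_ne_zero _ (ne_zero_of_notMem_range (mem_range_of_sub ht))) hp2, ?_⟩
    rintro x (rfl | hx)
    · rw [mul_comm]
      have := hC.pow_mem_mpow x hc N
      rw [mul_one] at this
      exact (hC.mpow x N).smul_mem ⟨p, adjoin_le (hZt x (Or.inl rfl)) hp1⟩ this
    · exact (hC.mpow x N).smul_mem ⟨_, adjoin_le (hZt x (Or.inr hx)) hA⟩ (hp3 x hx)

include hx₀

/-- A functional that vanishes on the sections over the regular points and over the poles of `t`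
is on each line over the rational functions a residue. -/
theorem exists_field_eq_res (hΛ : hC.Bdl Λ) (l : V →ₗ[ℂ] ℂ)
    (h1 : ∀ v ∈ secs Λ (regularSet O t), l v = 0) (h2 : ∀ v ∈ secs Λ (regularSet O t)ᶜ, l v = 0)
    (v : V) : ∃ q ∈ IntermediateField.adjoin ℂ {t}, ∀ f ∈ IntermediateField.adjoin ℂ {t},
      l (f • v) = hC.res t x₀ (q * f) := by
  have hZ : ({x | v ∉ Λ x} ∩ regularSet O t).Finite := (hΛ.finite_notMem v).inter_of_left _
  have := hZ.to_subtype
  obtain ⟨N, hN⟩ := exists_nat_bound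
    (fun x : ↥({x | v ∉ Λ x} ∩ regularSet O t) => hΛ.absorb x v) fun i m n hmn hp g hg =>
      hp g (hC.mpow_mono i (by omega) hg)
  obtain ⟨p, hp1, hp2, hp3⟩ := exists_polynomial_mem_mpow (hC := hC) ht hZ (fun x hx => hx.2) N
  have hpv : ∀ a ∈ Algebra.adjoin ℂ {t}, a • p • v ∈ secs Λ (regularSet O t) := by
    intro a ha x hx
    refine smul_mem_of_mem (adjoin_le hx ha) ?_
    by_cases hxv : v ∈ Λ x
    · exact smul_mem_of_mem (adjoin_le hx hp1) hxv
    · exact hN ⟨x, hxv, hx⟩ p (hp3 x ⟨hxv, hx⟩)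
  have := (finite_compl_regularSet hC t).to_subtype
  obtain ⟨m, hm⟩ := exists_nat_bound
    (fun x : ↥(regularSet O t)ᶜ => hΛ.absorb x (p • v)) fun i m n hmn hp g hg =>
      hp g (hC.mpow_mono i (by omega) hg)
  obtain ⟨q, hq, hq'⟩ := exists_eq_res (hC := hC) ht hx₀ m (fun f => l (f • p • v))
    (fun f _ g _ => by simp only [add_smul, map_add])
    (fun f _ c => by
      rw [mul_smul, algebraMap_smul, map_smul, smul_eq_mul])
    (fun f hf => h1 _ (hpv f hf))
    (fun f hf h => h2 _ fun x hx => by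
      refine hm ⟨x, hx⟩ f ?_
      have h3 := mem_of_mem_field (hC := hC) ht hx₀
        (mul_mem (pow_mem (IntermediateField.mem_adjoin_simple_self ℂ t) (m + 1)) hf) h hx
      have ht0 := ne_zero_of_notMem_range ht
      have h4 := hC.pow_mem_mpow x (hC.mem_inv_of_notMem hx) (m + 1)
      have h5 := (hC.mpow x _).smul_mem ⟨_, h3⟩ h4
      have e : f = t ^ (m + 1) * f * t⁻¹ ^ (m + 1) := by
        simp only [inv_pow]; field_simp
      rw [e]
      exact hC.mpow_mono x (by push_cast; omega) h5)
  have hpF := adjoin_le_field t hp1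
  refine ⟨q * p⁻¹, mul_mem (adjoin_le_field t hq) (inv_mem hpF), fun f hf => ?_⟩
  have := hq' (f * p⁻¹) (mul_mem hf (inv_mem hpF))
  simp only [smul_smul] at this
  rw [inv_mul_cancel_right₀ hp2] at this
  rw [this]
  congr 1
  ring

theorem eq_of_res_eq {q q' : K} (hq : q ∈ IntermediateField.adjoin ℂ {t})
    (hq' : q' ∈ IntermediateField.adjoin ℂ {t})
    (h : ∀ f ∈ IntermediateField.adjoin ℂ {t}, hC.res t x₀ (q * f) = hC.res t x₀ (q' * f)) :
    q = q' := by
  by_contra hne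
  have hne' := sub_ne_zero.2 hne
  have hf : (q - q')⁻¹ * t⁻¹ ∈ IntermediateField.adjoin ℂ {t} :=
    mul_mem (inv_mem (sub_mem hq hq')) (inv_mem (IntermediateField.mem_adjoin_simple_self ℂ t))
  have h1 := res_add (hC := hC) ht hx₀ (mul_mem (sub_mem hq hq') hf) (mul_mem hq' hf)
  rw [← add_mul, sub_add_cancel, h _ hf, mul_inv_cancel_left₀ hne'] at h1
  refine res_inv_mul_ne_zero (hC := hC) ht hx₀ (one_mem _) (by rw [inv_one]; exact one_mem _)
    one_ne_zero ?_
  rw [mul_one]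
  exact right_eq_add.1 h1

theorem exists_eq_res_tr (hΛ : hC.Bdl Λ) (l : V →ₗ[ℂ] ℂ)
    (h1 : ∀ v ∈ secs Λ (regularSet O t), l v = 0) (h2 : ∀ v ∈ secs Λ (regularSet O t)ᶜ, l v = 0)
    (v : V) : ∃ κ : K, ∀ g : K, l (g • v) = hC.res t x₀ (tr t (κ * g)) := by
  have := hC.finiteDimensional t ht
  choose q hq hq' using exists_field_eq_res (hC := hC) ht hx₀ hΛ l h1 h2
  let φ : K →ₗ[IntermediateField.adjoin ℂ {t}] IntermediateField.adjoin ℂ {t} :=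
    { toFun := fun g => ⟨q (g • v), hq _⟩
      map_add' := fun g h => Subtype.ext (by
        change q ((g + h) • v) = q (g • v) + q (h • v)
        refine eq_of_res_eq (hC := hC) ht hx₀ (hq _) (add_mem (hq _) (hq _)) fun f hf => ?_
        rw [← hq' _ f hf, add_mul, res_add ht hx₀ (mul_mem (hq _) hf) (mul_mem (hq _) hf),
          ← hq' _ f hf, ← hq' _ f hf, add_smul, smul_add, map_add])
      map_smul' := fun a g => Subtype.ext (by
        change q (((a : K) * g) • v) = (a : K) * q (g • v)
        refine eq_of_res_eq (hC := hC) ht hx₀ (hq _) (mul_mem a.2 (hq _)) fun f hf => ?_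
        have e : (a : K) * q (g • v) * f = q (g • v) * (f * a) := by ring
        rw [e, ← hq' _ f hf, ← hq' _ _ (mul_mem hf a.2), smul_smul, smul_smul, mul_assoc]) }
  have hnd := traceForm_nondegenerate (IntermediateField.adjoin ℂ {t}) K
  refine ⟨((Algebra.traceForm (IntermediateField.adjoin ℂ {t}) K).toDual hnd).symm φ,
    fun g => ?_⟩
  have h3 := LinearMap.BilinForm.apply_toDual_symm_apply (hB := hnd) φ g
  rw [Algebra.traceForm_apply] at h3
  rw [tr, h3]
  change _ = hC.res t x₀ (q (g • v))
  have h4 := hq' (g • v) 1 (one_mem _)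
  rwa [one_smul, mul_one] at h4

/-- Serre duality. -/
theorem h0_sharp (hΛ : hC.Bdl Λ) : h0 (sharp t Λ) = Module.length ℂ
    (Module.Dual ℂ (V ⧸ secs Λ (regularSet O t) ⊔ secs Λ (regularSet O t)ᶜ)) := by
  set A := secs Λ (regularSet O t)
  set B := secs Λ (regularSet O t)ᶜ
  let Φ₀ (ψ : Module.Dual K V) : V →ₗ[ℂ] ℂ :=
    { toFun := fun v => hC.res t x₀ (tr t (ψ v))
      map_add' := fun v w => by rw [map_add, tr_add, res_add ht hx₀ (tr_mem _ _) (tr_mem _ _)]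
      map_smul' := fun c v => by
        rw [← algebraMap_smul K c v, map_smul, smul_eq_mul,
          tr_mul _ (IntermediateField.algebraMap_mem _ c), res_mul ht hx₀ (tr_mem _ _)]
        rfl }
  have hΦ₀ : ∀ ψ v, Φ₀ ψ v = hC.res t x₀ (tr t (ψ v)) := fun _ _ => rfl
  have hker : ∀ ψ ∈ secs (sharp t Λ) Set.univ, A ⊔ B ≤ LinearMap.ker (Φ₀ ψ) := by
    intro ψ hψ
    refine sup_le (fun v hv => ?_) fun v hv => ?_
    · exact res_tr_eq_zero_of_regular ht hx₀ fun x hx => hψ x trivial v (hv x hx)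
    · exact res_tr_eq_zero_of_pole ht hx₀ fun x hx => hψ x trivial v (hv x hx)
  let Φ : secs (sharp t Λ) Set.univ →ₗ[ℂ] Module.Dual ℂ (V ⧸ A ⊔ B) :=
    { toFun := fun ψ => (A ⊔ B).liftQ (Φ₀ ψ) (hker ψ ψ.2)
      map_add' := fun ψ ψ' => by
        refine Submodule.linearMap_qext _ (LinearMap.ext fun v => ?_)
        change hC.res t x₀ (tr t ((ψ : Module.Dual K V) v + (ψ' : Module.Dual K V) v)) =
          hC.res t x₀ (tr t ((ψ : Module.Dual K V) v)) +
            hC.res t x₀ (tr t ((ψ' : Module.Dual K V) v))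
        rw [tr_add, res_add ht hx₀ (tr_mem _ _) (tr_mem _ _)]
      map_smul' := fun c ψ => by
        refine Submodule.linearMap_qext _ (LinearMap.ext fun v => ?_)
        change hC.res t x₀ (tr t (c • (ψ : Module.Dual K V) v)) =
          c * hC.res t x₀ (tr t ((ψ : Module.Dual K V) v))
        rw [Algebra.smul_def, tr_mul _ (IntermediateField.algebraMap_mem _ c),
          res_mul ht hx₀ (tr_mem _ _)] }
  have huniq : ∀ a b : K, (∀ g, hC.res t x₀ (tr t (a * g)) = hC.res t x₀ (tr t (b * g))) →
      a = b := fun a b h => by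
    rw [← sub_eq_zero]
    refine eq_zero_of_res_tr_eq_zero (hC := hC) ht hx₀ fun g => ?_
    have := res_add (hC := hC) ht hx₀ (tr_mem t ((a - b) * g)) (tr_mem t (b * g))
    rw [← tr_add, ← add_mul, sub_add_cancel, h] at this
    exact right_eq_add.1 this
  refine (LinearEquiv.ofBijective Φ ⟨?_, ?_⟩).length_eq
  · intro ψ ψ' hψ
    refine Subtype.ext (LinearMap.ext fun v => huniq _ _ fun g => ?_)
    have := congrArg (fun l => l (Submodule.Quotient.mk (g • v))) hψ
    change hC.res t x₀ (tr t ((ψ : Module.Dual K V) (g • v))) =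
      hC.res t x₀ (tr t ((ψ' : Module.Dual K V) (g • v))) at this
    rwa [map_smul, map_smul, smul_eq_mul, smul_eq_mul, mul_comm, mul_comm g] at this
  · intro l
    let l' : V →ₗ[ℂ] ℂ := l ∘ₗ (A ⊔ B).mkQ
    have hl : ∀ v ∈ A ⊔ B, l' v = 0 := fun v hv => by
      change l (Submodule.Quotient.mk v) = 0
      rw [(Submodule.Quotient.mk_eq_zero _).2 hv, map_zero]
    choose κ hκ using exists_eq_res_tr (hC := hC) ht hx₀ hΛ l'
      (fun v hv => hl v (Submodule.mem_sup_left hv))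
      (fun v hv => hl v (Submodule.mem_sup_right hv))
    let ψ : Module.Dual K V :=
      { toFun := κ
        map_add' := fun v w => huniq _ _ fun g => by
          rw [← hκ, add_mul, tr_add, res_add ht hx₀ (tr_mem _ _) (tr_mem _ _), ← hκ, ← hκ,
            smul_add, map_add]
        map_smul' := fun a v => huniq _ _ fun g => by
          rw [← hκ, smul_smul, hκ, RingHom.id_apply, smul_eq_mul]
          congr 2; ring }
    have hψ : ∀ v, hC.res t x₀ (tr t (ψ v)) = l' v := fun v => by
      have := hκ v 1
      rw [one_smul, mul_one] at this
      exact this.symm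
    have hmem : ψ ∈ secs (sharp t Λ) Set.univ := fun x _ => by
      by_cases hx : t ∈ O x
      · exact mem_sharp_of_regular ht hx₀ hΛ
          (fun v hv => (hψ v).trans (hl v (Submodule.mem_sup_left hv))) hx
      · exact mem_sharp_of_pole ht hx₀ hΛ
          (fun v hv => (hψ v).trans (hl v (Submodule.mem_sup_right hv))) hx
    refine ⟨⟨ψ, hmem⟩, Submodule.linearMap_qext _ (LinearMap.ext fun v => hψ v)⟩

omit hx₀ in
theorem h1_eq_of_h0_sharp (hΛ : hC.Bdl Λ) (hfin : h0 (sharp t Λ) ≠ ⊤) :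
    h1 t Λ = h0 (sharp t Λ) := by
  obtain ⟨x₀, hx₀⟩ := (hC.affine_compl ht).nonempty
  rw [h0_sharp ht hx₀ hΛ] at hfin ⊢
  rw [Module.length_ne_top_iff, isFiniteLength_iff_isNoetherian_isArtinian] at hfin
  have := hfin.1
  have h1' : Module.Finite ℂ
    (Module.Dual ℂ (V ⧸ secs Λ (regularSet O t) ⊔ secs Λ (regularSet O t)ᶜ)) := inferInstance
  have h2 := Module.finite_dual_iff ℂ |>.1 h1'
  rw [h1, Module.length_eq_finrank, Module.length_eq_finrank, Subspace.dual_finrank_eq]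

end IsCurve
end CobleCurve
end

noncomputable section
open scoped TensorProduct KaehlerDifferential
namespace CobleCurve
namespace IsCurve
variable {K : Type} [Field K] [Algebra ℂ K] {P : Type} {O : P → Subalgebra ℂ K} {hC : IsCurve O}
variable {V : Type} [AddCommGroup V] [Module K V] [Module ℂ V] [IsScalarTower ℂ K V]
  {Λ Λ' : ∀ x, Submodule (O x) V}

theorem exists_notMem_range (hC : IsCurve O) : ∃ t : K, t ∉ (algebraMap ℂ K).range := by
  by_contra! h
  have h1 := hC.finrank_kaehler
  have : ∀ η : Ω[K⁄ℂ], η = 0 := by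
    intro η
    have hη : η ∈ Submodule.span K (Set.range (KaehlerDifferential.D ℂ K)) := by
      rw [KaehlerDifferential.span_range_derivation]; trivial
    have h2 : Set.range (KaehlerDifferential.D ℂ K) ⊆ {0} := by
      rintro _ ⟨a, rfl⟩
      obtain ⟨c, rfl⟩ := h a
      exact Derivation.map_algebraMap _ c
    simpa using Submodule.span_mono (R := K) h2 hη
  have : Subsingleton Ω[K⁄ℂ] := ⟨fun a b => (this a).trans (this b).symm⟩
  rw [Module.finrank_zero_of_subsingleton] at h1
  omega

omit [Module ℂ V] [IsScalarTower ℂ K V] in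
theorem mem_span_basis_iff {ι : Type*} (b : Module.Basis ι K V) (x : P) (v : V) :
    v ∈ Submodule.span (O x) (Set.range b) ↔ ∀ i, b.repr v i ∈ O x := by
  rw [Module.Basis.mem_span_iff_repr_mem]
  refine forall_congr' fun i => ⟨?_, fun h => ⟨⟨_, h⟩, rfl⟩⟩
  rintro ⟨a, ha⟩
  rw [← ha]
  exact a.2

theorem bdl_one (hC : IsCurve O) : hC.Bdl fun x => hC.mpow x 0 := by
  have := hC.bdl_mpow (D := 0) (by simp)
  simpa using this

theorem mem_secs_one {S : Set P} {g : K} : g ∈ secs (fun x => hC.mpow x 0) S ↔ ∀ x ∈ S, g ∈ O x :=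
  forall₂_congr fun x _ => hC.mem_mpow_zero x g

theorem mem_secs_span {ι : Type*} (hC : IsCurve O) (b : Module.Basis ι K V) {S : Set P} {v : V} :
    v ∈ secs (fun x => Submodule.span (O x) (Set.range b)) S ↔
      ∀ i, b.repr v i ∈ secs (fun x => hC.mpow x 0) S := by
  simp only [mem_secs_one]
  refine ⟨fun h i x hx => (mem_span_basis_iff b x v).1 (h x hx) i,
    fun h x hx => (mem_span_basis_iff b x v).2 fun i => h i x hx⟩

theorem h0_one (hC : IsCurve O) : h0 (fun x => hC.mpow x 0) = 1 := by
  let e : ℂ →ₗ[ℂ] secs (fun x => hC.mpow x 0) Set.univ :=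
    (Algebra.linearMap ℂ K).codRestrict _ fun c => mem_secs_one.2 fun x _ => (O x).algebraMap_mem c
  have he : Function.Bijective e := by
    refine ⟨fun c d h => (algebraMap ℂ K).injective (congrArg Subtype.val h), fun g => ?_⟩
    obtain ⟨c, hc⟩ := hC.mem_range_of_forall_mem fun x => mem_secs_one.1 g.2 x trivial
    exact ⟨c, Subtype.ext hc⟩
  rw [h0, ← (LinearEquiv.ofBijective e he).length_eq, Module.length_eq_finrank,
    Module.finrank_self, Nat.cast_one]

theorem h0_span {ι : Type*} [Fintype ι] (hC : IsCurve O) (b : Module.Basis ι K V) :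
    h0 (fun x => Submodule.span (O x) (Set.range b)) = Fintype.card ι := by
  let e : secs (fun x => Submodule.span (O x) (Set.range b)) Set.univ →ₗ[ℂ]
      (ι → secs (fun x => hC.mpow x 0) Set.univ) := LinearMap.pi fun i =>
    ((b.coord i).restrictScalars ℂ ∘ₗ Submodule.subtype _).codRestrict _ fun v =>
      (mem_secs_span hC b).1 v.2 i
  have he' : ∀ v i, (e v i : K) = b.repr (v : V) i := fun _ _ => rfl
  have he : Function.Bijective e := by
    refine ⟨fun v w h => ?_, fun g => ?_⟩
    · refine Subtype.ext (b.repr.injective (Finsupp.ext fun i => ?_))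
      rw [← he', ← he', h]
    · have h1 : ∀ i, b.repr (∑ i, (g i : K) • b i) i = g i := fun i => b.repr_sum_self _ ▸ rfl
      refine ⟨⟨∑ i, (g i : K) • b i, (mem_secs_span hC b).2 fun i => ?_⟩,
        funext fun i => Subtype.ext (h1 i)⟩
      rw [h1]
      exact (g i).2
  rw [h0, (LinearEquiv.ofBijective e he).length_eq, Module.length_pi_of_fintype]
  change ∑ _ : ι, h0 (fun x => hC.mpow x 0) = _
  simp [h0_one]

theorem h1_span {ι : Type*} [Fintype ι] (hC : IsCurve O) (t : K) (b : Module.Basis ι K V) :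
    h1 t (fun x => Submodule.span (O x) (Set.range b)) =
      Fintype.card ι * h1 t (fun x => hC.mpow x 0) := by
  let U := regularSet O t
  rw [h1, length_quotient_eq_sum (fun i => (Submodule.mkQ
    (secs (fun x => hC.mpow x 0) U ⊔ secs (fun x => hC.mpow x 0) Uᶜ)) ∘ₗ
    (b.coord i).restrictScalars ℂ)]
  · rw [Finset.sum_const, Finset.card_univ, nsmul_eq_mul, h1]
  · intro v
    have e : ∀ i, ((Submodule.mkQ
      (secs (fun x => hC.mpow x 0) U ⊔ secs (fun x => hC.mpow x 0) Uᶜ)) ∘ₗ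
      (b.coord i).restrictScalars ℂ) v = 0 ↔ b.repr v i ∈
        secs (fun x => hC.mpow x 0) U ⊔ secs (fun x => hC.mpow x 0) Uᶜ := fun i =>
      Submodule.Quotient.mk_eq_zero _
    simp only [e]
    constructor
    · intro h i
      obtain ⟨a, ha, c, hc, rfl⟩ := Submodule.mem_sup.1 h
      rw [map_add, Finsupp.add_apply]
      exact Submodule.add_mem_sup ((mem_secs_span hC b).1 ha i) ((mem_secs_span hC b).1 hc i)
    · intro h
      choose a ha c hc hac using fun i => Submodule.mem_sup.1 (h i)
      have h1 : ∀ (g : ι → K) i, b.repr (∑ i, g i • b i) i = g i := fun g i =>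
        b.repr_sum_self _ ▸ rfl
      have : v = ∑ i, a i • b i + ∑ i, c i • b i := by
        rw [← Finset.sum_add_distrib]
        simp_rw [← add_smul, hac]
        exact (b.sum_repr v).symm
      rw [this]
      refine Submodule.add_mem_sup ((mem_secs_span hC b).2 fun i => ?_)
        ((mem_secs_span hC b).2 fun i => ?_)
      · rw [h1]; exact ha i
      · rw [h1]; exact hc i
  · intro q
    choose g hg using fun i => Submodule.Quotient.mk_surjective _ (q i)
    refine ⟨∑ i, g i • b i, fun i => ?_⟩
    have h1 : b.repr (∑ i, g i • b i) i = g i := b.repr_sum_self _ ▸ rfl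
    rw [← hg]
    change Submodule.Quotient.mk (b.repr (∑ i, g i • b i) i) = _
    rw [h1]

theorem h0_sharp_one (hC : IsCurve O) {t : K} (ht : t ∉ (algebraMap ℂ K).range) :
    h0 (sharp t fun x => hC.mpow x 0) = Module.length ℂ (StalkFamily.canonical O).H0 := by
  have hmem : ∀ ψ : Module.Dual K K, ψ ∈ secs (sharp t fun x => hC.mpow x 0) Set.univ ↔
      ψ 1 • KaehlerDifferential.D ℂ K t ∈ (StalkFamily.canonical O).H0 := by
    intro ψ
    refine ⟨fun h x => h x trivial 1 ((hC.mem_mpow_zero x 1).2 (one_mem _)), fun h x _ v hv => ?_⟩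
    have h1 : ψ v = v * ψ 1 := by rw [← smul_eq_mul, ← map_smul, smul_eq_mul, mul_one]
    rw [h1, mul_smul]
    exact ((StalkFamily.canonical O).stalk x).smul_mem ⟨v, (hC.mem_mpow_zero x v).1 hv⟩ (h x)
  let e : secs (sharp t fun x => hC.mpow x 0) Set.univ →ₗ[ℂ] (StalkFamily.canonical O).H0 :=
    { toFun := fun ψ => ⟨(ψ : Module.Dual K K) 1 • KaehlerDifferential.D ℂ K t, (hmem ψ).1 ψ.2⟩
      map_add' := fun ψ φ => Subtype.ext (add_smul _ _ _)
      map_smul' := fun c ψ => Subtype.ext (by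
        change (c • (ψ : Module.Dual K K) 1) • KaehlerDifferential.D ℂ K t =
          algebraMap ℂ K c • (ψ : Module.Dual K K) 1 • KaehlerDifferential.D ℂ K t
        rw [Algebra.smul_def, mul_smul]) }
  have he : Function.Bijective e := by
    refine ⟨fun ψ φ h => ?_, fun η => ?_⟩
    · have h1 := smul_left_injective K (hC.D_ne_zero t ht) (congrArg Subtype.val h)
      exact Subtype.ext (LinearMap.ext_ring h1)
    · obtain ⟨c, hc⟩ := hC.exists_smul_D ht (η : (StalkFamily.canonical O).V)
      have h1 : (LinearMap.toSpanSingleton K K c) 1 • KaehlerDifferential.D ℂ K t =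
          (η : (StalkFamily.canonical O).V) := by
        rw [LinearMap.toSpanSingleton_apply, one_smul, hc]
      refine ⟨⟨LinearMap.toSpanSingleton K K c, (hmem _).2 ?_⟩, Subtype.ext h1⟩
      rw [h1]
      exact η.2
  exact (LinearEquiv.ofBijective e he).length_eq

section Genus
variable (hg : Module.finrank ℂ (StalkFamily.canonical O).H0 = 3)
include hg

theorem h1_one (hC : IsCurve O) {t : K} (ht : t ∉ (algebraMap ℂ K).range) :
    h1 t (fun x => hC.mpow x 0) = 3 := by
  have : FiniteDimensional ℂ (StalkFamily.canonical O).H0 := .of_finrank_pos (by omega)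
  have h2 : h0 (sharp t fun x => hC.mpow x 0) = 3 := by
    rw [h0_sharp_one hC ht, Module.length_eq_finrank, hg]; rfl
  rw [h1_eq_of_h0_sharp ht hC.bdl_one (by rw [h2]; simp), h2]

omit hg in
omit [Module ℂ V] [IsScalarTower ℂ K V] in
theorem index_inf_left (x : P) : index Λ (fun x => Λ x ⊓ Λ' x) x = index Λ Λ' x := by
  have : (Λ x ⊓ Λ' x).submoduleOf (Λ x) = (Λ' x).submoduleOf (Λ x) := by
    ext v; simp [Submodule.submoduleOf]
  rw [index, index, this]

omit hg in
omit [Module ℂ V] [IsScalarTower ℂ K V] in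
theorem index_inf_right (x : P) : index Λ (fun x => Λ' x ⊓ Λ x) x = index Λ Λ' x := by
  have : (Λ' x ⊓ Λ x).submoduleOf (Λ x) = (Λ' x).submoduleOf (Λ x) := by
    ext v; simp [Submodule.submoduleOf]
  rw [index, index, this]

omit hg in
/-- Comparison of the Euler characteristics of two families of lattices. -/
theorem h0_add_sum_index {t : K} (ht : t ∉ (algebraMap ℂ K).range) (h : hC.Bdl Λ)
    (h' : hC.Bdl Λ') (T : Finset P) (hT : ∀ x ∉ T, Λ x = Λ' x) (hh0 : h0 Λ' ≠ ⊤)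
    (hh1 : h1 t Λ' ≠ ⊤) : h0 Λ ≠ ⊤ ∧ h1 t Λ ≠ ⊤ ∧
      h0 Λ + h1 t Λ' + ∑ x ∈ T, index Λ' Λ x = h0 Λ' + h1 t Λ + ∑ x ∈ T, index Λ Λ' x := by
  have hi := h.inf h'
  obtain ⟨c, d, e1, e2, e3⟩ := exists_h0_h1_eq ht h hi (fun _ => inf_le_left) T fun x hx => by
    rw [hT x hx, inf_idem]
  obtain ⟨c', d', e1', e2', e3'⟩ := exists_h0_h1_eq ht h' hi (fun _ => inf_le_right) T fun x hx => by
    rw [hT x hx, inf_idem]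
  simp only [index_inf_left] at e3
  simp only [index_inf_right] at e3'
  have f1 : ∑ x ∈ T, index Λ Λ' x ≠ ⊤ := by
    simp [h.index_ne_top h']
  have f2 : ∑ x ∈ T, index Λ' Λ x ≠ ⊤ := by
    simp [h'.index_ne_top h]
  have : ∀ {a b : ℕ∞}, a + b ≠ ⊤ → a ≠ ⊤ ∧ b ≠ ⊤ := fun h => by
    rwa [Ne, ENat.add_eq_top, not_or] at h
  have g1 := this (e3 ▸ f1)
  have g2 := this (e3' ▸ f2)
  have g3 := this (e1' ▸ hh0)
  have g4 : h1 t (fun x => Λ x ⊓ Λ' x) ≠ ⊤ := by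
    rw [e2', Ne, ENat.add_eq_top, not_or]
    exact ⟨g2.2, hh1⟩
  have g5 := this (e2 ▸ g4)
  refine ⟨?_, g5.2, ?_⟩
  · rw [e1, Ne, ENat.add_eq_top, not_or]
    exact ⟨g3.1, g1.1⟩
  · rw [e1, e1', ← e3, ← e3']
    have : d + h1 t Λ = d' + h1 t Λ' := e2.symm.trans e2'
    calc _ = h0 (fun x => Λ x ⊓ Λ' x) + c + c' + (d' + h1 t Λ') := by ring
      _ = _ := by rw [← this]; ring

theorem h0_h1_ne_top (h : hC.Bdl Λ) {t : K} (ht : t ∉ (algebraMap ℂ K).range) :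
    h0 Λ ≠ ⊤ ∧ h1 t Λ ≠ ⊤ := by
  have := h.finite
  let b := Module.finBasis K V
  have hb := bdl_span (hC := hC) b
  have := h0_add_sum_index ht h hb (h.finite_ne hb).toFinset (fun x hx => by simpa using hx)
    (by rw [h0_span hC]; simp) (by rw [h1_span hC, h1_one hg hC ht]; exact ENat.natCast_ne_top _)
  exact ⟨this.1, this.2.1⟩

/-- The degree in terms of the Euler characteristic. -/
theorem degree_eq (E : StalkFamily O) (h : hC.Bdl E.stalk) {t : K}
    (ht : t ∉ (algebraMap ℂ K).range) :
    E.degree = (h0 E.stalk).toNat - (h1 t E.stalk).toNat + 2 * E.rank := by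
  have := h.finite
  let b := Module.Free.chooseBasis K E.V
  let Λ : ∀ x, Submodule (O x) E.V := fun x => Submodule.span (O x) (Set.range b)
  have hb : hC.Bdl Λ := bdl_span (hC := hC) b
  have hcard : Fintype.card (Module.Free.ChooseBasisIndex K E.V) = E.rank :=
    (Module.finrank_eq_card_chooseBasisIndex K E.V).symm
  have e0 : h0 Λ = (E.rank : ℕ) := by rw [← hcard]; exact h0_span hC b
  have e1 : h1 t Λ = (E.rank * 3 : ℕ) := by
    rw [← hcard]
    exact (h1_span hC t b).trans (by rw [h1_one hg hC ht]; push_cast; rfl)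
  set T := (h.finite_ne hb).toFinset with hT
  obtain ⟨f0, f1, e⟩ := h0_add_sum_index ht h hb T (fun x hx => by simpa [hT] using hx)
    (by rw [e0]; simp) (by rw [e1]; exact ENat.natCast_ne_top _)
  have hd : E.degree = ∑ x ∈ T, (((index E.stalk Λ x).toNat : ℤ) - (index Λ E.stalk x).toNat) := by
    refine finsum_eq_sum_of_support_subset _ fun x hx => ?_
    by_contra hx'
    refine hx ?_
    have hx'' : E.stalk x = Λ x := by simpa [hT] using hx'
    change ((index E.stalk Λ x).toNat : ℤ) - (index Λ E.stalk x).toNat = 0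
    rw [index, index, hx'', sub_self]
  have hs : ∀ {Λ Λ' : ∀ x, Submodule (O x) E.V}, hC.Bdl Λ → hC.Bdl Λ' →
      ∑ x ∈ T, index Λ Λ' x = (∑ x ∈ T, (index Λ Λ' x).toNat : ℕ) := fun h h' => by
    rw [Nat.cast_sum]
    exact Finset.sum_congr rfl fun x _ => (ENat.natCast_toNat (h.index_ne_top h' x)).symm
  rw [hs h hb, hs hb h, e0, e1, ← ENat.natCast_toNat f0, ← ENat.natCast_toNat f1] at e
  norm_cast at e
  rw [hd, Finset.sum_sub_distrib]
  zify at e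
  linarith

end Genus
end IsCurve
end CobleCurve
end

noncomputable section
open scoped TensorProduct KaehlerDifferential
namespace CobleCurve
namespace IsCurve
variable {K : Type} [Field K] [Algebra ℂ K] {P : Type} {O : P → Subalgebra ℂ K} {hC : IsCurve O}

section Congr
variable {V : Type} [AddCommGroup V] [Module K V] [Module ℂ V] [IsScalarTower ℂ K V]
  {V' : Type} [AddCommGroup V'] [Module K V'] [Module ℂ V'] [IsScalarTower ℂ K V']
  {Λ : ∀ x, Submodule (O x) V} {Λ' : ∀ x, Submodule (O x) V'} (e : V ≃ₗ[K] V')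
  (he : ∀ x v, e v ∈ Λ' x ↔ v ∈ Λ x)
include he

theorem map_secs (S : Set P) :
    (secs Λ S).map ((e.restrictScalars ℂ : V ≃ₗ[ℂ] V') : V →ₗ[ℂ] V') = secs Λ' S := by
  ext v
  constructor
  · rintro ⟨w, hw, rfl⟩
    exact fun x hx => (he x w).2 (hw x hx)
  · intro h
    refine ⟨e.symm v, fun x hx => (he x _).1 ?_, e.apply_symm_apply v⟩
    rw [e.apply_symm_apply]
    exact h x hx

theorem h0_congr : h0 Λ = h0 Λ' := by
  rw [h0, h0, ← map_secs e he]
  exact ((e.restrictScalars ℂ).submoduleMap _).length_eq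

theorem h1_congr (t : K) : h1 t Λ = h1 t Λ' := by
  rw [h1, h1]
  refine (Submodule.Quotient.equiv _ _ (e.restrictScalars ℂ) ?_).length_eq
  rw [Submodule.map_sup, map_secs e he, map_secs e he]

end Congr

section Divisor
variable {V : Type} [AddCommGroup V] [Module K V] {Λ : ∀ x, Submodule (O x) V}

omit [Algebra ℂ K] in
theorem exists_dual_eq_one {v : V} (hv : v ≠ 0) : ∃ φ : Module.Dual K V, φ v = 1 := by
  obtain ⟨φ, hφ⟩ : ∃ φ : Module.Dual K V, φ v ≠ 0 := by
    by_contra! h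
    exact hv ((Module.forall_dual_apply_eq_zero_iff K v).1 h)
  exact ⟨(φ v)⁻¹ • φ, inv_mul_cancel₀ hφ⟩

/-- The divisor of a rational section. -/
theorem Bdl.exists_divisor (h : hC.Bdl Λ) {v : V} (hv : v ≠ 0) :
    ∃ D : P →₀ ℤ, ∀ x (u : K), u • v ∈ Λ x ↔ u ∈ hC.mpow x (- D x) := by
  obtain ⟨φ, hφ⟩ := exists_dual_eq_one (K := K) hv
  have key : ∀ x, ∃ n : ℤ, ∀ u : K, u • v ∈ Λ x ↔ u ∈ hC.mpow x (-n) := by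
    intro x
    obtain ⟨N, hN⟩ := h.absorb x v
    obtain ⟨M, hM⟩ := h.bound x φ
    have hM' : ∀ u : K, u • v ∈ Λ x → u ∈ hC.mpow x (-M) := fun u hu => by
      simpa [hφ] using hM _ hu
    obtain ⟨n, ⟨u₀, hu0, hu1, rfl⟩, hn⟩ := Int.exists_least_of_bdd
      (P := fun n => ∃ u : K, u ≠ 0 ∧ u • v ∈ Λ x ∧ hC.ord x u = n)
      ⟨-M, by
        rintro _ ⟨u, hu0, hu, rfl⟩
        exact (hC.mem_mpow_of_ne_zero x _ hu0).1 (hM' u hu)⟩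
      ⟨N, hC.unif x ^ (N : ℤ), zpow_ne_zero _ (hC.unif_ne_zero x),
        hN _ ((hC.mem_mpow x _ _).2 (Or.inr (hC.ord_unif_zpow x N).ge)), hC.ord_unif_zpow x N⟩
    refine ⟨- hC.ord x u₀, fun u => ?_⟩
    rw [neg_neg]
    by_cases hu : u = 0
    · simp [hu]
    rw [hC.mem_mpow_of_ne_zero x _ hu]
    refine ⟨fun hh => hn _ ⟨u, hu, hh, rfl⟩, fun hh => ?_⟩
    have : u = u * u₀⁻¹ * u₀ := by field_simp
    rw [this, mul_smul]
    refine smul_mem_of_mem ?_ hu1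
    rw [hC.mem_iff x (mul_ne_zero hu (inv_ne_zero hu0)), hC.ord_mul x hu (inv_ne_zero hu0),
      hC.ord_inv x hu0]
    omega
  choose D hD using key
  refine ⟨Finsupp.onFinset (((h.finite_notMem v).union (h.finite_notBound φ)).toFinset) D
    fun x hx => ?_, hD⟩
  by_contra hx'
  simp only [Set.Finite.mem_toFinset, Set.mem_union, Set.mem_ofPred_eq, not_or, not_not] at hx'
  refine hx ?_
  have h1 : (1 : K) ∈ hC.mpow x (- D x) := (hD x 1).1 (by rw [one_smul]; exact hx'.1)
  rw [hC.mem_mpow_of_ne_zero x _ one_ne_zero, hC.ord_one] at h1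
  have h2 := hx'.2 _ ((hD x (hC.unif x ^ (- D x))).2
    ((hC.mem_mpow x _ _).2 (Or.inr (hC.ord_unif_zpow x _).ge)))
  rw [map_smul, hφ, smul_eq_mul, mul_one, hC.zpow_mem_iff] at h2
  omega

theorem index_mpow (hC : IsCurve O) {D D' : P →₀ ℤ} {p : P} (h : D' p = D p + 1) :
    index (fun x => hC.mpow x (-D' x)) (fun x => hC.mpow x (-D x)) p = 1 := by
  rw [index, ← hC.length_complex_eq]
  have h0 := zpow_ne_zero (- D' p) (hC.unif_ne_zero p)
  have hπ : hC.unif p ^ (- D' p) ∈ hC.mpow p (- D' p) :=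
    (hC.mem_mpow p _ _).2 (Or.inr (hC.ord_unif_zpow p _).ge)
  let f : ℂ →ₗ[ℂ] (hC.mpow p (- D' p) ⧸ (hC.mpow p (- D p)).submoduleOf (hC.mpow p (- D' p))) :=
    LinearMap.toSpanSingleton ℂ _ (Submodule.Quotient.mk ⟨_, hπ⟩)
  have hf : ∀ c, f c = Submodule.Quotient.mk ⟨algebraMap ℂ K c * hC.unif p ^ (- D' p),
      (hC.mpow p _).smul_mem (algebraMap ℂ (O p) c) hπ⟩ := fun c => by
    rw [LinearMap.toSpanSingleton_apply, ← Submodule.Quotient.mk_smul]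
    congr 1
    exact Subtype.ext (Algebra.smul_def c _)
  have hmem : ∀ u : K, u * hC.unif p ^ (- D' p) ∈ hC.mpow p (- D p) ↔ u ∈ hC.mpow p 1 := by
    intro u
    rw [mul_comm, hC.mul_mem_mpow_iff p h0, hC.ord_unif_zpow, h]
    congr! 2
    ring
  have hinj : Function.Injective f := by
    rw [injective_iff_map_eq_zero]
    intro c hc
    rw [hf, Submodule.Quotient.mk_eq_zero] at hc
    by_contra hc0
    exact algebraMap_notMem (hC := hC) hc0 ((hmem _).1 hc)
  have hsurj : Function.Surjective f := by
    intro q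
    obtain ⟨⟨g, hg⟩, rfl⟩ := Submodule.Quotient.mk_surjective _ q
    have e : g = (g * hC.unif p ^ (D' p)) * hC.unif p ^ (- D' p) := by
      rw [mul_assoc, ← zpow_add₀ (hC.unif_ne_zero p)]; simp
    have hg' : g * hC.unif p ^ (D' p) ∈ O p := by
      rw [e, mul_comm, hC.mul_mem_mpow_iff p h0, hC.ord_unif_zpow, sub_self,
        hC.mem_mpow_zero] at hg
      exact hg
    obtain ⟨c, hc⟩ := hC.exists_sub_mem p hg'
    refine ⟨c, ?_⟩
    rw [hf]
    symm
    rw [Submodule.Quotient.eq]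
    change g - algebraMap ℂ K c * hC.unif p ^ (- D' p) ∈ hC.mpow p (- D p)
    nth_rw 1 [e]
    rw [← sub_mul, hmem]
    exact hc
  rw [← (LinearEquiv.ofBijective f ⟨hinj, hsurj⟩).length_eq, Module.length_eq_finrank,
    Module.finrank_self, Nat.cast_one]

theorem bdl_divisor (hC : IsCurve O) (D : P →₀ ℤ) : hC.Bdl fun x => hC.mpow x (- D x) :=
  hC.bdl_mpow (D := D) D.hasFiniteSupport

/-- The dimension of the space of functions with poles bounded by `D`. -/
def ell (hC : IsCurve O) (D : P →₀ ℤ) : ℕ := (h0 fun x => hC.mpow x (- D x)).toNat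

theorem apply_eq_add_degree {f : (P →₀ ℤ) → ℤ} (hf : ∀ D p, f (D + Finsupp.single p 1) = f D + 1)
    (D : P →₀ ℤ) : f D = f 0 + D.degree := by
  have h1 : ∀ D p (n : ℤ), f (D + Finsupp.single p n) = f D + n := by
    intro D p n
    induction n with
    | zero => simp
    | succ n ih => rw [Finsupp.single_add, ← add_assoc, hf, ih, add_assoc]
    | pred n ih =>
      have := hf (D + Finsupp.single p (-(n : ℤ) - 1)) p
      rw [add_assoc, ← Finsupp.single_add, sub_add_cancel, ih] at this
      linarith
  induction D using Finsupp.induction with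
  | zero => simp
  | single_add p n D' _ _ ih => rw [add_comm, h1, ih, map_add, Finsupp.degree_single]; ring

section Genus
variable (hg : Module.finrank ℂ (StalkFamily.canonical O).H0 = 3)
include hg

theorem chi_divisor (hC : IsCurve O) {t : K} (ht : t ∉ (algebraMap ℂ K).range) (D : P →₀ ℤ) :
    ((hC.ell D : ℕ) : ℤ) - (h1 t fun x => hC.mpow x (- D x)).toNat = D.degree - 2 := by
  have := apply_eq_add_degree
    (f := fun D => ((hC.ell D : ℕ) : ℤ) - (h1 t fun x => hC.mpow x (- D x)).toNat)
    (fun D p => by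
      have hD := hC.bdl_divisor D
      have hD' := hC.bdl_divisor (D + Finsupp.single p 1)
      obtain ⟨c, d, e1, e2, e3⟩ := exists_h0_h1_eq ht hD' hD (fun x u hu => by
        refine hC.mpow_mono x ?_ hu
        classical
        rw [Finsupp.add_apply, Finsupp.single_apply]; split_ifs <;> omega) {p} (fun x hx => by
        rw [Finset.mem_singleton] at hx
        simp only [Finsupp.add_apply, Finsupp.single_eq_of_ne hx, add_zero])
      rw [Finset.sum_singleton, index_mpow hC (by simp)] at e3
      obtain ⟨f0, f1⟩ := h0_h1_ne_top hg hD ht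
      obtain ⟨f0', f1'⟩ := h0_h1_ne_top hg hD' ht
      have hc : c ≠ ⊤ := fun h => by simp [h] at e3
      have hd : d ≠ ⊤ := fun h => by simp [h] at e3
      lift c to ℕ using hc
      lift d to ℕ using hd
      rw [← ENat.natCast_toNat f0, ← ENat.natCast_toNat f0'] at e1
      rw [← ENat.natCast_toNat f1, ← ENat.natCast_toNat f1'] at e2
      norm_cast at e1 e2 e3
      simp only [ell]
      omega) D
  rw [this]
  have e0 : hC.ell 0 = 1 := by
    have := h0_one hC
    simp only [ell, Finsupp.coe_zero, Pi.zero_apply, neg_zero, this]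
    rfl
  have e1 := h1_one hg hC ht
  simp only [e0, Finsupp.coe_zero, Pi.zero_apply, neg_zero, e1]
  change ((1 : ℕ) : ℤ) - (3 : ℕ) + _ = _
  push_cast
  ring

omit hg in
theorem h0_sharp_divisor {t : K} {κ : P →₀ ℤ}
    (hκ : ∀ x (g : K), g • KaehlerDifferential.D ℂ K t ∈ (StalkFamily.canonical O).stalk x ↔
      g ∈ hC.mpow x (- κ x)) (D : P →₀ ℤ) :
    h0 (sharp t fun x => hC.mpow x (- D x)) = h0 fun x => hC.mpow x (- (κ - D) x) := by
  refine h0_congr (LinearMap.ringLmapEquivSelf K K K) fun x ψ => ?_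
  change ψ 1 ∈ _ ↔ ∀ v ∈ hC.mpow x (- D x), ψ v • KaehlerDifferential.D ℂ K t ∈ _
  have h1 : ∀ v, ψ v = v * ψ 1 := fun v => by
    rw [← smul_eq_mul, ← map_smul, smul_eq_mul, mul_one]
  simp only [hκ]
  constructor
  · intro h v hv
    rw [h1]
    have := hC.mul_mem_mpow x hv h
    rw [Finsupp.sub_apply] at this
    exact hC.mpow_mono x (by omega) this
  · intro h
    have h2 := h (hC.unif x ^ (- D x)) ((hC.mem_mpow x _ _).2 (Or.inr (hC.ord_unif_zpow x _).ge))
    rw [h1, hC.mul_mem_mpow_iff x (zpow_ne_zero _ (hC.unif_ne_zero x)), hC.ord_unif_zpow] at h2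
    rw [Finsupp.sub_apply]
    exact hC.mpow_mono x (by omega) h2

theorem h0_sharp_ne_top {V : Type} [AddCommGroup V] [Module K V] [Module ℂ V] [IsScalarTower ℂ K V]
    {Λ : ∀ x, Submodule (O x) V} (h : hC.Bdl Λ) {t : K} (ht : t ∉ (algebraMap ℂ K).range) :
    h0 (sharp t Λ) ≠ ⊤ := by
  obtain ⟨x₀, hx₀⟩ := (hC.affine_compl ht).nonempty
  have hfin := (h0_h1_ne_top hg h ht).2
  rw [h1, Module.length_ne_top_iff, isFiniteLength_iff_isNoetherian_isArtinian] at hfin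
  have := hfin.1
  rw [h0_sharp ht hx₀ h, Module.length_eq_finrank]
  exact ENat.natCast_ne_top _

/-- The Riemann–Roch theorem for divisors. -/
theorem riemannRoch (hC : IsCurve O) {t : K} (ht : t ∉ (algebraMap ℂ K).range) {κ : P →₀ ℤ}
    (hκ : ∀ x (g : K), g • KaehlerDifferential.D ℂ K t ∈ (StalkFamily.canonical O).stalk x ↔
      g ∈ hC.mpow x (- κ x)) (D : P →₀ ℤ) :
    (hC.ell D : ℤ) - hC.ell (κ - D) = D.degree - 2 := by
  rw [← chi_divisor hg hC ht D, h1_eq_of_h0_sharp ht (hC.bdl_divisor D)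
    (h0_sharp_ne_top hg (hC.bdl_divisor D) ht), h0_sharp_divisor hκ]
  rfl

/-- The Riemann–Roch theorem for vector bundles. -/
theorem riemannRoch_bundle {E : StalkFamily O} (h : hC.Bdl E.stalk) {t : K}
    (ht : t ∉ (algebraMap ℂ K).range) :
    ((h0 E.stalk).toNat : ℤ) - (h0 (sharp t E.stalk)).toNat = E.degree - 2 * E.rank := by
  rw [degree_eq hg E h ht, h1_eq_of_h0_sharp ht h (h0_sharp_ne_top hg h ht)]
  ring

theorem degree_congr {E F : StalkFamily O} (h : hC.Bdl E.stalk) (h' : hC.Bdl F.stalk)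
    (e : E.Isomorphic F) : E.degree = F.degree := by
  obtain ⟨t, ht⟩ := hC.exists_notMem_range
  obtain ⟨e⟩ := e
  rw [degree_eq hg E h ht, degree_eq hg F h' ht, h0_congr e.toEquiv e.mem_iff,
    h1_congr e.toEquiv e.mem_iff, StalkFamily.rank, StalkFamily.rank, e.toEquiv.finrank_eq]

theorem degree_sub_add_quot {E : StalkFamily O} (h : hC.Bdl E.stalk) (W : Submodule K E.V) :
    E.degree = (E.sub W).degree + (E.quot W).degree := by
  obtain ⟨t, ht⟩ := hC.exists_notMem_range
  have := h.finite
  have h1 : hC.Bdl (E.sub W).stalk := h.comap_subtype W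
  have h2 : hC.Bdl (E.quot W).stalk := h.map_mkQ W
  obtain ⟨i, j, m, e1, e2, e3, e4⟩ := exists_h0_h1_eq_of_quotient ht h W
  change _ = h0 (E.sub W).stalk + _ at e1
  change h0 (E.quot W).stalk = _ at e2
  change IsCurve.h1 t (E.sub W).stalk = _ at e3
  change _ = _ + IsCurve.h1 t (E.quot W).stalk at e4
  rw [degree_eq hg E h ht, degree_eq hg _ h1 ht, degree_eq hg _ h2 ht]
  obtain ⟨a, a'⟩ := h0_h1_ne_top hg h ht
  obtain ⟨b, b'⟩ := h0_h1_ne_top hg h1 ht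
  obtain ⟨c, c'⟩ := h0_h1_ne_top hg h2 ht
  have hr : E.rank = (E.sub W).rank + (E.quot W).rank := by
    rw [add_comm]
    exact (Submodule.finrank_quotient_add_finrank W).symm
  have hsplit : ∀ {a b : ℕ∞}, a + b ≠ ⊤ → a ≠ ⊤ ∧ b ≠ ⊤ := fun h => by
    rwa [Ne, ENat.add_eq_top, not_or] at h
  obtain ⟨hi, hj⟩ := hsplit (e2 ▸ c)
  have hm := (hsplit (e3 ▸ b')).2
  lift i to ℕ using hi
  lift j to ℕ using hj
  lift m to ℕ using hm
  rw [← ENat.natCast_toNat a, ← ENat.natCast_toNat b] at e1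
  rw [← ENat.natCast_toNat c] at e2
  rw [← ENat.natCast_toNat b'] at e3
  rw [← ENat.natCast_toNat a', ← ENat.natCast_toNat c'] at e4
  norm_cast at e1 e2 e3 e4
  omega

/-- The degree of a line bundle in terms of the divisor of a rational section. -/
theorem degree_eq_degree_divisor {E : StalkFamily O} (h : hC.Bdl E.stalk) (hr : E.rank = 1)
    {v : E.V} (hv : v ≠ 0) {D : P →₀ ℤ}
    (hD : ∀ x (u : K), u • v ∈ E.stalk x ↔ u ∈ hC.mpow x (- D x)) :
    E.degree = D.degree ∧ (h0 E.stalk).toNat = hC.ell D := by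
  obtain ⟨t, ht⟩ := hC.exists_notMem_range
  let e : K ≃ₗ[K] E.V := LinearEquiv.ofBijective (LinearMap.toSpanSingleton K E.V v)
    ⟨smul_left_injective K hv, (finrank_eq_one_iff_of_nonzero' v hv).1 hr⟩
  have he : ∀ x u, e u ∈ E.stalk x ↔ u ∈ hC.mpow x (- D x) := hD
  have h2 := chi_divisor hg hC ht D
  rw [degree_eq hg E h ht, ← h0_congr e he, ← h1_congr e he, hr]
  exact ⟨by rw [ell] at h2; push_cast; linarith, rfl⟩

end Genus
end Divisor
end IsCurve
end CobleCurve
end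

noncomputable section
open scoped TensorProduct KaehlerDifferential
namespace CobleCurve
namespace IsCurve
variable {K : Type} [Field K] [Algebra ℂ K] {P : Type} {O : P → Subalgebra ℂ K} {hC : IsCurve O}

open scoped IntermediateField.algebraAdjoinAdjoin in
/-- The derivative with respect to `t` preserves almost all local rings. -/
theorem finite_setOf_exists_D (hC : IsCurve O) {t : K} (ht : t ∉ (algebraMap ℂ K).range) :
    {x | t ∈ O x ∧ ∃ a ∈ O x, ∃ g ∉ O x, KaehlerDifferential.D ℂ K a =
      g • KaehlerDifferential.D ℂ K t}.Finite := by
  have hD0 := hC.D_ne_zero t ht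
  choose δ hδ using fun a => hC.exists_smul_D ht (KaehlerDifferential.D ℂ K a)
  have huniq : ∀ {a g : K}, KaehlerDifferential.D ℂ K a = g • KaehlerDifferential.D ℂ K t →
      g = δ a := fun {a g} h => by
    rw [← hδ a] at h
    exact (smul_left_injective K hD0 h).symm
  have hadd : ∀ a b, δ (a + b) = δ a + δ b := fun a b =>
    (huniq (by rw [map_add, add_smul, hδ, hδ])).symm
  have hmul : ∀ a b, δ (a * b) = a * δ b + b * δ a := fun a b =>
    (huniq (by rw [Derivation.leibniz, add_smul, mul_smul, mul_smul, hδ, hδ])).symm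
  have hconst : ∀ c, δ (algebraMap ℂ K c) = 0 := fun c =>
    (huniq (by rw [Derivation.map_algebraMap, zero_smul])).symm
  have ht1 : δ t = 1 := (huniq (by rw [one_smul])).symm
  have hpol : ∀ {x}, t ∈ O x → ∀ p ∈ Algebra.adjoin ℂ {t}, δ p ∈ O x := by
    intro x hx p hp
    induction hp using Algebra.adjoin_induction with
    | mem y hy => rw [Set.mem_singleton_iff.1 hy, ht1]; exact one_mem _
    | algebraMap c => rw [hconst]; exact zero_mem _
    | add a b _ _ iha ihb => rw [hadd]; exact add_mem iha ihb
    | mul a b ha hb iha ihb =>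
      rw [hmul]
      exact add_mem (mul_mem (adjoin_le hx ha) ihb) (mul_mem (adjoin_le hx hb) iha)
  have := isPrincipalIdealRing_adjoin ht
  have := hC.finiteDimensional t ht
  have hfin : Module.Finite (Algebra.adjoin ℂ {t}) (integralClosure (Algebra.adjoin ℂ {t}) K) :=
    IsIntegralClosure.finite _ (IntermediateField.adjoin ℂ {t}) K _
  obtain ⟨s, hs⟩ := hfin.fg_top
  refine (s.finite_toSet.biUnion fun b _ => hC.finite_setOf_notMem (δ b)).subset ?_
  rintro x ⟨hx, a, ha, g, hg, hag⟩
  by_contra hx'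
  simp only [Set.mem_iUnion, not_exists, Set.mem_ofPred_eq, not_not] at hx'
  have hB : ∀ b : integralClosure (Algebra.adjoin ℂ {t}) K, δ (b : K) ∈ O x := by
    intro b
    have hmem : b ∈ Submodule.span (Algebra.adjoin ℂ {t}) (s : Set _) := hs ▸ trivial
    induction hmem using Submodule.span_induction with
    | mem y hy => exact hx' y hy
    | zero =>
      have : δ 0 = 0 := by simpa using hconst 0
      rw [ZeroMemClass.coe_zero, this]; exact zero_mem _
    | add a b _ _ iha ihb => rw [AddMemClass.coe_add, hadd]; exact add_mem iha ihb
    | smul p c _ ih =>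
      have e : ((p • c : integralClosure (Algebra.adjoin ℂ {t}) K) : K) = (p : K) * (c : K) := rfl
      rw [e, hmul]
      have hc : (c : K) ∈ O x := (hC.isIntegral_adjoin_iff t _).1 c.2 x hx
      exact add_mem (mul_mem (adjoin_le hx p.2) ih) (mul_mem hc (hpol hx p p.2))
  refine hg ?_
  rw [huniq hag]
  obtain ⟨c, hc1, hc2, hc3⟩ := hC.exists_mul_regular ht hx ha
  have h1 := hB ⟨_, (hC.isIntegral_adjoin_iff t _).2 hc3⟩
  have h2 := hB ⟨_, (hC.isIntegral_adjoin_iff t _).2 hc1⟩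
  simp only at h1 h2
  rw [hmul] at h1
  have h4 : c * δ a ∈ O x := by simpa using sub_mem h1 (mul_mem ha h2)
  have hc4 : c ∉ hC.mpow x 1 := fun h => hC.one_notMem_mpow_one x (by
    simpa using sub_mem h hc2)
  have hc0 : c ≠ 0 := fun h => hc4 (h ▸ zero_mem _)
  have := mul_mem (hC.inv_mem_of_notMem hc4) h4
  rwa [inv_mul_cancel_left₀ hc0] at this

/-- The divisor of the differential `dt`. -/
theorem exists_canonicalDivisor (hC : IsCurve O) {t : K} (ht : t ∉ (algebraMap ℂ K).range) :
    ∃ κ : P →₀ ℤ, ∀ x (g : K), g • KaehlerDifferential.D ℂ K t ∈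
      (StalkFamily.canonical O).stalk x ↔ g ∈ hC.mpow x (- κ x) := by
  have hD0 := hC.D_ne_zero t ht
  have key : ∀ x, ∃ n : ℤ, ∀ g : K, g • KaehlerDifferential.D ℂ K t ∈
      (StalkFamily.canonical O).stalk x ↔ g ∈ hC.mpow x (-n) := by
    intro x
    have hπ := hC.notMem_range_of_mem (hC.unif_ne_zero x) (hC.unif_mem_mpow x)
    obtain ⟨c, hc⟩ := hC.exists_smul_D hπ (KaehlerDifferential.D ℂ K t)
    have hc0 : c ≠ 0 := by
      rintro rfl
      rw [zero_smul] at hc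
      exact hD0 hc.symm
    refine ⟨hC.ord x c, fun g => ?_⟩
    rw [← hc, smul_smul, hC.smul_D_unif_mem_iff, mul_comm, ← hC.mem_mpow_zero,
      hC.mul_mem_mpow_iff x hc0, zero_sub]
  choose κ hκ using key
  refine ⟨Finsupp.onFinset ((hC.finite_setOf_notMem t).union
    (hC.finite_setOf_exists_D ht)).toFinset κ fun x hx => ?_, hκ⟩
  by_contra hx'
  simp only [Set.Finite.mem_toFinset, Set.mem_union, Set.mem_ofPred_eq, not_or, not_not, not_and,
    not_exists] at hx'
  refine hx ?_
  obtain ⟨h1, h2⟩ := hx'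
  have h3 : (1 : K) ∈ hC.mpow x (- κ x) := (hκ x 1).1 (by
    rw [one_smul]; exact Submodule.subset_span (R := O x) (M := Ω[K⁄ℂ]) ⟨t, h1, rfl⟩)
  rw [hC.mem_mpow_of_ne_zero x _ one_ne_zero, hC.ord_one] at h3
  obtain ⟨g, hg⟩ := hC.exists_smul_D ht (KaehlerDifferential.D ℂ K (hC.unif x))
  have hgO : g ∈ O x := by
    by_contra hgO
    exact h2 h1 _ (hC.unif_mem x) g hgO hg.symm
  have hg0 : g ≠ 0 := by
    rintro rfl
    rw [zero_smul] at hg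
    exact hC.D_unif_ne_zero x hg.symm
  have h4 := (hκ x (hC.unif x ^ (- κ x))).2
    ((hC.mem_mpow x _ _).2 (Or.inr (hC.ord_unif_zpow x _).ge))
  have e : hC.unif x ^ (- κ x) • KaehlerDifferential.D ℂ K t =
      (hC.unif x ^ (- κ x) * g⁻¹) • KaehlerDifferential.D ℂ K (hC.unif x) := by
    rw [← hg, smul_smul, inv_mul_cancel_right₀ hg0]
  rw [e, hC.smul_D_unif_mem_iff] at h4
  have h5 := mul_mem h4 hgO
  rw [inv_mul_cancel_right₀ hg0, hC.zpow_mem_iff] at h5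
  omega

end IsCurve
end CobleCurve
end

noncomputable section
open scoped TensorProduct KaehlerDifferential
namespace CobleCurve
namespace IsCurve
variable {K : Type} [Field K] [Algebra ℂ K] {P : Type} {O : P → Subalgebra ℂ K} {hC : IsCurve O}

/-- The functions with poles bounded by `D`. -/
def Lsp (hC : IsCurve O) (D : P →₀ ℤ) : Submodule ℂ K :=
  secs (fun x => hC.mpow x (- D x)) Set.univ

theorem mem_Lsp {D : P →₀ ℤ} {u : K} : u ∈ hC.Lsp D ↔ ∀ x, u ∈ hC.mpow x (- D x) :=
  ⟨fun h x => h x trivial, fun h x _ => h x⟩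

theorem Lsp_mono {D D' : P →₀ ℤ} (h : D ≤ D') : hC.Lsp D ≤ hC.Lsp D' := fun _ hu =>
  mem_Lsp.2 fun x => hC.mpow_mono x (neg_le_neg (h x)) (mem_Lsp.1 hu x)

/-- The divisor of a function. -/
def div (hC : IsCurve O) {u : K} (hu : u ≠ 0) : P →₀ ℤ :=
  Finsupp.onFinset (hC.finite_setOf_ord_ne_zero hu).toFinset (fun x => hC.ord x u)
    fun x hx => by simpa using hx

theorem div_apply {u : K} (hu : u ≠ 0) (x : P) : hC.div hu x = hC.ord x u := rfl

theorem mul_mem_Lsp_iff {u : K} (hu : u ≠ 0) {D : P →₀ ℤ} {g : K} :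
    u * g ∈ hC.Lsp D ↔ g ∈ hC.Lsp (D + hC.div hu) := by
  rw [mem_Lsp, mem_Lsp]
  refine forall_congr' fun x => ?_
  rw [hC.mul_mem_mpow_iff x hu, Finsupp.add_apply, div_apply]
  congr! 2
  ring

section Genus
variable (hg : Module.finrank ℂ (StalkFamily.canonical O).H0 = 3)
include hg

theorem finite_Lsp (D : P →₀ ℤ) : FiniteDimensional ℂ (hC.Lsp D) := by
  obtain ⟨t, ht⟩ := hC.exists_notMem_range
  have h := (h0_h1_ne_top hg (hC.bdl_divisor D) ht).1
  rw [h0, Module.length_ne_top_iff, isFiniteLength_iff_isNoetherian_isArtinian] at h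
  have := h.1
  exact inferInstanceAs
    (FiniteDimensional ℂ (secs (fun x => hC.mpow x (- D x)) Set.univ))

theorem finrank_Lsp (D : P →₀ ℤ) : Module.finrank ℂ (hC.Lsp D) = hC.ell D := by
  have := finite_Lsp (hC := hC) hg D
  rw [ell]
  change _ = (Module.length ℂ (hC.Lsp D)).toNat
  rw [Module.length_eq_finrank, ENat.toNat_natCast]

theorem ell_mono {D D' : P →₀ ℤ} (h : D ≤ D') : hC.ell D ≤ hC.ell D' := by
  have := finite_Lsp (hC := hC) hg D'
  rw [← finrank_Lsp hg, ← finrank_Lsp hg]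
  exact Submodule.finrank_mono (Lsp_mono h)

theorem degree_add_div (hC : IsCurve O) {u : K} (hu : u ≠ 0) (D : P →₀ ℤ) :
    (D + hC.div hu).degree = D.degree ∧ hC.ell (D + hC.div hu) = hC.ell D := by
  obtain ⟨t, ht⟩ := hC.exists_notMem_range
  have he : ∀ x v, LinearEquiv.smulOfNeZero K K u hu v ∈ hC.mpow x (- D x) ↔
      v ∈ hC.mpow x (- (D + hC.div hu) x) := fun x v => by
    rw [LinearEquiv.smulOfNeZero_apply, smul_eq_mul, hC.mul_mem_mpow_iff x hu, Finsupp.add_apply,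
      div_apply]
    congr! 2
    ring
  have e : hC.ell (D + hC.div hu) = hC.ell D := by rw [ell, ell, h0_congr _ he]
  refine ⟨?_, e⟩
  have h1 := chi_divisor hg hC ht D
  have h2 := chi_divisor hg hC ht (D + hC.div hu)
  rw [h1_congr _ he, e] at h2
  linarith

omit hg in
theorem degree_nonneg {D : P →₀ ℤ} (h : 0 ≤ D) : 0 ≤ D.degree :=
  Finset.sum_nonneg fun x _ => h x

omit hg in
theorem eq_zero_of_degree {D : P →₀ ℤ} (h : 0 ≤ D) (hd : D.degree ≤ 0) : D = 0 := by
  have h1 : D.degree = 0 := le_antisymm hd (degree_nonneg h)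
  have := (Finset.sum_eq_zero_iff_of_nonneg fun x _ => h x).1 h1
  ext x
  by_cases hx : x ∈ D.support
  · exact this x hx
  · exact Finsupp.notMem_support_iff.1 hx

omit hg in
theorem degree_mono {D D' : P →₀ ℤ} (h : D ≤ D') : D.degree ≤ D'.degree := by
  have := degree_nonneg (sub_nonneg.2 h)
  rw [map_sub] at this
  linarith

omit hg in
theorem eq_of_le_of_degree {D D' : P →₀ ℤ} (h : D ≤ D') (hd : D'.degree ≤ D.degree) : D = D' := by
  have := eq_zero_of_degree (sub_nonneg.2 h) (by rw [map_sub]; linarith)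
  rw [sub_eq_zero] at this
  exact this.symm

omit hg in
theorem nonneg_add_div {u : K} (hu : u ≠ 0) {D : P →₀ ℤ} (h : u ∈ hC.Lsp D) :
    0 ≤ D + hC.div hu := fun x => by
  have := (hC.mem_mpow_of_ne_zero x _ hu).1 (mem_Lsp.1 h x)
  rw [Finsupp.add_apply, div_apply]
  change (0 : ℤ) ≤ _
  omega

theorem exists_ne_zero_of_ell_pos {D : P →₀ ℤ} (h : 0 < hC.ell D) : ∃ u ≠ 0, u ∈ hC.Lsp D := by
  rw [← finrank_Lsp hg] at h
  have : Nontrivial (hC.Lsp D) := Module.nontrivial_of_finrank_pos h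
  obtain ⟨u, hu⟩ := exists_ne (0 : hC.Lsp D)
  exact ⟨u, fun h => hu (Subtype.ext h), u.2⟩

theorem ell_eq_zero {D : P →₀ ℤ} (h : D.degree < 0) : hC.ell D = 0 := by
  by_contra h0
  obtain ⟨u, hu, hD⟩ := exists_ne_zero_of_ell_pos hg (Nat.pos_of_ne_zero h0)
  have := degree_nonneg (nonneg_add_div hu hD)
  rw [(degree_add_div hg hC hu D).1] at this
  omega

/-- A divisor of degree zero with a section is principal. -/
theorem exists_eq_neg_div {D : P →₀ ℤ} (h : D.degree = 0) (h0 : 0 < hC.ell D) :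
    ∃ (u : K) (hu : u ≠ 0), D = - hC.div hu := by
  obtain ⟨u, hu, hD⟩ := exists_ne_zero_of_ell_pos hg h0
  refine ⟨u, hu, ?_⟩
  have := eq_zero_of_degree (nonneg_add_div hu hD)
    (by rw [(degree_add_div hg hC hu D).1, h])
  exact eq_neg_of_add_eq_zero_left this

omit hg in
theorem ell_zero : hC.ell 0 = 1 := by
  have := h0_one hC
  simp only [ell, Finsupp.coe_zero, Pi.zero_apply, neg_zero, this]
  rfl

theorem ell_le_ell_sub_single (D : P →₀ ℤ) (p : P) :
    hC.ell D ≤ hC.ell (D - Finsupp.single p 1) + 1 := by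
  obtain ⟨t, ht⟩ := hC.exists_notMem_range
  have hD := hC.bdl_divisor (D - Finsupp.single p 1)
  have hD' := hC.bdl_divisor D
  obtain ⟨c, d, e1, -, e3⟩ := exists_h0_h1_eq ht hD' hD (fun x u hu => by
    refine hC.mpow_mono x ?_ hu
    classical
    rw [Finsupp.sub_apply, Finsupp.single_apply]; split_ifs <;> omega) {p} (fun x hx => by
    rw [Finset.mem_singleton] at hx
    simp only [Finsupp.sub_apply, Finsupp.single_eq_of_ne hx, sub_zero])
  rw [Finset.sum_singleton, index_mpow hC (by simp)] at e3
  obtain ⟨f0, -⟩ := h0_h1_ne_top hg hD ht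
  obtain ⟨f0', -⟩ := h0_h1_ne_top hg hD' ht
  have hc : c ≠ ⊤ := fun h => by simp [h] at e3
  have hd : d ≠ ⊤ := fun h => by simp [h] at e3
  lift c to ℕ using hc
  lift d to ℕ using hd
  rw [← ENat.natCast_toNat f0, ← ENat.natCast_toNat f0'] at e1
  norm_cast at e1 e3
  simp only [ell]
  omega

section Canonical
variable {t : K} (ht : t ∉ (algebraMap ℂ K).range) {κ : P →₀ ℤ}
  (hκ : ∀ x (g : K), g • KaehlerDifferential.D ℂ K t ∈ (StalkFamily.canonical O).stalk x ↔
    g ∈ hC.mpow x (- κ x))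
include ht hκ

theorem ell_canonical : hC.ell κ = 3 := by
  have := riemannRoch hg hC ht hκ 0
  rw [sub_zero, ell_zero, map_zero] at this
  omega

theorem degree_canonical : κ.degree = 4 := by
  have := riemannRoch hg hC ht hκ κ
  rw [sub_self, ell_zero, ell_canonical hg ht hκ] at this
  push_cast at this
  linarith

theorem ell_le_degree {D : P →₀ ℤ} (h : 0 ≤ D) : (hC.ell D : ℤ) ≤ D.degree + 1 := by
  have h1 := riemannRoch hg hC ht hκ D
  have h2 : hC.ell (κ - D) ≤ hC.ell κ := ell_mono hg (by simpa using h)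
  rw [ell_canonical hg ht hκ] at h2
  omega

end Canonical

end Genus

theorem mul_mem_Lsp {D D' : P →₀ ℤ} {u v : K} (hu : u ∈ hC.Lsp D) (hv : v ∈ hC.Lsp D') :
    u * v ∈ hC.Lsp (D + D') := mem_Lsp.2 fun x => by
  have := hC.mul_mem_mpow x (mem_Lsp.1 hu x) (mem_Lsp.1 hv x)
  rw [Finsupp.add_apply]
  exact hC.mpow_mono x (by omega) this

theorem pow_mem_Lsp {D : P →₀ ℤ} {u : K} (hu : u ∈ hC.Lsp D) (n : ℕ) :
    u ^ n ∈ hC.Lsp (n • D) := by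
  induction n with
  | zero =>
    rw [pow_zero, zero_smul, mem_Lsp]
    intro x
    rw [Finsupp.coe_zero, Pi.zero_apply, neg_zero, hC.mem_mpow_zero]
    exact one_mem _
  | succ n ih =>
    rw [pow_succ, add_smul, one_smul]
    exact mul_mem_Lsp ih hu

/-- A function times a suitable polynomial in `t` has poles only at the poles of `t`. -/
theorem exists_polynomial_mul_mem (hC : IsCurve O) {t : K} (ht : t ∉ (algebraMap ℂ K).range)
    (v : K) :
    ∃ p ∈ Algebra.adjoin ℂ {t}, p ≠ 0 ∧ ∀ x, t ∈ O x → p * v ∈ O x := by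
  have hZ : ({x | v ∉ O x} ∩ regularSet O t).Finite := (hC.finite_setOf_notMem v).inter_of_left _
  have := hZ.to_subtype
  have hΛ := hC.bdl_one
  obtain ⟨N, hN⟩ := exists_nat_bound
    (fun x : ↥({x | v ∉ O x} ∩ regularSet O t) => hΛ.absorb x v) fun i m n hmn hp g hg =>
      hp g (hC.mpow_mono i (by omega) hg)
  obtain ⟨p, hp1, hp2, hp3⟩ := exists_polynomial_mem_mpow (hC := hC) ht hZ (fun x hx => hx.2) N
  refine ⟨p, hp1, hp2, fun x hx => ?_⟩
  by_cases hxv : v ∈ O x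
  · exact mul_mem (adjoin_le hx hp1) hxv
  · exact (hC.mem_mpow_zero x _).1 (hN ⟨x, hxv, hx⟩ p (hp3 x ⟨hxv, hx⟩))

section Gonality
variable (hg : Module.finrank ℂ (StalkFamily.canonical O).H0 = 3)
include hg

omit hg in
theorem linearIndependent_gen_pow {t : K} (ht : t ∉ (algebraMap ℂ K).range) (m : ℕ) :
    LinearIndependent ℂ fun j : Fin m => (IntermediateField.AdjoinSimple.gen ℂ t) ^ (j : ℕ) := by
  have h1 := ((Polynomial.basisMonomials ℂ).linearIndependent.map'
    (Polynomial.aeval t).toLinearMap (LinearMap.ker_eq_bot.2 (transcendental_iff_injective.1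
      (transcendental_of_notMem_range ht)))).comp (fun j : Fin m => (j : ℕ))
      Fin.val_injective
  refine LinearIndependent.of_comp (IntermediateField.adjoin ℂ {t}).val.toLinearMap ?_
  have e : (IntermediateField.adjoin ℂ {t}).val.toLinearMap ∘ (fun j : Fin m =>
      (IntermediateField.AdjoinSimple.gen ℂ t) ^ (j : ℕ)) =
      ((Polynomial.aeval t).toLinearMap ∘ (Polynomial.basisMonomials ℂ)) ∘
        fun j : Fin m => (j : ℕ) := by
    funext j
    simp
  rw [e]
  exact h1

omit hg in
theorem le_of_forall_mul_le {n k : ℕ} (hn : 0 < n) {d : ℤ}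
    (h : ∀ m : ℕ, ((m : ℤ) + 1) * n ≤ (m + k) * d + 1) : (n : ℤ) ≤ d := by
  by_contra! hlt
  have h3 := h (n * k + 1)
  push_cast at h3
  have h4 : ((n : ℤ) * k + 1 + k) * d ≤ (n * k + 1 + k) * (n - 1) :=
    mul_le_mul_of_nonneg_left (by linarith) (by positivity)
  nlinarith

omit hg in
theorem exists_linearIndependent_mem_Lsp {D : P →₀ ℤ} (hD : 0 ≤ D) {t : K}
    (ht : t ∉ (algebraMap ℂ K).range) (htD : t ∈ hC.Lsp D) :
    ∃ (k : ℕ) (e : Fin (Module.finrank (IntermediateField.adjoin ℂ {t}) K) → K),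
      LinearIndependent (IntermediateField.adjoin ℂ {t}) e ∧ ∀ i, e i ∈ hC.Lsp (k • D) := by
  have := hC.finiteDimensional t ht
  let b := Module.finBasis (IntermediateField.adjoin ℂ {t}) K
  choose p hp1 hp2 hp3 using fun i => exists_polynomial_mul_mem hC ht (b i)
  obtain ⟨k, hk⟩ : ∃ k : ℕ, ∀ i, p i * b i ∈ hC.Lsp (k • D) := by
    refine exists_nat_bound (fun i => ?_) fun i m n hmn h =>
      Lsp_mono (nsmul_le_nsmul_left hD hmn) h
    have hfin := (hC.finite_setOf_notMem t).to_subtype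
    obtain ⟨k, hk⟩ := exists_nat_bound
      (p := fun (x : {x | t ∉ O x}) k => p i * b i ∈ hC.mpow x (-(k : ℤ)))
      (fun x => ⟨(hC.ord x (p i * b i)).natAbs, (hC.mem_mpow _ _ _).2 (Or.inr (by omega))⟩)
      fun x m n hmn h => hC.mpow_mono x (by omega) h
    refine ⟨k, mem_Lsp.2 fun x => ?_⟩
    have hx0 : (0 : ℤ) ≤ D x := hD x
    by_cases hx : t ∈ O x
    · refine hC.mpow_mono x ?_ ((hC.mem_mpow_zero x _).2 (hp3 i x hx))
      simp only [Finsupp.smul_apply, nsmul_eq_mul]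
      nlinarith
    · refine hC.mpow_mono x ?_ (hk ⟨x, hx⟩)
      have h1 : D x ≠ 0 := fun h => hx (by
        have := mem_Lsp.1 htD x
        rwa [h, neg_zero, hC.mem_mpow_zero] at this)
      simp only [Finsupp.smul_apply, nsmul_eq_mul]
      have h2 : 1 ≤ D x := by omega
      nlinarith
  refine ⟨k, fun i => p i * b i, ?_, hk⟩
  have := b.linearIndependent.units_smul fun i =>
      Units.mk0 (⟨p i, adjoin_le_field t (hp1 i)⟩ : IntermediateField.adjoin ℂ {t})
        fun h => hp2 i (congrArg Subtype.val h)
  exact this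

theorem card_mul_le_ell {D : P →₀ ℤ} (hD : 0 ≤ D) {t : K} (ht : t ∉ (algebraMap ℂ K).range)
    (htD : t ∈ hC.Lsp D) {k n : ℕ} {e : Fin n → K}
    (he : LinearIndependent (IntermediateField.adjoin ℂ {t}) e) (hk : ∀ i, e i ∈ hC.Lsp (k • D))
    (m : ℕ) : (m + 1) * n ≤ hC.ell ((m + k) • D) := by
  have hall := linearIndependent_smul (linearIndependent_gen_pow ht (m + 1)) he
  have hmem : ∀ q : Fin (m + 1) × Fin n,
      (IntermediateField.AdjoinSimple.gen ℂ t) ^ (q.1 : ℕ) • e q.2 ∈ hC.Lsp ((m + k) • D) := by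
    intro q
    rw [add_smul]
    refine mul_mem_Lsp (Lsp_mono (nsmul_le_nsmul_left hD ?_) (pow_mem_Lsp htD q.1)) (hk q.2)
    omega
  have hfin := finite_Lsp (hC := hC) hg ((m + k) • D)
  let v : Fin (m + 1) × Fin n → hC.Lsp ((m + k) • D) := fun q => ⟨_, hmem q⟩
  have hv : LinearIndependent ℂ v :=
    LinearIndependent.of_comp (hC.Lsp ((m + k) • D)).subtype hall
  have hle := hv.fintype_card_le_finrank
  rwa [finrank_Lsp hg, Fintype.card_prod, Fintype.card_fin, Fintype.card_fin] at hle

theorem finrank_adjoin_le_degree {D : P →₀ ℤ} (hD : 0 ≤ D) {t : K}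
    (ht : t ∉ (algebraMap ℂ K).range) (htD : t ∈ hC.Lsp D) :
    (Module.finrank (IntermediateField.adjoin ℂ {t}) K : ℤ) ≤ D.degree := by
  obtain ⟨κ, hκ⟩ := hC.exists_canonicalDivisor ht
  have := hC.finiteDimensional t ht
  obtain ⟨k, e, hind, hk⟩ := exists_linearIndependent_mem_Lsp hD ht htD
  refine le_of_forall_mul_le (k := k) Module.finrank_pos fun m => ?_
  have hle := card_mul_le_ell hg hD ht htD hind hk m
  have hle2 := ell_le_degree (hC := hC) hg ht hκ (nsmul_nonneg hD (m + k))
  rw [map_nsmul, nsmul_eq_mul] at hle2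
  zify at hle
  push_cast at hle2
  linarith

theorem finrank_adjoin_ne_one (hC : IsCurve O) {t : K} (ht : t ∉ (algebraMap ℂ K).range) :
    Module.finrank (IntermediateField.adjoin ℂ {t}) K ≠ 1 := by
  intro h
  obtain ⟨x₀, hx₀⟩ := (hC.affine_compl ht).nonempty
  have htop : ∀ g : K, g ∈ IntermediateField.adjoin ℂ {t} := by
    intro g
    obtain ⟨c, hc⟩ := (finrank_eq_one_iff_of_nonzero' (1 : K) one_ne_zero).1 h g
    rw [← hc]
    have : c • (1 : K) = c := mul_one _
    rw [this]
    exact c.2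
  have h1 := h1_one hg hC ht
  have hsup : secs (fun x => hC.mpow x 0) (regularSet O t) ⊔
      secs (fun x => hC.mpow x 0) (regularSet O t)ᶜ = ⊤ := by
    rw [eq_top_iff]
    intro g _
    obtain ⟨r, p, hp, hr⟩ := exists_isRes (hC := hC) ht hx₀ (htop g)
    have h2 : t * (g - p) ∈ O x₀ := by
      have := add_mem (hC.mem_of_mem_mpow_one hr) ((O x₀).algebraMap_mem r)
      simpa using this
    have e : g = p + (g - p) := by ring
    rw [e]
    refine Submodule.add_mem_sup (mem_secs_one.2 fun x hx => adjoin_le hx hp)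
      (mem_secs_one.2 fun x hx => ?_)
    have h3 := mem_of_mem_field (hC := hC) ht hx₀ (htop _) h2 hx
    have h4 := mul_mem (inv_mem_stalk (hC := hC) hx) h3
    rwa [inv_mul_cancel_left₀ (ne_zero_of_notMem_range ht)] at h4
  rw [IsCurve.h1, hsup, Module.length_eq_zero] at h1
  exact absurd h1 (by norm_num)

/-- On a nonhyperelliptic curve a divisor that moves has degree at least three. -/
theorem three_le_degree (hh : ∀ t : K, Module.finrank (IntermediateField.adjoin ℂ {t}) K ≠ 2)
    {D : P →₀ ℤ} (h : 2 ≤ hC.ell D) : 3 ≤ D.degree := by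
  obtain ⟨g, hg0, hgD⟩ := exists_ne_zero_of_ell_pos hg (hC := hC) (D := D) (by omega)
  have hfin := finite_Lsp (hC := hC) hg D
  obtain ⟨f, hf, hfg⟩ : ∃ f ∈ hC.Lsp D, ∀ c : ℂ, f ≠ c • g := by
    by_contra! hcon
    have hle : hC.Lsp D ≤ Submodule.span ℂ {g} := fun f hf => by
      obtain ⟨c, hc⟩ := hcon f hf
      exact Submodule.mem_span_singleton.2 ⟨c, hc.symm⟩
    have := Submodule.finrank_mono hle
    rw [finrank_Lsp hg, finrank_span_singleton hg0] at this
    omega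
  have ht : f / g ∉ (algebraMap ℂ K).range := by
    rintro ⟨c, hc⟩
    refine hfg c ?_
    rw [Algebra.smul_def, hc, div_mul_cancel₀ _ hg0]
  have h1 := finrank_adjoin_le_degree hg (nonneg_add_div hg0 hgD) ht (by
    rw [← mul_mem_Lsp_iff, mul_div_cancel₀ _ hg0]
    exact hf)
  rw [(degree_add_div hg hC hg0 D).1] at h1
  have := hC.finiteDimensional _ ht
  have h2 : 0 < Module.finrank (IntermediateField.adjoin ℂ {f / g}) K := Module.finrank_pos
  have h3 := hh (f / g)
  have h4 := finrank_adjoin_ne_one hg hC ht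
  omega

/-- A divisor with three sections has degree at least four, and a canonical divisor is the only
one of degree four up to equivalence. -/
theorem four_le_degree (hh : ∀ t : K, Module.finrank (IntermediateField.adjoin ℂ {t}) K ≠ 2)
    {t : K} (ht : t ∉ (algebraMap ℂ K).range) {κ : P →₀ ℤ}
    (hκ : ∀ x (g : K), g • KaehlerDifferential.D ℂ K t ∈ (StalkFamily.canonical O).stalk x ↔
      g ∈ hC.mpow x (- κ x)) {D : P →₀ ℤ} (h : 3 ≤ hC.ell D) :
    4 ≤ D.degree ∧ (D.degree = 4 → ∃ (u : K) (hu : u ≠ 0), D = κ + hC.div hu) := by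
  obtain ⟨p, -⟩ := (hC.affine_compl ht).nonempty
  constructor
  · have h1 := ell_le_ell_sub_single (hC := hC) hg D p
    have h2 := three_le_degree (hC := hC) hg hh (D := D - Finsupp.single p 1) (by omega)
    rw [map_sub, Finsupp.degree_single] at h2
    omega
  · intro h4
    have h1 := riemannRoch hg hC ht hκ D
    obtain ⟨u, hu, e⟩ := exists_eq_neg_div (hC := hC) hg (D := κ - D)
      (by rw [map_sub, degree_canonical hg ht hκ, h4, sub_self]) (by omega)
    refine ⟨u, hu, ?_⟩
    have : D = κ - (κ - D) := by abel
    rw [this, e, sub_neg_eq_add]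

end Gonality
end IsCurve
end CobleCurve
end

noncomputable section
open scoped TensorProduct KaehlerDifferential
namespace CobleCurve
namespace IsCurve

section Wedge

theorem update_zero_pair {V : Type*} (a b c : V) : Function.update ![a, c] 0 b = ![b, c] := by
  funext i; fin_cases i <;> rfl

theorem update_one_pair {V : Type*} (a b c : V) : Function.update ![c, a] 1 b = ![c, b] := by
  funext i; fin_cases i <;> rfl

variable {K : Type} [Field K] {V : Type} [AddCommGroup V] [Module K V]

theorem ιMulti_add_left (a b c : V) : (exteriorPower.ιMulti K 2 ![a + b, c] : ⋀[K]^2 V) =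
    exteriorPower.ιMulti K 2 ![a, c] + exteriorPower.ιMulti K 2 ![b, c] := by
  simpa only [update_zero_pair] using
    (exteriorPower.ιMulti K 2 (M := V)).map_update_add ![a, c] 0 a b

theorem ιMulti_add_right (c a b : V) : (exteriorPower.ιMulti K 2 ![c, a + b] : ⋀[K]^2 V) =
    exteriorPower.ιMulti K 2 ![c, a] + exteriorPower.ιMulti K 2 ![c, b] := by
  simpa only [update_one_pair] using
    (exteriorPower.ιMulti K 2 (M := V)).map_update_add ![c, a] 1 a b

theorem ιMulti_smul_left (r : K) (a c : V) :
    (exteriorPower.ιMulti K 2 ![r • a, c] : ⋀[K]^2 V) = r • exteriorPower.ιMulti K 2 ![a, c] := by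
  simpa only [update_zero_pair] using
    (exteriorPower.ιMulti K 2 (M := V)).map_update_smul ![a, c] 0 r a

theorem ιMulti_smul_right (r : K) (c a : V) :
    (exteriorPower.ιMulti K 2 ![c, r • a] : ⋀[K]^2 V) = r • exteriorPower.ιMulti K 2 ![c, a] := by
  simpa only [update_one_pair] using
    (exteriorPower.ιMulti K 2 (M := V)).map_update_smul ![c, a] 1 r a

theorem ιMulti_self (a : V) : (exteriorPower.ιMulti K 2 ![a, a] : ⋀[K]^2 V) = 0 :=
  (exteriorPower.ιMulti K 2).map_eq_zero_of_eq ![a, a] (i := 0) (j := 1) rfl (by decide)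

theorem ιMulti_swap (w v : V) : (exteriorPower.ιMulti K 2 ![v, w] : ⋀[K]^2 V) =
    - exteriorPower.ιMulti K 2 ![w, v] := by
  have := ιMulti_self (K := K) (w + v)
  rw [ιMulti_add_left, ιMulti_add_right, ιMulti_add_right, ιMulti_self, ιMulti_self, zero_add,
    add_zero] at this
  exact eq_neg_of_add_eq_zero_right this

theorem ιMulti_eq_smul (w v : V) (α β γ δ : K) :
    (exteriorPower.ιMulti K 2 ![α • w + β • v, γ • w + δ • v] : ⋀[K]^2 V) =
      (α * δ - γ * β) • exteriorPower.ιMulti K 2 ![w, v] := by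
  rw [ιMulti_add_left, ιMulti_add_right, ιMulti_add_right]
  simp only [ιMulti_smul_left, ιMulti_smul_right, ιMulti_self, ιMulti_swap w v]
  module

variable {w v : V} (hwv : LinearIndependent K ![w, v]) (hr : Module.finrank K V = 2)
include hwv hr

theorem ιMulti_ne_zero : (exteriorPower.ιMulti K 2 ![w, v] : ⋀[K]^2 V) ≠ 0 := by
  have := Module.finite_of_finrank_pos (R := K) (M := V) (by omega)
  let b := basisOfLinearIndependentOfCardEqFinrank hwv (by simp [hr])
  have hb : (b : Fin 2 → V) = ![w, v] := coe_basisOfLinearIndependentOfCardEqFinrank _ _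
  intro h
  have h1 := exteriorPower.alternatingMapLinearEquiv_apply_ιMulti b.det ![w, v]
  rw [h, map_zero, ← hb, b.det_self] at h1
  exact zero_ne_one h1

theorem exists_eq_smul_add_smul (y : V) : ∃ α β : K, y = α • w + β • v := by
  have := Module.finite_of_finrank_pos (R := K) (M := V) (by omega)
  have hspan : Submodule.span K (Set.range ![w, v]) = ⊤ :=
    hwv.span_eq_top_of_card_eq_finrank' (by simp [hr])
  have : y ∈ Submodule.span K (Set.range ![w, v]) := hspan ▸ trivial
  rw [Matrix.range_cons, Matrix.range_cons, Matrix.range_empty, Set.union_empty,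
    Set.singleton_union, Submodule.mem_span_pair] at this
  obtain ⟨α, β, h⟩ := this
  exact ⟨α, β, h.symm⟩

theorem exists_smul_ιMulti (z : ⋀[K]^2 V) : ∃ c : K, c • exteriorPower.ιMulti K 2 ![w, v] = z := by
  have : z ∈ Submodule.span K (Set.range (exteriorPower.ιMulti K 2 (M := V))) := by
    rw [exteriorPower.ιMulti_span]; trivial
  induction this using Submodule.span_induction with
  | mem y hy =>
    obtain ⟨m, rfl⟩ := hy
    obtain ⟨α, β, h1⟩ := exists_eq_smul_add_smul hwv hr (m 0)
    obtain ⟨γ, δ, h2⟩ := exists_eq_smul_add_smul hwv hr (m 1)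
    have : m = ![α • w + β • v, γ • w + δ • v] := by
      rw [← h1, ← h2]; ext i; fin_cases i <;> rfl
    exact ⟨_, by rw [this, ιMulti_eq_smul]⟩
  | zero => exact ⟨0, zero_smul _ _⟩
  | add a b _ _ iha ihb =>
    obtain ⟨c, rfl⟩ := iha
    obtain ⟨d, rfl⟩ := ihb
    exact ⟨c + d, add_smul _ _ _⟩
  | smul r a _ ih =>
    obtain ⟨c, rfl⟩ := ih
    exact ⟨r * c, mul_smul _ _ _⟩

end Wedge

end IsCurve
end CobleCurve
end

noncomputable section
open scoped TensorProduct KaehlerDifferential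
namespace CobleCurve
namespace IsCurve
variable {K : Type} [Field K] [Algebra ℂ K] {P : Type} {O : P → Subalgebra ℂ K} {hC : IsCurve O}

theorem zpow_unif_mem_mpow (hC : IsCurve O) (x : P) (n : ℤ) : hC.unif x ^ n ∈ hC.mpow x n :=
  (hC.mem_mpow x _ _).2 (Or.inr (hC.ord_unif_zpow x n).ge)

theorem le_of_mpow_le {x : P} {m n : ℤ} (h : ∀ u ∈ hC.mpow x m, u ∈ hC.mpow x n) : n ≤ m := by
  have := h _ (hC.zpow_unif_mem_mpow x m)
  rwa [hC.mem_mpow_of_ne_zero x _ (zpow_ne_zero _ (hC.unif_ne_zero x)), hC.ord_unif_zpow] at this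

theorem eq_of_mpow_eq {x : P} {m n : ℤ} (h : ∀ u, u ∈ hC.mpow x m ↔ u ∈ hC.mpow x n) : m = n :=
  le_antisymm (le_of_mpow_le fun u hu => (h u).2 hu) (le_of_mpow_le fun u hu => (h u).1 hu)

section Canonical
variable {t : K} (ht : t ∉ (algebraMap ℂ K).range) {κ : P →₀ ℤ}
  (hκ : ∀ x (g : K), g • KaehlerDifferential.D ℂ K t ∈ (StalkFamily.canonical O).stalk x ↔
    g ∈ hC.mpow x (- κ x))

include hC ht in
theorem D_tmul_D_ne_zero :
    KaehlerDifferential.D ℂ K t ⊗ₜ[K] KaehlerDifferential.D ℂ K t ≠ 0 := by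
  obtain ⟨φ, hφ⟩ := exists_dual_eq_one (K := K) (hC.D_ne_zero t ht)
  intro h
  have := congrArg (LinearMap.mul' K K ∘ₗ TensorProduct.map φ φ) h
  simp [hφ] at this

include hC ht in
theorem exists_smul_D_tmul_D (z : Ω[K⁄ℂ] ⊗[K] Ω[K⁄ℂ]) :
    ∃ c : K, c • (KaehlerDifferential.D ℂ K t ⊗ₜ[K] KaehlerDifferential.D ℂ K t) = z := by
  induction z with
  | zero => exact ⟨0, zero_smul _ _⟩
  | tmul η θ =>
    obtain ⟨a, rfl⟩ := hC.exists_smul_D ht η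
    obtain ⟨b, rfl⟩ := hC.exists_smul_D ht θ
    exact ⟨a * b, by rw [TensorProduct.smul_tmul_smul]⟩
  | add a b iha ihb =>
    obtain ⟨c, rfl⟩ := iha
    obtain ⟨d, rfl⟩ := ihb
    exact ⟨c + d, add_smul _ _ _⟩

include ht hκ in
theorem smul_mem_bicanonical_iff (x : P) (u : K) :
    u • (KaehlerDifferential.D ℂ K t ⊗ₜ[K] KaehlerDifferential.D ℂ K t) ∈
      (StalkFamily.bicanonical O).stalk x ↔ u ∈ hC.mpow x (- (κ + κ) x) := by
  have e2 : - (κ + κ) x = - κ x + - κ x := by rw [Finsupp.add_apply]; ring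
  rw [e2]
  constructor
  · intro h
    have key : ∀ z ∈ (StalkFamily.bicanonical O).stalk x, ∃ c ∈ hC.mpow x (- κ x + - κ x),
        z = c • (KaehlerDifferential.D ℂ K t ⊗ₜ[K] KaehlerDifferential.D ℂ K t) := by
      intro z hz
      induction hz using Submodule.span_induction with
      | mem y hy =>
        obtain ⟨η, hη, θ, hθ, rfl⟩ := hy
        obtain ⟨a, rfl⟩ := hC.exists_smul_D ht η
        obtain ⟨b, rfl⟩ := hC.exists_smul_D ht θ
        refine ⟨a * b, hC.mul_mem_mpow x ((hκ x a).1 hη) ((hκ x b).1 hθ), ?_⟩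
        exact TensorProduct.smul_tmul_smul _ _ _ _
      | zero => exact ⟨0, zero_mem _, show (0 : Ω[K⁄ℂ] ⊗[K] Ω[K⁄ℂ]) = _ from (zero_smul K _).symm⟩
      | add a b _ _ iha ihb =>
        obtain ⟨c, hc, rfl⟩ := iha
        obtain ⟨d, hd, rfl⟩ := ihb
        exact ⟨c + d, add_mem hc hd, (add_smul c d _).symm⟩
      | smul r a _ ih =>
        obtain ⟨c, hc, rfl⟩ := ih
        exact ⟨r * c, (hC.mpow x _).smul_mem r hc, by rw [mul_smul]; rfl⟩
    obtain ⟨c, hc, e⟩ := key _ h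
    rw [smul_left_injective K (D_tmul_D_ne_zero (hC := hC) ht) e]
    exact hc
  · intro h
    set π := hC.unif x
    have hπ := hC.unif_ne_zero x
    have e : u • (KaehlerDifferential.D ℂ K t ⊗ₜ[K] KaehlerDifferential.D ℂ K t) =
        ((u * π ^ κ x) • KaehlerDifferential.D ℂ K t) ⊗ₜ[K]
          (π ^ (- κ x) • KaehlerDifferential.D ℂ K t) := by
      rw [TensorProduct.smul_tmul_smul, mul_assoc, ← zpow_add₀ hπ]
      simp
    rw [e]
    refine Submodule.subset_span (R := O x) (M := Ω[K⁄ℂ] ⊗[K] Ω[K⁄ℂ])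
      ⟨_, (hκ x _).2 ?_, _, (hκ x _).2 (hC.zpow_unif_mem_mpow x _), rfl⟩
    have := hC.mul_mem_mpow x h (hC.zpow_unif_mem_mpow x (κ x))
    exact hC.mpow_mono x (by omega) this

end Canonical

section RankTwo
variable {F : StalkFamily O} {W : Submodule K F.V} {w v : F.V}

omit [Algebra ℂ K] in
theorem linearIndependent_pair_of_notMem {V : Type} [AddCommGroup V] [Module K V]
    {W : Submodule K V} {w v : V} (hw : w ∈ W) (hw0 : w ≠ 0) (hv : v ∉ W) :
    LinearIndependent K ![w, v] := by
  rw [LinearIndependent.pair_iff' hw0]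
  rintro a rfl
  exact hv (W.smul_mem a hw)

omit [Algebra ℂ K] in
theorem finrank_eq_one_of_mem_of_notMem {V : Type} [AddCommGroup V] [Module K V]
    (hr : Module.finrank K V = 2) {W : Submodule K V} {w v : V} (hw : w ∈ W) (hw0 : w ≠ 0)
    (hv : v ∉ W) : Module.finrank K W = 1 ∧ Module.finrank K (V ⧸ W) = 1 := by
  have := Module.finite_of_finrank_pos (R := K) (M := V) (by omega)
  have h1 := Submodule.finrank_quotient_add_finrank W
  have h2 : 0 < Module.finrank K W := by
    have : Nontrivial W := ⟨⟨w, hw⟩, 0, fun h => hw0 (congrArg Subtype.val h)⟩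
    exact Module.finrank_pos
  have h3 := Submodule.finrank_lt (s := W) fun h => hv (h ▸ trivial)
  omega

/-- The determinant of an extension of line bundles. -/
theorem smul_ιMulti_mem_iff (hr : F.rank = 2) (hw : w ∈ W) (hw0 : w ≠ 0) (hv : v ∉ W)
    {a b : P →₀ ℤ} (ha : ∀ x (u : K), u • w ∈ F.stalk x ↔ u ∈ hC.mpow x (- a x))
    (hb : ∀ x (u : K), u • W.mkQ v ∈ (F.quot W).stalk x ↔ u ∈ hC.mpow x (- b x)) (x : P) (u : K) :
    u • (exteriorPower.ιMulti K 2 ![w, v] : ⋀[K]^2 F.V) ∈ F.det₂.stalk x ↔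
      u ∈ hC.mpow x (- (a + b) x) := by
  have hwv := linearIndependent_pair_of_notMem hw hw0 hv
  set π := hC.unif x
  have hπ : π ≠ 0 := hC.unif_ne_zero x
  have hz : π ^ b x * π ^ (- b x) = 1 := by rw [← zpow_add₀ hπ, add_neg_cancel, zpow_zero]
  have hW : ∀ y ∈ W, ∃ α : K, y = α • w := by
    intro y hy
    obtain ⟨α, β, h⟩ := exists_eq_smul_add_smul hwv hr y
    have hβ : β • v ∈ W := by
      have : β • v = y - α • w := by rw [h]; abel
      rw [this]; exact W.sub_mem hy (W.smul_mem α hw)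
    have hβ0 : β = 0 := by
      by_contra hβ0
      exact hv ((W.smul_mem_iff hβ0).1 hβ)
    exact ⟨α, by rw [h, hβ0, zero_smul, add_zero]⟩
  obtain ⟨y₀, hy₀, hy₀'⟩ := (hb x (π ^ (- b x))).2 (hC.zpow_unif_mem_mpow x _)
  have h1 : y₀ - π ^ (- b x) • v ∈ W := (Submodule.Quotient.eq W).1 hy₀'
  obtain ⟨α₀, hα₀⟩ := hW _ h1
  have hy₀e : y₀ = α₀ • w + π ^ (- b x) • v := by rw [← hα₀]; abel
  have hdec : ∀ y ∈ F.stalk x, ∃ γ ∈ hC.mpow x (- a x), ∃ β ∈ hC.mpow x (- b x),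
      y = (γ + β * π ^ b x * α₀) • w + β • v := by
    intro y hy
    obtain ⟨α, β, h⟩ := exists_eq_smul_add_smul hwv hr y
    have hβ : β ∈ hC.mpow x (- b x) := (hb x β).1 ⟨y, hy, by
      change Submodule.Quotient.mk y = Submodule.Quotient.mk (β • v)
      rw [Submodule.Quotient.eq, h, add_sub_cancel_right]
      exact W.smul_mem α hw⟩
    refine ⟨α - β * π ^ b x * α₀, (ha x _).1 ?_, β, hβ, by rw [sub_add_cancel, h]⟩
    have hβ' : β * π ^ b x ∈ O x := by
      rw [← hC.mem_mpow_zero]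
      have := hC.mul_mem_mpow x hβ (hC.zpow_unif_mem_mpow x (b x))
      rwa [neg_add_cancel] at this
    have e : (α - β * π ^ b x * α₀) • w = y - (β * π ^ b x) • y₀ := by
      rw [h, hy₀e, smul_add, smul_smul, smul_smul, mul_assoc β (π ^ b x) (π ^ (- b x)), hz,
        mul_one]
      module
    rw [e]
    exact (F.stalk x).sub_mem hy (smul_mem_of_mem hβ' hy₀)
  have e2 : - (a + b) x = - a x + - b x := by rw [Finsupp.add_apply]; ring
  rw [e2]
  constructor
  · intro h
    have key : ∀ z ∈ F.det₂.stalk x, ∃ c ∈ hC.mpow x (- a x + - b x),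
        z = c • (exteriorPower.ιMulti K 2 ![w, v] : ⋀[K]^2 F.V) := by
      intro z hz
      induction hz using Submodule.span_induction with
      | mem y hy =>
        obtain ⟨m, hm, rfl⟩ := hy
        obtain ⟨γ, hγ, β, hβ, h0⟩ := hdec _ (hm 0)
        obtain ⟨γ', hγ', β', hβ', h1⟩ := hdec _ (hm 1)
        have : m = ![m 0, m 1] := by ext i; fin_cases i <;> rfl
        rw [this, h0, h1, ιMulti_eq_smul]
        refine ⟨_, ?_, rfl⟩
        have e : (γ + β * π ^ b x * α₀) * β' - (γ' + β' * π ^ b x * α₀) * β = γ * β' - γ' * β := by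
          ring
        rw [e]
        exact sub_mem (hC.mul_mem_mpow x hγ hβ') (hC.mul_mem_mpow x hγ' hβ)
      | zero => exact ⟨0, zero_mem _, show (0 : ⋀[K]^2 F.V) = _ from (zero_smul K _).symm⟩
      | add a b _ _ iha ihb =>
        obtain ⟨c, hc, rfl⟩ := iha
        obtain ⟨d, hd, rfl⟩ := ihb
        exact ⟨c + d, add_mem hc hd, (add_smul c d _).symm⟩
      | smul r a _ ih =>
        obtain ⟨c, hc, rfl⟩ := ih
        exact ⟨r * c, (hC.mpow x _).smul_mem r hc, by rw [mul_smul]; rfl⟩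
    obtain ⟨c, hc, e⟩ := key _ h
    rw [smul_left_injective K (ιMulti_ne_zero hwv hr) e]
    exact hc
  · intro h
    have e : u • (exteriorPower.ιMulti K 2 ![w, v] : ⋀[K]^2 F.V) =
        exteriorPower.ιMulti K 2 ![(u * π ^ b x) • w, y₀] := by
      have := ιMulti_eq_smul w v (u * π ^ b x) 0 α₀ (π ^ (- b x))
      rw [zero_smul, add_zero, ← hy₀e] at this
      rw [this, mul_zero, sub_zero, mul_assoc, hz, mul_one]
    rw [e]
    refine Submodule.subset_span (R := O x) (M := ⋀[K]^2 F.V) ⟨_, fun i => ?_, rfl⟩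
    fin_cases i
    · refine (ha x _).2 ?_
      have := hC.mul_mem_mpow x h (hC.zpow_unif_mem_mpow x (b x))
      rwa [neg_add_cancel_right] at this
    · exact hy₀

section Degree
variable (hg : Module.finrank ℂ (StalkFamily.canonical O).H0 = 3)
  {t : K} (ht : t ∉ (algebraMap ℂ K).range) {κ : P →₀ ℤ}
  (hκ : ∀ x (g : K), g • KaehlerDifferential.D ℂ K t ∈ (StalkFamily.canonical O).stalk x ↔
    g ∈ hC.mpow x (- κ x))
include hg ht hκ

/-- The divisors of a line subbundle and of its quotient in a bundle of rank two with bicanonical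
determinant. -/
theorem exists_line_divisors (hF : hC.Bdl F.stalk) (hr : F.rank = 2)
    (hdet : F.det₂.Isomorphic (StalkFamily.bicanonical O)) (hw : w ∈ W) (hw0 : w ≠ 0)
    (hv : v ∉ W) : ∃ (a b : P →₀ ℤ) (h : K) (hh : h ≠ 0),
      (∀ x (u : K), u • w ∈ F.stalk x ↔ u ∈ hC.mpow x (- a x)) ∧
      (∀ x (u : K), u • W.mkQ v ∈ (F.quot W).stalk x ↔ u ∈ hC.mpow x (- b x)) ∧
      a + b = κ + κ + hC.div hh ∧ (F.sub W).degree = a.degree ∧ (F.quot W).degree = b.degree ∧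
      a.degree + b.degree = 8 ∧ F.degree = 8 := by
  have hq : hC.Bdl (F.quot W).stalk := hF.map_mkQ W
  have hs : hC.Bdl (F.sub W).stalk := hF.comap_subtype W
  have hv0 : W.mkQ v ≠ 0 := fun h => hv ((Submodule.Quotient.mk_eq_zero W).1 h)
  have hwv := linearIndependent_pair_of_notMem hw hw0 hv
  obtain ⟨r1, r2⟩ := finrank_eq_one_of_mem_of_notMem hr hw hw0 hv
  obtain ⟨a, ha⟩ := hF.exists_divisor hw0
  obtain ⟨b, hb⟩ := hq.exists_divisor hv0
  obtain ⟨δ⟩ := hdet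
  obtain ⟨h, hδ⟩ := exists_smul_D_tmul_D (hC := hC) ht
    (δ.toEquiv (exteriorPower.ιMulti K 2 ![w, v] : ⋀[K]^2 F.V))
  have hh : h ≠ 0 := by
    rintro rfl
    rw [zero_smul] at hδ
    exact ιMulti_ne_zero hwv hr ((LinearEquiv.map_eq_zero_iff δ.toEquiv).1 hδ.symm)
  have e : a + b = κ + κ + hC.div hh := by
    ext x
    have h1 : ∀ u, u ∈ hC.mpow x (- (a + b) x) ↔ u ∈ hC.mpow x (- (κ + κ + hC.div hh) x) := by
      intro u
      refine (smul_ιMulti_mem_iff hr hw hw0 hv ha hb x u).symm.trans ((δ.mem_iff x _).symm.trans ?_)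
      have e1 : δ.toEquiv (u • (exteriorPower.ιMulti K 2 ![w, v] : ⋀[K]^2 F.V)) =
          (h * u) • (KaehlerDifferential.D ℂ K t ⊗ₜ[K] KaehlerDifferential.D ℂ K t) := by
        rw [mul_comm, mul_smul, hδ]
        exact map_smul δ.toEquiv u _
      rw [e1]
      refine (smul_mem_bicanonical_iff ht hκ x _).trans ?_
      rw [hC.mul_mem_mpow_iff x hh,
        Finsupp.add_apply _ (hC.div hh), div_apply, neg_add, sub_eq_add_neg]
    have := eq_of_mpow_eq h1
    omega
  have d1 : (F.sub W).degree = a.degree :=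
    (degree_eq_degree_divisor hg hs r1 (v := ⟨w, hw⟩) (fun h => hw0 (congrArg Subtype.val h))
      ha).1
  have d2 : (F.quot W).degree = b.degree := (degree_eq_degree_divisor hg hq r2 hv0 hb).1
  have d3 : a.degree + b.degree = 8 := by
    rw [← map_add, e, (degree_add_div hg hC hh _).1, map_add, degree_canonical hg ht hκ]
    norm_num
  exact ⟨a, b, h, hh, ha, hb, e, d1, d2, d3, by rw [degree_sub_add_quot hg hF W, d1, d2, d3]⟩

theorem degree_eq_eight (hF : hC.Bdl F.stalk) (hr : F.rank = 2)
    (hdet : F.det₂.Isomorphic (StalkFamily.bicanonical O)) : F.degree = 8 := by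
  have := hF.finite
  have b := Module.finBasisOfFinrankEq K F.V hr
  have hli := b.linearIndependent
  obtain ⟨_, _, _, _, -, -, -, -, -, -, h⟩ := exists_line_divisors hg ht hκ hF hr hdet
    (W := Submodule.span K {b 0}) (w := b 0) (v := b 1) (Submodule.mem_span_singleton_self _)
    (b.ne_zero 0) (fun h => by
      obtain ⟨c, hc⟩ := Submodule.mem_span_singleton.1 h
      have h1 := congrArg (fun v => b.repr v 1) hc
      simp at h1)
  exact h

omit hg in
theorem isomorphic_canonical {L : StalkFamily O} (hr : L.rank = 1) {v : L.V} (hv : v ≠ 0)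
    {D : P →₀ ℤ} (hD : ∀ x (u : K), u • v ∈ L.stalk x ↔ u ∈ hC.mpow x (- D x))
    {h : K} (hh : h ≠ 0) (e : D = κ + hC.div hh) : L.Isomorphic (StalkFamily.canonical O) := by
  let e1 : K ≃ₗ[K] L.V := LinearEquiv.ofBijective (LinearMap.toSpanSingleton K L.V v)
    ⟨smul_left_injective K hv, (finrank_eq_one_iff_of_nonzero' v hv).1 hr⟩
  have hη : h • KaehlerDifferential.D ℂ K t ≠ 0 := smul_ne_zero hh (hC.D_ne_zero t ht)
  let e2 : K ≃ₗ[K] Ω[K⁄ℂ] := LinearEquiv.ofBijective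
    (LinearMap.toSpanSingleton K Ω[K⁄ℂ] (h • KaehlerDifferential.D ℂ K t))
    ⟨smul_left_injective K hη, (finrank_eq_one_iff_of_nonzero' _ hη).1 hC.finrank_kaehler⟩
  refine ⟨⟨e1.symm.trans e2, fun x y => ?_⟩⟩
  obtain ⟨u, rfl⟩ := e1.surjective y
  have h1 : e2 (e1.symm (e1 u)) = e2 u := by rw [e1.symm_apply_apply]
  refine Iff.trans (iff_of_eq (congrArg (· ∈ (StalkFamily.canonical O).stalk x) h1)) ?_
  change u • h • KaehlerDifferential.D ℂ K t ∈ _ ↔ u • v ∈ _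
  rw [hD, smul_smul, hκ, mul_comm, hC.mul_mem_mpow_iff x hh, e, Finsupp.add_apply, div_apply,
    neg_add, sub_eq_add_neg]

end Degree
end RankTwo
end IsCurve
end CobleCurve
end

noncomputable section
open scoped TensorProduct KaehlerDifferential
namespace CobleCurve

namespace StalkFamily
variable {K : Type} [Field K] [Algebra ℂ K] {P : Type} {O : P → Subalgebra ℂ K}
  {E F G E' F' : StalkFamily O}

theorem Isomorphic.symm (h : E.Isomorphic F) : F.Isomorphic E := by
  obtain ⟨e⟩ := h
  refine ⟨⟨e.toEquiv.symm, fun x v => ?_⟩⟩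
  rw [← e.mem_iff, e.toEquiv.apply_symm_apply]

theorem Isomorphic.trans (h : E.Isomorphic F) (h' : F.Isomorphic G) : E.Isomorphic G := by
  obtain ⟨e⟩ := h
  obtain ⟨e'⟩ := h'
  exact ⟨⟨e.toEquiv.trans e'.toEquiv, fun x v => (e'.mem_iff x _).trans (e.mem_iff x v)⟩⟩

theorem Isomorphic.directSum (h : E.Isomorphic E') (h' : F.Isomorphic F') :
    (E.directSum F).Isomorphic (E'.directSum F') := by
  obtain ⟨e⟩ := h
  obtain ⟨e'⟩ := h'
  exact ⟨⟨e.toEquiv.prodCongr e'.toEquiv, fun x v =>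
    and_congr (e.mem_iff x v.1) (e'.mem_iff x v.2)⟩⟩

theorem Isomorphic.rank_eq (h : E.Isomorphic F) : E.rank = F.rank := by
  obtain ⟨e⟩ := h
  exact e.toEquiv.finrank_eq

theorem sub_ker_snd (E F : StalkFamily O) :
    E.Isomorphic ((E.directSum F).sub (LinearMap.ker (LinearMap.snd K E.V F.V))) := by
  let e : E.V →ₗ[K] LinearMap.ker (LinearMap.snd K E.V F.V) :=
    (LinearMap.inl K E.V F.V).codRestrict _ fun v => rfl
  have he : Function.Bijective e := by
    refine ⟨fun v w h => congrArg (fun z => z.1.1) h, fun z => ⟨z.1.1, Subtype.ext ?_⟩⟩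
    exact Prod.ext rfl z.2.symm
  exact ⟨⟨LinearEquiv.ofBijective e he, fun x v => ⟨fun h => h.1, fun h => ⟨h, zero_mem _⟩⟩⟩⟩

theorem quot_ker_snd (E F : StalkFamily O) :
    ((E.directSum F).quot (LinearMap.ker (LinearMap.snd K E.V F.V))).Isomorphic F := by
  let e := (LinearMap.snd K E.V F.V).quotKerEquivOfSurjective LinearMap.snd_surjective
  have he : ∀ v : E.V × F.V, e (Submodule.Quotient.mk v) = v.2 := fun v => rfl
  refine ⟨⟨e, fun x z => ?_⟩⟩
  constructor
  · intro h
    refine ⟨((0, e z) : E.V × F.V), ⟨zero_mem _, h⟩, e.injective ?_⟩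
    exact he _
  · rintro ⟨v, hv, rfl⟩
    exact hv.2

/-- The subbundle corresponding under an isomorphism. -/
theorem Iso.sub_map (e : Iso E F) (W : Submodule K E.V) :
    (E.sub W).Isomorphic (F.sub (W.map (e.toEquiv : E.V →ₗ[K] F.V))) :=
  ⟨⟨e.toEquiv.submoduleMap W, fun x (v : W) => e.mem_iff x v⟩⟩

end StalkFamily

namespace IsCurve
variable {K : Type} [Field K] [Algebra ℂ K] {P : Type} {O : P → Subalgebra ℂ K} {hC : IsCurve O}

open StalkFamily

theorem H0_eq_secs (F : StalkFamily O) : F.H0 = secs F.stalk Set.univ := by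
  ext v
  exact ⟨fun h x _ => h x, fun h x => h x trivial⟩

theorem Bdl.congr {V V' : Type} [AddCommGroup V] [Module K V] [AddCommGroup V'] [Module K V']
    {Λ : ∀ x, Submodule (O x) V} {Λ' : ∀ x, Submodule (O x) V'} (h : hC.Bdl Λ) (e : V ≃ₗ[K] V')
    (he : ∀ x v, e v ∈ Λ' x ↔ v ∈ Λ x) : hC.Bdl Λ' := by
  have he' : ∀ x v, v ∈ Λ' x ↔ e.symm v ∈ Λ x := fun x v => by rw [← he, e.apply_symm_apply]
  have := h.finite
  refine ⟨e.finiteDimensional, fun x v => ?_, fun x φ => ?_, fun v => ?_, fun φ => ?_⟩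
  · obtain ⟨n, hn⟩ := h.absorb x (e.symm v)
    refine ⟨n, fun g hg => ?_⟩
    rw [he', map_smul]
    exact hn g hg
  · obtain ⟨n, hn⟩ := h.bound x (φ ∘ₗ (e : V →ₗ[K] V'))
    refine ⟨n, fun v hv => ?_⟩
    have := hn _ ((he' x v).1 hv)
    simpa using this
  · simp only [he']
    exact h.finite_notMem _
  · refine (h.finite_notBound (φ ∘ₗ (e : V →ₗ[K] V'))).subset fun x hx hx' => hx fun v hv => ?_
    have := hx' _ ((he' x v).1 hv)
    simpa using this

theorem bdl_directSum {E F : StalkFamily O} (hE : hC.Bdl E.stalk) (hF : hC.Bdl F.stalk) :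
    hC.Bdl (E.directSum F).stalk := by
  have := hE.finite
  have := hF.finite
  have hφ : ∀ (φ : Module.Dual K (E.directSum F).V) (v : (E.directSum F).V), φ v =
      (φ ∘ₗ LinearMap.inl K E.V F.V) v.1 + (φ ∘ₗ LinearMap.inr K E.V F.V) v.2 := fun φ v => by
    refine Eq.trans (congrArg φ ?_) (map_add φ _ _)
    exact (Prod.fst_add_snd v).symm
  refine ⟨inferInstanceAs (FiniteDimensional K (E.V × F.V)), fun x v => ?_, fun x φ => ?_,
    fun v => ?_, fun φ => ?_⟩
  · obtain ⟨n, hn⟩ := hE.absorb x v.1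
    obtain ⟨m, hm⟩ := hF.absorb x v.2
    exact ⟨max n m, fun g hg => ⟨hn g (hC.mpow_mono x (by push_cast; omega) hg),
      hm g (hC.mpow_mono x (by push_cast; omega) hg)⟩⟩
  · obtain ⟨n, hn⟩ := hE.bound x (φ ∘ₗ LinearMap.inl K E.V F.V)
    obtain ⟨m, hm⟩ := hF.bound x (φ ∘ₗ LinearMap.inr K E.V F.V)
    refine ⟨max n m, fun v hv => ?_⟩
    rw [hφ φ v]
    exact add_mem (hC.mpow_mono x (by push_cast; omega) (hn _ hv.1))
      (hC.mpow_mono x (by push_cast; omega) (hm _ hv.2))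
  · refine ((hE.finite_notMem v.1).union (hF.finite_notMem v.2)).subset fun x hx => ?_
    by_contra h
    simp only [Set.mem_union, Set.mem_ofPred_eq, not_or, not_not] at h
    exact hx ⟨h.1, h.2⟩
  · refine ((hE.finite_notBound (φ ∘ₗ LinearMap.inl K E.V F.V)).union
      (hF.finite_notBound (φ ∘ₗ LinearMap.inr K E.V F.V))).subset fun x hx => ?_
    by_contra h
    simp only [Set.mem_union, Set.mem_ofPred_eq, not_or, not_not] at h
    refine hx fun v hv => ?_
    rw [hφ φ v]
    exact add_mem (h.1 _ hv.1) (h.2 _ hv.2)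

section Canonical
variable {t : K} (ht : t ∉ (algebraMap ℂ K).range) {κ : P →₀ ℤ}
  (hκ : ∀ x (g : K), g • KaehlerDifferential.D ℂ K t ∈ (StalkFamily.canonical O).stalk x ↔
    g ∈ hC.mpow x (- κ x))
include ht hκ

theorem bdl_canonical : hC.Bdl (canonical O).stalk := by
  have hη := hC.D_ne_zero t ht
  let e : K ≃ₗ[K] Ω[K⁄ℂ] := LinearEquiv.ofBijective
    (LinearMap.toSpanSingleton K Ω[K⁄ℂ] (KaehlerDifferential.D ℂ K t))
    ⟨smul_left_injective K hη, (finrank_eq_one_iff_of_nonzero' _ hη).1 hC.finrank_kaehler⟩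
  exact (hC.bdl_divisor κ).congr (V' := (canonical O).V) e hκ

omit ht hκ in
theorem div_one : hC.div (one_ne_zero : (1 : K) ≠ 0) = 0 := by
  ext x
  rw [div_apply, hC.ord_one]
  rfl

variable (hg : Module.finrank ℂ (StalkFamily.canonical O).H0 = 3)
include hg

theorem degree_canonical_bundle : (canonical O).degree = 4 := by
  rw [← degree_canonical hg ht hκ]
  exact (degree_eq_degree_divisor hg (bdl_canonical ht hκ) hC.finrank_kaehler
    (hC.D_ne_zero t ht) hκ).1

theorem isGraded_Eo : (Eo O).IsGraded (Eo O) := by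
  have hc := bdl_canonical ht hκ
  have hE : hC.Bdl (Eo O).stalk := bdl_directSum hc hc
  have h1 := sub_ker_snd (canonical O) (canonical O)
  have h2 := quot_ker_snd (canonical O) (canonical O)
  set W := LinearMap.ker (LinearMap.snd K (canonical O).V (canonical O).V) with hW
  have hs : hC.Bdl ((Eo O).sub W).stalk := hE.comap_subtype W
  have hq : hC.Bdl ((Eo O).quot W).stalk := hE.map_mkQ W
  have d1 : ((Eo O).sub W).degree = 4 := by
    rw [← degree_congr hg hc hs h1, degree_canonical_bundle ht hκ hg]
  have d2 : ((Eo O).quot W).degree = 4 := by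
    rw [degree_congr hg hq hc h2, degree_canonical_bundle ht hκ hg]
  have r1 : ((Eo O).sub W).rank = 1 := h1.rank_eq.symm.trans hC.finrank_kaehler
  have r2 : (Eo O).rank = 2 := by
    have : Module.Finite K (canonical O).V := hc.finite
    refine (Module.finrank_prod (R := K) (M := (canonical O).V) (M' := (canonical O).V)).trans ?_
    rw [show Module.finrank K (canonical O).V = 1 from hC.finrank_kaehler]
  have hne : (KaehlerDifferential.D ℂ K t : (canonical O).V) ≠ 0 := hC.D_ne_zero t ht
  refine Or.inr ⟨W, fun h => ?_, fun h => ?_, ?_, h1.symm.directSum h2⟩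
  · have : ((KaehlerDifferential.D ℂ K t, 0) : (canonical O).V × (canonical O).V) = 0 :=
      (Submodule.eq_bot_iff W).1 h _ rfl
    exact hne (congrArg Prod.fst this)
  · have : ((0, KaehlerDifferential.D ℂ K t) : (canonical O).V × (canonical O).V) ∈ W :=
      h ▸ trivial
    exact hne this
  · rw [degree_sub_add_quot hg hE W, d1, d2, r1, r2]
    norm_num

/-- An extension of the canonical bundle by itself has the moduli point of `E_o`. -/
theorem sEquiv_Eo {F : StalkFamily O} (hF : hC.Bdl F.stalk) (hr : F.rank = 2)
    {W : Submodule K F.V} (hW : W ≠ ⊥) (hW' : W ≠ ⊤)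
    (h1 : (F.sub W).Isomorphic (canonical O)) (h2 : (F.quot W).Isomorphic (canonical O)) :
    F.SEquiv (Eo O) := by
  have hc := bdl_canonical ht hκ
  refine ⟨Eo O, Or.inr ⟨W, hW, hW', ?_, h1.directSum h2⟩, isGraded_Eo ht hκ hg⟩
  have hs : hC.Bdl (F.sub W).stalk := hF.comap_subtype W
  have hq : hC.Bdl (F.quot W).stalk := hF.map_mkQ W
  have r1 : (F.sub W).rank = 1 := h1.rank_eq.trans hC.finrank_kaehler
  rw [degree_sub_add_quot hg hF W, degree_congr hg hs hc h1, degree_congr hg hq hc h2,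
    degree_canonical_bundle ht hκ hg, hr, r1]
  norm_num

omit ht hκ in
theorem finite_H0 {F : StalkFamily O} (hF : hC.Bdl F.stalk) : FiniteDimensional ℂ F.H0 := by
  obtain ⟨t, ht⟩ := hC.exists_notMem_range
  have h := (h0_h1_ne_top hg hF ht).1
  rw [h0, Module.length_ne_top_iff, isFiniteLength_iff_isNoetherian_isArtinian] at h
  have := h.1
  rw [H0_eq_secs]
  infer_instance

omit ht hκ in
theorem finrank_H0 {F : StalkFamily O} (hF : hC.Bdl F.stalk) :
    Module.finrank ℂ F.H0 = (h0 F.stalk).toNat := by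
  have := finite_H0 hg hF
  rw [H0_eq_secs] at this ⊢
  rw [h0, Module.length_eq_finrank, ENat.toNat_natCast]

/-- If a bundle of rank two with bicanonical determinant has an unexpected number of sections,
it has a quotient line bundle contained in the canonical bundle. -/
theorem exists_quot_of_finrank_ne {F : StalkFamily O} (hF : hC.Bdl F.stalk) (hr : F.rank = 2)
    (hdet : F.det₂.Isomorphic (bicanonical O)) (h4 : Module.finrank ℂ F.H0 ≠ 4) :
    ∃ (W : Submodule K F.V) (w v : F.V) (a b : P →₀ ℤ) (h : K) (hh : h ≠ 0),
      w ∈ W ∧ w ≠ 0 ∧ v ∉ W ∧ (∀ x (u : K), u • w ∈ F.stalk x ↔ u ∈ hC.mpow x (- a x)) ∧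
      (∀ x (u : K), u • W.mkQ v ∈ (F.quot W).stalk x ↔ u ∈ hC.mpow x (- b x)) ∧
      a + b = κ + κ + hC.div hh ∧ (F.sub W).degree = a.degree ∧ a.degree + b.degree = 8 ∧
      b ≤ κ := by
  have hfin := hF.finite
  have hRR := riemannRoch_bundle hg hF ht
  rw [degree_eq_eight hg ht hκ hF hr hdet, hr, ← finrank_H0 hg hF] at hRR
  have hne : h0 (sharp t F.stalk) ≠ 0 := fun h => by
    rw [h] at hRR
    simp at hRR
    omega
  obtain ⟨ψ, hψ, hψ0⟩ : ∃ ψ ∈ secs (sharp t F.stalk) Set.univ, ψ ≠ 0 := by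
    by_contra! hcon
    refine hne ?_
    rw [h0, Module.length_eq_zero_iff]
    exact ⟨fun a b => Subtype.ext ((hcon a a.2).trans (hcon b b.2).symm)⟩
  obtain ⟨v, hv⟩ : ∃ v, ψ v = 1 := by
    obtain ⟨v, hv⟩ : ∃ v, ψ v ≠ 0 := by
      by_contra! hcon
      exact hψ0 (LinearMap.ext hcon)
    exact ⟨(ψ v)⁻¹ • v, by rw [map_smul, smul_eq_mul, inv_mul_cancel₀ hv]⟩
  have hr' : Module.finrank K F.V = 2 := hr
  have hrange : Module.finrank K (LinearMap.range ψ) ≤ 1 :=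
    (Submodule.finrank_le _).trans (Module.finrank_self K).le
  have hker := ψ.finrank_range_add_finrank_ker
  obtain ⟨w, hw, hw0⟩ : ∃ w ∈ LinearMap.ker ψ, w ≠ 0 := by
    have : Nontrivial (LinearMap.ker ψ) :=
      Module.nontrivial_of_finrank_pos (R := K) (by omega)
    obtain ⟨w, hw⟩ := exists_ne (0 : LinearMap.ker ψ)
    exact ⟨w, w.2, fun h => hw (Subtype.ext h)⟩
  have hv' : v ∉ LinearMap.ker ψ := fun h => one_ne_zero (hv.symm.trans h)
  obtain ⟨a, b, h, hh, ha, hb, e, d1, -, d3, -⟩ :=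
    exists_line_divisors hg ht hκ hF hr hdet hw hw0 hv'
  refine ⟨_, w, v, a, b, h, hh, hw, hw0, hv', ha, hb, e, d1, d3, fun x => ?_⟩
  have := le_of_mpow_le (hC := hC) (x := x) (m := - b x) (n := - κ x) fun u hu => by
    obtain ⟨y, hy, hy'⟩ := (hb x u).2 hu
    have hyu : y - u • v ∈ LinearMap.ker ψ := (Submodule.Quotient.eq _).1 hy'
    have h1 : ψ y = u := by
      rw [LinearMap.mem_ker, map_sub, map_smul, hv, smul_eq_mul, mul_one, sub_eq_zero] at hyu
      exact hyu
    rw [← hκ, ← h1]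
    exact hψ x trivial y hy
  omega

theorem finrank_H0_of_stable {F : StalkFamily O} (hF : hC.Bdl F.stalk) (hr : F.rank = 2)
    (hdet : F.det₂.Isomorphic (bicanonical O)) (hs : F.Stable) : Module.finrank ℂ F.H0 = 4 := by
  by_contra h4
  obtain ⟨W, w, v, a, b, h, hh, hw, hw0, hv, ha, hb, e, d1, d3, hle⟩ :=
    exists_quot_of_finrank_ne ht hκ hg hF hr hdet h4
  have h1 := hs W (fun h => hw0 (by rw [h] at hw; exact hw)) (fun h => hv (h ▸ trivial))
  have r1 : (F.sub W).rank = 1 := (finrank_eq_one_of_mem_of_notMem hr hw hw0 hv).1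
  rw [d1, hr, r1, degree_eq_eight hg ht hκ hF hr hdet] at h1
  have h2 := degree_mono hle
  rw [degree_canonical hg ht hκ] at h2
  push_cast at h1
  omega

theorem sEquiv_Eo_of_finrank_ne {F : StalkFamily O} (hF : F.InModuli)
    (h4 : Module.finrank ℂ F.H0 ≠ 4) : F.SEquiv (Eo O) := by
  have hB : hC.Bdl F.stalk := isVectorBundle_iff.1 hF.isVectorBundle
  have hr := hF.rank_eq
  obtain ⟨W, w, v, a, b, h, hh, hw, hw0, hv, ha, hb, e, d1, d3, hle⟩ :=
    exists_quot_of_finrank_ne ht hκ hg hB hr hF.det h4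
  have hW : W ≠ ⊥ := fun h => hw0 (by rw [h] at hw; exact hw)
  have hW' : W ≠ ⊤ := fun h => hv (h ▸ trivial)
  have h1 := hF.semistable W hW hW'
  obtain ⟨r1, r2⟩ := finrank_eq_one_of_mem_of_notMem hr hw hw0 hv
  rw [d1, hr, show (F.sub W).rank = 1 from r1, degree_eq_eight hg ht hκ hB hr hF.det] at h1
  push_cast at h1
  have hbκ := eq_of_le_of_degree hle (by rw [degree_canonical hg ht hκ]; omega)
  refine sEquiv_Eo ht hκ hg hB hr hW hW' ?_ ?_
  · refine isomorphic_canonical ht hκ (L := F.sub W) r1 (v := ⟨w, hw⟩)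
      (fun h => hw0 (congrArg Subtype.val h)) ha hh ?_
    rw [hbκ] at e
    refine add_right_cancel (b := κ) ?_
    rw [e]
    abel
  · exact isomorphic_canonical ht hκ (L := F.quot W) r2
      (fun h => hv ((Submodule.Quotient.mk_eq_zero W).1 h)) hb one_ne_zero
      (by rw [div_one, add_zero, hbκ])

end Canonical
end IsCurve
end CobleCurve
end

noncomputable section
open scoped TensorProduct KaehlerDifferential
namespace CobleCurve

namespace IsCurve
variable {K : Type} [Field K] [Algebra ℂ K] {P : Type} {O : P → Subalgebra ℂ K} {hC : IsCurve O}

open StalkFamily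

variable {t : K} (ht : t ∉ (algebraMap ℂ K).range) {κ : P →₀ ℤ}
  (hκ : ∀ x (g : K), g • KaehlerDifferential.D ℂ K t ∈ (StalkFamily.canonical O).stalk x ↔
    g ∈ hC.mpow x (- κ x))
  (hg : Module.finrank ℂ (StalkFamily.canonical O).H0 = 3)
  (hh : ∀ t : K, Module.finrank (IntermediateField.adjoin ℂ {t}) K ≠ 2)

include hg in
theorem two_le_ell {D : P →₀ ℤ} (h1 : (1 : K) ∈ hC.Lsp D) {g : K} (hgD : g ∈ hC.Lsp D)
    (hgr : g ∉ (algebraMap ℂ K).range) : 2 ≤ hC.ell D := by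
  have := finite_Lsp (hC := hC) hg D
  have hli : LinearIndependent ℂ ![(⟨1, h1⟩ : hC.Lsp D), ⟨g, hgD⟩] := by
    rw [LinearIndependent.pair_iff' (fun h => one_ne_zero (congrArg Subtype.val h))]
    intro a ha
    refine hgr ⟨a, ?_⟩
    rw [Algebra.algebraMap_eq_smul_one]
    exact congrArg Subtype.val ha
  have := hli.fintype_card_le_finrank
  rwa [Fintype.card_fin, finrank_Lsp hg] at this

/-- The coordinate on the quotient by a line subbundle. -/
theorem exists_quot_coordinate {F : StalkFamily O} {W : Submodule K F.V} {v : F.V} (hv : v ∉ W)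
    (hr : Module.finrank K (F.V ⧸ W) = 1) {b : P →₀ ℤ}
    (hb : ∀ x (u : K), u • W.mkQ v ∈ (F.quot W).stalk x ↔ u ∈ hC.mpow x (- b x)) :
    ∃ φ : Module.Dual K F.V, (∀ y, φ y = 0 ↔ y ∈ W) ∧
      (∀ x, ∀ y ∈ F.stalk x, φ y ∈ hC.mpow x (- b x)) ∧
      ∀ x, ∃ y ∈ F.stalk x, φ y = hC.unif x ^ (- b x) := by
  have hv0 : W.mkQ v ≠ 0 := fun h => hv ((Submodule.Quotient.mk_eq_zero W).1 h)
  obtain ⟨φ, hφ⟩ := exists_dual_eq_one (K := K) hv0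
  have hcoord : ∀ y, W.mkQ y = φ (W.mkQ y) • W.mkQ v := by
    intro y
    obtain ⟨c, hc⟩ := (finrank_eq_one_iff_of_nonzero' _ hv0).1 hr (W.mkQ y)
    rw [← hc, map_smul, hφ, smul_eq_mul, mul_one]
  refine ⟨φ ∘ₗ W.mkQ, fun y => ⟨fun h => ?_, fun h => ?_⟩, fun x y hy => ?_, fun x => ?_⟩
  · have := hcoord y
    rw [show φ (W.mkQ y) = 0 from h, zero_smul] at this
    exact (Submodule.Quotient.mk_eq_zero W).1 this
  · have : W.mkQ y = 0 := (Submodule.Quotient.mk_eq_zero W).2 h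
    rw [LinearMap.comp_apply, this, map_zero]
  · refine (hb x _).1 ?_
    rw [LinearMap.comp_apply, ← hcoord]
    exact ⟨y, hy, rfl⟩
  · obtain ⟨y, hy, hy'⟩ := (hb x _).2 (hC.zpow_unif_mem_mpow x (- b x))
    refine ⟨y, hy, ?_⟩
    have : W.mkQ y = hC.unif x ^ (- b x) • W.mkQ v := hy'
    rw [LinearMap.comp_apply, this, map_smul, hφ, smul_eq_mul, mul_one]

include ht hκ hg hh

/-- On a stable globally generated bundle with bicanonical determinant, independent sections are
generically independent. -/
theorem linearIndependent_sections {E : StalkFamily O} (hE : hC.Bdl E.stalk) (hr : E.rank = 2)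
    (hdet : E.det₂.Isomorphic (bicanonical O)) (hs : E.Stable) (hgg : E.GloballyGenerated)
    {s s' : E.H0} (hli : LinearIndependent ℂ ![s, s']) :
    LinearIndependent K ![(s : E.V), (s' : E.V)] := by
  have hs0 : s ≠ 0 := hli.ne_zero 0
  have hsV : (s : E.V) ≠ 0 := fun h => hs0 (Subtype.ext h)
  rw [LinearIndependent.pair_iff' hs0] at hli
  rw [LinearIndependent.pair_iff' hsV]
  intro g hgs
  have hgr : g ∉ (algebraMap ℂ K).range := by
    rintro ⟨c, rfl⟩
    exact hli c (Subtype.ext hgs)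
  set W := Submodule.span K {(s : E.V)} with hW
  have hsW : (s : E.V) ∈ W := Submodule.mem_span_singleton_self _
  have hr' : Module.finrank K E.V = 2 := hr
  obtain ⟨v, hv⟩ : ∃ v, v ∉ W := by
    by_contra! hcon
    have h1 : W = ⊤ := eq_top_iff.2 fun v _ => hcon v
    have h2 := finrank_span_singleton (K := K) hsV
    rw [← hW, h1, finrank_top] at h2
    omega
  obtain ⟨a, b, h, hh0, ha, hb, e, d1, -, d3, d4⟩ :=
    exists_line_divisors hg ht hκ hE hr hdet hsW hsV hv
  obtain ⟨r1, r2⟩ := finrank_eq_one_of_mem_of_notMem hr hsW hsV hv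
  have hst := hs W (fun h => hsV (by rw [h] at hsW; exact hsW)) (fun h => hv (h ▸ trivial))
  rw [d1, d4, hr, show (E.sub W).rank = 1 from r1] at hst
  have h1a : (1 : K) ∈ hC.Lsp a := mem_Lsp.2 fun x => (ha x 1).1 (by rw [one_smul]; exact s.2 x)
  have hga : g ∈ hC.Lsp a := mem_Lsp.2 fun x => (ha x g).1 (by rw [hgs]; exact s'.2 x)
  have hdeg := three_le_degree hg hh (two_le_ell hg h1a hga hgr)
  push_cast at hst
  have hda : a.degree = 3 := by omega
  have hdb : b.degree = 5 := by omega
  have hκ4 := degree_canonical hg ht hκ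
  have hRRa := riemannRoch hg hC ht hκ a
  have hRRb := riemannRoch hg hC ht hκ b
  rw [ell_eq_zero hg (D := κ - b) (by rw [map_sub]; omega), hdb] at hRRb
  have hella : 2 ≤ hC.ell a := two_le_ell hg h1a hga hgr
  obtain ⟨f, hf0, hf⟩ := exists_ne_zero_of_ell_pos hg (hC := hC) (D := κ - a) (by omega)
  have hm0 : h⁻¹ * f ≠ 0 := mul_ne_zero (inv_ne_zero hh0) hf0
  have hmul : ∀ u ∈ hC.Lsp κ, h⁻¹ * f * u ∈ hC.Lsp b := by
    intro u hu
    have h1 := mul_mem_Lsp hf hu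
    have h2 : b = κ - a + κ + hC.div hh0 := by
      refine add_left_cancel (a := a) ?_
      rw [e]; abel
    rw [h2, ← mul_mem_Lsp_iff, ← mul_assoc, ← mul_assoc, mul_inv_cancel₀ hh0, one_mul]
    exact h1
  have := finite_Lsp (hC := hC) hg b
  have := finite_Lsp (hC := hC) hg κ
  have hmap : (hC.Lsp κ).map (LinearMap.mulLeft ℂ (h⁻¹ * f)) = hC.Lsp b := by
    refine Submodule.eq_of_le_of_finrank_eq ?_ ?_
    · rintro _ ⟨u, hu, rfl⟩
      exact hmul u hu
    · rw [← (Submodule.equivMapOfInjective _ (mul_right_injective₀ hm0) _).finrank_eq,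
        finrank_Lsp hg, finrank_Lsp hg, ell_canonical hg ht hκ]
      omega
  obtain ⟨φ, -, hφ, hφ'⟩ := exists_quot_coordinate hv r2 hb
  have hsec : ∀ σ ∈ E.H0, φ σ ∈ hC.Lsp b := fun σ hσ => mem_Lsp.2 fun x => hφ x σ (hσ x)
  have hle : b + hC.div hm0 ≤ κ := by
    intro x
    by_contra hlt
    rw [not_le, Finsupp.add_apply, div_apply] at hlt
    have hall : ∀ y ∈ E.stalk x, φ y ∈ hC.mpow x (- b x + 1) := by
      intro y hy
      rw [← hgg x] at hy
      induction hy using Submodule.span_induction with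
      | mem σ hσ =>
        have := hsec σ hσ
        rw [← hmap] at this
        obtain ⟨u, hu, hu'⟩ := this
        rw [← hu']
        change h⁻¹ * f * u ∈ _
        rw [hC.mul_mem_mpow_iff x hm0]
        exact hC.mpow_mono x (by omega) (mem_Lsp.1 hu x)
      | zero => rw [map_zero]; exact zero_mem _
      | add y z _ _ ihy ihz => rw [map_add]; exact add_mem ihy ihz
      | smul r y _ ih =>
        have : φ (r • y) = (r : K) * φ y := map_smul φ (r : K) y
        rw [this]
        exact (hC.mpow x _).smul_mem r ih
    obtain ⟨y, hy, hy'⟩ := hφ' x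
    have := hall y hy
    rw [hy', hC.mem_mpow_of_ne_zero x _ (zpow_ne_zero _ (hC.unif_ne_zero x)),
      hC.ord_unif_zpow] at this
    omega
  have := degree_mono hle
  rw [(degree_add_div hg hC hm0 b).1] at this
  omega

end IsCurve
end CobleCurve
end

noncomputable section
open scoped TensorProduct KaehlerDifferential
namespace CobleCurve

namespace StalkFamily
variable {K : Type} [Field K] [Algebra ℂ K] {P : Type} {O : P → Subalgebra ℂ K}
  (E : StalkFamily O)

/-- The `K`-linear extension of a form on the space of sections. -/
def hat (h : Module.Dual ℂ E.H0) : K ⊗[ℂ] E.H0 →ₗ[K] K :=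
  (Algebra.linearMap ℂ K ∘ₗ h).liftBaseChange K

theorem hat_tmul (h : Module.Dual ℂ E.H0) (k : K) (u : E.H0) :
    E.hat h (k ⊗ₜ u) = k * algebraMap ℂ K (h u) := rfl

theorem hat_add (h h' : Module.Dual ℂ E.H0) : E.hat (h + h') = E.hat h + E.hat h' := by
  ext u
  simp [hat_tmul]

theorem hat_smul (c : ℂ) (h : Module.Dual ℂ E.H0) :
    E.hat (c • h) = algebraMap ℂ K c • E.hat h := by
  ext u
  simp [hat_tmul, Algebra.smul_def]

theorem evaluation_tmul (k : K) (u : E.H0) : E.evaluation (k ⊗ₜ u) = k • (u : E.V) := rfl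

/-- A form on the space of sections gives a section of the dual span. -/
def coev : Module.Dual ℂ E.H0 →ₗ[ℂ] E.dualSpan.V where
  toFun h := (E.hat h ∘ₗ (LinearMap.ker E.evaluation).subtype :
    Module.Dual K (LinearMap.ker E.evaluation))
  map_add' h h' := by
    rw [hat_add, LinearMap.add_comp]
    rfl
  map_smul' c h := by
    rw [hat_smul, LinearMap.smul_comp]
    rfl

theorem hat_mem {h : Module.Dual ℂ E.H0} {x : P} {z : K ⊗[ℂ] E.H0}
    (hz : z ∈ (trivialBundle O E.H0).stalk x) : E.hat h z ∈ O x := by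
  induction hz using Submodule.span_induction with
  | mem z hz =>
    obtain ⟨u, rfl⟩ := hz
    rw [hat_tmul, one_mul]
    exact (O x).algebraMap_mem _
  | zero => exact (map_zero (E.hat h)).symm ▸ zero_mem (O x)
  | add a b _ _ iha ihb => exact (map_add (E.hat h) a b).symm ▸ add_mem iha ihb
  | smul r a _ ih => exact (map_smul (E.hat h) (r : K) a).symm ▸ mul_mem r.2 ih

theorem coev_mem (h : Module.Dual ℂ E.H0) : E.coev h ∈ E.dualSpan.H0 := fun _ _ hz =>
  E.hat_mem hz

variable {E}

theorem evaluation_surjective (hgg : E.GloballyGenerated) {x : P}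
    (hspan : Submodule.span K (E.stalk x : Set E.V) = ⊤) : Function.Surjective E.evaluation := by
  rw [← LinearMap.range_eq_top, eq_top_iff, ← hspan, Submodule.span_le]
  intro v hv
  rw [← hgg x] at hv
  induction hv using Submodule.span_induction with
  | mem z hz => exact ⟨1 ⊗ₜ ⟨z, hz⟩, by rw [evaluation_tmul, one_smul]⟩
  | zero => exact zero_mem _
  | add a b _ _ iha ihb => exact add_mem iha ihb
  | smul r a _ ih => exact (LinearMap.range E.evaluation).smul_mem (r : K) ih

theorem eq_zero_of_linearIndependent {H : Type} [AddCommGroup H] [Module ℂ H]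
    {h h' : Module.Dual ℂ H} (hh : LinearIndependent ℂ ![h, h']) {a b : K}
    (hab : ∀ u, a * algebraMap ℂ K (h u) + b * algebraMap ℂ K (h' u) = 0) : a = 0 := by
  by_contra ha
  have hker : ∀ u ∈ LinearMap.ker h', h u = 0 := by
    intro u hu
    have := hab u
    rw [LinearMap.mem_ker.1 hu, map_zero, mul_zero, add_zero] at this
    exact (map_eq_zero _).1 ((mul_eq_zero.1 this).resolve_left ha)
  have : h ∈ LinearMap.range (LinearMap.dualMap h') := by
    rw [LinearMap.range_dualMap_eq_dualAnnihilator_ker, Submodule.mem_dualAnnihilator]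
    exact hker
  obtain ⟨φ, rfl⟩ := this
  have h1 := LinearIndependent.pair_iff.1 hh 1 (- φ 1) (by
    ext u
    have : φ (h' u) = h' u * φ 1 := by
      rw [← smul_eq_mul, ← map_smul, smul_eq_mul, mul_one]
    simp [this])
  exact one_ne_zero h1.1

/-- If independent sections of `E` are generically independent, then so are independent sections
of the dual span that come from forms on the sections of `E`. -/
theorem linearIndependent_coev (h4 : Module.finrank ℂ E.H0 = 4) (hr : Module.finrank K E.V = 2)
    (hli : ∀ {s s' : E.H0}, LinearIndependent ℂ ![s, s'] →
      LinearIndependent K ![(s : E.V), (s' : E.V)])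
    {h h' : Module.Dual ℂ E.H0} (hh : LinearIndependent ℂ ![h, h']) :
    LinearIndependent K ![E.coev h, E.coev h'] := by
  have hfin : FiniteDimensional ℂ E.H0 := .of_finrank_pos (by omega)
  have hfinV : FiniteDimensional K E.V := .of_finrank_pos (by omega)
  rw [LinearIndependent.pair_iff]
  intro a b hab
  set f : K ⊗[ℂ] E.H0 →ₗ[K] K := a • E.hat h + b • E.hat h' with hf
  have hfu : ∀ u : E.H0, f (1 ⊗ₜ u) = a * algebraMap ℂ K (h u) + b * algebraMap ℂ K (h' u) :=
    fun u => by simp [hf, hat_tmul]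
  have hker : LinearMap.ker E.evaluation ≤ LinearMap.ker f := by
    intro z hz
    exact congrArg (fun φ : Module.Dual K (LinearMap.ker E.evaluation) => φ ⟨z, hz⟩) hab
  obtain ⟨ψ, hψ⟩ : ∃ ψ : E.V →ₗ[K] K, ψ ∘ₗ E.evaluation = f := by
    have : f ∈ LinearMap.range E.evaluation.dualMap := by
      rw [LinearMap.range_dualMap_eq_dualAnnihilator_ker, Submodule.mem_dualAnnihilator]
      exact fun z hz => hker hz
    exact this
  have hψu : ∀ u : E.H0, ψ u = f (1 ⊗ₜ u) := fun u => by
    rw [← hψ, LinearMap.comp_apply, evaluation_tmul, one_smul]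
  have hU : 2 ≤ Module.finrank ℂ (LinearMap.ker (h.prod h')) := by
    have h1 := (h.prod h').finrank_range_add_finrank_ker
    have h2 := Submodule.finrank_le (LinearMap.range (h.prod h'))
    rw [Module.finrank_prod, Module.finrank_self] at h2
    omega
  have : Nontrivial (LinearMap.ker (h.prod h')) :=
    Module.nontrivial_of_finrank_pos (R := ℂ) (by omega)
  obtain ⟨u, hu⟩ := exists_ne (0 : LinearMap.ker (h.prod h'))
  obtain ⟨u', huu'⟩ := exists_linearIndependent_pair_of_one_lt_finrank (R := ℂ) hU hu
  have huK : LinearIndependent K ![((u : E.H0) : E.V), ((u' : E.H0) : E.V)] := by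
    refine hli ?_
    have := huu'.map' (LinearMap.ker (h.prod h')).subtype (Submodule.ker_subtype _)
    have e : (LinearMap.ker (h.prod h')).subtype ∘ ![u, u'] = ![(u : E.H0), (u' : E.H0)] := by
      ext i
      fin_cases i <;> rfl
    rwa [e] at this
  have hzero : ∀ u : LinearMap.ker (h.prod h'), ψ (u : E.H0) = 0 := by
    intro u
    have h1 : h (u : E.H0) = 0 := congrArg Prod.fst u.2
    have h2 : h' (u : E.H0) = 0 := congrArg Prod.snd u.2
    rw [hψu, hfu, h1, h2, map_zero, mul_zero, mul_zero, add_zero]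
  have hψ0 : ∀ v, ψ v = 0 := by
    intro v
    obtain ⟨α, β, rfl⟩ := IsCurve.exists_eq_smul_add_smul huK hr v
    rw [map_add, map_smul, map_smul, hzero, hzero, smul_zero, smul_zero, add_zero]
  have hfin0 : ∀ u, a * algebraMap ℂ K (h u) + b * algebraMap ℂ K (h' u) = 0 := fun u => by
    rw [← hfu, ← hψu, hψ0]
  exact ⟨eq_zero_of_linearIndependent hh hfin0, eq_zero_of_linearIndependent
    (LinearIndependent.pair_symm_iff.1 hh) fun u => by rw [add_comm]; exact hfin0 u⟩

end StalkFamily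
end CobleCurve
end

noncomputable section
open scoped TensorProduct KaehlerDifferential
namespace CobleCurve

namespace StalkFamily
variable {K : Type} [Field K] [Algebra ℂ K] {P : Type} {O : P → Subalgebra ℂ K}
  {E : StalkFamily O}

/-- The stalk of the trivial bundle with fibre the space of sections. -/
def secLattice (E : StalkFamily O) (x : P) : Submodule (O x) (K ⊗[ℂ] E.H0) :=
  (trivialBundle O E.H0).stalk x

variable (s : Module.Basis (Fin 4) ℂ E.H0)

theorem eq_sum_hat (z : K ⊗[ℂ] E.H0) :
    z = ∑ i, E.hat (s.coord i) z • (1 ⊗ₜ[ℂ] s i : K ⊗[ℂ] E.H0) := by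
  induction z with
  | zero => simp
  | tmul k u =>
    simp only [hat_tmul, TensorProduct.smul_tmul', smul_eq_mul, mul_one]
    conv_lhs => rw [← s.sum_repr u, TensorProduct.tmul_sum]
    refine Finset.sum_congr rfl fun i _ => ?_
    rw [TensorProduct.tmul_smul, TensorProduct.smul_tmul', Algebra.smul_def, mul_comm]
    rfl
  | add a b iha ihb =>
    conv_lhs => rw [iha, ihb]
    rw [← Finset.sum_add_distrib]
    refine Finset.sum_congr rfl fun i _ => ?_
    rw [map_add, add_smul]

theorem mem_trivialBundle_iff {x : P} {z : K ⊗[ℂ] E.H0} :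
    z ∈ E.secLattice x ↔ ∀ i, E.hat (s.coord i) z ∈ O x := by
  refine ⟨fun h i => E.hat_mem h, fun h => ?_⟩
  rw [eq_sum_hat s z]
  refine Submodule.sum_mem (R := O x) (M := K ⊗[ℂ] E.H0) (Submodule.span (O x) _) fun i _ => ?_
  exact Submodule.smul_mem (M := K ⊗[ℂ] E.H0) (Submodule.span (O x) _) (⟨_, h i⟩ : O x)
    (Submodule.subset_span ⟨s i, rfl⟩)

theorem evaluation_mem {x : P} {z : K ⊗[ℂ] E.H0} (hz : z ∈ E.secLattice x) :
    E.evaluation z ∈ E.stalk x := by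
  induction hz using Submodule.span_induction with
  | mem z hz =>
    obtain ⟨u, rfl⟩ := hz
    rw [evaluation_tmul, one_smul]
    exact u.2 x
  | zero => exact (map_zero E.evaluation).symm ▸ zero_mem (E.stalk x)
  | add a b _ _ iha ihb => exact (map_add E.evaluation a b).symm ▸ add_mem iha ihb
  | smul r a _ ih =>
    exact (map_smul E.evaluation (r : K) a).symm ▸ (E.stalk x).smul_mem r ih

theorem exists_evaluation_eq (hgg : E.GloballyGenerated) {x : P} {v : E.V} (hv : v ∈ E.stalk x) :
    ∃ z ∈ E.secLattice x, E.evaluation z = v := by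
  rw [← hgg x] at hv
  induction hv using Submodule.span_induction with
  | mem z hz =>
    exact ⟨(1 ⊗ₜ ⟨z, hz⟩ : K ⊗[ℂ] E.H0),
      Submodule.subset_span (R := O x) (M := K ⊗[ℂ] E.H0) ⟨_, rfl⟩, by
      rw [evaluation_tmul, one_smul]⟩
  | zero => exact ⟨0, zero_mem _, map_zero E.evaluation⟩
  | add a b _ _ iha ihb =>
    obtain ⟨z, hz, rfl⟩ := iha
    obtain ⟨z', hz', rfl⟩ := ihb
    exact ⟨z + z', add_mem hz hz', map_add E.evaluation z z'⟩
  | smul r a _ ih =>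
    obtain ⟨z, hz, rfl⟩ := ih
    exact ⟨r • z, Submodule.smul_mem _ r hz, map_smul E.evaluation (r : K) z⟩

/-- A splitting of the evaluation map at a point. -/
theorem exists_splitting (hC : IsCurve O) (hgg : E.GloballyGenerated) (x : P)
    (hfg : (E.stalk x).FG) : ∃ j : E.stalk x →ₗ[O x] E.secLattice x,
      ∀ v, E.evaluation (j v : K ⊗[ℂ] E.H0) = v := by
  have := hC.dvr x
  have : Module.Finite (O x) (E.stalk x) := Module.Finite.iff_fg.2 hfg
  let ev : E.secLattice x →ₗ[O x] E.stalk x :=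
    { toFun := fun z => ⟨E.evaluation (z : K ⊗[ℂ] E.H0), evaluation_mem z.2⟩
      map_add' := fun a b => Subtype.ext (map_add E.evaluation _ _)
      map_smul' := fun r a => Subtype.ext (map_smul E.evaluation (r : K) _) }
  have hev : Function.Surjective ev := fun v => by
    obtain ⟨z, hz, h⟩ := exists_evaluation_eq hgg v.2
    exact ⟨⟨z, hz⟩, Subtype.ext h⟩
  have : Module.IsTorsionFree (O x) (E.stalk x) := ⟨fun r hr v w h => by
    have hr0 : (r : K) ≠ 0 := fun h => hr.ne_zero (Subtype.ext h)
    exact Subtype.ext (smul_right_injective E.V hr0 (congrArg Subtype.val h))⟩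
  obtain ⟨j, hj⟩ := Module.projective_lifting_property ev LinearMap.id hev
  exact ⟨j, fun v => congrArg Subtype.val (LinearMap.congr_fun hj v)⟩

/-- The dual span is generated by the forms on the space of sections. -/
theorem dualSpan_stalk (hC : IsCurve O) (hgg : E.GloballyGenerated) (x : P)
    (hfg : (E.stalk x).FG) :
    E.dualSpan.stalk x = Submodule.span (O x) (Set.range fun i => E.coev (s.coord i)) := by
  refine le_antisymm (fun φ hφ => ?_) (Submodule.span_le.2 ?_)
  · change Module.Dual K (LinearMap.ker E.evaluation) at φ
    obtain ⟨j, hj⟩ := exists_splitting hC hgg x hfg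
    let e (i : Fin 4) : E.secLattice x :=
      ⟨1 ⊗ₜ[ℂ] s i, Submodule.subset_span (R := O x) (M := K ⊗[ℂ] E.H0) ⟨s i, rfl⟩⟩
    have hs : ∀ i, ((s i : E.H0) : E.V) ∈ E.stalk x := fun i => (s i).2 x
    have hd : ∀ i, ((e i : K ⊗[ℂ] E.H0) - j ⟨_, hs i⟩) ∈ LinearMap.ker E.evaluation := fun i => by
      rw [LinearMap.mem_ker, map_sub, hj, evaluation_tmul, one_smul, sub_self]
    let r (i : Fin 4) : O x := ⟨φ ⟨_, hd i⟩, hφ ⟨_, hd i⟩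
      (sub_mem (e i).2 (j ⟨_, hs i⟩).2)⟩
    let ε (i : Fin 4) : Module.Dual K (LinearMap.ker E.evaluation) :=
      E.hat (s.coord i) ∘ₗ (LinearMap.ker E.evaluation).subtype
    have key : φ = ∑ i, (r i : K) • ε i := by
      have hlat : ∀ m : LinearMap.ker E.evaluation, (m : K ⊗[ℂ] E.H0) ∈ E.secLattice x →
          φ m = ∑ i, (r i : K) * E.hat (s.coord i) m := by
        intro m hm
        have hc := (mem_trivialBundle_iff s).1 hm
        have h1 : ∑ i, (⟨_, hc i⟩ : O x) • (⟨_, hs i⟩ : E.stalk x) = 0 := by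
          refine Subtype.ext ?_
          rw [AddSubmonoidClass.coe_finsetSum]
          have h2 := congrArg E.evaluation (eq_sum_hat s (m : K ⊗[ℂ] E.H0))
          rw [LinearMap.mem_ker.1 m.2, map_sum] at h2
          refine Eq.trans (Finset.sum_congr rfl fun i _ => ?_) h2.symm
          rw [map_smul, evaluation_tmul, one_smul]
          rfl
        have h2 := congrArg (fun z => ((j z : E.secLattice x) : K ⊗[ℂ] E.H0)) h1
        simp only [map_sum, map_smul, map_zero, AddSubmonoidClass.coe_finsetSum] at h2
        have h3 : m = ∑ i, E.hat (s.coord i) m • (⟨_, hd i⟩ : LinearMap.ker E.evaluation) := by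
          refine Subtype.ext ?_
          rw [AddSubmonoidClass.coe_finsetSum]
          conv_lhs => rw [eq_sum_hat s (m : K ⊗[ℂ] E.H0)]
          refine Eq.trans (sub_zero _).symm ((congrArg (_ - ·) h2.symm).trans ?_)
          rw [← Finset.sum_sub_distrib]
          refine Finset.sum_congr rfl fun i _ => ?_
          exact (smul_sub (E.hat (s.coord i) (m : K ⊗[ℂ] E.H0)) (1 ⊗ₜ[ℂ] s i : K ⊗[ℂ] E.H0) _).symm
        conv_lhs => rw [h3]
        rw [map_sum]
        refine Finset.sum_congr rfl fun i _ => ?_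
        rw [map_smul, smul_eq_mul, mul_comm]
      refine LinearMap.ext fun m => ?_
      obtain ⟨N, hN⟩ := IsCurve.exists_nat_bound
        (p := fun (i : Fin 4) N => hC.unif x ^ N * E.hat (s.coord i) m ∈ O x)
        (fun i => ⟨(hC.ord x (E.hat (s.coord i) m)).natAbs, by
          have := hC.mul_mem_mpow x (hC.zpow_unif_mem_mpow x
            ((hC.ord x (E.hat (s.coord i) m)).natAbs : ℤ))
            ((hC.mem_mpow x (hC.ord x (E.hat (s.coord i) m)) _).2 (Or.inr le_rfl))
          rw [zpow_natCast] at this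
          exact (hC.mem_mpow_zero x _).1 (hC.mpow_mono x (by omega) this)⟩)
        (fun i N N' hNN h => by
          obtain ⟨k, rfl⟩ := Nat.exists_eq_add_of_le' hNN
          rw [pow_add, mul_assoc]
          exact mul_mem (pow_mem (hC.unif_mem x) _) h)
      have h1 := hlat (hC.unif x ^ N • m) ((mem_trivialBundle_iff s).2 fun i => by
        have : E.hat (s.coord i) ((hC.unif x ^ N • m : LinearMap.ker E.evaluation) :
            K ⊗[ℂ] E.H0) = hC.unif x ^ N * E.hat (s.coord i) m := map_smul _ _ _
        rw [this]
        exact hN i)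
      have hπ : hC.unif x ^ N ≠ 0 := pow_ne_zero _ (hC.unif_ne_zero x)
      refine mul_left_cancel₀ hπ ?_
      rw [map_smul, smul_eq_mul] at h1
      rw [h1, LinearMap.sum_apply, Finset.mul_sum]
      refine Finset.sum_congr rfl fun i _ => ?_
      have : E.hat (s.coord i) ((hC.unif x ^ N • m : LinearMap.ker E.evaluation) :
          K ⊗[ℂ] E.H0) = hC.unif x ^ N * E.hat (s.coord i) m := map_smul _ _ _
      rw [this, mul_left_comm]
      rfl
    have hmem : (∑ i, r i • E.coev (s.coord i) : E.dualSpan.V) ∈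
        Submodule.span (O x) (Set.range fun i => E.coev (s.coord i)) :=
      Submodule.sum_mem _ fun i _ => Submodule.smul_mem _ _ (Submodule.subset_span ⟨i, rfl⟩)
    exact key ▸ hmem
  · rintro _ ⟨i, rfl⟩
    exact E.coev_mem _ x

end StalkFamily
end CobleCurve
end

noncomputable section
open scoped TensorProduct KaehlerDifferential
namespace CobleCurve

namespace StalkFamily
variable {K : Type} [Field K] [Algebra ℂ K] {P : Type} {O : P → Subalgebra ℂ K}
  {E F : StalkFamily O}

theorem isVectorBundle_of_span (hC : IsCurve O) {ι : Type*} [Finite ι] {g : ι → F.V}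
    (hF : ∀ x, F.stalk x = Submodule.span (O x) (Set.range g))
    (b : Module.Basis (Fin (Module.finrank K F.V)) K F.V) (hb : ∀ j, ∃ i, g i = b j) :
    F.IsVectorBundle := by
  refine ⟨Module.Finite.of_basis b, fun x => ?_, fun x => ?_, b, ?_⟩
  · rw [hF]
    exact Submodule.fg_span (Set.finite_range g)
  · rw [eq_top_iff, ← b.span_eq, Submodule.span_le]
    rintro _ ⟨j, rfl⟩
    obtain ⟨i, hi⟩ := hb j
    rw [hF, ← hi]
    exact Submodule.subset_span (Submodule.subset_span ⟨i, rfl⟩)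
  · refine (Set.finite_iUnion fun i => Set.finite_iUnion fun j =>
      hC.finite_setOf_notMem (b.repr (g i) j)).subset fun x hx => ?_
    by_contra hx'
    simp only [Set.mem_iUnion, Set.mem_ofPred_eq, not_exists, not_not] at hx'
    refine hx ?_
    rw [hF]
    refine le_antisymm (Submodule.span_le.2 ?_) (Submodule.span_mono ?_)
    · rintro _ ⟨i, rfl⟩
      rw [← b.sum_repr (g i)]
      exact sum_mem fun j _ => IsCurve.smul_mem_of_mem (hx' i j) (Submodule.subset_span ⟨j, rfl⟩)
    · rintro _ ⟨j, rfl⟩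
      exact hb j

theorem det₂_stalk {ι : Type*} {g : ι → F.V} {x : P}
    (hF : F.stalk x = Submodule.span (O x) (Set.range g)) :
    F.det₂.stalk x = Submodule.span (O x)
      (Set.range fun p : ι × ι => (exteriorPower.ιMulti K 2 ![g p.1, g p.2] : ⋀[K]^2 F.V)) := by
  let N : Submodule (O x) (⋀[K]^2 F.V) := Submodule.span (O x)
      (Set.range fun p : ι × ι => (exteriorPower.ιMulti K 2 ![g p.1, g p.2] : ⋀[K]^2 F.V))
  have hN : ∀ a ∈ Submodule.span (O x) (Set.range g), ∀ b ∈ Submodule.span (O x) (Set.range g),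
      (exteriorPower.ιMulti K 2 ![a, b] : ⋀[K]^2 F.V) ∈ N := by
    intro a ha b hb
    induction ha using Submodule.span_induction with
    | mem a ha =>
      obtain ⟨i, rfl⟩ := ha
      induction hb using Submodule.span_induction with
      | mem b hb =>
        obtain ⟨j, rfl⟩ := hb
        exact Submodule.subset_span ⟨(i, j), rfl⟩
      | zero =>
        have := IsCurve.ιMulti_smul_right (0 : K) (g i) 0
        rw [zero_smul, zero_smul] at this
        rw [this]; exact zero_mem _
      | add b c _ _ ihb ihc => rw [IsCurve.ιMulti_add_right]; exact add_mem ihb ihc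
      | smul r b _ ih =>
        have := IsCurve.ιMulti_smul_right (r : K) (g i) b
        exact this ▸ N.smul_mem r ih
    | zero =>
      have := IsCurve.ιMulti_smul_left (0 : K) (0 : F.V) b
      rw [zero_smul, zero_smul] at this
      rw [this]; exact zero_mem _
    | add a c _ _ iha ihc => rw [IsCurve.ιMulti_add_left]; exact add_mem iha ihc
    | smul r a _ ih =>
      have := IsCurve.ιMulti_smul_left (r : K) a b
      exact this ▸ N.smul_mem r ih
  refine le_antisymm (Submodule.span_le.2 ?_) (Submodule.span_le.2 ?_)
  · rintro _ ⟨m, hm, rfl⟩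
    have : m = ![m 0, m 1] := by ext i; fin_cases i <;> rfl
    rw [this]
    exact hN _ (hF ▸ hm 0) _ (hF ▸ hm 1)
  · rintro _ ⟨p, rfl⟩
    refine Submodule.subset_span (R := O x) (M := ⋀[K]^2 F.V) ⟨_, fun i => ?_, rfl⟩
    rw [hF]
    fin_cases i
    · exact Submodule.subset_span ⟨p.1, rfl⟩
    · exact Submodule.subset_span ⟨p.2, rfl⟩

/-- The complementary pair of indices, ordered so that `(i, j, k, l)` is an even permutation. -/
def complPair : Fin 4 → Fin 4 → Fin 4 × Fin 4 :=
  ![![(0, 0), (2, 3), (3, 1), (1, 2)], ![(3, 2), (0, 0), (0, 3), (2, 0)],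
    ![(1, 3), (3, 0), (0, 0), (0, 1)], ![(2, 1), (0, 2), (1, 0), (0, 0)]]

/-- Two bundles generated by four sections whose matrices of relations are orthogonal have
isomorphic determinants. -/
theorem exists_det₂_iso (hrE : Module.finrank K E.V = 2) (hrF : Module.finrank K F.V = 2)
    {s : Fin 4 → E.V} {ε : Fin 4 → F.V} (hs : LinearIndependent K ![s 0, s 1])
    (hε : LinearIndependent K ![ε 2, ε 3]) {α β α' β' : K}
    (h2 : s 2 = α • s 0 + β • s 1) (h3 : s 3 = α' • s 0 + β' • s 1)
    (h0 : ε 0 = (-α) • ε 2 + (-α') • ε 3) (h1 : ε 1 = (-β) • ε 2 + (-β') • ε 3)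
    (hE : ∀ x, E.stalk x = Submodule.span (O x) (Set.range s))
    (hF : ∀ x, F.stalk x = Submodule.span (O x) (Set.range ε)) :
    ∃ Θ : Iso E.det₂ F.det₂, ∀ i j,
      Θ.toEquiv (exteriorPower.ιMulti K 2 ![s i, s j] : ⋀[K]^2 E.V) =
        (exteriorPower.ιMulti K 2 ![ε (complPair i j).1, ε (complPair i j).2] : ⋀[K]^2 F.V) := by
  have hw := IsCurve.ιMulti_ne_zero hs hrE
  have hw' := IsCurve.ιMulti_ne_zero hε hrF
  let e1 : K ≃ₗ[K] ⋀[K]^2 E.V := LinearEquiv.ofBijective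
    (LinearMap.toSpanSingleton K (⋀[K]^2 E.V) (exteriorPower.ιMulti K 2 ![s 0, s 1]))
    ⟨smul_left_injective K hw, IsCurve.exists_smul_ιMulti hs hrE⟩
  let e2 : K ≃ₗ[K] ⋀[K]^2 F.V := LinearEquiv.ofBijective
    (LinearMap.toSpanSingleton K (⋀[K]^2 F.V) (exteriorPower.ιMulti K 2 ![ε 2, ε 3]))
    ⟨smul_left_injective K hw', IsCurve.exists_smul_ιMulti hε hrF⟩
  let A : Fin 4 → K := ![1, 0, α, α']
  let B : Fin 4 → K := ![0, 1, β, β']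
  let C : Fin 4 → K := ![-α, -β, 1, 0]
  let D : Fin 4 → K := ![-α', -β', 0, 1]
  have hAB : ∀ i, s i = A i • s 0 + B i • s 1 := by
    intro i
    fin_cases i
    · simp [A, B]
    · simp [A, B]
    · exact h2
    · exact h3
  have hCD : ∀ i, ε i = C i • ε 2 + D i • ε 3 := by
    intro i
    fin_cases i
    · exact h0
    · exact h1
    · simp [C, D]
    · simp [C, D]
  have hdet : ∀ i j, A i * B j - A j * B i = C (complPair i j).1 * D (complPair i j).2 -
      C (complPair i j).2 * D (complPair i j).1 := by
    intro i j
    fin_cases i <;> fin_cases j <;> simp [A, B, C, D, complPair] <;> ring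
  have hΘ : ∀ i j, e2 (e1.symm (exteriorPower.ιMulti K 2 ![s i, s j])) =
      exteriorPower.ιMulti K 2 ![ε (complPair i j).1, ε (complPair i j).2] := by
    intro i j
    have h1 : e1 (A i * B j - A j * B i) = exteriorPower.ιMulti K 2 ![s i, s j] := by
      rw [hAB i, hAB j, IsCurve.ιMulti_eq_smul]; rfl
    rw [← h1, e1.symm_apply_apply, hdet, hCD (complPair i j).1, hCD (complPair i j).2,
      IsCurve.ιMulti_eq_smul]
    rfl
  have hinv : ∀ k l, (complPair (complPair k l).1 (complPair k l).2 = (k, l) ∨ k = l) := by decide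
  have hle : ∀ x z, z ∈ E.det₂.stalk x → e2 (e1.symm z) ∈ F.det₂.stalk x := by
    intro x z hz
    rw [det₂_stalk (hE x)] at hz
    rw [det₂_stalk (hF x)]
    induction hz using Submodule.span_induction with
    | mem z hz =>
      obtain ⟨p, rfl⟩ := hz
      refine Submodule.subset_span (R := O x) (M := ⋀[K]^2 F.V) ⟨complPair p.1 p.2, ?_⟩
      exact (hΘ p.1 p.2).symm
    | zero => exact (map_zero (e1.symm.trans e2)).symm ▸ zero_mem _
    | add a b _ _ iha ihb => exact (map_add (e1.symm.trans e2) a b).symm ▸ add_mem iha ihb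
    | smul r a _ ih =>
      exact (map_smul (e1.symm.trans e2) (r : K) a).symm ▸ Submodule.smul_mem _ r ih
  have hge : ∀ x z, z ∈ F.det₂.stalk x → e1 (e2.symm z) ∈ E.det₂.stalk x := by
    intro x z hz
    rw [det₂_stalk (hF x)] at hz
    rw [det₂_stalk (hE x)]
    induction hz using Submodule.span_induction with
    | mem z hz =>
      obtain ⟨p, rfl⟩ := hz
      refine Submodule.subset_span (R := O x) (M := ⋀[K]^2 E.V) ⟨complPair p.1 p.2, ?_⟩
      obtain h | h := hinv p.1 p.2
      · have := hΘ (complPair p.1 p.2).1 (complPair p.1 p.2).2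
        rw [h] at this
        change _ = e1 (e2.symm (exteriorPower.ιMulti K 2 ![ε p.1, ε p.2]))
        rw [← this, e2.symm_apply_apply, e1.apply_symm_apply]
      · have h' : complPair p.1 p.2 = (0, 0) := by
          rw [h]; generalize p.2 = i; revert i; decide
        change _ = e1 (e2.symm (exteriorPower.ιMulti K 2 ![ε p.1, ε p.2]))
        rw [h', h, IsCurve.ιMulti_self, map_zero, map_zero]
        exact IsCurve.ιMulti_self _
    | zero => exact (map_zero (e2.symm.trans e1)).symm ▸ zero_mem _
    | add a b _ _ iha ihb => exact (map_add (e2.symm.trans e1) a b).symm ▸ add_mem iha ihb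
    | smul r a _ ih =>
      exact (map_smul (e2.symm.trans e1) (r : K) a).symm ▸ Submodule.smul_mem _ r ih
  refine ⟨⟨e1.symm.trans e2, fun x v => ⟨fun h => ?_, hle x v⟩⟩, hΘ⟩
  have := hge x _ h
  have e : e1 (e2.symm ((e1.symm.trans e2) v)) = v :=
    (congrArg e1 (e2.symm_apply_apply _)).trans (e1.apply_symm_apply v)
  exact e ▸ this

/-- Complementary isomorphisms exchange the terms of the Plücker form in pairs. -/
theorem pluckerForm_eq (s : Module.Basis (Fin 4) ℂ E.H0) (ε : Module.Basis (Fin 4) ℂ F.H0)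
    (δ : Iso E.det₂ (bicanonical O)) (δ' : Iso F.det₂ (bicanonical O))
    (h : ∀ i j, wedge δ (s i) (s j) =
      wedge δ' (ε (complPair i j).1) (ε (complPair i j).2)) :
    pluckerForm s δ = pluckerForm ε δ' := by
  have hswap : ∀ i j, wedge δ' (ε i) (ε j) = - wedge δ' (ε j) (ε i) := by
    intro i j
    refine Subtype.ext ?_
    refine (congrArg δ'.toEquiv
      (IsCurve.ιMulti_swap (K := K) ((ε j : F.H0) : F.V) (ε i : F.H0))).trans ?_
    exact map_neg δ'.toEquiv _
  have e01 := h 0 1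
  have e23 := h 2 3
  have e02 := h 0 2
  have e13 := h 1 3
  have e03 := h 0 3
  have e12 := h 1 2
  simp only [complPair] at e01 e23 e02 e13 e03 e12
  ext φ
  simp only [pluckerForm, add_apply, sub_apply,
    QuadraticMap.linMulLin_apply, Module.Dual.eval_apply]
  rw [e01, e23, e02, e13, e03, e12]
  simp only [Matrix.cons_val]
  rw [hswap 3 1, hswap 2 0, map_neg, map_neg]
  ring

end StalkFamily
end CobleCurve
end

noncomputable section
open scoped TensorProduct KaehlerDifferential
namespace CobleCurve

namespace StalkFamily
variable {K : Type} [Field K] [Algebra ℂ K] {P : Type} {O : P → Subalgebra ℂ K}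
  {E : StalkFamily O}

/-- Relations between sections of the dual span are orthogonal to those between the sections
of `E`. -/
theorem coev_eq (s : Module.Basis (Fin 4) ℂ E.H0)
    (hs : LinearIndependent K ![((s 0 : E.H0) : E.V), (s 1 : E.H0)]) {α β α' β' : K}
    (h2 : ((s 2 : E.H0) : E.V) = α • (s 0 : E.H0) + β • (s 1 : E.H0))
    (h3 : ((s 3 : E.H0) : E.V) = α' • (s 0 : E.H0) + β' • (s 1 : E.H0)) :
    E.coev (s.coord 0) = (-α) • E.coev (s.coord 2) + (-α') • E.coev (s.coord 3) ∧
    E.coev (s.coord 1) = (-β) • E.coev (s.coord 2) + (-β') • E.coev (s.coord 3) := by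
  have key : ∀ m ∈ LinearMap.ker E.evaluation,
      E.hat (s.coord 0) m + α * E.hat (s.coord 2) m + α' * E.hat (s.coord 3) m = 0 ∧
      E.hat (s.coord 1) m + β * E.hat (s.coord 2) m + β' * E.hat (s.coord 3) m = 0 := by
    intro m hm
    have h := congrArg E.evaluation (eq_sum_hat s m)
    rw [LinearMap.mem_ker.1 hm, map_sum] at h
    simp only [map_smul, evaluation_tmul, one_smul, Fin.sum_univ_four, h2, h3] at h
    refine LinearIndependent.pair_iff.1 hs _ _ (Eq.trans ?_ h.symm)
    module
  constructor
  · refine LinearMap.ext (M₃ := K) fun m : LinearMap.ker E.evaluation => ?_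
    have := (key m m.2).1
    change E.hat (s.coord 0) m = -α * E.hat (s.coord 2) m + -α' * E.hat (s.coord 3) m
    linear_combination this
  · refine LinearMap.ext (M₃ := K) fun m : LinearMap.ker E.evaluation => ?_
    have := (key m m.2).2
    change E.hat (s.coord 1) m = -β * E.hat (s.coord 2) m + -β' * E.hat (s.coord 3) m
    linear_combination this

theorem finrank_dualSpan (h4 : Module.finrank ℂ E.H0 = 4) (hr : Module.finrank K E.V = 2)
    (hev : Function.Surjective E.evaluation) : Module.finrank K E.dualSpan.V = 2 := by
  have : FiniteDimensional ℂ E.H0 := .of_finrank_pos (by omega)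
  have : FiniteDimensional K E.V := .of_finrank_pos (by omega)
  have h1 := E.evaluation.finrank_range_add_finrank_ker
  rw [LinearMap.range_eq_top.2 hev, finrank_top, hr, Module.finrank_baseChange, h4] at h1
  have h2 : Module.finrank K (Module.Dual K (LinearMap.ker E.evaluation)) = 2 := by
    refine (Subspace.dual_finrank_eq (K := K) (V := LinearMap.ker E.evaluation)).trans ?_
    omega
  exact h2

/-- If independent sections of the globally generated bundle `E` are generically independent, then
the dual span is a bundle of rank two with the same determinant, and wedges of sections of `E`
correspond to complementary wedges of sections of the dual span. -/
theorem exists_dualSpan_iso (hC : IsCurve O) [Nonempty P] (hE : E.IsVectorBundle)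
    (hgg : E.GloballyGenerated)
    (h4 : Module.finrank ℂ E.H0 = 4) (hr : Module.finrank K E.V = 2)
    (hli : ∀ {s s' : E.H0}, LinearIndependent ℂ ![s, s'] →
      LinearIndependent K ![(s : E.V), (s' : E.V)]) :
    E.dualSpan.IsVectorBundle ∧ E.dualSpan.rank = 2 ∧
    ∃ (s : Module.Basis (Fin 4) ℂ E.H0) (Θ : Iso E.det₂ E.dualSpan.det₂), ∀ i j,
      Θ.toEquiv (exteriorPower.ιMulti K 2 ![((s i : E.H0) : E.V), (s j : E.H0)] : ⋀[K]^2 E.V) =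
        (exteriorPower.ιMulti K 2 ![E.coev (s.coord (complPair i j).1),
          E.coev (s.coord (complPair i j).2)] : ⋀[K]^2 E.dualSpan.V) := by
  obtain ⟨x₀⟩ := ‹Nonempty P›
  have hrd := finrank_dualSpan h4 hr (evaluation_surjective hgg (hE.span_eq_top x₀))
  have : FiniteDimensional ℂ E.H0 := .of_finrank_pos (by omega)
  have s := Module.finBasisOfFinrankEq ℂ E.H0 h4
  have hs : LinearIndependent K ![((s 0 : E.H0) : E.V), (s 1 : E.H0)] := by
    refine hli ?_
    have h := s.linearIndependent.comp ![(0 : Fin 4), 1] (by decide)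
    have e : ⇑s ∘ ![(0 : Fin 4), 1] = ![s 0, s 1] := by
      ext i
      fin_cases i <;> rfl
    rwa [e] at h
  have hε : LinearIndependent K ![E.coev (s.coord 2), E.coev (s.coord 3)] := by
    refine linearIndependent_coev h4 hr hli ?_
    have h := s.dualBasis.linearIndependent.comp ![(2 : Fin 4), 3] (by decide)
    have e : ⇑s.dualBasis ∘ ![(2 : Fin 4), 3] = ![s.coord 2, s.coord 3] := by
      rw [s.coe_dualBasis]
      funext i
      fin_cases i <;> rfl
    rwa [e] at h
  obtain ⟨α, β, h2⟩ := IsCurve.exists_eq_smul_add_smul hs hr (s 2 : E.H0)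
  obtain ⟨α', β', h3⟩ := IsCurve.exists_eq_smul_add_smul hs hr (s 3 : E.H0)
  obtain ⟨e0, e1⟩ := coev_eq s hs h2 h3
  have hstalk := fun x => dualSpan_stalk s hC hgg x (hE.fg x)
  refine ⟨?_, hrd, s, ?_⟩
  · let b₀ := basisOfLinearIndependentOfCardEqFinrank hε (by simp [hrd])
    have hb₀ : (b₀ : Fin 2 → E.dualSpan.V) = ![E.coev (s.coord 2), E.coev (s.coord 3)] :=
      coe_basisOfLinearIndependentOfCardEqFinrank _ _
    refine isVectorBundle_of_span hC hstalk (b₀.reindex (finCongr hrd.symm)) fun j => ?_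
    rw [Module.Basis.reindex_apply, hb₀]
    generalize (finCongr hrd.symm).symm j = i
    fin_cases i
    · exact ⟨2, rfl⟩
    · exact ⟨3, rfl⟩
  · refine exists_det₂_iso (s := fun i => ((s i : E.H0) : E.V))
      (ε := fun i => E.coev (s.coord i)) hr hrd hs hε h2 h3 e0 e1 (fun x => ?_) hstalk
    rw [← hgg x]
    refine le_antisymm (Submodule.span_le.2 fun v hv => ?_) (Submodule.span_le.2 ?_)
    · have h := congrArg Subtype.val (s.sum_repr ⟨v, hv⟩)
      rw [AddSubmonoidClass.coe_finsetSum] at h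
      change _ = v at h
      rw [← h]
      refine sum_mem fun i _ => ?_
      exact IsCurve.smul_mem_of_mem (x := x)
        ((O x).algebraMap_mem (s.repr ⟨v, hv⟩ i)) (Submodule.subset_span ⟨i, rfl⟩)
    · rintro _ ⟨i, rfl⟩
      exact Submodule.subset_span (s i).2

end StalkFamily
end CobleCurve
end

noncomputable section
open scoped TensorProduct KaehlerDifferential
namespace CobleCurve

namespace IsCurve
variable {K : Type} [Field K] [Algebra ℂ K] {P : Type} {O : P → Subalgebra ℂ K} {hC : IsCurve O}

open StalkFamily

variable {t : K} (ht : t ∉ (algebraMap ℂ K).range) {κ : P →₀ ℤ}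
  (hκ : ∀ x (g : K), g • KaehlerDifferential.D ℂ K t ∈ (StalkFamily.canonical O).stalk x ↔
    g ∈ hC.mpow x (- κ x))
  (hg : Module.finrank ℂ (StalkFamily.canonical O).H0 = 3)
  (hh : ∀ t : K, Module.finrank (IntermediateField.adjoin ℂ {t}) K ≠ 2)
  {E : StalkFamily O}

include hg in
/-- A quotient line bundle of the dual span has three sections. -/
theorem three_le_ell_quot (h4 : Module.finrank ℂ E.H0 = 4) (hr : E.dualSpan.rank = 2)
    (hli : ∀ {h h' : Module.Dual ℂ E.H0}, LinearIndependent ℂ ![h, h'] →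
      LinearIndependent K ![E.coev h, E.coev h'])
    {W : Submodule K E.dualSpan.V} {w v : E.dualSpan.V} (hw : w ∈ W) (hw0 : w ≠ 0) (hv : v ∉ W)
    {b : P →₀ ℤ} (hb : ∀ x (u : K), u • W.mkQ v ∈ (E.dualSpan.quot W).stalk x ↔
      u ∈ hC.mpow x (- b x)) : 3 ≤ hC.ell b := by
  have : FiniteDimensional ℂ E.H0 := .of_finrank_pos (by omega)
  have := finite_Lsp (hC := hC) hg b
  obtain ⟨r1, r2⟩ := finrank_eq_one_of_mem_of_notMem hr hw hw0 hv
  obtain ⟨φ, hφ, hφ', -⟩ := exists_quot_coordinate hv r2 hb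
  let T : Module.Dual ℂ E.H0 →ₗ[ℂ] hC.Lsp b :=
    (φ.restrictScalars ℂ ∘ₗ E.coev).codRestrict _ fun h =>
      mem_Lsp.2 fun x => hφ' x _ (E.coev_mem h x)
  have hker : Module.finrank ℂ (LinearMap.ker T) ≤ 1 := by
    by_contra! hlt
    have : Nontrivial (LinearMap.ker T) :=
      Module.nontrivial_of_finrank_pos (R := ℂ) (by omega)
    obtain ⟨u, hu⟩ := exists_ne (0 : LinearMap.ker T)
    obtain ⟨u', huu'⟩ := exists_linearIndependent_pair_of_one_lt_finrank (R := ℂ) hlt hu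
    have h1 := huu'.map' (LinearMap.ker T).subtype (Submodule.ker_subtype _)
    have e : (LinearMap.ker T).subtype ∘ ![u, u'] =
        ![(u : Module.Dual ℂ E.H0), (u' : Module.Dual ℂ E.H0)] := by
      funext i
      fin_cases i <;> rfl
    rw [e] at h1
    have h2 := hli h1
    have hmem : ∀ z : LinearMap.ker T, E.coev z ∈ W := fun z =>
      (hφ _).1 (congrArg Subtype.val z.2)
    have hne : (⟨_, hmem u⟩ : W) ≠ 0 := fun h => h2.ne_zero 0 (congrArg Subtype.val h)
    obtain ⟨c, hc⟩ := (finrank_eq_one_iff_of_nonzero' _ hne).1 r1 ⟨_, hmem u'⟩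
    exact (LinearIndependent.pair_iff' (h2.ne_zero 0)).1 h2 c (congrArg Subtype.val hc)
  have h1 := T.finrank_range_add_finrank_ker
  rw [Subspace.dual_finrank_eq, h4] at h1
  have h2 := Submodule.finrank_le (LinearMap.range T)
  rw [finrank_Lsp hg] at h2
  omega

include ht hκ hg hh

theorem linearIndependent_coev_of_stable (hE : E.InModuli) (hs : E.Stable)
    (hgg : E.GloballyGenerated) {h h' : Module.Dual ℂ E.H0} (hi : LinearIndependent ℂ ![h, h']) :
    LinearIndependent K ![E.coev h, E.coev h'] := by
  have hB : hC.Bdl E.stalk := isVectorBundle_iff.1 hE.isVectorBundle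
  exact linearIndependent_coev (finrank_H0_of_stable ht hκ hg hB hE.rank_eq hE.det hs) hE.rank_eq
    (linearIndependent_sections ht hκ hg hh hB hE.rank_eq hE.det hs hgg) hi

theorem dualSpan_bundle (hE : E.InModuli) (hs : E.Stable) (hgg : E.GloballyGenerated) :
    E.dualSpan.IsVectorBundle ∧ E.dualSpan.rank = 2 ∧
    ∃ (s : Module.Basis (Fin 4) ℂ E.H0) (Θ : Iso E.det₂ E.dualSpan.det₂), ∀ i j,
      Θ.toEquiv (exteriorPower.ιMulti K 2 ![((s i : E.H0) : E.V), (s j : E.H0)] : ⋀[K]^2 E.V) =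
        (exteriorPower.ιMulti K 2 ![E.coev (s.coord (complPair i j).1),
          E.coev (s.coord (complPair i j).2)] : ⋀[K]^2 E.dualSpan.V) := by
  have hB : hC.Bdl E.stalk := isVectorBundle_iff.1 hE.isVectorBundle
  obtain ⟨p, -⟩ := (hC.affine_compl ht).nonempty
  have : Nonempty P := ⟨p⟩
  exact exists_dualSpan_iso hC hE.isVectorBundle hgg
    (finrank_H0_of_stable ht hκ hg hB hE.rank_eq hE.det hs) hE.rank_eq
    (linearIndependent_sections ht hκ hg hh hB hE.rank_eq hE.det hs hgg)

theorem dualSpan_det (hE : E.InModuli) (hs : E.Stable) (hgg : E.GloballyGenerated) :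
    E.dualSpan.det₂.Isomorphic (bicanonical O) := by
  obtain ⟨-, -, s, Θ, -⟩ := dualSpan_bundle ht hκ hg hh hE hs hgg
  exact Isomorphic.trans (Isomorphic.symm ⟨Θ⟩) hE.det

/-- Line subbundles of the dual span have degree at most four, and a line subbundle of degree
four and its quotient are canonical. -/
theorem dualSpan_sub (hE : E.InModuli) (hs : E.Stable) (hgg : E.GloballyGenerated)
    {W : Submodule K E.dualSpan.V} (hW : W ≠ ⊥) (hW' : W ≠ ⊤) :
    (E.dualSpan.sub W).rank = 1 ∧ (E.dualSpan.sub W).degree ≤ 4 ∧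
      ((E.dualSpan.sub W).degree = 4 → (E.dualSpan.sub W).Isomorphic (canonical O) ∧
        (E.dualSpan.quot W).Isomorphic (canonical O)) := by
  have hB : hC.Bdl E.stalk := isVectorBundle_iff.1 hE.isVectorBundle
  have hdet := dualSpan_det ht hκ hg hh hE hs hgg
  obtain ⟨hV, hr, -⟩ := dualSpan_bundle ht hκ hg hh hE hs hgg
  have hB' : hC.Bdl E.dualSpan.stalk := isVectorBundle_iff.1 hV
  obtain ⟨w, hw, hw0⟩ := W.exists_mem_ne_zero_of_ne_bot hW
  obtain ⟨v, hv⟩ : ∃ v, v ∉ W := by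
    by_contra! hcon
    exact hW' (eq_top_iff.2 fun v _ => hcon v)
  obtain ⟨r1, r2⟩ := finrank_eq_one_of_mem_of_notMem hr hw hw0 hv
  obtain ⟨a, b, h, hh0, ha, hb, e, d1, -, d3, -⟩ :=
    exists_line_divisors hg ht hκ hB' hr hdet hw hw0 hv
  have h3 := three_le_ell_quot hg (finrank_H0_of_stable ht hκ hg hB hE.rank_eq hE.det hs) hr
    (linearIndependent_coev_of_stable ht hκ hg hh hE hs hgg) hw hw0 hv hb
  obtain ⟨h5, h6⟩ := four_le_degree hg hh ht hκ h3
  refine ⟨r1, by omega, fun h7 => ?_⟩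
  obtain ⟨u, hu, hbu⟩ := h6 (by omega)
  constructor
  · have hq : h * u⁻¹ ≠ 0 := mul_ne_zero hh0 (inv_ne_zero hu)
    refine isomorphic_canonical ht hκ (L := E.dualSpan.sub W) r1 (v := ⟨w, hw⟩)
      (fun h => hw0 (congrArg Subtype.val h)) ha hq ?_
    have hdiv : hC.div hq = hC.div hh0 - hC.div hu := by
      ext x
      rw [Finsupp.sub_apply, div_apply, div_apply, div_apply, hC.ord_mul x hh0 (inv_ne_zero hu),
        hC.ord_inv x hu]
      ring
    rw [hdiv]
    refine add_right_cancel (b := b) ?_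
    rw [e, hbu]
    abel
  · exact isomorphic_canonical ht hκ (L := E.dualSpan.quot W) r2
      (fun h => hv ((Submodule.Quotient.mk_eq_zero W).1 h)) hb hu hbu

theorem dualSpan_inModuli (hE : E.InModuli) (hs : E.Stable) (hgg : E.GloballyGenerated) :
    E.dualSpan.InModuli := by
  have hdet := dualSpan_det ht hκ hg hh hE hs hgg
  obtain ⟨hV, hr, -⟩ := dualSpan_bundle ht hκ hg hh hE hs hgg
  refine ⟨hV, hr, fun W hW hW' => ?_, hdet⟩
  obtain ⟨h1, h2, -⟩ := dualSpan_sub ht hκ hg hh hE hs hgg hW hW'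
  rw [hr, h1, degree_eq_eight hg ht hκ (isVectorBundle_iff.1 hV : hC.Bdl _) hr hdet]
  push_cast
  omega

/-- Unless it has the moduli point of `E_o`, the dual span has the Plücker forms of `E`. -/
theorem exists_isPluckerForm_dualSpan (hE : E.InModuli) (hs : E.Stable)
    (hgg : E.GloballyGenerated) (hEo : ¬ E.dualSpan.SEquiv (Eo O)) :
    ∃ q, E.dualSpan.IsPluckerForm q ∧ E.IsPluckerForm q := by
  obtain ⟨-, -, s, Θ, hΘ⟩ := dualSpan_bundle ht hκ hg hh hE hs hgg
  have hB : hC.Bdl E.stalk := isVectorBundle_iff.1 hE.isVectorBundle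
  have h4 := finrank_H0_of_stable ht hκ hg hB hE.rank_eq hE.det hs
  have h4' : Module.finrank ℂ E.dualSpan.H0 = 4 := by
    by_contra h
    exact hEo (sEquiv_Eo_of_finrank_ne ht hκ hg
      (dualSpan_inModuli ht hκ hg hh hE hs hgg) h)
  have : FiniteDimensional ℂ E.H0 := .of_finrank_pos (by omega)
  let c : Module.Dual ℂ E.H0 →ₗ[ℂ] E.dualSpan.H0 := E.coev.codRestrict _ E.coev_mem
  have hc : LinearMap.ker c = ⊥ := by
    refine (Submodule.eq_bot_iff _).2 fun h hh' => ?_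
    by_contra h0
    obtain ⟨h', hi⟩ := exists_linearIndependent_pair_of_one_lt_finrank (R := ℂ)
      (by rw [Subspace.dual_finrank_eq]; omega) h0
    exact (linearIndependent_coev_of_stable ht hκ hg hh hE hs hgg hi).ne_zero 0
      (congrArg Subtype.val hh')
  have hli : LinearIndependent ℂ (c ∘ s.dualBasis) := s.dualBasis.linearIndependent.map' c hc
  let ε := basisOfLinearIndependentOfCardEqFinrank hli (by simp [h4'])
  have hε : ∀ i, ((ε i : E.dualSpan.H0) : E.dualSpan.V) = E.coev (s.coord i) := by
    intro i
    have : ε i = c (s.dualBasis i) :=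
      congrFun (coe_basisOfLinearIndependentOfCardEqFinrank _ _) i
    rw [this, s.coe_dualBasis]
    rfl
  obtain ⟨δ⟩ := hE.det
  let δ' : Iso E.dualSpan.det₂ (bicanonical O) :=
    ⟨Θ.toEquiv.symm.trans δ.toEquiv, fun x v => (δ.mem_iff x _).trans (by
      rw [← Θ.mem_iff]
      exact iff_of_eq (congrArg (· ∈ E.dualSpan.det₂.stalk x) (Θ.toEquiv.apply_symm_apply v)))⟩
  refine ⟨_, ⟨ε, δ', rfl⟩, s, δ, (pluckerForm_eq s ε δ δ' fun i j => Subtype.ext ?_).symm⟩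
  change δ.toEquiv _ = δ.toEquiv (Θ.toEquiv.symm (exteriorPower.ιMulti K 2
    ![((ε _ : E.dualSpan.H0) : E.dualSpan.V), (ε _ : E.dualSpan.H0)] : ⋀[K]^2 E.dualSpan.V))
  rw [hε, hε]
  refine congrArg δ.toEquiv ?_
  refine (Θ.toEquiv.symm_apply_apply _).symm.trans (congrArg Θ.toEquiv.symm (hΘ i j))

end IsCurve
end CobleCurve
end

noncomputable section
open scoped TensorProduct KaehlerDifferential
namespace CobleCurve

section Plucker

/-- The polar form of the Plücker form `z₀ z₅ - z₁ z₄ + z₂ z₃`. -/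
def pluckerBilin : LinearMap.BilinForm ℂ (Fin 6 → ℂ) :=
  LinearMap.mk₂ ℂ (fun x y => x 0 * y 5 + x 5 * y 0 - x 1 * y 4 - x 4 * y 1 + x 2 * y 3 + x 3 * y 2)
    (fun x x' y => by simp only [Pi.add_apply]; ring)
    (fun c x y => by simp only [Pi.smul_apply, smul_eq_mul]; ring)
    (fun x y y' => by simp only [Pi.add_apply]; ring)
    (fun c x y => by simp only [Pi.smul_apply, smul_eq_mul]; ring)

theorem pluckerBilin_apply (x y : Fin 6 → ℂ) : pluckerBilin x y =
    x 0 * y 5 + x 5 * y 0 - x 1 * y 4 - x 4 * y 1 + x 2 * y 3 + x 3 * y 2 := rfl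

theorem pluckerBilin_single (x : Fin 6 → ℂ) : pluckerBilin x (Pi.single 0 1) = x 5 ∧
    pluckerBilin x (Pi.single 1 1) = - x 4 ∧ pluckerBilin x (Pi.single 2 1) = x 3 ∧
    pluckerBilin x (Pi.single 3 1) = x 2 ∧ pluckerBilin x (Pi.single 4 1) = - x 1 ∧
    pluckerBilin x (Pi.single 5 1) = x 0 := by
  refine ⟨?_, ?_, ?_, ?_, ?_, ?_⟩ <;> simp [pluckerBilin_apply]

theorem ker_pluckerBilin : LinearMap.ker pluckerBilin = ⊥ := by
  refine (Submodule.eq_bot_iff _).2 fun x hx => ?_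
  have h : ∀ y, pluckerBilin x y = 0 := fun y => by rw [LinearMap.mem_ker.1 hx]; rfl
  obtain ⟨h0, h1, h2, h3, h4, h5⟩ := pluckerBilin_single x
  rw [h] at h0 h1 h2 h3 h4 h5
  ext i
  fin_cases i
  · exact h5.symm
  · exact neg_eq_zero.1 h4.symm
  · exact h3.symm
  · exact h2.symm
  · exact neg_eq_zero.1 h1.symm
  · exact h0.symm

theorem finrank_orthogonal_pluckerBilin (W : Submodule ℂ (Fin 6 → ℂ)) :
    Module.finrank ℂ W + Module.finrank ℂ (pluckerBilin.orthogonal W) = 6 := by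
  rw [LinearMap.BilinForm.finrank_add_finrank_orthogonal', ker_pluckerBilin, inf_bot_eq]
  simp

/-- A subspace of dimension two contains an isotropic vector. -/
theorem exists_isotropic {W : Submodule ℂ (Fin 6 → ℂ)} (hW : 1 < Module.finrank ℂ W) :
    ∃ z ∈ W, z ≠ 0 ∧ z 0 * z 5 - z 1 * z 4 + z 2 * z 3 = 0 := by
  have : Nontrivial W := Module.nontrivial_of_finrank_pos (R := ℂ) (by omega)
  obtain ⟨u, hu⟩ := exists_ne (0 : W)
  obtain ⟨v, huv⟩ := exists_linearIndependent_pair_of_one_lt_finrank (R := ℂ) hW hu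
  set Q : (Fin 6 → ℂ) → ℂ := fun z => z 0 * z 5 - z 1 * z 4 + z 2 * z 3 with hQ
  by_cases h0 : Q u = 0
  · exact ⟨u, u.2, fun h => hu (Subtype.ext h), h0⟩
  · obtain ⟨l, hl⟩ := exists_quadratic_eq_zero (a := Q u) (b := pluckerBilin u v) (c := Q v) h0
      (IsAlgClosed.exists_eq_mul_self _)
    refine ⟨(l • u + v : W), Subtype.property _, fun h => ?_, ?_⟩
    · have := (LinearIndependent.pair_iff.1 huv l 1 (by rw [one_smul]; exact Subtype.ext h)).2
      exact one_ne_zero this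
    · rw [pluckerBilin_apply] at hl
      simp only [hQ] at hl
      simp only [Submodule.coe_add, Submodule.coe_smul, Pi.add_apply, Pi.smul_apply, smul_eq_mul]
      linear_combination hl

/-- A quadric of the form `p₀ p₅ - p₁ p₄ + p₂ p₃` that contains a linear space of codimension
two admits an isotropic linear relation between the `pᵢ`. -/
theorem exists_isotropic_relation {N : Type*} [AddCommGroup N] [Module ℂ N] (p : Fin 6 → N)
    (S : Submodule ℂ N) [FiniteDimensional ℂ S] (hS : Module.finrank ℂ S ≤ 2)
    (hq : ∀ φ : Module.Dual ℂ N, (∀ n ∈ S, φ n = 0) →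
      φ (p 0) * φ (p 5) - φ (p 1) * φ (p 4) + φ (p 2) * φ (p 3) = 0) :
    ∃ z : Fin 6 → ℂ, z ≠ 0 ∧ ∑ i, z i • p i = 0 ∧ z 0 * z 5 - z 1 * z 4 + z 2 * z 3 = 0 := by
  let T : (Fin 6 → ℂ) →ₗ[ℂ] N := Fintype.linearCombination ℂ p
  have hT : ∀ z, T z = ∑ i, z i • p i := fun z => Fintype.linearCombination_apply ℂ p z
  have hTs : ∀ i, T (Pi.single i 1) = p i := fun i => by
    rw [Fintype.linearCombination_apply_single, one_smul]
  by_contra hcon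
  have haniso : ∀ z ∈ LinearMap.ker T, z 0 * z 5 - z 1 * z 4 + z 2 * z 3 = 0 → z = 0 := by
    intro z hz hz'
    by_contra h0
    exact hcon ⟨z, h0, (hT z).symm.trans hz, hz'⟩
  have hk : Module.finrank ℂ (LinearMap.ker T) ≤ 1 := by
    by_contra! hlt
    obtain ⟨z, hz, h0, h1⟩ := exists_isotropic hlt
    exact h0 (haniso z hz h1)
  obtain ⟨g₀, hg₀⟩ := T.rangeRestrict.exists_rightInverse_of_surjective T.range_rangeRestrict
  obtain ⟨g, hg⟩ := LinearMap.exists_extend g₀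
  have hgT : ∀ z, g (T z) - z ∈ LinearMap.ker T := by
    intro z
    have h1 : g (T z) = g₀ (T.rangeRestrict z) := LinearMap.congr_fun hg (T.rangeRestrict z)
    have h2 := congrArg Subtype.val (LinearMap.congr_fun hg₀ (T.rangeRestrict z))
    rw [LinearMap.mem_ker, map_sub, h1, sub_eq_zero]
    exact h2
  set U := pluckerBilin.orthogonal (LinearMap.ker T ⊔ S.map g) with hU
  have hsymm : ∀ x y, pluckerBilin x y = pluckerBilin y x := fun x y => by
    rw [pluckerBilin_apply, pluckerBilin_apply]; ring
  have hUo : ∀ y ∈ U, ∀ z ∈ LinearMap.ker T ⊔ S.map g, pluckerBilin y z = 0 := fun y hy z hz =>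
    (hsymm y z).trans (hy z hz)
  have hUQ : ∀ y ∈ U, y 0 * y 5 - y 1 * y 4 + y 2 * y 3 = 0 := by
    intro y hy
    have h1 : ∀ i, (pluckerBilin y ∘ₗ g) (p i) = pluckerBilin y (Pi.single i 1) := by
      intro i
      have := hUo y hy _ (Submodule.mem_sup_left (hgT (Pi.single i 1)))
      rw [map_sub, sub_eq_zero, hTs] at this
      exact this
    have h2 := hq (pluckerBilin y ∘ₗ g) fun n hn =>
      hUo y hy _ (Submodule.mem_sup_right ⟨n, hn, rfl⟩)
    obtain ⟨e0, e1, e2, e3, e4, e5⟩ := pluckerBilin_single y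
    rw [h1, h1, h1, h1, h1, h1, e0, e1, e2, e3, e4, e5] at h2
    linear_combination h2
  have hUU : U ≤ pluckerBilin.orthogonal (U ⊔ LinearMap.ker T) := by
    intro y hy z hz
    obtain ⟨u, hu, w, hw, rfl⟩ := Submodule.mem_sup.1 hz
    have h1 := hUQ _ (add_mem hu hy)
    have h2 := hUQ _ hu
    have h3 := hUQ _ hy
    have h4 := hy w (Submodule.mem_sup_left hw)
    change pluckerBilin (u + w) y = 0
    change pluckerBilin w y = 0 at h4
    rw [map_add, LinearMap.add_apply, h4, add_zero, pluckerBilin_apply]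
    simp only [Pi.add_apply] at h1
    linear_combination h1 - h2 - h3
  have hinf : U ⊓ LinearMap.ker T = ⊥ :=
    (Submodule.eq_bot_iff _).2 fun z hz => haniso z hz.2 (hUQ z hz.1)
  have d1 := finrank_orthogonal_pluckerBilin (LinearMap.ker T ⊔ S.map g)
  have d2 := finrank_orthogonal_pluckerBilin (U ⊔ LinearMap.ker T)
  have d3 := Submodule.finrank_mono hUU
  have d4 := Submodule.finrank_sup_add_finrank_inf_eq U (LinearMap.ker T)
  have d5 := Submodule.finrank_add_le_finrank_add_finrank (LinearMap.ker T) (S.map g)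
  have d6 := Submodule.finrank_map_le g S
  rw [hinf, finrank_bot] at d4
  rw [← hU] at d1
  omega

/-- The Plücker relation characterizes the decomposable bivectors of a space of dimension four. -/
theorem exists_decomposition {z : Fin 6 → ℂ} (hz : z ≠ 0)
    (h : z 0 * z 5 - z 1 * z 4 + z 2 * z 3 = 0) :
    ∃ a b : Fin 4 → ℂ, z 0 = a 0 * b 1 - a 1 * b 0 ∧ z 1 = a 0 * b 2 - a 2 * b 0 ∧
      z 2 = a 0 * b 3 - a 3 * b 0 ∧ z 3 = a 1 * b 2 - a 2 * b 1 ∧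
      z 4 = a 1 * b 3 - a 3 * b 1 ∧ z 5 = a 2 * b 3 - a 3 * b 2 := by
  obtain ⟨i, hi⟩ := Function.ne_iff.1 hz
  rw [Pi.zero_apply] at hi
  fin_cases i
  · change z 0 ≠ 0 at hi
    refine ⟨![1, 0, -z 3 / z 0, -z 4 / z 0], ![0, z 0, z 1, z 2], ?_⟩
    simp only [Matrix.cons_val]
    refine ⟨?_, ?_, ?_, ?_, ?_, ?_⟩ <;> field_simp <;>
      first | ring1 | linear_combination h
  · change z 1 ≠ 0 at hi
    refine ⟨![1, z 3 / z 1, 0, -z 5 / z 1], ![0, z 0, z 1, z 2], ?_⟩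
    simp only [Matrix.cons_val]
    refine ⟨?_, ?_, ?_, ?_, ?_, ?_⟩ <;> field_simp <;>
      first | ring1 | linear_combination h | linear_combination -h
  · change z 2 ≠ 0 at hi
    refine ⟨![1, z 4 / z 2, z 5 / z 2, 0], ![0, z 0, z 1, z 2], ?_⟩
    simp only [Matrix.cons_val]
    refine ⟨?_, ?_, ?_, ?_, ?_, ?_⟩ <;> field_simp <;>
      first | ring1 | linear_combination h
  · change z 3 ≠ 0 at hi
    refine ⟨![-z 1 / z 3, -1, 0, z 5 / z 3], ![z 0, 0, -z 3, -z 4], ?_⟩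
    simp only [Matrix.cons_val]
    refine ⟨?_, ?_, ?_, ?_, ?_, ?_⟩ <;> field_simp <;>
      first | ring1 | linear_combination h
  · change z 4 ≠ 0 at hi
    refine ⟨![z 2 / z 4, 1, z 5 / z 4, 0], ![-z 0, 0, z 3, z 4], ?_⟩
    simp only [Matrix.cons_val]
    refine ⟨?_, ?_, ?_, ?_, ?_, ?_⟩ <;> field_simp <;>
      first | ring1 | linear_combination h | linear_combination -h
  · change z 5 ≠ 0 at hi
    refine ⟨![z 2 / z 5, z 4 / z 5, 1, 0], ![-z 1, -z 3, 0, z 5], ?_⟩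
    simp only [Matrix.cons_val]
    refine ⟨?_, ?_, ?_, ?_, ?_, ?_⟩ <;> field_simp <;>
      first | ring1 | linear_combination h

/-- The Pfaffian of a singular alternating matrix of size four. -/
theorem pfaffian_eq_zero {y : Fin 4 → Fin 4 → ℂ} (hy : ∀ i j, y j i = - y i j) {a : Fin 4 → ℂ}
    (ha : a ≠ 0) (h : ∀ k, ∑ i, a i * y i k = 0) :
    y 0 1 * y 2 3 - y 0 2 * y 1 3 + y 0 3 * y 1 2 = 0 := by
  have hd : ∀ i, y i i = 0 := fun i => self_eq_neg.1 (hy i i)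
  obtain ⟨i, hi⟩ := Function.ne_iff.1 ha
  rw [Pi.zero_apply] at hi
  have h0 := h 0
  have h1 := h 1
  have h2 := h 2
  have h3 := h 3
  simp only [Fin.sum_univ_four, hd, hy 0 1, hy 0 2, hy 0 3, hy 1 2, hy 1 3, hy 2 3] at h0 h1 h2 h3
  refine (mul_eq_zero.1 ?_).resolve_left hi
  fin_cases i
  · change a 0 * _ = 0
    linear_combination y 2 3 * h1 - y 1 3 * h2 + y 1 2 * h3
  · change a 1 * _ = 0
    linear_combination - y 2 3 * h0 + y 0 3 * h2 - y 0 2 * h3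
  · change a 2 * _ = 0
    linear_combination y 1 3 * h0 - y 0 3 * h1 + y 0 1 * h3
  · change a 3 * _ = 0
    linear_combination - y 1 2 * h0 + y 0 2 * h1 - y 0 1 * h2

end Plucker

end CobleCurve
end

noncomputable section
open scoped TensorProduct KaehlerDifferential
namespace CobleCurve

namespace StalkFamily
variable {K : Type} [Field K] [Algebra ℂ K] {P : Type} {O : P → Subalgebra ℂ K}
  {E F : StalkFamily O}

/-- The wedge product of sections as a bilinear map. -/
def wedgeBilin (δ : Iso E.det₂ (bicanonical O)) : E.H0 →ₗ[ℂ] E.H0 →ₗ[ℂ] (bicanonical O).H0 :=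
  LinearMap.mk₂ ℂ (wedge δ)
    (fun a b c => Subtype.ext ((congrArg δ.toEquiv
      (IsCurve.ιMulti_add_left (K := K) (a : E.V) b c)).trans (map_add δ.toEquiv _ _)))
    (fun r a c => Subtype.ext ((congrArg δ.toEquiv
      (IsCurve.ιMulti_smul_left (algebraMap ℂ K r) (a : E.V) c)).trans
        (map_smul δ.toEquiv (algebraMap ℂ K r) _)))
    (fun a b c => Subtype.ext ((congrArg δ.toEquiv
      (IsCurve.ιMulti_add_right (K := K) (a : E.V) b c)).trans (map_add δ.toEquiv _ _)))
    (fun r a c => Subtype.ext ((congrArg δ.toEquiv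
      (IsCurve.ιMulti_smul_right (algebraMap ℂ K r) (a : E.V) c)).trans
        (map_smul δ.toEquiv (algebraMap ℂ K r) _)))

theorem wedgeBilin_self (δ : Iso E.det₂ (bicanonical O)) (a : E.H0) : wedgeBilin δ a a = 0 :=
  Subtype.ext ((congrArg δ.toEquiv (IsCurve.ιMulti_self (K := K) (a : E.V))).trans
    (map_zero δ.toEquiv))

theorem wedgeBilin_swap (δ : Iso E.det₂ (bicanonical O)) (a b : E.H0) :
    wedgeBilin δ b a = - wedgeBilin δ a b :=
  Subtype.ext ((congrArg δ.toEquiv (IsCurve.ιMulti_swap (K := K) (a : E.V) b)).trans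
    (map_neg δ.toEquiv _))

theorem pluckerForm_apply (s : Module.Basis (Fin 4) ℂ E.H0) (δ : Iso E.det₂ (bicanonical O))
    (φ : Module.Dual ℂ (bicanonical O).H0) : pluckerForm s δ φ =
      φ (wedgeBilin δ (s 0) (s 1)) * φ (wedgeBilin δ (s 2) (s 3)) -
      φ (wedgeBilin δ (s 0) (s 2)) * φ (wedgeBilin δ (s 1) (s 3)) +
      φ (wedgeBilin δ (s 0) (s 3)) * φ (wedgeBilin δ (s 1) (s 2)) := rfl

/-- If independent sections of `E` are generically independent, then the Plücker quadric contains
no linear space of codimension two. -/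
theorem exists_pluckerForm_ne_zero (hr : Module.finrank K E.V = 2)
    (hli : ∀ {s s' : E.H0}, LinearIndependent ℂ ![s, s'] →
      LinearIndependent K ![(s : E.V), (s' : E.V)])
    (s : Module.Basis (Fin 4) ℂ E.H0) (δ : Iso E.det₂ (bicanonical O))
    (S : Submodule ℂ (bicanonical O).H0) [FiniteDimensional ℂ S] (hS : Module.finrank ℂ S ≤ 2) :
    ∃ φ : Module.Dual ℂ (bicanonical O).H0, (∀ n ∈ S, φ n = 0) ∧ pluckerForm s δ φ ≠ 0 := by
  by_contra! hcon
  obtain ⟨z, hz0, hz, hq⟩ := exists_isotropic_relation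
    ![wedgeBilin δ (s 0) (s 1), wedgeBilin δ (s 0) (s 2), wedgeBilin δ (s 0) (s 3),
      wedgeBilin δ (s 1) (s 2), wedgeBilin δ (s 1) (s 3), wedgeBilin δ (s 2) (s 3)] S hS
    (fun φ hφ => by
      have := hcon φ hφ
      rw [pluckerForm_apply] at this
      exact this)
  obtain ⟨a, b, e0, e1, e2, e3, e4, e5⟩ := exists_decomposition hz0 hq
  set σ : E.H0 := ∑ i, a i • s i with hσ
  set τ : E.H0 := ∑ i, b i • s i with hτ
  have hwedge : wedgeBilin δ σ τ = 0 := by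
    rw [← hz, hσ, hτ]
    simp only [Fin.sum_univ_four, Fin.sum_univ_six, map_add, map_smul, LinearMap.add_apply,
      LinearMap.smul_apply, Matrix.cons_val, wedgeBilin_self, wedgeBilin_swap δ (s 0) (s 1),
      wedgeBilin_swap δ (s 0) (s 2), wedgeBilin_swap δ (s 0) (s 3), wedgeBilin_swap δ (s 1) (s 2),
      wedgeBilin_swap δ (s 1) (s 3), wedgeBilin_swap δ (s 2) (s 3), e0, e1, e2, e3, e4, e5]
    module
  have hστ : LinearIndependent ℂ ![σ, τ] := by
    rw [LinearIndependent.pair_iff]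
    intro c d hcd
    have hab : ∀ i, c * a i + d * b i = 0 := by
      intro i
      have h1 := congrArg (fun v => s.repr v i) hcd
      simpa [hσ, hτ, map_add, map_smul, map_sum, Finsupp.single_apply] using h1
    by_contra hne
    refine hz0 ?_
    have hzero : ∀ i j, a i * b j - a j * b i = 0 := by
      intro i j
      by_cases hc : c = 0
      · have hd : d ≠ 0 := fun hd => hne ⟨hc, hd⟩
        refine (mul_eq_zero.1 (?_ : d * (a i * b j - a j * b i) = 0)).resolve_left hd
        linear_combination a i * hab j - a j * hab i
      · refine (mul_eq_zero.1 (?_ : c * (a i * b j - a j * b i) = 0)).resolve_left hc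
        linear_combination b j * hab i - b i * hab j
    ext i
    fin_cases i
    · exact e0.trans (hzero _ _)
    · exact e1.trans (hzero _ _)
    · exact e2.trans (hzero _ _)
    · exact e3.trans (hzero _ _)
    · exact e4.trans (hzero _ _)
    · exact e5.trans (hzero _ _)
  refine IsCurve.ιMulti_ne_zero (hli hστ) hr ((LinearEquiv.map_eq_zero_iff δ.toEquiv).1 ?_)
  exact congrArg Subtype.val hwedge

/-- If two independent sections have the wedge product zero, then the Plücker quadric contains a
linear space of codimension two. -/
theorem exists_pluckerForm_eq_zero (s : Module.Basis (Fin 4) ℂ F.H0)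
    (δ : Iso F.det₂ (bicanonical O)) {σ τ : F.H0} (hστ : LinearIndependent ℂ ![σ, τ])
    (h : wedgeBilin δ σ τ = 0) :
    ∃ S : Submodule ℂ (bicanonical O).H0, FiniteDimensional ℂ S ∧ Module.finrank ℂ S ≤ 2 ∧
      ∀ φ : Module.Dual ℂ (bicanonical O).H0, (∀ n ∈ S, φ n = 0) → pluckerForm s δ φ = 0 := by
  have : FiniteDimensional ℂ F.H0 := Module.Finite.of_basis s
  refine ⟨LinearMap.range (wedgeBilin δ σ), inferInstance, ?_, fun φ hφ => ?_⟩
  · have h1 := (wedgeBilin δ σ).finrank_range_add_finrank_ker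
    have h2 : 2 ≤ Module.finrank ℂ (LinearMap.ker (wedgeBilin δ σ)) := by
      have h3 := (Submodule.finrank_mono (Submodule.span_le.2 (?_ :
        Set.range ![σ, τ] ⊆ (LinearMap.ker (wedgeBilin δ σ) : Set F.H0))))
      · rwa [finrank_span_eq_card hστ, Fintype.card_fin] at h3
      · rintro _ ⟨i, rfl⟩
        fin_cases i
        · exact wedgeBilin_self δ σ
        · exact h
    rw [Module.finrank_eq_card_basis s, Fintype.card_fin] at h1
    omega
  · rw [pluckerForm_apply]
    refine pfaffian_eq_zero (y := fun i j => φ (wedgeBilin δ (s i) (s j)))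
      (a := fun i => s.repr σ i) (fun i j => ?_) (fun h0 => ?_) fun k => ?_
    · rw [wedgeBilin_swap δ (s i) (s j), map_neg]
    · refine hστ.ne_zero 0 (s.repr.map_eq_zero_iff.1 ?_)
      ext i
      exact congrFun h0 i
    · have h1 := hφ _ ⟨s k, rfl⟩
      rw [← s.sum_repr σ] at h1
      simpa only [map_sum, map_smul, LinearMap.sum_apply, LinearMap.smul_apply, smul_eq_mul]
        using h1

end StalkFamily

namespace IsCurve
variable {K : Type} [Field K] [Algebra ℂ K] {P : Type} {O : P → Subalgebra ℂ K} {hC : IsCurve O}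

open StalkFamily

variable {t : K} (ht : t ∉ (algebraMap ℂ K).range) {κ : P →₀ ℤ}
  (hκ : ∀ x (g : K), g • KaehlerDifferential.D ℂ K t ∈ (StalkFamily.canonical O).stalk x ↔
    g ∈ hC.mpow x (- κ x))
  (hg : Module.finrank ℂ (StalkFamily.canonical O).H0 = 3)
  {E F : StalkFamily O}

include ht hκ hg

theorem exists_sub_of_not_stable (hF : F.InModuli) (hs : ¬ F.Stable) :
    ∃ W : Submodule K F.V, W ≠ ⊥ ∧ W ≠ ⊤ ∧ (F.sub W).degree = 4 ∧ (F.sub W).rank = 1 := by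
  have hB : hC.Bdl F.stalk := isVectorBundle_iff.1 hF.isVectorBundle
  simp only [Stable, not_forall, not_lt] at hs
  obtain ⟨W, hW, hW', h1⟩ := hs
  have h2 := hF.semistable W hW hW'
  obtain ⟨w, hw, hw0⟩ := W.exists_mem_ne_zero_of_ne_bot hW
  obtain ⟨v, hv⟩ : ∃ v, v ∉ W := by
    by_contra! hcon
    exact hW' (eq_top_iff.2 fun v _ => hcon v)
  have r1 : (F.sub W).rank = 1 := (finrank_eq_one_of_mem_of_notMem hF.rank_eq hw hw0 hv).1
  rw [r1, hF.rank_eq, degree_eq_eight hg ht hκ hB hF.rank_eq hF.det] at h1 h2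
  push_cast at h1 h2
  exact ⟨W, hW, hW', by omega, r1⟩

/-- A bundle that is not stable has independent sections with wedge product zero. -/
theorem exists_wedge_eq_zero (hF : F.InModuli) (hs : ¬ F.Stable)
    (δ : Iso F.det₂ (bicanonical O)) :
    ∃ σ τ : F.H0, LinearIndependent ℂ ![σ, τ] ∧ wedgeBilin δ σ τ = 0 := by
  have hB : hC.Bdl F.stalk := isVectorBundle_iff.1 hF.isVectorBundle
  obtain ⟨W, hW, hW', d, -⟩ := exists_sub_of_not_stable ht hκ hg hF hs
  obtain ⟨w, hw, hw0⟩ := W.exists_mem_ne_zero_of_ne_bot hW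
  obtain ⟨v, hv⟩ : ∃ v, v ∉ W := by
    by_contra! hcon
    exact hW' (eq_top_iff.2 fun v _ => hcon v)
  obtain ⟨a, b, h, hh0, ha, -, -, d1, -⟩ :=
    exists_line_divisors hg ht hκ hB hF.rank_eq hF.det hw hw0 hv
  have hRR := riemannRoch hg hC ht hκ a
  rw [← d1, d] at hRR
  have hell : 1 < Module.finrank ℂ (hC.Lsp a) := by
    rw [finrank_Lsp hg]
    omega
  have := finite_Lsp (hC := hC) hg a
  have : Nontrivial (hC.Lsp a) := Module.nontrivial_of_finrank_pos (R := ℂ) (by omega)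
  obtain ⟨u, hu⟩ := exists_ne (0 : hC.Lsp a)
  obtain ⟨u', huu'⟩ := exists_linearIndependent_pair_of_one_lt_finrank (R := ℂ) hell hu
  have hmem : ∀ u : hC.Lsp a, (u : K) • w ∈ F.H0 := fun u x => (ha x u).2 (mem_Lsp.1 u.2 x)
  refine ⟨⟨_, hmem u⟩, ⟨_, hmem u'⟩, ?_, Subtype.ext ?_⟩
  · rw [LinearIndependent.pair_iff]
    intro c d hcd
    refine LinearIndependent.pair_iff.1 huu' c d (Subtype.ext ?_)
    have h1 : algebraMap ℂ K c • (u : K) • w + algebraMap ℂ K d • (u' : K) • w = 0 :=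
      congrArg Subtype.val hcd
    rw [smul_smul, smul_smul, ← add_smul] at h1
    have h2 := (smul_eq_zero.1 h1).resolve_right hw0
    rw [← Algebra.smul_def, ← Algebra.smul_def] at h2
    exact h2
  · refine (congrArg δ.toEquiv (?_ : (exteriorPower.ιMulti K 2 ![(u : K) • w, (u' : K) • w] :
      ⋀[K]^2 F.V) = 0)).trans (map_zero δ.toEquiv)
    rw [ιMulti_smul_left, ιMulti_smul_right, ιMulti_self, smul_zero, smul_zero]

variable (hh : ∀ t : K, Module.finrank (IntermediateField.adjoin ℂ {t}) K ≠ 2)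
include hh

theorem sameGamma_dualSpan (hE : E.InModuli) (hs : E.Stable) (hgg : E.GloballyGenerated)
    (hEo : ¬ E.dualSpan.SEquiv (Eo O)) : E.dualSpan.SameGamma E := by
  have hB : hC.Bdl E.stalk := isVectorBundle_iff.1 hE.isVectorBundle
  obtain ⟨q, h1, h2⟩ := exists_isPluckerForm_dualSpan ht hκ hg hh hE hs hgg hEo
  refine ⟨q, ?_, h1, h2⟩
  obtain ⟨s, δ, rfl⟩ := h2
  obtain ⟨φ, -, hφ⟩ := exists_pluckerForm_ne_zero hE.rank_eq
    (linearIndependent_sections ht hκ hg hh hB hE.rank_eq hE.det hs hgg) s δ ⊥ (by simp)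
  exact fun h => hφ (by rw [h]; rfl)

theorem stable_of_sameGamma (hE : E.InModuli) (hs : E.Stable) (hgg : E.GloballyGenerated)
    (hF : F.InModuli) (hFE : F.SameGamma E) : F.Stable := by
  have hB : hC.Bdl E.stalk := isVectorBundle_iff.1 hE.isVectorBundle
  by_contra hns
  obtain ⟨q, -, ⟨s', δ', rfl⟩, s, δ, hq⟩ := hFE
  obtain ⟨σ, τ, hστ, hw⟩ := exists_wedge_eq_zero ht hκ hg hF hns δ'
  obtain ⟨S, hfin, hS, hzero⟩ := exists_pluckerForm_eq_zero s' δ' hστ hw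
  obtain ⟨φ, hφ, hne⟩ := exists_pluckerForm_ne_zero hE.rank_eq
    (linearIndependent_sections ht hκ hg hh hB hE.rank_eq hE.det hs hgg) s δ S hS
  exact hne (hq ▸ hzero φ hφ)

theorem stable_of_sEquiv_dualSpan (hE : E.InModuli) (hs : E.Stable) (hgg : E.GloballyGenerated)
    (hF : F.InModuli) (hFE : F.SEquiv E.dualSpan) (hEo : ¬ F.SEquiv (Eo O)) : F.Stable := by
  by_contra hns
  have hEb := dualSpan_inModuli ht hκ hg hh hE hs hgg
  have hBF : hC.Bdl F.stalk := isVectorBundle_iff.1 hF.isVectorBundle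
  have hB : hC.Bdl E.dualSpan.stalk := isVectorBundle_iff.1 hEb.isVectorBundle
  have h8 := degree_eq_eight hg ht hκ hB hEb.rank_eq hEb.det
  have h8F := degree_eq_eight hg ht hκ hBF hF.rank_eq hF.det
  obtain ⟨G, hFG, hEG⟩ := hFE
  obtain ⟨hst, -⟩ | ⟨W, hW, hW', hd, hWG⟩ := hFG
  · exact hns hst
  obtain ⟨hst, ⟨e⟩⟩ | ⟨W', hW₁, hW₂, hd', hWG'⟩ := hEG
  · obtain ⟨w, hw, hw0⟩ := W.exists_mem_ne_zero_of_ne_bot hW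
    obtain ⟨v, hv⟩ : ∃ v, v ∉ W := by
      by_contra! hcon
      exact hW' (eq_top_iff.2 fun v _ => hcon v)
    have r1 : (F.sub W).rank = 1 := (finrank_eq_one_of_mem_of_notMem hF.rank_eq hw hw0 hv).1
    rw [hF.rank_eq, h8F, r1] at hd
    obtain ⟨e'⟩ := hWG.trans (Isomorphic.symm ⟨e⟩)
    obtain ⟨X, hiso⟩ : ∃ X, (F.sub W).Isomorphic (E.dualSpan.sub X) :=
      ⟨_, (sub_ker_snd (F.sub W) (F.quot W)).trans (e'.sub_map _)⟩
    have hsF : hC.Bdl (F.sub W).stalk := hBF.comap_subtype W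
    have hsE : hC.Bdl (E.dualSpan.sub X).stalk := hB.comap_subtype X
    have hdeg := degree_congr hg hsF hsE hiso
    have hrX := hiso.rank_eq
    rw [r1] at hrX
    have hX : X ≠ ⊥ := fun h => by
      have h1 : Module.finrank K X = 1 := hrX.symm
      rw [h, finrank_bot] at h1
      omega
    have hX' : X ≠ ⊤ := fun h => by
      have h1 : Module.finrank K X = 1 := hrX.symm
      rw [h, finrank_top] at h1
      have h2 : Module.finrank K E.dualSpan.V = 2 := hEb.rank_eq
      omega
    have := hst X hX hX'
    rw [← hdeg, ← hrX, hEb.rank_eq, h8] at this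
    push_cast at this hd
    omega
  · obtain ⟨h1, -, h3⟩ := dualSpan_sub ht hκ hg hh hE hs hgg hW₁ hW₂
    rw [hEb.rank_eq, h8, h1] at hd'
    push_cast at hd'
    obtain ⟨i1, i2⟩ := h3 (by omega)
    exact hEo ⟨Eo O, Or.inr ⟨W, hW, hW', hd,
      hWG.trans (hWG'.symm.trans (i1.directSum i2))⟩, isGraded_Eo ht hκ hg⟩

end IsCurve
end CobleCurve
end

theorem dual_span_stable {C : AlgebraicGeometry.Scheme.{0}} [AlgebraicGeometry.IsIntegral C]
    (f : C ⟶ AlgebraicGeometry.Spec (CommRingCat.of ℂ))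
    [AlgebraicGeometry.IsProper f] [AlgebraicGeometry.SmoothOfRelativeDimension 1 f]
    (hgenus : CobleCurve.genus f = 3) (hnonhyp : ¬ CobleCurve.HasDoubleCover f)
    (E : CobleCurve.StalkFamily (CobleCurve.localRing f))
    (hE : E.InModuli) (hstable : E.Stable) (hgg : E.GloballyGenerated) :
    E.dualSpan.InModuli ∧
    (¬ E.dualSpan.SEquiv (CobleCurve.StalkFamily.Eo (CobleCurve.localRing f)) →
      E.dualSpan.SameGamma E) ∧
    ∀ F : CobleCurve.StalkFamily (CobleCurve.localRing f), F.InModuli →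
      (F.SameGamma E ∨ F.SEquiv E.dualSpan) →
      ¬ F.SEquiv (CobleCurve.StalkFamily.Eo (CobleCurve.localRing f)) →
      F.Stable := by
  have hC := CobleCurve.isCurve f
  obtain ⟨t, ht⟩ := hC.exists_notMem_range
  obtain ⟨κ, hκ⟩ := CobleCurve.IsCurve.exists_canonicalDivisor hC ht
  have hh := not_exists.1 hnonhyp
  refine ⟨CobleCurve.IsCurve.dualSpan_inModuli ht hκ hgenus hh hE hstable hgg,
    CobleCurve.IsCurve.sameGamma_dualSpan ht hκ hgenus hh hE hstable hgg, fun F hF h hEo => ?_⟩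
  obtain h | h := h
  · exact CobleCurve.IsCurve.stable_of_sameGamma ht hκ hgenus hh hE hstable hgg hF h
  · exact CobleCurve.IsCurve.stable_of_sEquiv_dualSpan ht hκ hgenus hh hE hstable hgg hF h hEo
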